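/- Let d ≥ 3 and r > (d²+1)/(d(d−1)). Let 𝔓_d(r) be the closed pentagon in the (1/p,1/q)-plane with vertices P(r) = (1/r, 1/(rd)), Q_1(r) = (1/(rd), 1/(rd)), Q_2 = ((d−1)/d, (d−1)/d), Q_3 = ((d−1)/d, 1/d), Q_4 = (d(d−1)/(d²+1), (d−1)/(d²+1)). Then V_r^I A is bounded from L^p(ℝ^d) to L^q(ℝ^d) for every (1/p, 1/q) in the interior of 𝔓_d(r), and V_r^I A is unbounded from L^p(ℝ^d) to L^q(ℝ^d) for every (1/p, 1/q) not in 𝔓_d(r). -/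

import Mathlib

open MeasureTheory Metric Set
open scoped ENNReal NNReal FourierTransform

noncomputable section

/-- Euclidean `d`-space. -/
abbrev Euc (d : ℕ) : Type := EuclideanSpace ℝ (Fin d)

/-- The normalized surface measure `σ` on the unit sphere `S^{d-1} ⊆ ℝ^d`. -/
def sphereMeasure (d : ℕ) : Measure (Euc d) :=
  (((volume : Measure (Euc d)).toSphere Set.univ)⁻¹ : ℝ≥0∞) •
    ((volume : Measure (Euc d)).toSphere.map Subtype.val)

/-- The spherical average `A_t f(x) = ∫_{S^{d-1}} f(x - t y) dσ(y)`. -/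
def sphAvg {d : ℕ} (f : Euc d → ℂ) (t : ℝ) (x : Euc d) : ℂ :=
  ∫ y, f (x - t • y) ∂(sphereMeasure d)

/-- The `r`-variation of the family `t ↦ a t` over the set `E ⊆ ℝ`. -/
def rVar (r : ℝ) (E : Set ℝ) (a : ℝ → ℂ) : ℝ≥0∞ :=
  ⨆ (N : ℕ) (t : Fin (N + 1) → ℝ) (_ : StrictMono t) (_ : ∀ i, t i ∈ E),
    (∑ i : Fin N, (‖a (t i.succ) - a (t i.castSucc)‖₊ : ℝ≥0∞) ^ r) ^ (1 / r)

/-- The global variation operator `V_r A` for the spherical means. -/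
def VrA {d : ℕ} (r : ℝ) (f : Euc d → ℂ) (x : Euc d) : ℝ≥0∞ :=
  rVar r (Set.Ioi 0) (fun t => sphAvg f t x)

/-- The local variation operator `V_r^I A`, `I = [1,2]`. -/
def VrIA {d : ℕ} (r : ℝ) (f : Euc d → ℂ) (x : Euc d) : ℝ≥0∞ :=
  rVar r (Set.Icc 1 2) (fun t => sphAvg f t x)

/-- `L^q` norm (with respect to `μ`) of an `ℝ≥0∞`-valued function, `1 ≤ q ≤ ∞`. -/
def lqNorm {α : Type*} [MeasurableSpace α] (q : ℝ≥0∞) (g : α → ℝ≥0∞)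
    (μ : Measure α) : ℝ≥0∞ :=
  if q = ∞ then essSup g μ else (∫⁻ x, g x ^ q.toReal ∂μ) ^ (1 / q.toReal)

/-- Boundedness `L^p → L^q` of an `ℝ≥0∞`-valued operator (exponents in `ℝ≥0∞`). -/
def IsBddLpLq (d : ℕ) (p q : ℝ≥0∞) (T : (Euc d → ℂ) → Euc d → ℝ≥0∞) : Prop :=
  ∃ C : ℝ≥0, ∀ f : Euc d → ℂ, MemLp f p volume →
    lqNorm q (T f) volume ≤ C * eLpNorm f p volume

/-- The pentagon `𝔓_d(r)` of Theorem 1.2, with vertices `P(r), Q_1(r), Q_2, Q_3, Q_4`. -/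
def pentagonBig (d : ℕ) (r : ℝ) : Set (ℝ × ℝ) :=
  convexHull ℝ ({(1 / r, 1 / (r * (d : ℝ))), (1 / (r * (d : ℝ)), 1 / (r * (d : ℝ))),
    (((d : ℝ) - 1) / d, ((d : ℝ) - 1) / d), (((d : ℝ) - 1) / d, 1 / (d : ℝ)),
    ((d : ℝ) * ((d : ℝ) - 1) / ((d : ℝ) ^ 2 + 1),
      ((d : ℝ) - 1) / ((d : ℝ) ^ 2 + 1))} : Set (ℝ × ℝ))

section
open MeasureTheory Metric Set
open scoped ENNReal NNReal FourierTransform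

namespace Pent

/-- the five linear inequalities. -/
def Ineqs (d : ℕ) (r x y : ℝ) : Prop :=
  y ≤ x ∧ (d:ℝ) * x ≤ d - 1 ∧ x ≤ d * y ∧ (d + 1) * x ≤ (d - 1) * (1 + y) ∧ 1 ≤ r * d * y

lemma rpos {d : ℕ} (hd : 3 ≤ d) {r : ℝ}
    (hr : ((d : ℝ) ^ 2 + 1) / ((d : ℝ) * ((d : ℝ) - 1)) < r) :
    0 < r ∧ (d:ℝ)^2 + 1 < r * (d * (d - 1)) ∧ 1 < r := by
  have hd' : (3:ℝ) ≤ d := by exact_mod_cast hd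
  have h1 : 0 < (d:ℝ) * (d - 1) := by nlinarith
  have h0 : (d:ℝ)^2 + 1 < r * (d * (d - 1)) := by rwa [div_lt_iff₀ h1] at hr
  have h2 : 0 < r := lt_trans (by positivity) hr
  refine ⟨h2, h0, ?_⟩
  by_contra h
  push Not at h
  nlinarith

lemma convex_ineqs (d : ℕ) (r : ℝ) : Convex ℝ {z : ℝ × ℝ | Ineqs d r z.1 z.2} := by
  rintro ⟨x1, y1⟩ ⟨a1, a2, a3, a4, a5⟩ ⟨x2, y2⟩ ⟨b1, b2, b3, b4, b5⟩ s t hs ht hst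
  simp only [Prod.smul_mk, Prod.mk_add_mk, smul_eq_mul, mem_ofPred_eq, Ineqs] at *
  have ht : t = 1 - s := by linarith
  subst ht
  refine ⟨?_, ?_, ?_, ?_, ?_⟩
  · nlinarith
  · nlinarith
  · nlinarith
  · nlinarith
  · nlinarith

set_option maxHeartbeats 1600000 in
lemma pent_sub {d : ℕ} (hd : 3 ≤ d) {r : ℝ}
    (hr : ((d : ℝ) ^ 2 + 1) / ((d : ℝ) * ((d : ℝ) - 1)) < r) :
    pentagonBig d r ⊆ {z : ℝ × ℝ | Ineqs d r z.1 z.2} := by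
  obtain ⟨h0, h1, h2⟩ := rpos hd hr
  have hd' : (3:ℝ) ≤ d := by exact_mod_cast hd
  apply convexHull_min _ (convex_ineqs d r)
  have hd0 : (d:ℝ) ≠ 0 := by positivity
  have e1 : r * d * (1 / (r * d)) = 1 := by field_simp
  have hi : 0 < 1 / (r * d) := by positivity
  have h1r : 1 / r = d * (1 / (r * d)) := by field_simp
  have e5 : (d:ℝ) * ((d - 1) / d) = d - 1 := by field_simp
  have e6 : (d:ℝ) * (1 / d) = 1 := by field_simp
  have e7 : ((d:ℝ)^2+1) * ((d - 1) / (d^2+1)) = d - 1 := by field_simp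
  have e8 : (d:ℝ) * (d - 1) / (d^2+1) = d * ((d - 1) / (d^2+1)) := by ring
  have e9 : (d:ℝ) - 1 = d * ((d - 1) / d) := e5.symm
  have key : (d:ℝ)^2 + 1 < r * d * (d - 1) := by linarith
  have k1 : ((d:ℝ)^2+1) * (1 / (r * d)) ≤ d - 1 := by
    rw [mul_one_div, div_le_iff₀ (by positivity)]; nlinarith
  have k4 : (d:ℝ) ≤ d^2 := by nlinarith
  have k3 : 0 < (d - 1) / ((d:ℝ)^2+1) := div_pos (by linarith) (by positivity)
  have k2 : 1 ≤ r * d * ((d - 1) / (d^2+1)) := by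
    rw [← mul_div_assoc, le_div_iff₀ (by positivity)]; linarith
  rintro z (rfl | rfl | rfl | rfl | rfl)
  · simp only [mem_ofPred_eq, Ineqs, h1r]
    set w := 1 / (r * d)
    refine ⟨?_, ?_, ?_, ?_, ?_⟩ <;> nlinarith
  · simp only [mem_ofPred_eq, Ineqs]
    set w := 1 / (r * d)
    refine ⟨?_, ?_, ?_, ?_, ?_⟩ <;> nlinarith
  · simp only [mem_ofPred_eq, Ineqs]
    set w := ((d:ℝ) - 1) / d
    have : 2/3 ≤ w := by
      rw [div_le_div_iff₀ (by norm_num) (by positivity)]; linarith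
    refine ⟨?_, ?_, ?_, ?_, ?_⟩ <;> nlinarith
  · simp only [mem_ofPred_eq, Ineqs]
    have : 1 / (d:ℝ) ≤ (d-1)/d := by gcongr; linarith
    set w := ((d:ℝ) - 1) / d
    set w' := 1 / (d:ℝ)
    have : w = 1 - w' := by
      apply mul_left_cancel₀ hd0; linarith
    refine ⟨?_, ?_, ?_, ?_, ?_⟩ <;> nlinarith
  · simp only [mem_ofPred_eq, Ineqs, e8]
    set w := ((d:ℝ) - 1) / (d^2+1)
    refine ⟨?_, ?_, ?_, ?_, ?_⟩ <;> nlinarith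

lemma seg_mem {C : Set (ℝ × ℝ)} (hC : Convex ℝ C) {a1 a2 b1 b2 x y : ℝ}
    (ha : (a1, a2) ∈ C) (hb : (b1, b2) ∈ C) (h1 : a2 ≤ y) (h2 : y ≤ b2) (hlt : a2 < b2)
    (h : (b2 - a2) * (x - a1) = (y - a2) * (b1 - a1)) : (x, y) ∈ C := by
  have hp : 0 < b2 - a2 := by linarith
  have := hC ha hb (a := (b2 - y) / (b2 - a2)) (b := (y - a2) / (b2 - a2))
    (div_nonneg (by linarith) hp.le) (div_nonneg (by linarith) hp.le) (by field_simp; ring)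
  convert this using 1
  ext
  · simp; field_simp; linarith
  · simp; field_simp; ring

lemma seg_mem' {C : Set (ℝ × ℝ)} (hC : Convex ℝ C) {a b x y : ℝ}
    (ha : (a, y) ∈ C) (hb : (b, y) ∈ C) (h1 : a ≤ x) (h2 : x ≤ b) : (x, y) ∈ C := by
  rcases eq_or_lt_of_le (h1.trans h2) with h | h
  · have : x = a := by linarith
    rwa [this]
  have hp : 0 < b - a := by linarith
  have := hC ha hb (a := (b - x) / (b - a)) (b := (x - a) / (b - a))
    (div_nonneg (by linarith) hp.le) (div_nonneg (by linarith) hp.le) (by field_simp; ring)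
  convert this using 1
  ext
  · simp; field_simp; ring
  · simp; field_simp; ring

set_option maxHeartbeats 1600000 in
lemma mem_pent {d : ℕ} (hd : 3 ≤ d) {r : ℝ}
    (hr : ((d : ℝ) ^ 2 + 1) / ((d : ℝ) * ((d : ℝ) - 1)) < r) {x y : ℝ}
    (h : Ineqs d r x y) : (x, y) ∈ pentagonBig d r := by
  obtain ⟨h0, h1, h2⟩ := rpos hd hr
  have hd' : (3:ℝ) ≤ d := by exact_mod_cast hd
  have hC : Convex ℝ (pentagonBig d r) := convex_convexHull _ _
  have mem : ∀ z ∈ ({(1 / r, 1 / (r * (d : ℝ))), (1 / (r * (d : ℝ)), 1 / (r * (d : ℝ))),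
    (((d : ℝ) - 1) / d, ((d : ℝ) - 1) / d), (((d : ℝ) - 1) / d, 1 / (d : ℝ)),
    ((d : ℝ) * ((d : ℝ) - 1) / ((d : ℝ) ^ 2 + 1),
      ((d : ℝ) - 1) / ((d : ℝ) ^ 2 + 1))} : Set (ℝ × ℝ)), z ∈ pentagonBig d r :=
    fun z hz => subset_convexHull ℝ _ hz
  have hP := mem (1 / r, 1 / (r * (d : ℝ))) (by simp)
  have hQ1 := mem (1 / (r * (d : ℝ)), 1 / (r * (d : ℝ))) (by simp)
  have hQ2 := mem (((d : ℝ) - 1) / d, ((d : ℝ) - 1) / d) (by simp)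
  have hQ3 := mem (((d : ℝ) - 1) / d, 1 / (d : ℝ)) (by simp)
  have hQ4 := mem ((d : ℝ) * ((d : ℝ) - 1) / ((d : ℝ) ^ 2 + 1),
      ((d : ℝ) - 1) / ((d : ℝ) ^ 2 + 1)) (by simp)
  clear mem
  have hd0 : (d:ℝ) ≠ 0 := by positivity
  have e1 : r * d * (1 / (r * d)) = 1 := by field_simp
  have hi : 0 < 1 / (r * d) := by positivity
  have h1r : 1 / r = d * (1 / (r * d)) := by field_simp
  have e5 : (d:ℝ) * ((d - 1) / d) = d - 1 := by field_simp
  have e6 : (d:ℝ) * (1 / d) = 1 := by field_simp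
  have e7 : ((d:ℝ)^2+1) * ((d - 1) / (d^2+1)) = d - 1 := by field_simp
  have e8 : (d:ℝ) * (d - 1) / (d^2+1) = d * ((d - 1) / (d^2+1)) := by ring
  have k1 : ((d:ℝ)^2+1) * (1 / (r * d)) < d - 1 := by
    rw [mul_one_div, div_lt_iff₀ (by positivity)]; nlinarith
  have k3 : (1:ℝ) ≤ (d - 1) / d * d := by field_simp; linarith
  rw [h1r] at hP
  rw [e8] at hQ4
  have f1 : (d - 1) / (d:ℝ) = 1 - 1 / d := by field_simp
  rw [f1] at hQ2 hQ3
  obtain ⟨i1, i2, i3, i4, i5⟩ := h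
  set w := 1 / (r * d)
  set v := 1 / (d:ℝ)
  set u := ((d:ℝ) - 1) / (d^2+1)
  have hyw : w ≤ y := by
    have : 0 < r * d := by positivity
    by_contra hh
    push Not at hh
    nlinarith
  have hwu : w < u := by
    by_contra hh
    push Not at hh
    nlinarith
  have hxv : x ≤ 1 - v := by
    by_contra hh
    push Not at hh
    nlinarith
  have huv : u < v := by
    by_contra hh
    push Not at hh
    nlinarith
  have hv : v ≤ 1/3 := by
    by_contra hh
    push Not at hh
    nlinarith
  have hdiag : (y, y) ∈ pentagonBig d r :=
    seg_mem hC hQ1 hQ2 hyw (by linarith) (by linarith) (by ring)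
  rcases le_total y u with c1 | c1
  · refine seg_mem' hC hdiag (b := d * y) ?_ i1 i3
    exact seg_mem hC hP hQ4 hyw c1 hwu (by ring)
  rcases le_total y v with c2 | c2
  · refine seg_mem' hC hdiag (b := (d-1)*(1+y)/(d+1)) ?_ i1 (by rw [le_div_iff₀ (by positivity)]; linarith)
    refine seg_mem hC hQ4 hQ3 c1 c2 huv ?_
    field_simp
    have hv' : 1 = d * v := e6.symm
    have : v * (d^2+1) = d + v := by nlinarith
    clear_value u v w
    have hu : u = (d-1)/(d^2+1) := by field_simp; linarith
    have hv' : v = 1 / d := by field_simp; linarith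
    subst hu hv'
    field_simp
    ring
  · refine seg_mem' hC hdiag (b := 1 - v) ?_ i1 hxv
    rcases eq_or_lt_of_le (show v ≤ 1 - v by linarith) with h | h
    · exfalso; linarith
    exact seg_mem hC hQ3 hQ2 c2 (by linarith) h (by ring)

lemma interior_strict {d : ℕ} (hd : 3 ≤ d) {r : ℝ}
    (hr : ((d : ℝ) ^ 2 + 1) / ((d : ℝ) * ((d : ℝ) - 1)) < r) {x y : ℝ}
    (h : (x, y) ∈ interior (pentagonBig d r)) :
    y < x ∧ (d:ℝ) * x < d - 1 ∧ x < d * y ∧ (d + 1) * x < (d - 1) * (1 + y) ∧ 1 < r * d * y := by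
  obtain ⟨h0, h1, h2⟩ := rpos hd hr
  have hd' : (3:ℝ) ≤ d := by exact_mod_cast hd
  rw [mem_interior_iff_mem_nhds, Metric.mem_nhds_iff] at h
  obtain ⟨ε, hε, hb⟩ := h
  have hm : ∀ s t : ℝ, |s| < ε → |t| < ε → Ineqs d r (x + s) (y + t) := by
    intro s t hs ht
    apply pent_sub hd hr (a := (x + s, y + t))
    apply hb
    simp [Prod.dist_eq, Real.dist_eq, hs, ht]
  have he : |ε/2| < ε := by rw [abs_of_pos (by positivity)]; linarith
  have he' : |-(ε/2)| < ε := by rw [abs_neg]; exact he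
  have h00 : |(0:ℝ)| < ε := by simpa
  have hrd : 0 < r * d := by positivity
  obtain ⟨a1, a2, a3, a4, a5⟩ := hm (ε/2) 0 he h00
  obtain ⟨b1, b2, b3, b4, b5⟩ := hm (-(ε/2)) 0 he' h00
  obtain ⟨c1, c2, c3, c4, c5⟩ := hm 0 (-(ε/2)) h00 he'
  refine ⟨?_, ?_, ?_, ?_, ?_⟩ <;> nlinarith

set_option maxHeartbeats 1600000 in
/-- choice of the parameters -/
lemma params {d : ℕ} (hd : 3 ≤ d) {r : ℝ} (hr : 1 < r) {x y : ℝ}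
    (hxy : y < x) (h1 : (d:ℝ) * x < d - 1) (h2 : x < d * y)
    (h3 : (d + 1) * x < (d - 1) * (1 + y)) (h5 : (d:ℝ)^2 + 1 < r * (d * (d - 1))) (h4 : 1 < r * d * y) :
    ∃ x' y' β τ : ℝ, 0 < y' ∧ 1 / r ≤ x' ∧ x < x' ∧ x' < 1 ∧ y' < y ∧ 0 < β ∧ β ≤ 1 ∧ β ≤ 1 / x' - 1 ∧
      (d - 1) / (d + 1) ≤ τ ∧ τ ≤ 1 ∧ β * τ * x' = y' ∧ 2 * x' < (d - 1) * (β * x' + y') := by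
  have hd' : (3:ℝ) ≤ d := by exact_mod_cast hd
  have hr0 : 0 < r := by linarith
  have hy0 : 0 < y := by
    by_contra h; push Not at h
    have : r * d * y ≤ 0 := mul_nonpos_of_nonneg_of_nonpos (by positivity) h
    linarith
  have hx0 : 0 < x := by linarith
  have e7 : ((d:ℝ)^2+1) * ((d - 1) / (d^2+1)) = d - 1 := by field_simp
  have hd1 : 0 < (d:ℝ) - 1 := by linarith
  have hr1 : r * (1 / r) = 1 := by field_simp
  have hir : 0 < 1 / r := by positivity
  rcases le_or_gt y (((d:ℝ) - 1) / (d^2+1)) with c | c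
  · have hM : max x (1/r) < d * y := by
      refine max_lt h2 ?_
      rw [div_lt_iff₀ hr0]; linarith
    obtain ⟨Y, hY1, hY2⟩ := exists_between hM
    obtain ⟨hY3, hY4⟩ := max_lt_iff.1 hY1
    set y' := Y / d with hy'
    have hYd : Y = d * y' := by rw [hy']; field_simp
    have hy'p : 0 < y' := by rw [hy']; apply div_pos <;> linarith
    have hyy : y' < y := by
      rw [hYd] at hY2; exact lt_of_mul_lt_mul_left hY2 (by positivity)
    have hL : max (max x (1/r)) (y' * (d+1)/(d-1)) < Y := by
      refine max_lt hY1 ?_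
      rw [div_lt_iff₀ hd1, hYd]
      nlinarith
    obtain ⟨x', hx1, hx2⟩ := exists_between hL
    obtain ⟨hx3, hx4⟩ := max_lt_iff.1 hx1
    obtain ⟨hx5, hx6⟩ := max_lt_iff.1 hx3
    have hx'0 : 0 < x' := by linarith
    have k0 : y' * (d+1)/(d-1) * (d-1) = y' * (d+1) := by field_simp
    have k1 : y' * (d^2+1) ≤ d - 1 := by
      rw [mul_comm, ← e7]; gcongr; linarith
    have k2 : y' * (d+1)/(d-1) ≤ 1 - x' := by
      rw [div_le_iff₀ hd1]
      nlinarith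
    have kp : 0 < y' * (d+1)/(d-1) := by positivity
    refine ⟨x', y', y' * (d+1)/(d-1) / x', (d-1)/(d+1), hy'p, hx6.le, hx5, by linarith, hyy,
      by positivity, ?_, ?_, le_rfl, ?_, ?_, ?_⟩
    · rw [div_le_one hx'0]; exact hx4.le
    · rw [div_le_iff₀ hx'0, sub_mul, div_mul_cancel₀ _ hx'0.ne']; linarith
    · rw [div_le_one (by positivity)]; linarith
    · field_simp
    · rw [div_mul_cancel₀ _ hx'0.ne']
      nlinarith
  · have e6 : (d:ℝ) * (1 / d) = 1 := by field_simp
    have huv : ((d:ℝ) - 1) / (d^2+1) < 1 / (d:ℝ) := by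
      rw [div_lt_div_iff₀ (by positivity) (by positivity)]; nlinarith
    have hu : 0 < ((d:ℝ) - 1) / (d^2+1) := by positivity
    set u := ((d:ℝ) - 1) / (d^2+1)
    set v := 1 / (d:ℝ)
    have k0 : (d+1)*x/(d-1) * (d-1) = (d+1)*x := by field_simp
    have hM : max u ((d+1)*x/(d-1) - 1) < min y v := by
      refine max_lt (lt_min c huv) (lt_min ?_ ?_)
      · have : (d+1)*x/(d-1) < 1 + y := by rw [div_lt_iff₀ hd1]; linarith
        linarith
      · have : (d+1)*x/(d-1) < 1 + v := by
          rw [div_lt_iff₀ hd1]; nlinarith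
        linarith
    obtain ⟨y', hY1, hY2⟩ := exists_between hM
    obtain ⟨hY3, hY4⟩ := max_lt_iff.1 hY1
    obtain ⟨hY5, hY6⟩ := lt_min_iff.1 hY2
    set X := (d-1)*(1+y')/((d:ℝ)+1) with hX
    have hX' : X * (d+1) = (d-1)*(1+y') := by rw [hX]; field_simp
    have hdy : (d:ℝ) * y' < 1 := by rw [← e6]; gcongr
    have kL : y' * (d+1)/(d-1) * (d-1) = y' * (d+1) := by field_simp
    have hyd : (d:ℝ) - 1 < y' * (d^2+1) := by
      rw [← e7, mul_comm]; gcongr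
    have hL : max (max x (1/r)) (max (1 - y' * (d+1)/(d-1)) (1/2)) < X := by
      refine max_lt (max_lt ?_ ?_) (max_lt ?_ ?_)
      · rw [hX, lt_div_iff₀ (by positivity)]
        nlinarith
      · have a1 : 1/r < d * u := by
          rw [div_lt_iff₀ hr0]
          have : (d:ℝ)^2+1 < r * d * ((d^2+1)*u) := by rw [e7]; linarith
          have : ((d:ℝ)^2+1) * 1 < ((d^2+1))*(d * u * r) := by linarith
          exact lt_of_mul_lt_mul_left this (by positivity)
        refine a1.trans ?_
        rw [hX, lt_div_iff₀ (by positivity)]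
        nlinarith
      · have : 1 - X < y' * (d+1)/(d-1) := by
          rw [lt_div_iff₀ hd1]
          have : 0 < (d:ℝ)+1 := by positivity
          have h : (1-X)*(d-1)*(d+1) < y'*(d+1)*(d+1) := by nlinarith
          exact lt_of_mul_lt_mul_right h this.le
        linarith
      · rw [hX, lt_div_iff₀ (by positivity)]
        nlinarith
    obtain ⟨x', hx1, hx2⟩ := exists_between hL
    obtain ⟨hx3, hx4⟩ := max_lt_iff.1 hx1
    obtain ⟨hx5, hx6⟩ := max_lt_iff.1 hx3
    obtain ⟨hx7, hx8⟩ := max_lt_iff.1 hx4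
    have hx'0 : 0 < x' := by linarith
    have hx'1 : y' < 1 - x' := by
      have : X < 1 - y' := by
        rw [hX, div_lt_iff₀ (by positivity)]; nlinarith
      linarith
    have hy'0 : 0 < y' := by linarith
    have hb : (1/x' - 1) * x' = 1 - x' := by field_simp
    refine ⟨x', y', 1/x' - 1, y'/(1-x'), hy'0, hx6.le, hx5, by linarith, hY5, ?_, ?_, le_rfl,
      ?_, ?_, ?_, ?_⟩
    · rw [sub_pos, lt_div_iff₀ hx'0]; linarith
    · have : 1/x' ≤ 2 := by rw [div_le_iff₀ hx'0]; linarith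
      linarith
    · rw [div_le_div_iff₀ (by positivity) (by linarith)]
      have : (1 - x') * (d-1) < y' * (d+1)/(d-1) * (d-1) := by gcongr; linarith
      linarith
    · rw [div_le_one (by linarith)]; linarith
    · rw [mul_right_comm, hb]
      have hne : (1 - x') ≠ 0 := ne_of_gt (by linarith)
      field_simp
    · rw [hb]
      have : x' * (d+1) < X * (d+1) := by gcongr
      linarith

end Pent
end

section
open MeasureTheory Metric Set
open scoped ENNReal NNReal FourierTransform

namespace Pent

lemma toSphere_univ_ne_zero {d : ℕ} (hd : 3 ≤ d) :
    (volume : Measure (Euc d)).toSphere Set.univ ≠ 0 := by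
  rw [Measure.toSphere_apply_univ]
  have h1 : (volume : Measure (Euc d)) (ball 0 1) ≠ 0 := (measure_ball_pos _ _ one_pos).ne'
  simp only [finrank_euclideanSpace, Fintype.card_fin, ne_eq, mul_eq_zero, h1, or_false]
  norm_cast
  omega

lemma toSphere_univ_ne_top {d : ℕ} :
    (volume : Measure (Euc d)).toSphere Set.univ ≠ ∞ := by
  rw [Measure.toSphere_apply_univ]
  exact ENNReal.mul_ne_top (by simp) measure_ball_lt_top.ne

lemma sphereMeasure_prob {d : ℕ} (hd : 3 ≤ d) : IsProbabilityMeasure (sphereMeasure d) := by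
  constructor
  rw [sphereMeasure, Measure.smul_apply, Measure.map_apply measurable_subtype_coe MeasurableSet.univ,
    preimage_univ, smul_eq_mul]
  exact ENNReal.inv_mul_cancel (toSphere_univ_ne_zero hd) toSphere_univ_ne_top

lemma sphereMeasure_ae (d : ℕ) : ∀ᵐ y ∂(sphereMeasure d), ‖y‖ = 1 := by
  apply Measure.ae_smul_measure
  have hm : MeasurableSet {y : Euc d | ‖y‖ = 1} := (measurableSet_eq_fun measurable_norm measurable_const)
  rw [ae_map_iff measurable_subtype_coe.aemeasurable hm]
  refine Filter.Eventually.of_forall fun y => ?_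
  have := y.2
  simpa using this

open scoped Pointwise in
lemma cap_lemma {d : ℕ} (hd : 3 ≤ d) : ∃ c : ℝ, 0 < c ∧ ∀ e : Euc d, ‖e‖ = 1 → ∀ ρ : ℝ, 0 < ρ → ρ ≤ 1 →
    ENNReal.ofReal (c * ρ ^ (d - 1)) ≤ sphereMeasure d (closedBall e ρ) := by
  set T := (volume : Measure (Euc d)).toSphere Set.univ with hT
  have hT0 : T ≠ 0 := toSphere_univ_ne_zero hd
  have hT1 : T ≠ ∞ := toSphere_univ_ne_top
  set b := (volume : Measure (Euc d)) (ball 0 1) with hb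
  have hb0 : 0 < b := measure_ball_pos _ _ one_pos
  have hb1 : b ≠ ∞ := measure_ball_lt_top.ne
  have hTi : 0 < (T⁻¹).toReal := ENNReal.toReal_pos (by simpa using hT1) (by simpa using hT0)
  have hbr : 0 < b.toReal := ENNReal.toReal_pos hb0.ne' hb1
  refine ⟨(T⁻¹).toReal * (b.toReal / 8 ^ d), by positivity, fun e he ρ hρ hρ1 => ?_⟩
  set K := ⌊1 / ρ⌋₊ with hK
  have hKρ : K * ρ ≤ 1 := by
    have : (K:ℝ) ≤ 1 / ρ := Nat.floor_le (by positivity)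
    rwa [le_div_iff₀ hρ] at this
  have hK1 : 1 / ρ ≤ K + 1 := (Nat.lt_floor_add_one _).le
  -- the balls
  set B : ℕ → Set (Euc d) := fun k => ball ((1/2 + k * ρ / 4 : ℝ) • e) (ρ / 8) with hB
  have hsub : (⋃ k ∈ Finset.range (K+1), B k) ⊆ Ioo (0:ℝ) 1 • (((↑) : sphere (0:Euc d) 1 → Euc d) '' (Subtype.val ⁻¹' closedBall e ρ)) := by
    intro w hw
    simp only [mem_iUnion, Finset.mem_range, exists_prop] at hw
    obtain ⟨k, hk, hw⟩ := hw
    have hkK : (k:ℝ) * ρ ≤ 1 := by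
      have : (k:ℝ) ≤ K := by exact_mod_cast Nat.lt_succ_iff.1 hk
      nlinarith
    set s := 1/2 + (k:ℝ) * ρ / 4 with hs
    have hk0 : 0 ≤ (k:ℝ) * ρ := by positivity
    have hw' : ‖w - s • e‖ < ρ / 8 := by rw [← dist_eq_norm]; exact hw
    have hse : ‖s • e‖ = s := by rw [norm_smul, he, Real.norm_of_nonneg (by positivity)]; ring
    have h1 : |‖w‖ - s| < ρ / 8 := by
      have := abs_norm_sub_norm_le w (s • e)
      rw [hse] at this
      linarith
    rw [abs_lt] at h1
    have hwp : 0 < ‖w‖ := by linarith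
    refine Set.mem_smul.2 ⟨‖w‖, ⟨hwp, by linarith⟩, ‖w‖⁻¹ • w, ?_, ?_⟩
    · refine ⟨⟨‖w‖⁻¹ • w, ?_⟩, ?_, rfl⟩
      · simp [norm_smul, hwp.ne']
      · simp only [mem_preimage, mem_closedBall, dist_eq_norm]
        have : ‖w‖⁻¹ • w - e = ‖w‖⁻¹ • ((w - s • e) + (s - ‖w‖) • e) := by
          rw [sub_smul, sub_add_sub_cancel, smul_sub, smul_smul, inv_mul_cancel₀ hwp.ne', one_smul]
        rw [this, norm_smul, norm_inv, norm_norm, inv_mul_le_iff₀ hwp]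
        have h2 : ‖(s - ‖w‖) • e‖ ≤ ρ / 8 := by
          rw [norm_smul, he, mul_one, Real.norm_eq_abs, abs_le]
          constructor <;> linarith
        have := norm_add_le (w - s • e) ((s - ‖w‖) • e)
        nlinarith
    · simp [smul_smul, hwp.ne']
  have hdisj : (Finset.range (K+1) : Set ℕ).PairwiseDisjoint B := by
    intro k _ l _ hkl
    apply ball_disjoint_ball
    rw [dist_eq_norm, ← sub_smul, norm_smul, he, mul_one, Real.norm_eq_abs]
    have : (1:ℝ) ≤ |(k:ℝ) - l| := by
      have : (1:ℤ) ≤ |(k:ℤ) - l| := Int.one_le_abs (by omega)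
      exact_mod_cast this
    have h3 : (1/2 + (k:ℝ) * ρ / 4 - (1/2 + l * ρ / 4)) = (k - l) * (ρ / 4) := by ring
    rw [h3, abs_mul, abs_of_pos (by positivity : 0 < ρ/4)]
    nlinarith
  have hvol : ∀ k, volume (B k) = ENNReal.ofReal ((ρ / 8) ^ d) * b := by
    intro k
    rw [hB, Measure.addHaar_ball_of_pos _ _ (by positivity)]
    simp [hb]
  have hge : ENNReal.ofReal ((K+1) * (ρ/8)^d * b.toReal) ≤ volume (⋃ k ∈ Finset.range (K+1), B k) := by
    rw [measure_biUnion_finset hdisj (fun _ _ => measurableSet_ball)]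
    simp only [hvol, Finset.sum_const, Finset.card_range, nsmul_eq_mul]
    rw [ENNReal.ofReal_mul (by positivity), ENNReal.ofReal_mul (by positivity), ENNReal.ofReal_toReal hb1, mul_assoc]
    gcongr
    rw [← Nat.cast_succ, ENNReal.ofReal_natCast]
  rw [sphereMeasure, Measure.smul_apply, Measure.map_apply measurable_subtype_coe measurableSet_closedBall,
    Measure.toSphere_apply' _ (measurable_subtype_coe measurableSet_closedBall), smul_eq_mul]
  calc ENNReal.ofReal ((T⁻¹).toReal * (b.toReal / 8 ^ d) * ρ ^ (d-1))
      ≤ ENNReal.ofReal ((T⁻¹).toReal * ((K+1) * (ρ/8)^d * b.toReal)) := by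
        apply ENNReal.ofReal_le_ofReal
        rw [mul_assoc]
        refine mul_le_mul_of_nonneg_left ?_ hTi.le
        have : ρ ^ d = ρ ^ (d - 1) * ρ := by rw [← pow_succ]; congr; omega
        rw [div_pow, this]
        rw [div_le_iff₀ hρ] at hK1
        have : b.toReal / 8 ^ d * ρ ^ (d - 1) * 1 ≤ b.toReal / 8 ^ d * ρ ^ (d - 1) * ((K+1) * ρ) := by
          gcongr
        calc _ = b.toReal / 8 ^ d * ρ ^ (d - 1) * 1 := by ring
          _ ≤ _ := this
          _ = _ := by ring
    _ = T⁻¹ * ENNReal.ofReal ((K+1) * (ρ/8)^d * b.toReal) := by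
        rw [ENNReal.ofReal_mul ENNReal.toReal_nonneg, ENNReal.ofReal_toReal (by simpa using hT0)]
    _ ≤ T⁻¹ * (Module.finrank ℝ (Euc d) * volume (Ioo (0:ℝ) 1 • (((↑) : sphere (0:Euc d) 1 → Euc d) '' (Subtype.val ⁻¹' closedBall e ρ)))) := by
        gcongr
        calc _ ≤ _ := hge
          _ ≤ volume (Ioo (0:ℝ) 1 • (((↑) : sphere (0:Euc d) 1 → Euc d) '' (Subtype.val ⁻¹' closedBall e ρ))) := measure_mono hsub
          _ = 1 * volume (Ioo (0:ℝ) 1 • (((↑) : sphere (0:Euc d) 1 → Euc d) '' (Subtype.val ⁻¹' closedBall e ρ))) := by rw [one_mul]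
          _ ≤ _ := by
            gcongr
            simp only [finrank_euclideanSpace, Fintype.card_fin]
            norm_cast
            omega

end Pent
end

section
open MeasureTheory Metric Set
open scoped ENNReal NNReal FourierTransform

namespace Pent

/-- complex valued indicator function -/
def ind {d : ℕ} (S : Set (Euc d)) : Euc d → ℂ := S.indicator (fun _ => 1)

lemma sphAvg_ind {d : ℕ} {S : Set (Euc d)} (hS : MeasurableSet S) (t : ℝ) (x : Euc d) :
    sphAvg (ind S) t x = (((sphereMeasure d) {y | x - t • y ∈ S}).toReal : ℂ) := by
  have hm : MeasurableSet {y : Euc d | x - t • y ∈ S} :=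
    (measurable_const.sub (measurable_id.const_smul t)) hS
  have : (fun y => ind S (x - t • y)) = {y : Euc d | x - t • y ∈ S}.indicator (fun _ => (1:ℂ)) := by
    ext y; simp [ind, indicator]
  rw [sphAvg, this, integral_indicator_const _ hm]
  simp [Measure.real]

lemma sphAvg_zero {d : ℕ} {S : Set (Euc d)} (hS : MeasurableSet S) (t : ℝ) (x : Euc d)
    (h : ∀ y, ‖y‖ = 1 → x - t • y ∉ S) : sphAvg (ind S) t x = 0 := by
  have : (sphereMeasure d) {y | x - t • y ∈ S} = 0 := by
    rw [← compl_compl {y : Euc d | x - t • y ∈ S}, ← mem_ae_iff]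
    filter_upwards [sphereMeasure_ae d] with y hy using h y hy
  rw [sphAvg_ind hS, this]; simp

lemma sphAvg_one {d : ℕ} (hd : 3 ≤ d) {S : Set (Euc d)} (hS : MeasurableSet S) (t : ℝ) (x : Euc d)
    (h : ∀ y, ‖y‖ = 1 → x - t • y ∈ S) : sphAvg (ind S) t x = 1 := by
  have := sphereMeasure_prob hd
  have : (sphereMeasure d) {y | x - t • y ∈ S} = 1 := by
    apply (prob_compl_eq_zero_iff _).1
    · rw [← mem_ae_iff]
      filter_upwards [sphereMeasure_ae d] with y hy using h y hy
    · exact (measurable_const.sub (measurable_id.const_smul t)) hS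
  rw [sphAvg_ind hS, this]; simp

lemma sphAvg_ge {d : ℕ} (hd : 3 ≤ d) {S : Set (Euc d)} (hS : MeasurableSet S) (t : ℝ) (x e : Euc d) (ρ c : ℝ)
    (h : ∀ y, ‖y‖ = 1 → ‖y - e‖ ≤ ρ → x - t • y ∈ S)
    (hc : ENNReal.ofReal c ≤ sphereMeasure d (closedBall e ρ)) :
    ENNReal.ofReal c ≤ ‖sphAvg (ind S) t x‖ₑ := by
  have := sphereMeasure_prob hd
  rw [sphAvg_ind hS]
  have h1 : sphereMeasure d (closedBall e ρ) ≤ (sphereMeasure d) {y | x - t • y ∈ S} := by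
    apply measure_mono_ae
    filter_upwards [sphereMeasure_ae d] with y hy hy2
    have hy3 : y ∈ closedBall e ρ := hy2
    rw [mem_closedBall, dist_eq_norm] at hy3
    exact h y hy hy3
  refine (hc.trans h1).trans (le_of_eq ?_)
  rw [← ofReal_norm]
  simp only [Complex.norm_real, Real.norm_eq_abs]
  rw [abs_of_nonneg ENNReal.toReal_nonneg, ENNReal.ofReal_toReal (measure_ne_top _ _)]

lemma rVar_ge {r : ℝ} (hr : 0 < r) {E : Set ℝ} {a : ℝ → ℂ} {s t : ℝ} (hs : s ∈ E) (ht : t ∈ E) (hst : s < t) :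
    ‖a t - a s‖ₑ ≤ rVar r E a := by
  refine le_trans ?_ (le_iSup _ 1)
  refine le_trans ?_ (le_iSup _ ![s, t])
  have hm : StrictMono ![s, t] := by
    intro i j hij; fin_cases i <;> fin_cases j <;> simp_all
  refine le_trans ?_ (le_iSup _ hm)
  refine le_trans ?_ (le_iSup _ (by intro i; fin_cases i <;> simp [hs, ht]))
  simp only [Finset.univ_unique, Fin.default_eq_zero, Finset.sum_singleton]
  rw [← ENNReal.rpow_mul, mul_one_div_cancel hr.ne', ENNReal.rpow_one]
  simp [enorm]

lemma rVar_ge' {r : ℝ} (hr : 0 < r) {E : Set ℝ} {a : ℝ → ℂ} {s t : ℝ} (hs : s ∈ E) (ht : t ∈ E)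
    (h0 : a s = 0) : ‖a t‖ₑ ≤ rVar r E a := by
  rcases lt_trichotomy s t with h | h | h
  · simpa [h0] using rVar_ge (a := a) hr hs ht h
  · subst h; simp [h0]
  · simpa [h0] using rVar_ge (a := a) hr ht hs h

lemma lqNorm_ge {d : ℕ} {q : ℝ≥0∞} (hq : 1 ≤ q) {g : Euc d → ℝ≥0∞} {U : Set (Euc d)} (hU : MeasurableSet U)
    (hU0 : volume U ≠ 0) {l : ℝ≥0∞} (h : ∀ x ∈ U, l ≤ g x) :
    l * volume U ^ (q⁻¹.toReal) ≤ lqNorm q g volume := by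
  rw [lqNorm]
  split_ifs with hqt
  · subst hqt
    simp only [ENNReal.inv_top, ENNReal.toReal_zero, ENNReal.rpow_zero, mul_one]
    rw [essSup]
    refine le_of_not_gt fun hlt => hU0 ?_
    have := ae_lt_of_essSup_lt hlt
    rw [ae_iff] at this
    refine measure_mono_null ?_ this
    intro x hx
    simpa using h x hx
  · have hq0 : 0 < q.toReal := ENNReal.toReal_pos (by positivity) hqt
    have hinv : q⁻¹.toReal = 1 / q.toReal := by simp [ENNReal.toReal_inv]
    rw [hinv]
    have h1 : l ^ q.toReal * volume U ≤ ∫⁻ x, g x ^ q.toReal := by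
      calc l ^ q.toReal * volume U = ∫⁻ x in U, l ^ q.toReal := by simp
        _ ≤ ∫⁻ x in U, g x ^ q.toReal := by
          apply setLIntegral_mono' hU
          intro x hx
          gcongr
          exact h x hx
        _ ≤ _ := setLIntegral_le_lintegral _ _
    calc l * volume U ^ (1 / q.toReal) = (l ^ q.toReal * volume U) ^ (1 / q.toReal) := by
          rw [ENNReal.mul_rpow_of_nonneg _ _ (by positivity), ← ENNReal.rpow_mul, mul_one_div_cancel hq0.ne',
            ENNReal.rpow_one]
      _ ≤ _ := by gcongr

lemma contra {d : ℕ} {r : ℝ} {p q : ℝ≥0∞} (hq : 1 ≤ q) (hbd : IsBddLpLq d p q (VrIA r))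
    {L B A c1 c2 c3 : ℝ} (hc1 : 0 < c1) (hc2 : 0 < c2) (hc3 : 0 < c3) (M0 : ℕ)
    (hlt : A * p⁻¹.toReal < L + B * q⁻¹.toReal)
    (H : ∀ M : ℕ, M0 ≤ M → 0 < M → ∃ S U : Set (Euc d), MeasurableSet S ∧ MeasurableSet U ∧
      volume S ≤ ENNReal.ofReal (c3 * (M:ℝ) ^ A) ∧ ENNReal.ofReal (c2 * (M:ℝ) ^ B) ≤ volume U ∧
      ∀ x ∈ U, ENNReal.ofReal (c1 * (M:ℝ) ^ L) ≤ VrIA r (ind S) x) : False := by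
  obtain ⟨C, hC⟩ := hbd
  set X := p⁻¹.toReal
  set Y := q⁻¹.toReal
  have hX : 0 ≤ X := ENNReal.toReal_nonneg
  have hY : 0 ≤ Y := ENNReal.toReal_nonneg
  have key : ∀ M : ℕ, M0 ≤ M → 0 < M → c1 * c2 ^ Y * (M:ℝ) ^ (L + B * Y - A * X) ≤ C * c3 ^ X := by
    intro M hM hM0
    obtain ⟨S, U, hS, hU, hSv, hUv, hV⟩ := H M hM hM0
    have hMr : (0:ℝ) < M := by exact_mod_cast hM0
    have hSf : volume S ≠ ∞ := ne_top_of_le_ne_top ENNReal.ofReal_ne_top hSv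
    have hU0 : volume U ≠ 0 := by
      intro h0; rw [h0, nonpos_iff_eq_zero, ENNReal.ofReal_eq_zero] at hUv
      have : 0 < c2 * (M:ℝ) ^ B := by positivity
      linarith
    have hmem : MemLp (ind S) p volume := memLp_indicator_const p hS (1:ℂ) (Or.inr hSf)
    have h1 := lqNorm_ge hq hU hU0 hV
    have h2 := hC _ hmem
    have h3 : eLpNorm (ind S) p volume ≤ volume S ^ X := by
      refine (eLpNorm_indicator_const_le (1:ℂ) p).trans ?_
      simp [X, ENNReal.toReal_inv]
    have h4 : ENNReal.ofReal (c1 * (M:ℝ) ^ L) * (ENNReal.ofReal (c2 * (M:ℝ) ^ B)) ^ Y ≤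
        C * (ENNReal.ofReal (c3 * (M:ℝ) ^ A)) ^ X := by
      calc _ ≤ ENNReal.ofReal (c1 * (M:ℝ) ^ L) * volume U ^ Y := by gcongr
        _ ≤ _ := h1
        _ ≤ _ := h2
        _ ≤ C * volume S ^ X := by gcongr
        _ ≤ _ := by gcongr
    rw [ENNReal.ofReal_rpow_of_pos (by positivity), ENNReal.ofReal_rpow_of_pos (by positivity),
      ← ENNReal.ofReal_mul (by positivity), ← ENNReal.ofReal_coe_nnreal (p := C), ← ENNReal.ofReal_mul (by positivity),
      ENNReal.ofReal_le_ofReal_iff (by positivity), Real.mul_rpow (by positivity) (by positivity),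
      Real.mul_rpow (by positivity) (by positivity), ← Real.rpow_mul hMr.le, ← Real.rpow_mul hMr.le] at h4
    rw [Real.rpow_sub hMr, Real.rpow_add hMr, ← mul_div_assoc, div_le_iff₀ (by positivity)]
    calc _ = c1 * (M:ℝ) ^ L * (c2 ^ Y * (M:ℝ) ^ (B * Y)) := by ring
      _ ≤ _ := h4
      _ = _ := by ring
  have ht : Filter.Tendsto (fun M : ℕ => c1 * c2 ^ Y * (M:ℝ) ^ (L + B * Y - A * X)) Filter.atTop Filter.atTop := by
    apply Filter.Tendsto.const_mul_atTop (by positivity)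
    exact (tendsto_rpow_atTop (by linarith)).comp tendsto_natCast_atTop_atTop
  obtain ⟨M, hM1, hM2, hM3⟩ := ((ht.eventually_gt_atTop (C * c3 ^ X)).and
    ((Filter.eventually_ge_atTop M0).and (Filter.eventually_gt_atTop 0))).exists
  exact absurd (key M hM2 hM3) (not_le.2 hM1)

end Pent
end

section
open MeasureTheory Metric Set
open scoped ENNReal NNReal FourierTransform

namespace Pent

/-- volume of the unit ball -/
def bvol (d : ℕ) : ℝ := (volume (ball (0 : Euc d) 1)).toReal

lemma bvol_pos (d : ℕ) : 0 < bvol d :=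
  ENNReal.toReal_pos (measure_ball_pos _ _ one_pos).ne' measure_ball_lt_top.ne

lemma vol_ball {d : ℕ} (x : Euc d) {ρ : ℝ} (hρ : 0 < ρ) : volume (ball x ρ) = ENNReal.ofReal (ρ ^ d * bvol d) := by
  rw [Measure.addHaar_ball_of_pos _ _ hρ, ENNReal.ofReal_mul (by positivity), bvol,
    ENNReal.ofReal_toReal measure_ball_lt_top.ne]
  simp

lemma vol_cball {d : ℕ} (x : Euc d) {ρ : ℝ} (hρ : 0 < ρ) : volume (closedBall x ρ) = ENNReal.ofReal (ρ ^ d * bvol d) := by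
  rw [Measure.addHaar_closedBall _ _ hρ.le, ENNReal.ofReal_mul (by positivity), bvol,
    ENNReal.ofReal_toReal measure_ball_lt_top.ne]
  simp

/-- annulus -/
def ann {d : ℕ} (c : Euc d) : Set (Euc d) := ball c (19/10) \ closedBall c (11/10)

lemma ann_meas {d : ℕ} (c : Euc d) : MeasurableSet (ann c) := measurableSet_ball.diff measurableSet_closedBall

def annv (d : ℕ) : ℝ := (19/10)^d * bvol d - (11/10)^d * bvol d

lemma annv_pos {d : ℕ} (hd : 3 ≤ d) : 0 < annv d := by
  have := bvol_pos d
  have : (11/10 : ℝ)^d < (19/10)^d := by gcongr <;> first | omega | norm_num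
  unfold annv; nlinarith

lemma vol_ann {d : ℕ} (c : Euc d) : volume (ann c) = ENNReal.ofReal (annv d) := by
  have := bvol_pos d
  rw [ann, measure_sdiff (closedBall_subset_ball (by norm_num)) measurableSet_closedBall.nullMeasurableSet
    measure_closedBall_lt_top.ne, vol_ball _ (by norm_num), vol_cball _ (by norm_num), annv,
    ENNReal.ofReal_sub _ (by positivity)]

lemma mem_ann {d : ℕ} {c x : Euc d} (h : x ∈ ann c) : 11/10 < ‖x - c‖ ∧ ‖x - c‖ < 19/10 := by
  simp only [ann, mem_sdiff, mem_ball, mem_closedBall, not_le, dist_eq_norm] at h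
  exact ⟨h.2, h.1⟩

lemma ann_V {d : ℕ} (hd : 3 ≤ d) {r : ℝ} (hr : 0 < r) {S : Set (Euc d)} (hS : MeasurableSet S) {δ k : ℝ} (hδ : 0 < δ) (hδ1 : δ ≤ 1/20) {c : Euc d}
    (hcS : closedBall c δ ⊆ S) {x : Euc d} (hx : x ∈ ann c)
    (h0 : ∀ y, ‖y‖ = 1 → x - (1:ℝ) • y ∉ S) (hk : ∀ e : Euc d, ‖e‖ = 1 → ∀ ρ : ℝ, 0 < ρ → ρ ≤ 1 →
    ENNReal.ofReal (k * ρ ^ (d - 1)) ≤ sphereMeasure d (closedBall e ρ)) :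
    ENNReal.ofReal (k * (δ / 4) ^ (d-1)) ≤ VrIA r (ind S) x := by
  obtain ⟨h1, h2⟩ := mem_ann hx
  set t := ‖x - c‖
  have hp : 0 < t := by linarith
  refine le_trans ?_ (rVar_ge' (s := 1) (t := t) hr (by simp) ⟨by linarith, by linarith⟩
    (sphAvg_zero hS _ _ h0))
  refine sphAvg_ge hd hS t x (t⁻¹ • (x - c)) (δ/4) _ ?_ (hk _ ?_ _ (by positivity) (by linarith))
  · intro y hy hy2
    apply hcS
    rw [mem_closedBall, dist_eq_norm]
    have : x - t • y - c = -(t • (y - t⁻¹ • (x - c))) := by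
      rw [smul_sub, smul_smul, mul_inv_cancel₀ hp.ne', one_smul]; abel
    rw [this, norm_neg, norm_smul, Real.norm_of_nonneg hp.le]
    nlinarith
  · rw [norm_smul, norm_inv, Real.norm_of_nonneg hp.le]; exact inv_mul_cancel₀ hp.ne'

lemma ex_b {d : ℕ} (hd : 3 ≤ d) {r : ℝ} (hr : 0 < r) {p q : ℝ≥0∞} (hq : 1 ≤ q)
    (h : (d:ℝ) - 1 < d * p⁻¹.toReal) : ¬ IsBddLpLq d p q (VrIA r) := by
  intro hbd
  obtain ⟨k, hk0, hk⟩ := cap_lemma hd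
  refine contra (L := -((d-1 : ℕ):ℝ)) (B := 0) (A := -(d:ℝ)) (c1 := k / 4 ^ (d-1)) (c2 := annv d) (c3 := bvol d) hq hbd
    (by positivity) (annv_pos hd) (bvol_pos d) 20 ?_ ?_
  · rw [Nat.cast_sub (by omega)]; push_cast; linarith
  intro M hM hM0
  have hMr : (20:ℝ) ≤ M := by exact_mod_cast hM
  have hMp : (0:ℝ) < M := by linarith
  have hδ : (1:ℝ) / M ≤ 1/20 := by gcongr
  refine ⟨closedBall 0 (1 / M), ann 0, measurableSet_closedBall, ann_meas _, ?_, ?_, ?_⟩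
  · rw [vol_cball _ (by positivity), Real.rpow_neg hMp.le, Real.rpow_natCast]
    apply le_of_eq; congr 1; rw [one_div, inv_pow]; ring
  · rw [vol_ann]; simp
  · intro x hx
    refine le_trans (le_of_eq ?_) (ann_V hd hr measurableSet_closedBall (δ := 1/M) (by positivity) hδ subset_rfl hx ?_ hk)
    · rw [Real.rpow_neg hMp.le, Real.rpow_natCast]
      congr 1; rw [div_pow, div_pow, one_pow]; field_simp
    · intro y hy hmem
      obtain ⟨h1, h2⟩ := mem_ann hx
      simp only [one_smul, mem_closedBall, dist_zero_right, sub_zero] at hmem h1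
      have := norm_sub_norm_le x y
      linarith

lemma ex_a {d : ℕ} (hd : 3 ≤ d) {r : ℝ} (hr : 0 < r) {p q : ℝ≥0∞} (hq : 1 ≤ q)
    (h : p⁻¹.toReal < q⁻¹.toReal) : ¬ IsBddLpLq d p q (VrIA r) := by
  intro hbd
  obtain ⟨k, hk0, hk⟩ := cap_lemma hd
  refine contra (L := 0) (B := 1) (A := 1) (c1 := k * (1 / 20 / 4) ^ (d-1)) (c2 := annv d) (c3 := (1/20)^d * bvol d) hq hbd
    (by positivity) (annv_pos hd) (by have := bvol_pos d; positivity) 0 ?_ ?_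
  · linarith
  intro M hM hM0
  set e : Euc d := EuclideanSpace.single ⟨0, by omega⟩ 1 with he
  have hne : ‖e‖ = 1 := by simp [he]
  set c : ℕ → Euc d := fun k => (10 * (k:ℝ)) • e with hc
  have hcd : ∀ k l, k ≠ l → 10 ≤ ‖c k - c l‖ := by
    intro k l hkl
    rw [hc]; simp only
    rw [← sub_smul, norm_smul, hne, mul_one, Real.norm_eq_abs, ← mul_sub, abs_mul]
    have : (1:ℝ) ≤ |(k:ℝ) - l| := by
      have : (1:ℤ) ≤ |(k:ℤ) - l| := Int.one_le_abs (by omega)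
      exact_mod_cast this
    rw [abs_of_pos (by norm_num : (0:ℝ) < 10)]
    linarith
  have hSm : MeasurableSet (⋃ k ∈ Finset.range M, closedBall (c k) (1/20)) :=
    Finset.measurableSet_biUnion _ (fun _ _ => measurableSet_closedBall)
  refine ⟨⋃ k ∈ Finset.range M, closedBall (c k) (1/20), ⋃ k ∈ Finset.range M, ann (c k),
    hSm, Finset.measurableSet_biUnion _ (fun _ _ => ann_meas _), ?_, ?_, ?_⟩
  · refine (measure_biUnion_finset_le _ _).trans ?_
    simp only [vol_cball _ (by norm_num : (0:ℝ) < 1/20), Finset.sum_const, Finset.card_range, nsmul_eq_mul]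
    rw [Real.rpow_one, mul_comm _ (M:ℝ), ENNReal.ofReal_mul (by positivity) (q := (1/20)^d * bvol d)]
    simp
  · rw [measure_biUnion_finset _ (fun _ _ => ann_meas _)]
    · simp only [vol_ann, Finset.sum_const, Finset.card_range, nsmul_eq_mul]
      rw [Real.rpow_one, mul_comm _ (M:ℝ), ENNReal.ofReal_mul (by positivity)]
      simp
    · intro k _ l _ hkl
      rw [Function.onFun, Set.disjoint_left]
      intro x hx hx'
      have h1 := hcd k l hkl
      obtain ⟨_, h2⟩ := mem_ann hx
      obtain ⟨_, h3⟩ := mem_ann hx'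
      have : c k - c l = (x - c l) - (x - c k) := by abel
      rw [this] at h1
      have := norm_sub_le (x - c l) (x - c k)
      linarith
  · intro x hx
    simp only [mem_iUnion, exists_prop] at hx
    obtain ⟨l, hl, hx⟩ := hx
    refine le_trans (le_of_eq ?_) (ann_V hd hr hSm (δ := 1/20) (by positivity) le_rfl (c := c l) ?_ hx ?_ hk)
    · simp
    · exact subset_biUnion_of_mem (u := fun k => closedBall (c k) (1/20)) (by exact_mod_cast hl)
    · intro y hy hmem
      simp only [mem_iUnion, exists_prop, one_smul, mem_closedBall, dist_eq_norm] at hmem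
      obtain ⟨m, hm, hmem⟩ := hmem
      obtain ⟨h2, h3⟩ := mem_ann hx
      by_cases hlm : l = m
      · subst hlm
        have := norm_sub_norm_le (x - c l) y
        have h5 : x - c l - y = x - y - c l := by abel
        rw [h5] at this
        linarith
      · have h1 := hcd l m hlm
        have : c l - c m = (x - y - c m) + y - (x - c l) := by abel
        rw [this] at h1
        have h6 := norm_sub_le ((x - y - c m) + y) (x - c l)
        have h7 := norm_add_le (x - y - c m) y
        linarith


lemma pow_sub_le (n : ℕ) {a b : ℝ} (ha : 0 ≤ a) (hab : a ≤ b) (hb : b ≤ 2) :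
    b ^ n - a ^ n ≤ n * 2 ^ n * (b - a) := by
  induction n with
  | zero => simp
  | succ n ih =>
    have h1 : b ^ n ≤ 2 ^ n := by gcongr; linarith
    have h2 : 0 ≤ (n:ℝ) * 2 ^ n * (b - a) := by have : 0 ≤ b - a := by linarith
                                                positivity
    have h3 : 0 ≤ (2:ℝ) ^ n * (b - a) := by have : 0 ≤ b - a := by linarith
                                            positivity
    have h4 : a ^ n ≤ b ^ n := by gcongr
    calc b ^ (n+1) - a ^ (n+1) = b ^ n * (b - a) + a * (b ^ n - a ^ n) := by ring
      _ ≤ 2 ^ n * (b - a) + 2 * (n * 2 ^ n * (b - a)) := by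
        gcongr <;> linarith
      _ ≤ _ := by push_cast; rw [pow_succ]; nlinarith

lemma ex_c {d : ℕ} (hd : 3 ≤ d) {r : ℝ} (hr : 0 < r) {p q : ℝ≥0∞} (hq : 1 ≤ q)
    (h : d * q⁻¹.toReal < p⁻¹.toReal) : ¬ IsBddLpLq d p q (VrIA r) := by
  intro hbd
  have hb := bvol_pos d
  refine contra (L := 0) (B := -(d:ℝ)) (A := -1) (c1 := 1) (c2 := bvol d) (c3 := d * 2 ^ d * 2 * bvol d) hq hbd
    (by positivity) hb (by positivity) 20 ?_ ?_
  · linarith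
  intro M hM hM0
  have hMr : (20:ℝ) ≤ M := by exact_mod_cast hM
  have hMp : (0:ℝ) < M := by linarith
  have hδ0 : (0:ℝ) < 1 / M := by positivity
  have hδ : (1:ℝ) / M ≤ 1/20 := by gcongr
  set δ := 1 / (M:ℝ) with hδd
  have hSm : MeasurableSet (closedBall (0 : Euc d) (3/2 + δ) \ ball 0 (3/2 - δ)) := measurableSet_closedBall.diff measurableSet_ball
  refine ⟨closedBall 0 (3/2 + δ) \ ball 0 (3/2 - δ), ball 0 δ, hSm, measurableSet_ball, ?_, ?_, ?_⟩
  · have hsub : ball (0 : Euc d) (3/2 - δ) ⊆ closedBall 0 (3/2 + δ) :=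
      (ball_subset_ball (by linarith)).trans ball_subset_closedBall
    rw [measure_sdiff hsub measurableSet_ball.nullMeasurableSet measure_ball_lt_top.ne, vol_cball _ (by linarith),
      vol_ball _ (by linarith), ← ENNReal.ofReal_sub]
    · apply ENNReal.ofReal_le_ofReal
      have := pow_sub_le d (a := 3/2 - δ) (b := 3/2 + δ) (by linarith) (by linarith) (by linarith)
      rw [Real.rpow_neg hMp.le, Real.rpow_one, ← one_div, ← hδd, ← sub_mul]
      calc _ ≤ (d * 2 ^ d * (3/2 + δ - (3/2 - δ))) * bvol d := by gcongr
        _ = _ := by ring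
    · have : 0 ≤ 3/2 - δ := by linarith
      positivity
  · rw [vol_ball _ (by positivity), Real.rpow_neg hMp.le, Real.rpow_natCast]
    apply le_of_eq; congr 1; rw [hδd, one_div, inv_pow]; ring
  · intro x hx
    simp only [mem_ball, dist_zero_right] at hx
    have h1 : sphAvg (ind (closedBall (0 : Euc d) (3/2 + δ) \ ball 0 (3/2 - δ))) 1 x = 0 := by
      apply sphAvg_zero hSm
      intro y hy hmem
      simp only [mem_sdiff, mem_ball, dist_zero_right, one_smul, not_lt] at hmem
      have := norm_sub_le x y
      linarith [hmem.2]
    have h2 : sphAvg (ind (closedBall (0 : Euc d) (3/2 + δ) \ ball 0 (3/2 - δ))) (3/2) x = 1 := by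
      apply sphAvg_one hd hSm
      intro y hy
      simp only [mem_sdiff, mem_ball, mem_closedBall, dist_zero_right, not_lt]
      have hn : ‖(3/2 : ℝ) • y‖ = 3/2 := by rw [norm_smul, hy]; norm_num
      have := norm_sub_le x ((3/2 : ℝ) • y)
      have h3 := norm_sub_norm_le ((3/2 : ℝ) • y) x
      rw [norm_sub_rev] at h3
      constructor <;> linarith
    refine le_trans ?_ (rVar_ge' (s := 1) (t := 3/2) hr (by simp) ⟨by norm_num, by norm_num⟩ h1)
    rw [h2]; simp

lemma rVar_ge_sum {r : ℝ} {E : Set ℝ} {a : ℝ → ℂ} {N : ℕ} (t : Fin (N+1) → ℝ) (ht : StrictMono t) (hE : ∀ i, t i ∈ E) :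
    (∑ i : Fin N, ‖a (t i.succ) - a (t i.castSucc)‖ₑ ^ r) ^ (1 / r) ≤ rVar r E a := by
  refine le_trans ?_ (le_iSup _ N)
  refine le_trans ?_ (le_iSup _ t)
  refine le_trans ?_ (le_iSup _ ht)
  refine le_trans ?_ (le_iSup _ hE)
  simp [enorm]

lemma ex_e {d : ℕ} (hd : 3 ≤ d) {r : ℝ} (hr : 0 < r) {p q : ℝ≥0∞} (hq : 1 ≤ q)
    (h : r * d * q⁻¹.toReal < 1) : ¬ IsBddLpLq d p q (VrIA r) := by
  intro hbd
  have hb := bvol_pos d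
  refine contra (L := 1/r) (B := -(d:ℝ)) (A := 0) (c1 := 1) (c2 := bvol d / 4^d) (c3 := 3 ^ d * bvol d) hq hbd
    (by positivity) (by positivity) (by positivity) 20 ?_ ?_
  · have : d * q⁻¹.toReal < 1 / r := by rw [lt_div_iff₀ hr]; linarith
    linarith
  intro M hM hM0
  have hMr : (20:ℝ) ≤ M := by exact_mod_cast hM
  have hMp : (0:ℝ) < M := by linarith
  set δ := 1 / (4 * (M:ℝ)) with hδd
  have hδ0 : 0 < δ := by positivity
  have hδM : 4 * δ * M = 1 := by rw [hδd]; field_simp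
  set S : Set (Euc d) := closedBall 0 3 ∩ ⋃ k : ℕ, {y | |‖y‖ - (1 + 2 * k * (4 * δ))| ≤ δ} with hS
  have hSm : MeasurableSet S := by
    refine measurableSet_closedBall.inter (MeasurableSet.iUnion fun k => ?_)
    exact measurableSet_le (by fun_prop) measurable_const
  refine ⟨S, ball 0 δ, hSm, measurableSet_ball, ?_, ?_, ?_⟩
  · refine (measure_mono inter_subset_left).trans ?_
    rw [vol_cball _ (by norm_num)]; simp
  · rw [vol_ball _ (by positivity), Real.rpow_neg hMp.le, Real.rpow_natCast]
    apply le_of_eq; congr 1; rw [hδd, div_pow, mul_pow]; field_simp; simp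
  · intro x hx
    simp only [mem_ball, dist_zero_right] at hx
    have hnorm : ∀ t : ℝ, 0 ≤ t → ∀ y : Euc d, ‖y‖ = 1 → |‖x - t • y‖ - t| < δ := by
      intro t ht y hy
      have hn : ‖t • y‖ = t := by rw [norm_smul, hy, mul_one, Real.norm_of_nonneg ht]
      have := abs_norm_sub_norm_le (t • y - x) (t • y)
      rw [hn, norm_sub_rev (t • y) x, show t • y - x - t • y = -x by abel, norm_neg] at this
      linarith
    have hev : ∀ i : ℕ, i ≤ M → Even i → sphAvg (ind S) (1 + i * (4 * δ)) x = 1 := by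
      intro i hi hev
      apply sphAvg_one hd hSm
      intro y hy
      have hiM : (i:ℝ) ≤ M := by exact_mod_cast hi
      have h1 := hnorm (1 + i * (4 * δ)) (by positivity) y hy
      obtain ⟨k, hk⟩ := hev
      refine ⟨?_, ?_⟩
      · rw [mem_closedBall, dist_zero_right]
        rw [abs_lt] at h1
        nlinarith
      · refine mem_iUnion.2 ⟨k, ?_⟩
        have : (i:ℝ) = 2 * k := by rw [hk]; push_cast; ring
        rw [this] at h1 ⊢
        exact h1.le
    have hodd : ∀ i : ℕ, i ≤ M → ¬ Even i → sphAvg (ind S) (1 + i * (4 * δ)) x = 0 := by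
      intro i hi hev
      apply sphAvg_zero hSm
      intro y hy hmem
      have h1 := hnorm (1 + i * (4 * δ)) (by positivity) y hy
      obtain ⟨k, hk⟩ := mem_iUnion.1 hmem.2
      have hk : |‖x - (1 + i * (4 * δ)) • y‖ - (1 + 2 * k * (4 * δ))| ≤ δ := hk
      have h2 : (1:ℝ) ≤ |(i:ℝ) - 2 * k| := by
        have : (1:ℤ) ≤ |(i:ℤ) - 2 * k| := Int.one_le_abs (by
          intro h0; apply hev; exact ⟨k, by omega⟩)
        exact_mod_cast this
      have h3 : |((i:ℝ) - 2 * k) * (4 * δ)| ≤ 2 * δ := by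
        rw [abs_lt] at h1
        rw [abs_le] at hk ⊢
        constructor <;> linarith
      rw [abs_mul, abs_of_pos (by positivity : 0 < 4 * δ)] at h3
      nlinarith
    set t : Fin (M+1) → ℝ := fun i => 1 + (i:ℕ) * (4 * δ) with ht
    have hmono : StrictMono t := by
      intro i j hij
      simp only [ht]
      have : ((i:ℕ):ℝ) < ((j:ℕ):ℝ) := by exact_mod_cast hij
      nlinarith
    have hE : ∀ i, t i ∈ Icc (1:ℝ) 2 := by
      intro i
      have : ((i:ℕ):ℝ) ≤ M := by exact_mod_cast Nat.lt_succ_iff.1 i.2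
      have h0 : (0:ℝ) ≤ ((i:ℕ):ℝ) := by positivity
      constructor <;> simp only [ht] <;> nlinarith
    refine le_trans (le_of_eq ?_) (rVar_ge_sum t hmono hE)
    have : ∀ i : Fin M, ‖sphAvg (ind S) (t i.succ) x - sphAvg (ind S) (t i.castSucc) x‖ₑ = 1 := by
      intro i
      simp only [ht, Fin.val_succ, Fin.val_castSucc]
      by_cases hi : Even (i:ℕ)
      · rw [hev i i.2.le hi, hodd (i+1) i.2 (by rwa [Nat.even_add_one, not_not])]
        simp
      · rw [hodd i i.2.le hi, hev (i+1) i.2 (by rwa [Nat.even_add_one])]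
        simp
    simp only [this]
    simp
    rw [← ENNReal.ofReal_natCast, ENNReal.ofReal_rpow_of_pos hMp]

lemma ex_d {d : ℕ} (hd : 3 ≤ d) {r : ℝ} (hr : 0 < r) {p q : ℝ≥0∞} (hq : 1 ≤ q)
    (h : ((d:ℝ) - 1) * (1 + q⁻¹.toReal) < (d + 1) * p⁻¹.toReal) : ¬ IsBddLpLq d p q (VrIA r) := by
  intro hbd
  obtain ⟨k, hk0, hk⟩ := cap_lemma hd
  obtain ⟨n, rfl⟩ : ∃ n, d = n + 1 := ⟨d - 1, by omega⟩
  simp only [Nat.add_sub_cancel] at hk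
  push_cast at h
  have box : ∀ (a b c e : ℝ), a ≤ b → c ≤ e → MeasurableSet {y : Euc (n+1) | y 0 ∈ Icc a b ∧ ∀ i : Fin n, y i.succ ∈ Icc c e} ∧
     volume {y : Euc (n+1) | y 0 ∈ Icc a b ∧ ∀ i : Fin n, y i.succ ∈ Icc c e} = ENNReal.ofReal ((b - a) * (e - c)^n) := by
    intro a b c e hab hce
    have hpre : {y : Euc (n+1) | y 0 ∈ Icc a b ∧ ∀ i : Fin n, y i.succ ∈ Icc c e} =
      (WithLp.ofLp : Euc (n+1) → Fin (n+1) → ℝ) ⁻¹' (Set.pi univ (Fin.cons (Icc a b) (fun _ => Icc c e))) := by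
      ext y
      simp [Set.mem_pi, Fin.forall_fin_succ]
    have hmeas : MeasurableSet (Set.pi univ (Fin.cons (Icc a b) (fun _ => Icc c e) : Fin (n+1) → Set ℝ)) := by
      apply MeasurableSet.univ_pi
      intro i
      refine Fin.cases ?_ (fun j => ?_) i <;> simp
    have hmp := PiLp.volume_preserving_ofLp (Fin (n+1))
    rw [hpre]
    refine ⟨hmp.measurable hmeas, ?_⟩
    rw [hmp.measure_preimage hmeas.nullMeasurableSet, volume_pi_pi, Fin.prod_univ_succ]
    simp only [Fin.cons_zero, Fin.cons_succ, Real.volume_Icc, Finset.prod_const, Finset.card_univ, Fintype.card_fin]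
    rw [ENNReal.ofReal_mul (by linarith), ENNReal.ofReal_pow (by linarith)]
  refine contra (L := -(n:ℝ)) (B := -(n:ℝ)) (A := -((n:ℝ)+2)) (c1 := k / 4 ^ n) (c2 := 6/10 * (1/2)^n) (c3 := 2 * 2^n) hq hbd
    (by positivity) (by positivity) (by positivity) 20 ?_ ?_
  · linarith
  intro M hM hM0
  have hMr : (20:ℝ) ≤ M := by exact_mod_cast hM
  have hMp : (0:ℝ) < M := by linarith
  have hδ0 : (0:ℝ) < 1 / M := by positivity
  have hδ : (1:ℝ) / M ≤ 1/20 := by gcongr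
  set δ := 1 / (M:ℝ) with hδd
  obtain ⟨hS1, hS2⟩ := box (-(δ^2)) (δ^2) (-δ) δ (by nlinarith) (by linarith)
  obtain ⟨hU1, hU2⟩ := box (12/10) (18/10) (-(δ/4)) (δ/4) (by norm_num) (by linarith)
  refine ⟨_, _, hS1, hU1, ?_, ?_, ?_⟩
  · rw [hS2]
    apply le_of_eq; congr 1
    rw [Real.rpow_neg hMp.le, Real.rpow_add hMp, Real.rpow_natCast]
    norm_num
    rw [show δ + δ = 2 * δ by ring, mul_pow, hδd]; field_simp
    rw [div_pow]; field_simp; ring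
  · rw [hU2]
    apply le_of_eq; congr 1
    rw [Real.rpow_neg hMp.le, Real.rpow_natCast, show δ/4 - -(δ/4) = 1/2 * δ by ring, mul_pow, hδd, div_pow]
    have : (M:ℝ)^n ≠ 0 := by positivity
    norm_num; field_simp
  · rintro x ⟨hx0, hx⟩
    have hz : sphAvg (ind {y : Euc (n+1) | y 0 ∈ Icc (-(δ^2)) (δ^2) ∧ ∀ i : Fin n, y i.succ ∈ Icc (-δ) δ}) 1 x = 0 := by
      apply sphAvg_zero hS1
      intro y hy hmem
      have h1 := hmem.1
      simp only [one_smul, PiLp.sub_apply] at h1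
      have h2 : |y 0| ≤ 1 := by rw [← hy]; exact PiLp.norm_apply_le y 0
      rw [abs_le] at h2
      have := hx0.1
      nlinarith [h1.2]
    have ht : x 0 ∈ Icc (1:ℝ) 2 := ⟨by linarith [hx0.1], by linarith [hx0.2]⟩
    refine le_trans ?_ (rVar_ge' (s := 1) (t := x 0) hr (by simp) ht hz)
    refine sphAvg_ge hd hS1 (x 0) x (EuclideanSpace.single 0 1) (δ/4) _ ?_ (le_trans (le_of_eq ?_) (hk _ (by simp) _ (by positivity) (by linarith)))
    · intro y hy hy2
      have hc : ∀ i, |(y - EuclideanSpace.single 0 1 : Euc (n+1)) i| ≤ δ/4 := fun i => (PiLp.norm_apply_le _ i).trans hy2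
      have hy0 : ‖y - EuclideanSpace.single 0 1‖^2 = 2 - 2 * y 0 := by
        rw [@norm_sub_sq_real, hy]
        simp [EuclideanSpace.inner_single_right]
        ring
      have hyle : y 0 ≤ 1 := by
        have h2 : |y 0| ≤ 1 := by rw [← hy]; exact PiLp.norm_apply_le y 0
        exact (abs_le.1 h2).2
      refine ⟨?_, fun i => ?_⟩
      · simp only [PiLp.sub_apply, PiLp.smul_apply, smul_eq_mul]
        have h3 : ‖y - EuclideanSpace.single 0 1‖^2 ≤ (δ/4)^2 := by gcongr
        have := hx0.1
        have := hx0.2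
        constructor
        · nlinarith
        · nlinarith
      · have h4 := hc i.succ
        simp at h4
        simp only [PiLp.sub_apply, PiLp.smul_apply, smul_eq_mul]
        have h5 := hx i
        have h6 : |x 0 * y i.succ| ≤ δ/2 := by
          rw [abs_mul, abs_of_nonneg (by linarith [ht.1])]
          nlinarith [ht.2, abs_nonneg (y i.succ), ht.1]
        rw [abs_le] at h6
        constructor <;> linarith [h5.1, h5.2]
    · congr 1
      rw [Real.rpow_neg hMp.le, Real.rpow_natCast, hδd, div_pow, div_pow]
      field_simp; simp

end Pent
end

section
open MeasureTheory Metric Set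
open scoped ENNReal NNReal FourierTransform
namespace Pent

open scoped ContDiff in
lemma fourier_ae {V : Type*} [NormedAddCommGroup V] [InnerProductSpace ℝ V] [FiniteDimensional ℝ V]
    [MeasurableSpace V] [BorelSpace V] {g : V → ℂ} (h1 : Integrable g) (h2 : MemLp g 2) :
    𝓕 g =ᵐ[volume] (𝓕 (h2.toLp g) : Lp ℂ 2 (volume : Measure V)) := by
  apply ae_eq_of_integral_contDiff_smul_eq
  · exact (VectorFourier.fourierIntegral_continuous (L := innerₗ V)
      Real.continuous_fourierChar continuous_inner h1).locallyIntegrable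
  · exact (Lp.memLp _).locallyIntegrable (by norm_num)
  · intro φ φs φc
    have hg₁ : HasCompactSupport (Complex.ofRealCLM ∘ φ) := φc.comp_left rfl
    have hg₂ : ContDiff ℝ ∞ (Complex.ofRealCLM ∘ φ) := by fun_prop
    let S : SchwartzMap V ℂ := hg₁.toSchwartzMap hg₂
    have hS : ∀ x, S x = φ x := fun x => rfl
    have e1 : (Lp.toTemperedDistribution (𝓕 (h2.toLp g) : Lp ℂ 2 (volume : Measure V))) S
        = ∫ x, φ x • (𝓕 (h2.toLp g) : Lp ℂ 2 (volume : Measure V)) x := by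
      rw [Lp.toTemperedDistribution_apply]
      simp [hS]
    rw [← e1, ← Lp.fourier_toTemperedDistribution_eq, TemperedDistribution.fourier_apply,
      Lp.toTemperedDistribution_apply]
    have e2 : ∫ x, (𝓕 S) x • (h2.toLp g) x = ∫ x, (𝓕 S) x • g x := by
      apply integral_congr_ae
      filter_upwards [h2.coeFn_toLp] with x hx
      rw [hx]
    rw [e2]
    have := (VectorFourier.integral_fourierIntegral_smul_eq_flip (μ := volume) (ν := volume) (L := innerₗ V)
      Real.continuous_fourierChar continuous_inner S.integrable h1)
    rw [flip_innerₗ] at this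
    have h3 : (𝓕 (S : V → ℂ)) = VectorFourier.fourierIntegral Real.fourierChar volume (innerₗ V) S := rfl
    rw [SchwartzMap.fourier_coe, h3, this]
    rfl

lemma plancherel {V : Type*} [NormedAddCommGroup V] [InnerProductSpace ℝ V] [FiniteDimensional ℝ V]
    [MeasurableSpace V] [BorelSpace V] {g : V → ℂ} (h1 : Integrable g) (h2 : MemLp g 2) :
    eLpNorm (𝓕 g) 2 = eLpNorm g 2 := by
  rw [eLpNorm_congr_ae (fourier_ae h1 h2)]
  have := Lp.norm_fourier_eq (h2.toLp g)
  rw [Lp.norm_def, Lp.norm_def, ENNReal.toReal_eq_toReal_iff' (Lp.memLp _).2.ne (Lp.memLp _).2.ne] at this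
  rw [this, eLpNorm_congr_ae h2.coeFn_toLp]

lemma plancherel' {V : Type*} [NormedAddCommGroup V] [InnerProductSpace ℝ V] [FiniteDimensional ℝ V]
    [MeasurableSpace V] [BorelSpace V] {g : V → ℂ} (h1 : Integrable g) (h2 : MemLp g 2) :
    ∫⁻ x, ‖𝓕 g x‖ₑ ^ 2 = ∫⁻ x, ‖g x‖ₑ ^ 2 := by
  have := plancherel h1 h2
  rw [eLpNorm_eq_lintegral_rpow_enorm_toReal (by norm_num) (by norm_num),
    eLpNorm_eq_lintegral_rpow_enorm_toReal (by norm_num) (by norm_num)] at this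
  have h := (ENNReal.rpow_left_injective (x := 1 / (2:ℝ≥0∞).toReal) (by simp)) this
  simpa using h
end Pent
end

section
open MeasureTheory Metric Set
open scoped ENNReal NNReal FourierTransform
namespace Pent

lemma lint_comp_smul {n : ℕ} {c : ℝ} (hc : c ≠ 0) (f : Euc n → ℝ≥0∞) :
    ∫⁻ x, f (c • x) = ENNReal.ofReal (|c| ^ n)⁻¹ * ∫⁻ x, f x := by
  have h := Measure.map_addHaar_smul (volume : Measure (Euc n)) hc
  have e : ∫⁻ x, f (c • x) = ∫⁻ x, f x ∂(Measure.map (c • ·) (volume : Measure (Euc n))) := by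
    rw [(measurableEmbedding_const_smul₀ hc).lintegral_map]
  rw [e, h, lintegral_smul_measure]
  simp [abs_inv]

lemma integrable_bdd {α F : Type*} [MeasurableSpace α] [NormedAddCommGroup F] {μ : Measure α}
    {f : α → F}
    (hm : AEStronglyMeasurable f μ) {M : ℝ} (hM : ∀ x, ‖f x‖ ≤ M) {s : Set α}
    (hs : μ s ≠ ∞) (h0 : ∀ x, x ∉ s → f x = 0) : Integrable f μ := by
  rw [← integrableOn_iff_integrable_of_support_subset (s := s)]
  · exact Measure.integrableOn_of_bounded hs hm (Filter.Eventually.of_forall hM)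
  · intro x hx
    by_contra h
    exact hx (h0 x h)

lemma memLp_bdd {α F : Type*} [MeasurableSpace α] [NormedAddCommGroup F] {μ : Measure α}
    {f : α → F} (p : ℝ≥0∞)
    (hm : AEStronglyMeasurable f μ) {M : ℝ} (hM : ∀ x, ‖f x‖ ≤ M) {s : Set α}
    (hs : μ s ≠ ∞) (h0 : ∀ x, x ∉ s → f x = 0) : MemLp f p μ := by
  obtain ⟨t, hst, ht, hμt⟩ := exists_measurable_superset μ s
  have e : f = t.indicator f := by
    ext x
    by_cases hx : x ∈ t
    · simp [hx]
    · rw [indicator_of_notMem hx, h0 x (fun h => hx (hst h))]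
  rw [e, memLp_indicator_iff_restrict ht]
  haveI : IsFiniteMeasure (μ.restrict t) := ⟨by simpa [hμt] using hs.lt_top⟩
  exact MemLp.of_bound hm.restrict M (Filter.Eventually.of_forall hM)

/-- the character `e^{2πit}` as a complex number -/
def ec (t : ℝ) : ℂ := (Real.fourierChar t : ℂ)

lemma ec_norm (t : ℝ) : ‖ec t‖ = 1 := Circle.norm_coe _
lemma ec_add (s t : ℝ) : ec (s + t) = ec s * ec t := by
  simp [ec, AddChar.map_add_eq_mul]
@[fun_prop] lemma ec_cont : Continuous ec := by
  unfold ec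
  exact continuous_subtype_val.comp Real.continuous_fourierChar

lemma fourier_ec {V : Type*} [NormedAddCommGroup V] [InnerProductSpace ℝ V]
    [MeasurableSpace V] [BorelSpace V] [FiniteDimensional ℝ V] (f : V → ℂ) (w : V) :
    𝓕 f w = ∫ v, ec (-(inner ℝ v w)) * f v := by
  rw [Real.fourier_eq]; rfl

lemma fourier_ec_real (f : ℝ → ℂ) (w : ℝ) :
    𝓕 f w = ∫ v, ec (-(v * w)) * f v := by
  rw [Real.fourier_real_eq]; rfl
end Pent
end

section
open MeasureTheory Metric Set
open scoped ENNReal NNReal FourierTransform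
namespace Pent

/-- data: `H` bounded, measurable, supported in a product of balls -/
structure BddSupp {n : ℕ} (H : ℝ × Euc n → ℂ) (M ρ : ℝ) : Prop where
  meas : Measurable H
  bdd : ∀ p, ‖H p‖ ≤ M
  supp : ∀ p, ρ < |p.1| ∨ ρ < ‖p.2‖ → H p = 0

variable {n : ℕ} {H : ℝ × Euc n → ℂ} {M ρ : ℝ} {k : ℝ → ℂ}

def box (n : ℕ) (ρ : ℝ) : Set (ℝ × Euc n) := closedBall 0 ρ ×ˢ closedBall 0 ρ

lemma box_fin (n : ℕ) (ρ : ℝ) : (volume : Measure (ℝ × Euc n)) (box n ρ) ≠ ∞ := by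
  rw [box, Measure.volume_eq_prod, Measure.prod_prod]
  exact ENNReal.mul_ne_top measure_closedBall_lt_top.ne measure_closedBall_lt_top.ne

lemma BddSupp.zero_off (h : BddSupp H M ρ) : ∀ p, p ∉ box n ρ → H p = 0 := by
  intro p hp
  apply h.supp
  by_contra hc
  push Not at hc
  exact hp ⟨by simpa using hc.1, by simpa using hc.2⟩

lemma BddSupp.integrable (h : BddSupp H M ρ) : Integrable H :=
  integrable_bdd h.meas.aestronglyMeasurable h.bdd (box_fin n ρ) h.zero_off

def nearA (k : ℝ → ℂ) (H : ℝ × Euc n → ℂ) (x : Euc n) (b : ℝ) : ℂ :=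
  ∫ p : ℝ × Euc n, k (b - p.1 - ‖x - p.2‖ ^ 2) * H p

def Hhat (H : ℝ × Euc n → ℂ) (l : ℝ) (y : Euc n) : ℂ := ∫ v, ec (-(v * l)) * H (v, y)

lemma nearA_joint (h : BddSupp H M ρ) (hk : Continuous k) (A : ℝ) (hA : ∀ s, A < |s| → k s = 0)
    (Kb : ℝ) (hKb : ∀ s, ‖k s‖ ≤ Kb) (x : Euc n) :
    Integrable (fun q : ℝ × (ℝ × Euc n) => k (q.1 - q.2.1 - ‖x - q.2.2‖ ^ 2) * H q.2) := by
  have hm := h.meas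
  have hM0 : 0 ≤ Kb := (norm_nonneg _).trans (hKb 0)
  refine integrable_bdd (M := Kb * M) (s := closedBall 0 (A + ρ + (‖x‖ + ρ)^2) ×ˢ box n ρ) ?_ ?_ ?_ ?_
  · apply Measurable.aestronglyMeasurable
    apply Measurable.mul
    · apply hk.measurable.comp; fun_prop
    · exact hm.comp measurable_snd
  · intro q
    rw [norm_mul]
    exact mul_le_mul (hKb _) (h.bdd _) (norm_nonneg _) hM0
  · rw [Measure.volume_eq_prod, Measure.prod_prod]
    exact ENNReal.mul_ne_top measure_closedBall_lt_top.ne (box_fin n ρ)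
  · intro q hq
    by_cases h2 : q.2 ∈ box n ρ
    · have h1 : q.1 ∉ closedBall (0:ℝ) (A + ρ + (‖x‖ + ρ)^2) := fun h => hq ⟨h, h2⟩
      have h21 : |q.2.1| ≤ ρ := by simpa using h2.1
      have h22 : ‖q.2.2‖ ≤ ρ := by simpa using h2.2
      simp only [mem_closedBall, dist_zero_right, Real.norm_eq_abs, not_le] at h1
      rw [hA, zero_mul]
      have e1 : ‖x - q.2.2‖ ^ 2 ≤ (‖x‖ + ρ)^2 := by
        apply pow_le_pow_left₀ (norm_nonneg _)
        exact (norm_sub_le _ _).trans (by linarith)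
      have e2 : |q.1| ≤ |q.1 - q.2.1 - ‖x - q.2.2‖ ^ 2| + |q.2.1| + ‖x - q.2.2‖ ^ 2 := by
        have := abs_add_three (q.1 - q.2.1 - ‖x - q.2.2‖ ^ 2) q.2.1 (‖x - q.2.2‖ ^ 2)
        rw [abs_of_nonneg (sq_nonneg ‖x - q.2.2‖)] at this
        have e0 : q.1 - q.2.1 - ‖x - q.2.2‖ ^ 2 + q.2.1 + ‖x - q.2.2‖ ^ 2 = q.1 := by ring
        rwa [e0] at this
      linarith
    · rw [h.zero_off _ h2, mul_zero]

lemma shift_ft (k : ℝ → ℂ) (τ l : ℝ) :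
    ∫ b, ec (-(b * l)) * k (b - τ) = ec (-(τ * l)) * 𝓕 k l := by
  rw [fourier_ec_real, ← integral_const_mul,
    ← integral_sub_right_eq_self (fun b => ec (-(τ * l)) * (ec (-(b * l)) * k b)) τ]
  congr 1; ext b
  rw [← mul_assoc, ← ec_add]; congr 2; ring

lemma nearA_ft (h : BddSupp H M ρ) (hk : Continuous k) (A : ℝ) (hA : ∀ s, A < |s| → k s = 0)
    (Kb : ℝ) (hKb : ∀ s, ‖k s‖ ≤ Kb) (x : Euc n) (l : ℝ) :
    𝓕 (nearA k H x) l = 𝓕 k l * ∫ y, ec (-(‖x - y‖ ^ 2 * l)) * Hhat H l y := by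
  have hj := nearA_joint h hk A hA Kb hKb x
  have hj' : Integrable (fun q : ℝ × (ℝ × Euc n) =>
      ec (-(q.1 * l)) * (k (q.1 - q.2.1 - ‖x - q.2.2‖ ^ 2) * H q.2)) := by
    refine (hj.bdd_mul (c := 1) ?_ ?_)
    · exact Continuous.aestronglyMeasurable (by fun_prop)
    · exact Filter.Eventually.of_forall fun q => (ec_norm _).le
  rw [fourier_ec_real]
  have e1 : ∀ b, ec (-(b * l)) * nearA k H x b =
      ∫ p : ℝ × Euc n, ec (-(b * l)) * (k (b - p.1 - ‖x - p.2‖ ^ 2) * H p) := by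
    intro b; rw [nearA, integral_const_mul]
  simp_rw [e1]
  rw [integral_integral_swap hj']
  have e2 : ∀ p : ℝ × Euc n, ∫ b, ec (-(b * l)) * (k (b - p.1 - ‖x - p.2‖ ^ 2) * H p)
      = 𝓕 k l * (ec (-(‖x - p.2‖ ^ 2 * l)) * (ec (-(p.1 * l)) * H p)) := by
    intro p
    simp_rw [← mul_assoc]
    rw [integral_mul_const]
    have := shift_ft k (p.1 + ‖x - p.2‖ ^ 2) l
    simp_rw [← sub_sub] at this
    rw [this, add_mul, neg_add, ec_add]; ring
  simp_rw [e2]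
  rw [integral_const_mul]
  congr 1
  have hi : Integrable (fun p : ℝ × Euc n => ec (-(‖x - p.2‖ ^ 2 * l)) * (ec (-(p.1 * l)) * H p)) := by
    refine Integrable.bdd_mul (c := 1) (Integrable.bdd_mul (c := 1) h.integrable ?_ ?_) ?_ ?_
    · exact Continuous.aestronglyMeasurable (by fun_prop)
    · exact Filter.Eventually.of_forall fun q => (ec_norm _).le
    · exact Continuous.aestronglyMeasurable (by fun_prop)
    · exact Filter.Eventually.of_forall fun q => (ec_norm _).le
  rw [Measure.volume_eq_prod] at hi ⊢
  rw [integral_prod_symm _ hi]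
  congr 1; ext y
  rw [Hhat, ← integral_const_mul]
end Pent
end

section
open MeasureTheory Metric Set
open scoped ENNReal NNReal FourierTransform
namespace Pent
variable {n : ℕ} {H : ℝ × Euc n → ℂ} {M ρ : ℝ} {k : ℝ → ℂ}

lemma Hhat_meas (h : BddSupp H M ρ) : Measurable (fun p : ℝ × Euc n => Hhat H p.1 p.2) := by
  have : StronglyMeasurable (fun q : (ℝ × Euc n) × ℝ => ec (-(q.2 * q.1.1)) * H (q.2, q.1.2)) := by
    apply Measurable.stronglyMeasurable
    apply Measurable.mul
    · exact ec_cont.measurable.comp (by fun_prop)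
    · exact h.meas.comp (by fun_prop)
  exact this.integral_prod_right.measurable

lemma Hhat_bdd (h : BddSupp H M ρ) (l : ℝ) (y : Euc n) : ‖Hhat H l y‖ ≤ M * volume.real (closedBall (0:ℝ) ρ) := by
  have : Hhat H l y = ∫ v in closedBall (0:ℝ) ρ, ec (-(v * l)) * H (v, y) := by
    rw [Hhat, setIntegral_eq_integral_of_forall_compl_eq_zero]
    intro v hv
    rw [h.zero_off _ (fun hh => hv hh.1), mul_zero]
  rw [this]
  apply norm_setIntegral_le_of_norm_le_const measure_closedBall_lt_top
  intro v _
  rw [norm_mul, ec_norm, one_mul]; exact h.bdd _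

lemma Hhat_zero (h : BddSupp H M ρ) (l : ℝ) (y : Euc n) (hy : y ∉ closedBall (0 : Euc n) ρ) : Hhat H l y = 0 := by
  rw [Hhat]
  apply integral_eq_zero_of_ae
  refine Filter.Eventually.of_forall fun v => ?_
  change _ * H (v, y) = 0
  rw [h.zero_off (v, y) (fun hh => hy (show y ∈ closedBall (0 : Euc n) ρ from (Set.mem_prod.1 hh).2)), mul_zero]

def nearT (H : ℝ × Euc n → ℂ) (l : ℝ) (x : Euc n) : ℂ := ∫ y, ec (-(‖x - y‖ ^ 2 * l)) * Hhat H l y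

lemma nearT_meas (h : BddSupp H M ρ) : Measurable (fun p : ℝ × Euc n => nearT H p.1 p.2) := by
  have : StronglyMeasurable (fun q : (ℝ × Euc n) × Euc n => ec (-(‖q.1.2 - q.2‖ ^ 2 * q.1.1)) * Hhat H q.1.1 q.2) := by
    apply Measurable.stronglyMeasurable
    apply Measurable.mul
    · exact ec_cont.measurable.comp (by fun_prop)
    · exact (Hhat_meas h).comp (f := fun q : (ℝ × Euc n) × Euc n => (q.1.1, q.2)) (by fun_prop)
  exact this.integral_prod_right.measurable

lemma nearT_l2 (h : BddSupp H M ρ) {l : ℝ} (hl : l ≠ 0) :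
    ∫⁻ x, ‖nearT H l x‖ₑ ^ 2 = ENNReal.ofReal (|2 * l| ^ n)⁻¹ * ∫⁻ y, ‖Hhat H l y‖ₑ ^ 2 := by
  let G : Euc n → ℂ := fun y => ec (-(‖y‖ ^ 2 * l)) * Hhat H l y
  have hGm : Measurable G := by
    apply Measurable.mul
    · exact ec_cont.measurable.comp (by fun_prop)
    · exact (Hhat_meas h).comp (f := fun y : Euc n => (l, y)) (by fun_prop)
  have hGn : ∀ y, ‖G y‖ = ‖Hhat H l y‖ := fun y => by simp [G, ec_norm]
  have hGb : ∀ y, ‖G y‖ ≤ M * volume.real (closedBall (0:ℝ) ρ) := fun y => by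
    rw [hGn]; exact Hhat_bdd h l y
  have hG0 : ∀ y, y ∉ closedBall (0 : Euc n) ρ → G y = 0 := fun y hy => by
    simp [G, Hhat_zero h l y hy]
  have hfin : (volume : Measure (Euc n)) (closedBall (0 : Euc n) ρ) ≠ ∞ := measure_closedBall_lt_top.ne
  have e1 : ∀ x, ‖nearT H l x‖ₑ = ‖𝓕 G ((-(2 * l)) • x)‖ₑ := by
    intro x
    have : nearT H l x = ec (-(‖x‖ ^ 2 * l)) * 𝓕 G ((-(2 * l)) • x) := by
      rw [fourier_ec, nearT, ← integral_const_mul]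
      congr 1; ext y
      simp only [G]
      rw [← mul_assoc, ← mul_assoc, ← ec_add, ← ec_add]
      congr 2
      rw [norm_sub_sq_real, inner_smul_right, real_inner_comm]; ring
    rw [this, enorm_mul, ← ofReal_norm, ec_norm]; simp
  simp_rw [e1]
  have e2 := lint_comp_smul (n := n) (c := -(2 * l)) (by simpa using hl) (fun w => ‖𝓕 G w‖ₑ ^ 2)
  rw [e2, plancherel' (integrable_bdd hGm.aestronglyMeasurable hGb hfin hG0)
    (memLp_bdd 2 hGm.aestronglyMeasurable hGb hfin hG0), abs_neg]
  congr 2; ext y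
  rw [← ofReal_norm, hGn, ofReal_norm]

lemma Hhat_l2 (h : BddSupp H M ρ) (y : Euc n) :
    ∫⁻ l, ‖Hhat H l y‖ₑ ^ 2 = ∫⁻ v, ‖H (v, y)‖ₑ ^ 2 := by
  have hm : Measurable (fun v => H (v, y)) := h.meas.comp (by fun_prop)
  have h0 : ∀ v, v ∉ closedBall (0 : ℝ) ρ → H (v, y) = 0 := fun v hv =>
    h.zero_off _ (fun hh => hv hh.1)
  have hfin : (volume : Measure ℝ) (closedBall (0 : ℝ) ρ) ≠ ∞ := measure_closedBall_lt_top.ne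
  rw [← plancherel' (integrable_bdd hm.aestronglyMeasurable (fun v => h.bdd (v, y)) hfin h0)
    (memLp_bdd 2 hm.aestronglyMeasurable (fun v => h.bdd (v, y)) hfin h0)]
  congr 1; ext l
  rw [fourier_ec_real, Hhat]

lemma nearA_l2 (h : BddSupp H M ρ) (hk : Continuous k) (A : ℝ) (hA : ∀ s, A < |s| → k s = 0)
    (Kb : ℝ) (hKb : ∀ s, ‖k s‖ ≤ Kb) (x : Euc n) :
    ∫⁻ b, ‖nearA k H x b‖ₑ ^ 2 = ∫⁻ l, ‖𝓕 k l‖ₑ ^ 2 * ‖nearT H l x‖ₑ ^ 2 := by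
  have hj := nearA_joint h hk A hA Kb hKb x
  have hM0 : 0 ≤ Kb := (norm_nonneg _).trans (hKb 0)
  have h1 : Integrable (nearA k H x) := hj.integral_prod_left
  have hb : ∀ b, ‖nearA k H x b‖ ≤ ∫ p, Kb * ‖H p‖ := by
    intro b
    apply norm_integral_le_of_norm_le (h.integrable.norm.const_mul _)
    refine Filter.Eventually.of_forall fun p => ?_
    rw [norm_mul]; exact mul_le_mul_of_nonneg_right (hKb _) (norm_nonneg _)
  have h2 : MemLp (nearA k H x) 2 := by
    rw [memLp_two_iff_integrable_sq_norm h1.1]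
    simp_rw [sq]
    exact h1.norm.bdd_mul h1.1.norm (Filter.Eventually.of_forall fun b => by
      rw [norm_norm]; exact hb b)
  rw [← plancherel' h1 h2]
  congr 1; ext l
  rw [nearA_ft h hk A hA Kb hKb x l, enorm_mul, mul_pow]; rfl

lemma near_core (h : BddSupp H M ρ) (hk : Continuous k) (A : ℝ) (hA : ∀ s, A < |s| → k s = 0)
    (Kb : ℝ) (hKb : ∀ s, ‖k s‖ ≤ Kb) (c : ℝ) (hc : ∀ l, ‖𝓕 k l‖ ^ 2 ≤ c * |2 * l| ^ n) :
    ∫⁻ x, ∫⁻ b, ‖nearA k H x b‖ₑ ^ 2 ≤ ENNReal.ofReal c * ∫⁻ y, ∫⁻ v, ‖H (v, y)‖ₑ ^ 2 := by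
  have hkc : HasCompactSupport k := by
    apply HasCompactSupport.of_support_subset_isCompact (isCompact_closedBall (0:ℝ) A)
    intro s hs
    by_contra hh
    exact hs (hA s (by simpa using hh))
  have hFm : Measurable (𝓕 k) := (VectorFourier.fourierIntegral_continuous (L := innerₗ ℝ)
      Real.continuous_fourierChar continuous_inner (hk.integrable_of_hasCompactSupport hkc)).measurable
  simp_rw [nearA_l2 h hk A hA Kb hKb]
  rw [lintegral_lintegral_swap]
  · simp_rw [← Hhat_l2 h]
    rw [lintegral_lintegral_swap (f := fun y l => ‖Hhat H l y‖ₑ ^ 2)]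
    · have hmT : ∀ l, Measurable fun x => ‖nearT H l x‖ₑ ^ 2 := fun l =>
        ((nearT_meas h).comp (f := fun x => (l, x)) (by fun_prop)).enorm.pow_const 2
      rw [← lintegral_const_mul' _ _ (by simp)]
      have hne : ∀ᵐ l : ℝ, l ≠ 0 := by
        rw [ae_iff]; simp
      apply lintegral_mono_ae
      filter_upwards [hne] with l hl
      rw [lintegral_const_mul _ (hmT l), nearT_l2 h hl, ← mul_assoc]
      gcongr
      have hp : 0 < |2 * l| ^ n := by positivity
      rw [← ofReal_norm, ← ENNReal.ofReal_pow (norm_nonneg _), ← ENNReal.ofReal_mul (by positivity)]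
      apply ENNReal.ofReal_le_ofReal
      rw [← div_eq_mul_inv, div_le_iff₀ hp]; exact hc l
    · apply Measurable.aemeasurable
      exact ((Hhat_meas h).comp (f := fun q : Euc n × ℝ => (q.2, q.1)) (by fun_prop)).enorm.pow_const 2
  · apply Measurable.aemeasurable
    refine Measurable.mul (f := fun q : Euc n × ℝ => ‖𝓕 k q.2‖ₑ ^ 2) (g := fun q => ‖nearT H q.2 q.1‖ₑ ^ 2) ?_ ?_
    · exact (hFm.comp measurable_snd).enorm.pow_const 2
    · exact ((nearT_meas h).comp (f := fun q : Euc n × ℝ => (q.2, q.1)) (by fun_prop)).enorm.pow_const 2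
end Pent
end

section
open MeasureTheory Metric Set
open scoped ENNReal NNReal FourierTransform ContDiff
namespace Pent

/-- admissible kernels: `n`-th derivatives of test functions -/
def IsKer (n : ℕ) (κ : ℝ → ℝ) : Prop :=
  ∃ Ψ : ℝ → ℝ, ContDiff ℝ ∞ Ψ ∧ HasCompactSupport Ψ ∧ κ = iteratedDeriv n Ψ

lemma test_iter {Ψ : ℝ → ℝ} (h : ContDiff ℝ ∞ Ψ) (hc : HasCompactSupport Ψ) (n : ℕ) :
    ContDiff ℝ ∞ (iteratedDeriv n Ψ) ∧ HasCompactSupport (iteratedDeriv n Ψ) := by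
  induction n with
  | zero => simpa using ⟨h, hc⟩
  | succ n ih =>
    rw [iteratedDeriv_succ]
    refine ⟨?_, ih.2.deriv⟩
    exact (contDiff_infty_iff_deriv.1 ih.1).2

lemma IsKer.smooth {n : ℕ} {κ : ℝ → ℝ} (h : IsKer n κ) : ContDiff ℝ ∞ κ ∧ HasCompactSupport κ := by
  obtain ⟨Ψ, h1, h2, rfl⟩ := h
  exact test_iter h1 h2 n

lemma IsKer.deriv {n : ℕ} {κ : ℝ → ℝ} (h : IsKer n κ) : IsKer n (deriv κ) := by
  obtain ⟨Ψ, h1, h2, rfl⟩ := h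
  refine ⟨_root_.deriv Ψ, (contDiff_infty_iff_deriv.1 h1).2, h2.deriv, ?_⟩
  rw [← iteratedDeriv_succ, iteratedDeriv_succ']

def cplx (κ : ℝ → ℝ) : ℝ → ℂ := fun s => (κ s : ℂ)

lemma cplx_cont {κ : ℝ → ℝ} (h : Continuous κ) : Continuous (cplx κ) := by
  unfold cplx; fun_prop

lemma cplx_int {κ : ℝ → ℝ} (h : Continuous κ) (hc : HasCompactSupport κ) : Integrable (cplx κ) :=
  (h.integrable_of_hasCompactSupport hc).ofReal

lemma ft_deriv {Ψ : ℝ → ℝ} (h : ContDiff ℝ ∞ Ψ) (hc : HasCompactSupport Ψ) (η : ℝ) :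
    ‖𝓕 (cplx (deriv Ψ)) η‖ = 2 * Real.pi * |η| * ‖𝓕 (cplx Ψ) η‖ := by
  have hd : ∀ s, HasDerivAt (cplx Ψ) (cplx (deriv Ψ) s) s := fun s =>
    ((h.differentiable (by simp)) s).hasDerivAt.ofReal_comp
  have e : deriv (cplx Ψ) = cplx (deriv Ψ) := by ext s; exact (hd s).deriv
  have := Real.fourier_deriv (cplx_int h.continuous hc) (fun s => (hd s).differentiableAt)
    (by rw [e]; exact cplx_int (contDiff_infty_iff_deriv.1 h).2.continuous hc.deriv)
  rw [e] at this
  rw [this]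
  simp [abs_of_pos Real.pi_pos]

lemma ft_iter {Ψ : ℝ → ℝ} (h : ContDiff ℝ ∞ Ψ) (hc : HasCompactSupport Ψ) (n : ℕ) (η : ℝ) :
    ‖𝓕 (cplx (iteratedDeriv n Ψ)) η‖ = (2 * Real.pi * |η|) ^ n * ‖𝓕 (cplx Ψ) η‖ := by
  induction n with
  | zero => simp
  | succ n ih =>
    rw [iteratedDeriv_succ, ft_deriv (test_iter h hc n).1 (test_iter h hc n).2, ih]; ring

lemma ft_bdd {κ : ℝ → ℝ} (η : ℝ) : ‖𝓕 (cplx κ) η‖ ≤ ∫ s, |κ s| := by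
  rw [fourier_ec_real]
  refine (norm_integral_le_integral_norm _).trans (le_of_eq ?_)
  congr 1; ext s; simp [ec_norm, cplx]

lemma IsKer.ft {n m : ℕ} (hm : m ≤ 2 * n) {κ : ℝ → ℝ} (h : IsKer n κ) :
    ∃ C, 0 ≤ C ∧ ∀ η, ‖𝓕 (cplx κ) η‖ ^ 2 ≤ C * |2 * η| ^ m := by
  obtain ⟨Ψ, h1, h2, rfl⟩ := h
  set I1 := ∫ s, |Ψ s|
  set I2 := ∫ s, |iteratedDeriv n Ψ s|
  have hI1 : 0 ≤ I1 := integral_nonneg fun _ => abs_nonneg _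
  have hI2 : 0 ≤ I2 := integral_nonneg fun _ => abs_nonneg _
  refine ⟨(Real.pi ^ n * I1) ^ 2 + I2 ^ 2, by positivity, fun η => ?_⟩
  by_cases hη : |2 * η| ≤ 1
  · have e : ‖𝓕 (cplx (iteratedDeriv n Ψ)) η‖ ^ 2 ≤ (Real.pi ^ n * I1) ^ 2 * |2 * η| ^ m := by
      calc _ = ((2 * Real.pi * |η|) ^ n * ‖𝓕 (cplx Ψ) η‖) ^ 2 := by rw [ft_iter h1 h2]
        _ ≤ ((2 * Real.pi * |η|) ^ n * I1) ^ 2 := by gcongr; exact ft_bdd η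
        _ = (Real.pi ^ n * I1) ^ 2 * |2 * η| ^ (2 * n) := by
          rw [abs_mul, abs_two]; simp only [mul_pow]; ring
        _ ≤ _ := by
          gcongr ?_ * ?_
          exact pow_le_pow_of_le_one (abs_nonneg _) hη hm
    have : 0 ≤ I2 ^ 2 * |2 * η| ^ m := by positivity
    linarith [add_mul ((Real.pi ^ n * I1) ^ 2) (I2^2) (|2 * η| ^ m)]
  · push Not at hη
    have e : ‖𝓕 (cplx (iteratedDeriv n Ψ)) η‖ ^ 2 ≤ I2 ^ 2 := by gcongr; exact ft_bdd η
    have e2 : I2 ^ 2 ≤ I2 ^ 2 * |2 * η| ^ m := by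
      apply le_mul_of_one_le_right (by positivity) (one_le_pow₀ hη.le)
    have : 0 ≤ (Real.pi ^ n * I1) ^ 2 * |2 * η| ^ m := by positivity
    linarith [add_mul ((Real.pi ^ n * I1) ^ 2) (I2^2) (|2 * η| ^ m)]

def dil (L : ℝ) (κ : ℝ → ℝ) : ℝ → ℝ := fun s => L * κ (L * s)

lemma ft_dil {κ : ℝ → ℝ} {L : ℝ} (hL : 0 < L) (l : ℝ) : 𝓕 (cplx (dil L κ)) l = 𝓕 (cplx κ) (l / L) := by
  rw [fourier_ec_real, fourier_ec_real]
  have := Measure.integral_comp_mul_left (fun v => ec (-(v * (l / L))) * cplx κ v) L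
  rw [abs_of_pos (inv_pos.2 hL)] at this
  have e : ∫ v, ec (-(v * l)) * cplx (dil L κ) v = ∫ v, (L:ℂ) * (ec (-(L * v * (l / L))) * cplx κ (L * v)) := by
    congr 1; ext v
    have : L * v * (l / L) = v * l := by field_simp
    rw [this]; simp [cplx, dil]; ring
  rw [e, integral_const_mul, this, Complex.real_smul, ← mul_assoc, ← Complex.ofReal_mul, mul_inv_cancel₀ hL.ne']
  simp

lemma dil_ft {n m : ℕ} (hm : m ≤ 2 * n) {κ : ℝ → ℝ} (h : IsKer n κ) :
    ∃ C, 0 ≤ C ∧ ∀ L > 0, ∀ l, ‖𝓕 (cplx (dil L κ)) l‖ ^ 2 ≤ (C * (L ^ m)⁻¹) * |2 * l| ^ m := by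
  obtain ⟨C, hC, h⟩ := h.ft hm
  refine ⟨C, hC, fun L hL l => ?_⟩
  rw [ft_dil hL]
  refine (h _).trans (le_of_eq ?_)
  rw [← mul_div_assoc, abs_div, abs_of_pos hL, div_pow]; ring

/-! coordinates -/
def split {n : ℕ} (i : Fin (n+1)) : Euc (n+1) ≃ᵐ ℝ × Euc n :=
  (MeasurableEquiv.toLp 2 (Fin (n+1) → ℝ)).symm.trans
    ((MeasurableEquiv.piFinSuccAbove (fun _ => ℝ) i).trans
      (MeasurableEquiv.prodCongr (MeasurableEquiv.refl ℝ) (MeasurableEquiv.toLp 2 (Fin n → ℝ))))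

lemma split_mp {n : ℕ} (i : Fin (n+1)) : MeasurePreserving (split i) := by
  refine ((PiLp.volume_preserving_ofLp (Fin (n+1))).trans
    ((volume_preserving_piFinSuccAbove (fun _ => ℝ) i).trans ?_))
  exact (MeasurePreserving.id volume).prod (PiLp.volume_preserving_toLp (Fin n))

lemma split_fst {n : ℕ} (i : Fin (n+1)) (y : Euc (n+1)) : (split i y).1 = y i := rfl
lemma split_snd {n : ℕ} (i : Fin (n+1)) (y : Euc (n+1)) (j : Fin n) :
    (split i y).2 j = y (i.succAbove j) := rfl
lemma split_sub {n : ℕ} (i : Fin (n+1)) (x y : Euc (n+1)) : split i (x - y) = split i x - split i y := rfl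
lemma split_norm {n : ℕ} (i : Fin (n+1)) (y : Euc (n+1)) :
    ‖y‖ ^ 2 = (split i y).1 ^ 2 + ‖(split i y).2‖ ^ 2 := by
  rw [EuclideanSpace.norm_sq_eq, EuclideanSpace.norm_sq_eq, Fin.sum_univ_succAbove _ i]
  simp [split_fst, split_snd]
end Pent
end

section
open MeasureTheory Metric Set
open scoped ENNReal NNReal FourierTransform ContDiff
namespace Pent

def av {d : ℕ} (k : ℝ → ℝ) (f : Euc d → ℝ) (x : Euc d) (b : ℝ) : ℝ :=
  ∫ y, k (b - ‖x - y‖ ^ 2) * f y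

lemma image_sq : (fun s : ℝ => s ^ 2) '' Ioi 0 = Ioi 0 := by
  ext v; constructor
  · rintro ⟨s, hs, rfl⟩; exact pow_pos (mem_Ioi.1 hs) 2
  · intro hv; exact ⟨Real.sqrt v, Real.sqrt_pos.2 hv, Real.sq_sqrt (le_of_lt hv)⟩

lemma sq_inj : InjOn (fun s : ℝ => s ^ 2) (Ioi 0) := by
  intro a ha b hb h
  exact (pow_left_inj₀ (le_of_lt ha) (le_of_lt hb) two_ne_zero).1 h

lemma sq_der : ∀ x ∈ Ioi (0:ℝ), HasDerivWithinAt (fun s : ℝ => s ^ 2) (2 * x) (Ioi 0) x := by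
  intro x _
  simpa using (hasDerivAt_pow 2 x).hasDerivWithinAt

lemma subst_int (g : ℝ → ℂ) : ∫ v in Ioi (0:ℝ), g v = ∫ s in Ioi (0:ℝ), (2 * s : ℝ) • g (s ^ 2) := by
  have := integral_image_eq_integral_abs_deriv_smul measurableSet_Ioi sq_der sq_inj g
  rw [image_sq] at this
  rw [this]
  apply setIntegral_congr_fun measurableSet_Ioi
  intro s hs
  simp only
  rw [abs_of_pos (by have := mem_Ioi.1 hs; positivity)]

lemma subst_lint (g : ℝ → ℝ≥0∞) : ∫⁻ v in Ioi (0:ℝ), g v = ∫⁻ s in Ioi (0:ℝ), ENNReal.ofReal (2 * s) * g (s ^ 2) := by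
  have := lintegral_image_eq_lintegral_abs_deriv_mul measurableSet_Ioi sq_der sq_inj g
  rw [image_sq] at this
  rw [this]
  apply setLIntegral_congr_fun measurableSet_Ioi
  intro s hs
  simp only
  rw [abs_of_pos (by have := mem_Ioi.1 hs; positivity)]

lemma aff_int {ε : ℝ} (hε : ε = 1 ∨ ε = -1) (α : ℝ) (g : ℝ → ℂ) : ∫ s, g s = ∫ s, g (α + ε * s) := by
  rcases hε with rfl | rfl
  · simp_rw [one_mul]; rw [integral_add_left_eq_self]
  · simp_rw [neg_one_mul]
    rw [integral_neg_eq_self (fun s => g (α + s)), integral_add_left_eq_self]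

lemma aff_lint {ε : ℝ} (hε : ε = 1 ∨ ε = -1) (α : ℝ) (g : ℝ → ℝ≥0∞) : ∫⁻ s, g s = ∫⁻ s, g (α + ε * s) := by
  rcases hε with rfl | rfl
  · simp_rw [one_mul]; rw [lintegral_add_left_eq_self]
  · simp_rw [neg_one_mul]
    rw [lintegral_neg_eq_self (fun s => g (α + s)), lintegral_add_left_eq_self]

lemma eps_sq {ε : ℝ} (hε : ε = 1 ∨ ε = -1) : ε * ε = 1 := by rcases hε with rfl | rfl <;> norm_num

lemma subst1 {ε : ℝ} (hε : ε = 1 ∨ ε = -1) (α : ℝ) (g : ℝ → ℂ) (k : ℝ → ℂ)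
    (h0 : ∀ s, ε * (s - α) ≤ 0 → g s = 0) :
    ∫ s, k ((s - α) ^ 2) * g s = ∫ v, k v * (g (α + ε * Real.sqrt v) / (2 * Real.sqrt v : ℝ)) := by
  rw [aff_int hε α]
  have z : ∀ s, s ∉ Ioi (0:ℝ) → g (α + ε * s) = 0 := by
    intro s hs
    apply h0
    rw [add_sub_cancel_left, ← mul_assoc, eps_sq hε, one_mul]; exact not_lt.1 hs
  rw [← setIntegral_eq_integral_of_forall_compl_eq_zero (s := Ioi 0)
    (f := fun s => k ((α + ε * s - α) ^ 2) * g (α + ε * s)) (fun s hs => by rw [z s hs, mul_zero]),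
    ← setIntegral_eq_integral_of_forall_compl_eq_zero (s := Ioi 0)
    (f := fun v => k v * (g (α + ε * Real.sqrt v) / (2 * Real.sqrt v : ℝ)))
    (fun v hv => by
      rw [z, zero_div, mul_zero]
      rw [Real.sqrt_eq_zero_of_nonpos (not_lt.1 hv)]; simp), subst_int (fun v => k v * (g (α + ε * Real.sqrt v) / (2 * Real.sqrt v : ℝ)))]
  apply setIntegral_congr_fun measurableSet_Ioi
  intro s hs
  have hs' : 0 < s := hs
  simp only
  rw [Real.sqrt_sq hs'.le, Complex.real_smul, add_sub_cancel_left, mul_pow, pow_two ε, eps_sq hε, one_mul]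
  have : ((2 * s : ℝ) : ℂ) ≠ 0 := by exact_mod_cast (by positivity)
  generalize ((2 * s : ℝ) : ℂ) = w at *
  field_simp

lemma subst2 {ε : ℝ} (hε : ε = 1 ∨ ε = -1) (α : ℝ) {c : ℝ} (hc : 0 < c) (g : ℝ → ℂ)
    (h0 : ∀ s, ε * (s - α) < c → g s = 0) :
    ∫⁻ v, ‖(g (α + ε * Real.sqrt v) / (2 * Real.sqrt v : ℝ))‖ₑ ^ 2 ≤ ENNReal.ofReal (1 / (2 * c)) * ∫⁻ s, ‖g s‖ₑ ^ 2 := by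
  have z : ∀ s, s < c → g (α + ε * s) = 0 := by
    intro s hs
    apply h0
    rw [add_sub_cancel_left, ← mul_assoc, eps_sq hε, one_mul]; exact hs
  rw [aff_lint hε α (fun s => ‖g s‖ₑ ^ 2), ← setLIntegral_eq_of_support_subset (s := Ioi 0)
    (f := fun v => ‖(g (α + ε * Real.sqrt v) / (2 * Real.sqrt v : ℝ))‖ₑ ^ 2), subst_lint,
    ← lintegral_const_mul' _ _ (by simp)]
  · refine (lintegral_mono_ae ?_).trans (setLIntegral_le_lintegral (Ioi 0) _)
    refine (ae_restrict_iff' measurableSet_Ioi).2 (Filter.Eventually.of_forall ?_)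
    intro s hs
    have hs' : 0 < s := hs
    rw [Real.sqrt_sq hs'.le]
    by_cases hsc : s < c
    · simp [z s hsc]
    push Not at hsc
    rw [← ofReal_norm, ← ofReal_norm, norm_div, Complex.norm_real, Real.norm_of_nonneg (by positivity : 0 ≤ 2 * s),
      ← ENNReal.ofReal_pow (by positivity), ← ENNReal.ofReal_pow (by positivity),
      ← ENNReal.ofReal_mul (by positivity), ← ENNReal.ofReal_mul (by positivity)]
    apply ENNReal.ofReal_le_ofReal
    have e : 2 * s * (‖g (α + ε * s)‖ / (2 * s)) ^ 2 = 1 / (2 * s) * ‖g (α + ε * s)‖ ^ 2 := by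
      field_simp
    rw [e]
    gcongr
  · intro v hv
    by_contra hh
    have : Real.sqrt v = 0 := Real.sqrt_eq_zero_of_nonpos (not_lt.1 hh)
    apply hv
    simp [this]
end Pent
end

section
open MeasureTheory Metric Set
open scoped ENNReal NNReal FourierTransform ContDiff
namespace Pent
variable {n : ℕ}

/-- bounded measurable functions with support in a ball -/
structure Bf {d : ℕ} (f : Euc d → ℝ) (M ρ : ℝ) : Prop where
  meas : Measurable f
  bdd : ∀ y, |f y| ≤ M
  supp : ∀ y, ρ < ‖y‖ → f y = 0

def Hof (i : Fin (n+1)) (ε α : ℝ) (f : Euc (n+1) → ℝ) : ℝ × Euc n → ℂ := fun p =>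
  (f ((split i).symm (α + ε * Real.sqrt p.1, p.2)) : ℂ) / (2 * Real.sqrt p.1 : ℝ)

lemma split_symm_fst (i : Fin (n+1)) (p : ℝ × Euc n) : (split i).symm p i = p.1 := by
  rw [← split_fst, MeasurableEquiv.apply_symm_apply]

lemma Hof_bdd (i : Fin (n+1)) {ε α c M ρ : ℝ} (hε : ε = 1 ∨ ε = -1) (hc : 0 < c) {f : Euc (n+1) → ℝ}
    (hf : Bf f M ρ) (hs : ∀ y, ε * (y i - α) < c → f y = 0) :
    BddSupp (Hof i ε α f) (M / (2 * c)) ((|ρ| + |α|) ^ 2 + |ρ|) := by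
  have hM : 0 ≤ M := (abs_nonneg _).trans (hf.bdd 0)
  have z : ∀ (s : ℝ) y', s < c → f ((split i).symm (α + ε * s, y')) = 0 := by
    intro s y' h
    apply hs
    rw [split_symm_fst, add_sub_cancel_left, ← mul_assoc, eps_sq hε, one_mul]; exact h
  refine ⟨?_, ?_, ?_⟩
  · apply Measurable.div
    · exact Complex.measurable_ofReal.comp (hf.meas.comp ((split i).symm.measurable.comp (by fun_prop)))
    · fun_prop
  · intro p
    unfold Hof
    by_cases h : Real.sqrt p.1 < c
    · rw [z _ _ h]; simp; positivity
    push Not at h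
    rw [norm_div, Complex.norm_real, Complex.norm_real, Real.norm_of_nonneg (by positivity : 0 ≤ 2 * √p.1)]
    have := hf.bdd ((split i).symm (α + ε * √p.1, p.2))
    rw [Real.norm_eq_abs]
    gcongr
  · intro p hp
    have key : f ((split i).symm (α + ε * √p.1, p.2)) = 0 := by
      by_cases h1 : √p.1 < c
      · exact z _ _ h1
      push Not at h1
      have hpos : 0 < p.1 := Real.sqrt_pos.1 (hc.trans_le h1)
      apply hf.supp
      have hn := split_norm i ((split i).symm (α + ε * √p.1, p.2))
      rw [MeasurableEquiv.apply_symm_apply] at hn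
      simp only at hn
      set w := (split i).symm (α + ε * √p.1, p.2)
      by_contra hcon
      push Not at hcon
      have hρ : ‖w‖ ≤ |ρ| := hcon.trans (le_abs_self _)
      have hw2 : ‖w‖ ^ 2 ≤ |ρ| ^ 2 := by gcongr
      rcases hp with hp | hp
      · rw [abs_of_pos hpos] at hp
        have h3 : |ρ| + |α| < √p.1 := by
          apply Real.lt_sqrt_of_sq_lt; linarith [abs_nonneg ρ]
        have h4 : (α + ε * √p.1) ^ 2 ≤ |ρ| ^ 2 := by nlinarith [sq_nonneg ‖p.2‖]
        have h5 := abs_le.1 (abs_le_of_sq_le_sq h4 (abs_nonneg _))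
        have h6 : √p.1 ≤ |ρ| + |α| := by
          rcases hε with rfl | rfl
          · linarith [h5.2, neg_abs_le α]
          · linarith [h5.1, le_abs_self α]
        linarith
      · have h4 : ‖p.2‖ ^ 2 ≤ |ρ| ^ 2 := by nlinarith [sq_nonneg (α + ε * √p.1)]
        have h5 := abs_le.1 (abs_le_of_sq_le_sq h4 (abs_nonneg _))
        nlinarith [h5.2, abs_nonneg ρ, sq_nonneg (|ρ| + |α|)]
    unfold Hof
    rw [key]; simp

lemma Bf.integrable {d : ℕ} {f : Euc d → ℝ} {M ρ : ℝ} (hf : Bf f M ρ) : Integrable f := by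
  apply integrable_bdd hf.meas.aestronglyMeasurable (M := M) hf.bdd (s := closedBall 0 ρ) measure_closedBall_lt_top.ne
  intro y hy
  exact hf.supp y (by simpa using hy)

lemma av_eq_nearA (i : Fin (n+1)) {ε α c M ρ Kb : ℝ} (hε : ε = 1 ∨ ε = -1) (hc : 0 < c) {f : Euc (n+1) → ℝ}
    (hf : Bf f M ρ) (hs : ∀ y, ε * (y i - α) < c → f y = 0) {k : ℝ → ℝ} (hk : Continuous k)
    (hKb : ∀ s, |k s| ≤ Kb) (x' : Euc n) (b : ℝ) :
    ((av k f ((split i).symm (α, x')) b : ℝ) : ℂ) = nearA (cplx k) (Hof i ε α f) x' b := by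
  have hH := Hof_bdd i hε hc hf hs
  set x := (split i).symm (α, x') with hx
  have hxs : split i x = (α, x') := by rw [hx, MeasurableEquiv.apply_symm_apply]
  have mp := (split_mp i).symm
  have hfi : Integrable (fun p : ℝ × Euc n => ((f ((split i).symm p) : ℝ) : ℂ)) :=
    (mp.integrable_comp_of_integrable hf.integrable).ofReal
  have e1 : ((av k f x b : ℝ) : ℂ) = ∫ p : ℝ × Euc n, cplx k (b - (p.1 - α) ^ 2 - ‖x' - p.2‖ ^ 2) * (f ((split i).symm p) : ℂ) := by
    rw [av, ← integral_complex_ofReal, ← mp.integral_comp' (g := fun y => ((k (b - ‖x - y‖ ^ 2) * f y : ℝ) : ℂ))]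
    congr 1; ext p
    rw [split_norm i, split_sub, hxs, MeasurableEquiv.apply_symm_apply]
    simp only [Prod.fst_sub, Prod.snd_sub, cplx]
    push_cast
    congr 3
    ring_nf
  rw [e1, nearA]
  have hc1 : Continuous (cplx k) := cplx_cont hk
  have hkb : ∀ s, ‖cplx k s‖ ≤ Kb := fun s => by simpa [cplx] using hKb s
  have i1 : Integrable (fun p : ℝ × Euc n => cplx k (b - (p.1 - α) ^ 2 - ‖x' - p.2‖ ^ 2) * (f ((split i).symm p) : ℂ)) := by
    refine hfi.bdd_mul (c := Kb) ?_ (Filter.Eventually.of_forall fun p => hkb _)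
    exact Continuous.aestronglyMeasurable (by fun_prop)
  have i2 : Integrable (fun p : ℝ × Euc n => cplx k (b - p.1 - ‖x' - p.2‖ ^ 2) * Hof i ε α f p) := by
    refine hH.integrable.bdd_mul (c := Kb) ?_ (Filter.Eventually.of_forall fun p => hkb _)
    exact Continuous.aestronglyMeasurable (by fun_prop)
  rw [Measure.volume_eq_prod] at i1 i2 ⊢
  rw [integral_prod_symm _ i1, integral_prod_symm _ i2]
  congr 1; ext y'
  have := subst1 hε α (fun s => (f ((split i).symm (s, y')) : ℂ)) (fun v => cplx k (b - v - ‖x' - y'‖ ^ 2)) ?_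
  · simpa [Hof] using this
  · intro s h
    rw [hs]; · simp
    rw [split_symm_fst]; exact h.trans_lt hc

lemma near_cone (i : Fin (n+1)) {ε α c M ρ Kb A C : ℝ} (hε : ε = 1 ∨ ε = -1) (hc : 0 < c) {f : Euc (n+1) → ℝ}
    (hf : Bf f M ρ) (hs : ∀ y, ε * (y i - α) < c → f y = 0) {k : ℝ → ℝ} (hk : Continuous k)
    (hA : ∀ s, A < |s| → k s = 0)
    (hKb : ∀ s, |k s| ≤ Kb) (hC : ∀ l, ‖𝓕 (cplx k) l‖ ^ 2 ≤ C * |2 * l| ^ n) :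
    ∫⁻ x', ∫⁻ b, ‖av k f ((split i).symm (α, x')) b‖ₑ ^ 2 ≤
      ENNReal.ofReal C * (ENNReal.ofReal (1 / (2 * c)) * ∫⁻ y, ‖f y‖ₑ ^ 2) := by
  have hH := Hof_bdd i hε hc hf hs
  have e : ∀ x' b, ‖av k f ((split i).symm (α, x')) b‖ₑ = ‖nearA (cplx k) (Hof i ε α f) x' b‖ₑ := by
    intro x' b
    rw [← av_eq_nearA i hε hc hf hs hk hKb, ← ofReal_norm, ← ofReal_norm, Complex.norm_real]
  simp_rw [e]
  refine (near_core hH (cplx_cont hk) A (fun s h => by simp [cplx, hA s h]) Kb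
    (fun s => by simpa [cplx] using hKb s) C hC).trans ?_
  gcongr
  have mp := (split_mp i).symm
  rw [← mp.lintegral_comp (f := fun y => ‖f y‖ₑ ^ 2) (hf.meas.enorm.pow_const 2), Measure.volume_eq_prod,
    lintegral_prod_symm (fun p => ‖f ((split i).symm p)‖ₑ ^ 2) (((hf.meas.comp mp.measurable).enorm.pow_const 2).aemeasurable),
    ← lintegral_const_mul' _ _ (by simp)]
  apply lintegral_mono
  intro y'
  have := subst2 hε α hc (fun s => (f ((split i).symm (s, y')) : ℂ)) (fun s h => by
    rw [hs]; · simp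
    rw [split_symm_fst]; exact h)
  refine this.trans (le_of_eq ?_)
  congr 2; ext s
  rw [← ofReal_norm, Complex.norm_real, ofReal_norm]
end Pent
end

section
open MeasureTheory Metric Set
open scoped ENNReal NNReal FourierTransform ContDiff
namespace Pent
variable {n : ℕ}

lemma av_meas {d : ℕ} {k : ℝ → ℝ} (hk : Continuous k) {f : Euc d → ℝ} (hf : Measurable f) :
    Measurable (fun q : Euc d × ℝ => av k f q.1 q.2) := by
  have : StronglyMeasurable (fun q : (Euc d × ℝ) × Euc d => k (q.1.2 - ‖q.1.1 - q.2‖ ^ 2) * f q.2) := by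
    apply Measurable.stronglyMeasurable
    apply Measurable.mul
    · exact hk.measurable.comp (by fun_prop)
    · exact hf.comp (by fun_prop)
  exact this.integral_prod_right.measurable

lemma av_int_meas {d : ℕ} {k : ℝ → ℝ} (hk : Continuous k) {f : Euc d → ℝ} (hf : Measurable f) :
    Measurable (fun x : Euc d => ∫⁻ b, ‖av k f x b‖ₑ ^ 2) :=
  ((av_meas hk hf).enorm.pow_const 2).lintegral_prod_right'

lemma near_slab (i : Fin (n+1)) {ε c M ρ Kb A C ξ R : ℝ} (hε : ε = 1 ∨ ε = -1) (hc : 0 < c) {f : Euc (n+1) → ℝ}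
    (hf : Bf f M ρ) (hs : ∀ y, ε * y i < 2 * c → f y = 0) {k : ℝ → ℝ} (hk : Continuous k)
    (hA : ∀ s, A < |s| → k s = 0)
    (hKb : ∀ s, |k s| ≤ Kb) (hC : ∀ l, ‖𝓕 (cplx k) l‖ ^ 2 ≤ C * |2 * l| ^ n)
    {S : Set (Euc (n+1))} (hS1 : ∀ x ∈ S, |x i| ≤ c) (hS2 : ∀ x ∈ S, |x i - ξ| ≤ R) :
    ∫⁻ x in S, ∫⁻ b, ‖av k f x b‖ₑ ^ 2 ≤
      ENNReal.ofReal (2 * R) * (ENNReal.ofReal C * (ENNReal.ofReal (1 / (2 * c)) * ∫⁻ y, ‖f y‖ₑ ^ 2)) := by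
  have hΦ := av_int_meas hk hf.meas
  set Φ : Euc (n+1) → ℝ≥0∞ := fun x => ∫⁻ b, ‖av k f x b‖ₑ ^ 2 with hΦd
  let T : Set ℝ := {α | |α| ≤ c} ∩ closedBall ξ R
  have hT : MeasurableSet T := by
    apply MeasurableSet.inter _ measurableSet_closedBall
    exact measurableSet_le (by fun_prop) (by fun_prop)
  let T' : Set (Euc (n+1)) := {x | x i ∈ T}
  have hT' : MeasurableSet T' := hT.preimage (by fun_prop : Measurable fun x : Euc (n+1) => x i)
  have hST : S ⊆ T' := fun x hx => ⟨hS1 x hx, by simpa [Real.dist_eq] using hS2 x hx⟩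
  refine (lintegral_mono_set hST).trans ?_
  have mp := (split_mp i).symm
  rw [← lintegral_indicator hT', ← mp.lintegral_comp (hΦ.indicator hT'), Measure.volume_eq_prod,
    lintegral_prod (fun p => T'.indicator Φ ((split i).symm p)) ((hΦ.indicator hT').comp mp.measurable).aemeasurable]
  have e : ∀ α, ∫⁻ x', T'.indicator Φ ((split i).symm (α, x')) =
      T.indicator (fun α => ∫⁻ x', Φ ((split i).symm (α, x'))) α := by
    intro α
    by_cases h : α ∈ T
    · rw [indicator_of_mem h]
      congr 1; ext x'
      rw [indicator_of_mem]; change _ ∈ T; rwa [split_symm_fst]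
    · rw [indicator_of_notMem h]
      apply lintegral_eq_zero_of_ae_eq_zero
      refine Filter.Eventually.of_forall fun x' => ?_
      change T'.indicator Φ _ = 0
      rw [indicator_of_notMem]; change ¬ (_ ∈ T); rwa [split_symm_fst]
  simp_rw [e]
  rw [lintegral_indicator hT]
  have b1 : ∀ α ∈ T, ∫⁻ x', Φ ((split i).symm (α, x')) ≤ (ENNReal.ofReal C * (ENNReal.ofReal (1 / (2 * c)) * ∫⁻ y, ‖f y‖ₑ ^ 2)) := by
    intro α hα
    apply near_cone i hε hc hf _ hk hA hKb hC
    intro y hy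
    apply hs
    have h1 : ε * α ≤ c := by
      have := abs_le.1 (show |α| ≤ c from hα.1)
      rcases hε with rfl | rfl <;> linarith
    nlinarith
  refine (setLIntegral_mono' hT b1).trans ?_
  rw [setLIntegral_const, mul_comm]
  gcongr
  refine (measure_mono inter_subset_right).trans ?_
  rw [Real.volume_closedBall]

lemma av_sum {d : ℕ} {ι : Type*} (s : Finset ι) {k : ℝ → ℝ} (hk : Continuous k) {Kb : ℝ} (hKb : ∀ s, |k s| ≤ Kb)
    (f : ι → Euc d → ℝ) (hf : ∀ j ∈ s, Integrable (f j)) (x : Euc d) (b : ℝ) :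
    av k (fun y => ∑ j ∈ s, f j y) x b = ∑ j ∈ s, av k (f j) x b := by
  unfold av
  rw [← integral_finsetSum]
  · simp_rw [Finset.mul_sum]
  · intro j hj
    refine (hf j hj).bdd_mul (c := Kb) ?_ (Filter.Eventually.of_forall fun p => hKb _)
    exact Continuous.aestronglyMeasurable (by fun_prop)

lemma enorm_sum_sq {ι : Type*} (s : Finset ι) (a : ι → ℝ) :
    ‖∑ j ∈ s, a j‖ₑ ^ 2 ≤ s.card * ∑ j ∈ s, ‖a j‖ₑ ^ 2 := by
  have e : ∀ t : ℝ, ‖t‖ₑ ^ 2 = ENNReal.ofReal (t ^ 2) := fun t => by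
    rw [← ofReal_norm, ← ENNReal.ofReal_pow (norm_nonneg _), Real.norm_eq_abs, sq_abs]
  simp_rw [e]
  rw [← ENNReal.ofReal_sum_of_nonneg (fun _ _ => sq_nonneg _), ← ENNReal.ofReal_natCast, ← ENNReal.ofReal_mul (by positivity)]
  exact ENNReal.ofReal_le_ofReal sq_sum_le_card_mul_sum_sq

lemma test_bdd {κ : ℝ → ℝ} (h : Continuous κ) (hc : HasCompactSupport κ) :
    ∃ K, 0 ≤ K ∧ ∀ s, |κ s| ≤ K := by
  obtain ⟨K, hK⟩ := hc.exists_bound_of_continuous h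
  exact ⟨K, (norm_nonneg _).trans (hK 0), hK⟩

lemma test_supp {κ : ℝ → ℝ} (hc : HasCompactSupport κ) :
    ∃ A, 0 < A ∧ ∀ s, A < |s| → κ s = 0 := by
  obtain ⟨A, hA⟩ := hc.isCompact.isBounded.subset_closedBall 0
  refine ⟨max A 1, by positivity, fun s hs => ?_⟩
  by_contra h
  have := hA (subset_tsupport κ h)
  simp at this
  have := le_max_left A 1
  linarith

lemma dil_props {L : ℝ} (hL : 0 < L) {κ : ℝ → ℝ} (h : Continuous κ) {K A : ℝ} (hK : ∀ s, |κ s| ≤ K)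
    (hA : ∀ s, A < |s| → κ s = 0) :
    Continuous (dil L κ) ∧ (∀ s, |dil L κ s| ≤ L * K) ∧ ∀ s, A / L < |s| → dil L κ s = 0 := by
  refine ⟨by unfold dil; fun_prop, fun s => ?_, fun s hs => ?_⟩
  · rw [dil, abs_mul, abs_of_pos hL]; gcongr; exact hK _
  · rw [dil, hA, mul_zero]
    rw [abs_mul, abs_of_pos hL]; rwa [div_lt_iff₀' hL] at hs

lemma near_final {m : ℕ} {κ : ℝ → ℝ} (hκ : IsKer m κ) (hm : n ≤ 2 * m) :
    ∃ C, 0 ≤ C ∧ ∀ L > 0, ∀ (f : Euc (n+1) → ℝ) (M ρ : ℝ), Bf f M ρ → (∀ y, ‖y‖ < 1/2 → f y = 0) →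
    ∀ (S : Set (Euc (n+1))) (R : ℝ), 0 ≤ R → S ⊆ closedBall 0 (1 / (4 * (n + 1))) →
    (∀ i, ∃ ξ, ∀ x ∈ S, |x i - ξ| ≤ R) →
    ∫⁻ x in S, ∫⁻ b, ‖av (dil L κ) f x b‖ₑ ^ 2 ≤ ENNReal.ofReal (C * R * (L ^ n)⁻¹) * ∫⁻ y, ‖f y‖ₑ ^ 2 := by
  obtain ⟨C, hC0, hC⟩ := dil_ft hm hκ
  obtain ⟨K, hK0, hK⟩ := test_bdd hκ.smooth.1.continuous hκ.smooth.2
  obtain ⟨A, hA0, hA⟩ := test_supp hκ.smooth.2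
  set c : ℝ := 1 / (4 * (n + 1)) with hcd
  have hc : 0 < c := by positivity
  let ι := Fin (n+1) × Bool
  let sg : Bool → ℝ := fun β => if β then 1 else -1
  have hsg : ∀ β, sg β = 1 ∨ sg β = -1 := fun β => by cases β <;> simp [sg]
  let N : ℝ := Fintype.card ι
  refine ⟨N * N * (2 * C * (1 / (2 * c))), by positivity, fun L hL f M ρ hf hf2 S R hR hS hS2 => ?_⟩
  obtain ⟨d1, d2, d3⟩ := dil_props hL hκ.smooth.1.continuous hK hA
  let As : ι → Set (Euc (n+1)) := fun j => {y | 2 * c ≤ sg j.2 * y j.1}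
  have hAs : ∀ j, MeasurableSet (As j) := fun j => measurableSet_le (by fun_prop) (by fun_prop)
  let mu : Euc (n+1) → ℝ := fun y => ∑ j, (As j).indicator 1 y
  have hmu1 : ∀ y, f y ≠ 0 → 1 ≤ mu y := by
    intro y hy
    have h1 : 1/2 ≤ ‖y‖ := by
      by_contra h; exact hy (hf2 y (not_le.1 h))
    have : ∃ i, 2 * c ≤ |y i| := by
      by_contra hcon
      push Not at hcon
      have hsq : ‖y‖ ^ 2 < (1/2) ^ 2 := by
        rw [EuclideanSpace.norm_sq_eq]
        calc ∑ i, ‖y i‖ ^ 2 < ∑ i : Fin (n+1), (2 * c) ^ 2 := by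
              apply Finset.sum_lt_sum_of_nonempty Finset.univ_nonempty; intro i _
              rw [Real.norm_eq_abs]
              exact pow_lt_pow_left₀ (hcon i) (abs_nonneg _) two_ne_zero
          _ = (n + 1) * (2 * c) ^ 2 := by simp
          _ = 1 / (4 * (n+1)) := by rw [hcd]; field_simp; norm_num
          _ ≤ 1 / (4 * 1) := by gcongr; linarith [Nat.cast_nonneg (α := ℝ) n]
          _ ≤ (1/2) ^ 2 := by norm_num
      nlinarith [norm_nonneg y]
    obtain ⟨i, hi⟩ := this
    have : ∃ β, y ∈ As (i, β) := by
      rcases abs_cases (y i) with h | h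
      · exact ⟨true, by simp only [As, sg, mem_ofPred_eq]; simp; linarith⟩
      · exact ⟨false, by simp only [As, sg, mem_ofPred_eq]; simp; linarith⟩
    obtain ⟨β, hβ⟩ := this
    have := Finset.single_le_sum (f := fun j => (As j).indicator (1 : Euc (n+1) → ℝ) y)
      (fun j _ => indicator_nonneg (fun _ _ => zero_le_one) _) (Finset.mem_univ (i, β))
    simpa [hβ] using this
  let g : ι → Euc (n+1) → ℝ := fun j y => (As j).indicator 1 y * ((mu y)⁻¹ * f y)
  have hmu0 : ∀ y, 0 ≤ mu y := fun y => Finset.sum_nonneg fun j _ => indicator_nonneg (fun _ _ => zero_le_one) _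
  have hgf : ∀ j y, |g j y| ≤ |f y| := by
    intro j y
    by_cases h : f y = 0
    · simp [g, h]
    have h1 := hmu1 y h
    simp only [g, abs_mul]
    have i1 : |(As j).indicator (1 : Euc (n+1) → ℝ) y| ≤ 1 := by
      by_cases h : y ∈ As j <;> simp [h]
    have i2 : |(mu y)⁻¹| ≤ 1 := by
      rw [abs_inv, abs_of_nonneg (hmu0 y)]; exact inv_le_one_of_one_le₀ h1
    calc _ ≤ 1 * (1 * |f y|) := by gcongr
      _ = _ := by ring
  have hmum : Measurable mu := by
    apply Finset.measurable_fun_sum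
    intro j _; exact measurable_one.indicator (hAs j)
  have hg : ∀ j, Bf (g j) M ρ := fun j => ⟨(measurable_one.indicator (hAs j)).mul (hmum.inv.mul hf.meas),
    fun y => (hgf j y).trans (hf.bdd y), fun y hy => by simp [g, hf.supp y hy]⟩
  have hsum : f = fun y => ∑ j, g j y := by
    ext y
    by_cases h : f y = 0
    · simp [g, h]
    have h1 := hmu1 y h
    simp only [g]
    rw [← Finset.sum_mul]
    change _ = mu y * _
    field_simp
  have hav : ∀ x b, av (dil L κ) f x b = ∑ j, av (dil L κ) (g j) x b := by
    intro x b
    conv_lhs => rw [hsum]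
    exact av_sum _ d1 d2 g (fun j _ => (hg j).integrable) x b
  have hΦ : ∀ j, Measurable (fun x => ∫⁻ b, ‖av (dil L κ) (g j) x b‖ₑ ^ 2) := fun j => av_int_meas d1 (hg j).meas
  have hb : ∀ j x, Measurable (fun b => ‖av (dil L κ) (g j) x b‖ₑ ^ 2) := fun j x =>
    ((av_meas d1 (hg j).meas).comp (f := fun b => (x, b)) (by fun_prop)).enorm.pow_const 2
  calc ∫⁻ x in S, ∫⁻ b, ‖av (dil L κ) f x b‖ₑ ^ 2
      ≤ ∫⁻ x in S, ∫⁻ b, (Fintype.card ι : ℝ≥0∞) * ∑ j, ‖av (dil L κ) (g j) x b‖ₑ ^ 2 := by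
        apply lintegral_mono; intro x; apply lintegral_mono; intro b
        simp only
        rw [hav]; exact enorm_sum_sq _ _
    _ = (Fintype.card ι : ℝ≥0∞) * ∑ j, ∫⁻ x in S, ∫⁻ b, ‖av (dil L κ) (g j) x b‖ₑ ^ 2 := by
        rw [← lintegral_finsetSum _ (fun j _ => hΦ j), ← lintegral_const_mul' _ _ (by simp)]
        congr 1; ext x
        rw [lintegral_const_mul' _ _ (by simp), lintegral_finsetSum _ (fun j _ => hb j x)]
    _ ≤ (Fintype.card ι : ℝ≥0∞) * ∑ j : ι, ENNReal.ofReal (2 * R) * (ENNReal.ofReal (C * (L ^ n)⁻¹) * (ENNReal.ofReal (1 / (2 * c)) * ∫⁻ y, ‖f y‖ₑ ^ 2)) := by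
        gcongr with j _
        obtain ⟨ξ, hξ⟩ := hS2 j.1
        refine (near_slab j.1 (hsg j.2) hc (hg j) ?_ d1 d3 d2 (hC L hL) ?_ hξ).trans ?_
        · intro y hy
          have : y ∉ As j := by simpa [As] using hy
          simp [g, this]
        · intro x hx
          exact (PiLp.norm_apply_le x j.1).trans (by simpa using hS hx)
        · gcongr with y
          rw [← ofReal_norm, ← ofReal_norm]; exact ENNReal.ofReal_le_ofReal (hgf j y)
    _ = _ := by
        rw [Finset.sum_const, Finset.card_univ, nsmul_eq_mul]
        have hN : (Fintype.card ι : ℝ≥0∞) = ENNReal.ofReal N := by simp [N]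
        rw [hN]
        simp only [← mul_assoc]
        congr 1
        have hN0 : 0 ≤ N := by positivity
        rw [← ENNReal.ofReal_mul hN0, ← ENNReal.ofReal_mul (by positivity), ← ENNReal.ofReal_mul (by positivity),
          ← ENNReal.ofReal_mul (by positivity)]
        congr 1; ring
end Pent
end

section
open MeasureTheory Metric Set
open scoped ENNReal NNReal FourierTransform ContDiff
namespace Pent

lemma ibp_iter {Ψ : ℝ → ℝ} (hΨ : ContDiff ℝ ∞ Ψ) (hc : HasCompactSupport Ψ) (N : ℕ) :
    ∀ Φ : ℝ → ℝ, ContDiff ℝ ∞ Φ → |∫ s, Φ s * iteratedDeriv N Ψ s| = |∫ s, iteratedDeriv N Φ s * Ψ s| := by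
  induction N with
  | zero => intro Φ _; simp
  | succ N ih =>
    intro Φ hΦ
    obtain ⟨t1, t2⟩ := test_iter hΨ hc N
    have hΦ' := (contDiff_infty_iff_deriv.1 hΦ)
    rw [iteratedDeriv_succ' (f := Φ), ← ih _ hΦ'.2, iteratedDeriv_succ]
    set ψ := iteratedDeriv N Ψ
    have t1' := (contDiff_infty_iff_deriv.1 t1)
    have := integral_mul_deriv_eq_deriv_mul_of_integrable (u := Φ) (v := ψ) (u' := deriv Φ) (v' := deriv ψ)
      (fun x _ => (hΦ'.1 x).hasDerivAt) (fun x _ => (t1'.1 x).hasDerivAt)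
      (Continuous.integrable_of_hasCompactSupport (hΦ.continuous.mul t1'.2.continuous) t2.deriv.mul_left)
      (Continuous.integrable_of_hasCompactSupport (hΦ'.2.continuous.mul t1.continuous) t2.mul_left)
      (Continuous.integrable_of_hasCompactSupport (hΦ.continuous.mul t1.continuous) t2.mul_left)
    rw [this, abs_neg]

/-- smooth compactly supported function equal to `t^a` on `[1/2,3/2]` -/
lemma exists_chi (a : ℝ) : ∃ χ : ℝ → ℝ, ContDiff ℝ ∞ χ ∧ HasCompactSupport χ ∧ ∀ t, |t - 1| ≤ 1/2 → χ t = t ^ a := by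
  let b : ContDiffBump (1:ℝ) := ⟨1/2, 3/4, by norm_num, by norm_num⟩
  refine ⟨fun t => b t * t ^ a, ?_, b.hasCompactSupport.mul_right, ?_⟩
  · rw [contDiff_iff_contDiffAt]
    intro t
    by_cases ht : 0 < t
    · exact b.contDiff.contDiffAt.mul (Real.contDiffAt_rpow_const_of_ne ht.ne')
    · have : (fun t => b t * t ^ a) =ᶠ[nhds t] fun _ => 0 := by
        filter_upwards [Iio_mem_nhds (show t < 1/4 by linarith)] with s hs
        rw [b.zero_of_le_dist, zero_mul]
        rw [Real.dist_eq]
        have : s < 1/4 := hs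
        rw [abs_of_neg (by linarith)]
        change (3/4:ℝ) ≤ _
        linarith
      exact contDiffAt_const.congr_of_eventuallyEq this
  · intro t ht
    have : b t = 1 := b.one_of_mem_closedBall (by rw [mem_closedBall, Real.dist_eq]; exact ht)
    simp [this]

lemma iter_bdd {χ : ℝ → ℝ} (h : ContDiff ℝ ∞ χ) (hc : HasCompactSupport χ) (N : ℕ) :
    ∃ K, 0 ≤ K ∧ ∀ i ≤ N, ∀ t, ‖iteratedFDeriv ℝ i χ t‖ ≤ K := by
  have : ∀ i, ∃ K, 0 ≤ K ∧ ∀ t, ‖iteratedFDeriv ℝ i χ t‖ ≤ K := by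
    intro i
    obtain ⟨t1, t2⟩ := test_iter h hc i
    obtain ⟨K, hK, h⟩ := test_bdd t1.continuous t2
    exact ⟨K, hK, fun t => by rw [norm_iteratedFDeriv_eq_norm_iteratedDeriv]; exact h t⟩
  choose K hK0 hK using this
  refine ⟨∑ i ∈ Finset.range (N+1), K i, Finset.sum_nonneg fun i _ => hK0 i, fun i hi t => (hK i t).trans ?_⟩
  exact Finset.single_le_sum (fun i _ => hK0 i) (Finset.mem_range.2 (by omega))

lemma quad_iter {al be A D : ℝ} (hA : 0 ≤ A) (hD1 : |al| + 2 * |be| * A ≤ D) (hD2 : 2 * |be| ≤ D ^ 2)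
    (s : ℝ) (hs : |s| ≤ A) (i : ℕ) (hi : 1 ≤ i) :
    ‖iteratedFDeriv ℝ i (fun s : ℝ => 1 + al * s - be * s ^ 2) s‖ ≤ D ^ i := by
  have hD0 : 0 ≤ D := le_trans (by positivity) hD1
  rw [norm_iteratedFDeriv_eq_norm_iteratedDeriv]
  obtain ⟨j, rfl⟩ : ∃ j, i = j + 1 := ⟨i - 1, by omega⟩
  have d1 : deriv (fun s : ℝ => 1 + al * s - be * s ^ 2) = fun s => al - 2 * be * s := by
    ext s
    have : HasDerivAt (fun s : ℝ => 1 + al * s - be * s ^ 2) (al * 1 - be * (2 * s)) s := by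
      refine HasDerivAt.sub ?_ ?_
      · exact ((hasDerivAt_id s).const_mul al).const_add 1
      · simpa using (hasDerivAt_pow 2 s).const_mul be
    rw [this.deriv]; ring
  rw [iteratedDeriv_succ', d1]
  have d2 : deriv (fun s : ℝ => al - 2 * be * s) = fun _ => - 2 * be := by
    ext s
    have : HasDerivAt (fun s : ℝ => al - 2 * be * s) (-(2 * be * 1)) s :=
      ((hasDerivAt_id s).const_mul (2 * be)).const_sub al
    rw [this.deriv]; ring
  rcases j with _ | j
  · simp only [iteratedDeriv_zero, zero_add, pow_one]
    refine le_trans ?_ hD1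
    rw [Real.norm_eq_abs]
    refine (abs_sub _ _).trans ?_
    rw [abs_mul, abs_mul, abs_two]
    gcongr
  rw [iteratedDeriv_succ', d2]
  rcases j with _ | j
  · simp only [iteratedDeriv_zero, zero_add, Real.norm_eq_abs, abs_mul, abs_neg, abs_two]
    exact hD2
  · have e : iteratedDeriv (j+1) (fun _ : ℝ => -2 * be) = fun _ => 0 := by
      rw [iteratedDeriv_succ', deriv_const']
      ext s
      have := iteratedDeriv_const (𝕜 := ℝ) (n := j) (c := (0:ℝ)) (x := s)
      rw [this]; split_ifs <;> rfl
    rw [e]; simp; positivity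

def Fv (a v u : ℝ) : ℝ := if u ^ 2 < v then (v - u ^ 2) ^ a else 0

lemma Fv_nonneg (a v u : ℝ) : 0 ≤ Fv a v u := by
  unfold Fv; split_ifs with h
  · exact Real.rpow_nonneg (by linarith) _
  · exact le_rfl

lemma Fv_le {a : ℝ} (ha : 0 ≤ a) {v u B : ℝ} (hB : 0 ≤ B) (h : v - u ^ 2 ≤ B) : Fv a v u ≤ B ^ a := by
  unfold Fv; split_ifs with h'
  · exact Real.rpow_le_rpow (by linarith) h ha
  · positivity

lemma Fv_meas (a : ℝ) : Measurable (fun p : ℝ × ℝ => Fv a p.1 p.2) := by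
  unfold Fv
  refine Measurable.ite (measurableSet_lt (by fun_prop) (by fun_prop)) (by fun_prop) measurable_const

/-- trivial bound -/
lemma kb_triv {κ : ℝ → ℝ} {A K : ℝ} (hA0 : 0 ≤ A) (hK0 : 0 ≤ K) (hA : ∀ s, A < |s| → κ s = 0) (hK : ∀ s, |κ s| ≤ K)
    {F : ℝ → ℝ} {B : ℝ} (hB : ∀ s, |s| ≤ A → |F s| ≤ B) (hB0 : 0 ≤ B) : |∫ s, F s * κ s| ≤ B * K * (2 * A) := by
  have e : ∫ s, F s * κ s = ∫ s in Icc (-A) A, F s * κ s := by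
    rw [setIntegral_eq_integral_of_forall_compl_eq_zero]
    intro s hs
    rw [hA, mul_zero]
    by_contra h
    exact hs (abs_le.1 (not_lt.1 h))
  rw [e, ← Real.norm_eq_abs]
  refine (norm_setIntegral_le_of_norm_le_const (C := B * K) (by simp) ?_).trans (le_of_eq ?_)
  · intro s hs
    rw [norm_mul]
    have := hB s (abs_le.2 hs)
    exact mul_le_mul this (hK s) (norm_nonneg _) hB0
  · rw [Real.volume_real_Icc_of_le (by linarith)]; ring

set_option maxHeartbeats 2000000 in
lemma kb {N : ℕ} {a : ℝ} (ha : 0 ≤ a) (hN : a + 2 ≤ N) {κ : ℝ → ℝ} (hκ : IsKer N κ) :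
    ∃ C A : ℝ, 0 ≤ C ∧ 0 ≤ A ∧ (∀ ε v w, 0 < ε → ε ≤ 1 → v ≤ 5 →
      |∫ s, Fv a v (w - ε * s) * κ s| ≤ C * ε ^ a * (1 + ((v - w ^ 2) / ε) ^ 2)⁻¹) ∧
     (∀ ε v w, 1 < ε → v ≤ 5 → |∫ s, Fv a v (w - ε * s) * κ s| ≤ C) ∧
     (∀ ε v w, 1 < ε → v ≤ 5 → A * ε < |w| → ∫ s, Fv a v (w - ε * s) * κ s = 0) := by
  obtain ⟨Ψ, hΨ, hΨc, rfl⟩ := hκ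
  obtain ⟨t1, t2⟩ := test_iter hΨ hΨc N
  obtain ⟨K, hK0, hK⟩ := test_bdd t1.continuous t2
  obtain ⟨K', hK'0, hK'⟩ := test_bdd hΨ.continuous hΨc
  obtain ⟨A1, hA10, hA1⟩ := test_supp t2
  obtain ⟨A2, hA20, hA2⟩ := test_supp hΨc
  obtain ⟨A, hA0, hA, hA'⟩ : ∃ A : ℝ, 0 < A ∧ (∀ s, A < |s| → iteratedDeriv N Ψ s = 0) ∧ (∀ s, A < |s| → Ψ s = 0) :=
    ⟨max A1 A2, by positivity, fun s hs => hA1 s ((le_max_left _ _).trans_lt hs), fun s hs => hA2 s ((le_max_right _ _).trans_lt hs)⟩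
  obtain ⟨χ, hχ, hχc, hχ1⟩ := exists_chi a
  obtain ⟨K2, hK20, hK2⟩ := iter_bdd hχ hχc N
  set C1 : ℝ := A * (6 + 3 * A) + 1 with hC1
  have hC1' : 1 ≤ C1 := by have : 0 ≤ A * (6 + 3 * A) := by positivity
                           linarith
  set D0 : ℝ := 6 + 10 * A + 10 with hD0
  set Ca := (3 * C1) ^ a * K * (2 * A) * (1 + (2 * C1) ^ 2) with hCa
  set Cb := (N.factorial * K2 * D0 ^ N) * K' * (2 * A) * 2 with hCb
  set Cc := (5:ℝ) ^ a * K * (2 * A) with hCc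
  have hCa0 : 0 ≤ Ca := by positivity
  have hCb0 : 0 ≤ Cb := by positivity
  have hCc0 : 0 ≤ Cc := by positivity
  have far0 : ∀ ε v w, 0 < ε → v ≤ 5 → 3 + A * ε < |w| → ∫ s, Fv a v (w - ε * s) * iteratedDeriv N Ψ s = 0 := by
    intro ε v w hε hv hw
    rw [← integral_zero ℝ ℝ]; congr 1; ext s
    by_cases hs : A < |s|
    · rw [hA s hs, mul_zero]
    push Not at hs
    have : 3 < |w - ε * s| := by
      have h1 := abs_sub_abs_le_abs_sub w (ε * s)
      have h2 : |ε * s| ≤ ε * A := by rw [abs_mul, abs_of_pos hε]; gcongr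
      linarith
    have h3 : ¬ ((w - ε * s) ^ 2 < v) := by
      rw [← sq_abs]; nlinarith
    simp [Fv, h3]
  refine ⟨Ca + Cb + Cc, 3 + A, by positivity, by positivity, ?_, ?_, ?_⟩
  · intro ε v w hε hε1 hv
    set m := v - w ^ 2 with hm
    have hpos : 0 ≤ ε ^ a * (1 + (m / ε) ^ 2)⁻¹ := by positivity
    by_cases hw : 3 + A * ε < |w|
    · rw [far0 ε v w hε hv hw, abs_zero]; positivity
    push Not at hw
    have hw' : |w| ≤ 3 + A := by nlinarith
    have hdiff : ∀ s, |s| ≤ A → |(v - (w - ε * s) ^ 2) - m| ≤ C1 * ε := by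
      intro s hs
      have e : (v - (w - ε * s) ^ 2) - m = ε * (s * (2 * w - ε * s)) := by rw [hm]; ring
      rw [e, abs_mul, abs_of_pos hε, abs_mul]
      have h2 : |2 * w - ε * s| ≤ 6 + 3 * A := by
        refine (abs_sub _ _).trans ?_
        rw [abs_mul, abs_mul, abs_two, abs_of_pos hε]
        have : ε * |s| ≤ 1 * A := by gcongr
        linarith
      have h9 : |s| * |2 * w - ε * s| ≤ A * (6 + 3 * A) := by gcongr
      have := mul_le_mul_of_nonneg_left h9 hε.le
      rw [hC1]; linarith
    by_cases h1 : |m| ≤ 2 * C1 * ε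
    · have hb : |∫ s, Fv a v (w - ε * s) * iteratedDeriv N Ψ s| ≤ (3 * C1 * ε) ^ a * K * (2 * A) := by
        refine kb_triv hA0.le hK0 hA hK (fun s hs => ?_) (by positivity)
        rw [abs_of_nonneg (Fv_nonneg _ _ _)]
        apply Fv_le ha (by positivity)
        have := (abs_le.1 (hdiff s hs)).2
        have := (abs_le.1 h1).2
        linarith
      rw [Real.mul_rpow (by positivity) hε.le] at hb
      have h2 : (m / ε) ^ 2 ≤ (2 * C1) ^ 2 := by
        rw [← sq_abs, abs_div, abs_of_pos hε]
        gcongr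
        rwa [div_le_iff₀ hε]
      have h3 : (1 + (2 * C1) ^ 2)⁻¹ ≤ (1 + (m / ε) ^ 2)⁻¹ := by gcongr
      calc _ ≤ _ := hb
        _ = Ca * ε ^ a * (1 + (2 * C1) ^ 2)⁻¹ := by rw [hCa]; field_simp
        _ ≤ (Ca + Cb + Cc) * ε ^ a * (1 + (m / ε) ^ 2)⁻¹ := by gcongr; linarith
    push Not at h1
    by_cases h2 : m < 0
    · have : ∫ s, Fv a v (w - ε * s) * iteratedDeriv N Ψ s = 0 := by
        rw [← integral_zero ℝ ℝ]; congr 1; ext s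
        by_cases hs : A < |s|
        · rw [hA s hs, mul_zero]
        push Not at hs
        have := (abs_le.1 (hdiff s hs)).2
        rw [abs_of_neg h2] at h1
        have h8 : 0 < C1 * ε := by positivity
        have h3 : ¬ ((w - ε * s) ^ 2 < v) := by linarith
        simp [Fv, h3]
      rw [this, abs_zero]; positivity
    push Not at h2
    rw [abs_of_nonneg h2] at h1
    have hm0 : 0 < m := by nlinarith
    have hm5 : m ≤ 5 := by nlinarith [sq_nonneg w]
    have hw3 : |w| ≤ 3 := by
      have : w ^ 2 ≤ 3 ^ 2 := by nlinarith
      exact abs_le_of_sq_le_sq this (by norm_num)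
    set θ := ε / m with hθ
    have hθ0 : 0 < θ := by positivity
    set al := 2 * w * θ with hal
    set be := θ ^ 2 * m with hbe
    let q : ℝ → ℝ := fun s => 1 + al * s - be * s ^ 2
    have hq : ∀ s, v - (w - ε * s) ^ 2 = m * q s := by
      intro s
      simp only [q, hal, hbe, hθ]
      field_simp
      rw [hm]; ring
    have hθ1 : θ ≤ 1 := by rw [hθ, div_le_one hm0]; nlinarith
    have hqd : ContDiff ℝ ∞ q := by simp only [q]; fun_prop
    have e1 : ∀ s, Fv a v (w - ε * s) * iteratedDeriv N Ψ s = m ^ a * ((χ ∘ q) s * iteratedDeriv N Ψ s) := by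
      intro s
      by_cases hs : A < |s|
      · rw [hA s hs]; ring
      push Not at hs
      have h3 := hdiff s hs
      have h4 : |q s - 1| ≤ 1/2 := by
        have : (v - (w - ε * s) ^ 2) - m = m * (q s - 1) := by rw [hq]; ring
        rw [this, abs_mul, abs_of_pos hm0] at h3
        by_contra hcon
        push Not at hcon
        have := mul_lt_mul_of_pos_left hcon hm0
        linarith
      have h5 : 0 < q s := by linarith [(abs_le.1 h4).1]
      have h6 : (w - ε * s) ^ 2 < v := by have := hq s; have := mul_pos hm0 h5; linarith
      rw [Function.comp, hχ1 _ h4, Fv, if_pos h6, hq, Real.mul_rpow hm0.le h5.le]; ring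
    simp_rw [e1]
    rw [integral_const_mul, abs_mul, ibp_iter hΨ hΨc N _ (hχ.comp hqd), abs_of_pos (Real.rpow_pos_of_pos hm0 a)]
    have hb : |∫ s, iteratedDeriv N (χ ∘ q) s * Ψ s| ≤ (N.factorial * K2 * (D0 * θ) ^ N) * K' * (2 * A) := by
      refine kb_triv hA0.le hK'0 hA' hK' (fun s hs => ?_) (by positivity)
      rw [← Real.norm_eq_abs, ← norm_iteratedFDeriv_eq_norm_iteratedDeriv]
      apply norm_iteratedFDeriv_comp_le hχ hqd (by exact_mod_cast le_top) s (fun i hi => hK2 i hi _)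
      intro i hi _
      apply quad_iter hA0.le _ _ s hs i hi
      · rw [hal, hbe, abs_mul, abs_mul, abs_two, abs_of_pos hθ0, abs_of_pos (by positivity : 0 < θ ^ 2 * m)]
        have : θ ^ 2 * m ≤ θ * 5 := by nlinarith
        have : 2 * (θ ^ 2 * m) * A ≤ 2 * (θ * 5) * A := by gcongr
        have : 2 * |w| * θ ≤ 2 * 3 * θ := by gcongr
        rw [hD0]; linarith
      · rw [hbe, abs_of_pos (by positivity : 0 < θ ^ 2 * m), mul_pow, hD0]
        have h9 : 2 * m ≤ (6 + 10 * A + 10) ^ 2 := by nlinarith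
        have := mul_le_mul_of_nonneg_right h9 (sq_nonneg θ)
        linarith
    have hx : 0 < m / ε := by positivity
    have hx2 : 1 ≤ m / ε := by rw [le_div_iff₀ hε]; nlinarith
    have key : m ^ a * θ ^ N ≤ ε ^ a * (2 * (1 + (m / ε) ^ 2)⁻¹) := by
      have e2 : m ^ a = ε ^ a * (m / ε) ^ a := by
        rw [← Real.mul_rpow hε.le hx.le]; congr 1; field_simp
      have e3 : θ ^ N = (m / ε) ^ (-(N:ℝ)) := by
        rw [Real.rpow_neg hx.le, Real.rpow_natCast, hθ, ← inv_pow, inv_div]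
      rw [e2, e3, mul_assoc, ← Real.rpow_add hx]
      gcongr
      calc (m / ε) ^ (a + -(N:ℝ)) ≤ (m / ε) ^ (-2 : ℝ) := by
            apply Real.rpow_le_rpow_of_exponent_le hx2; linarith
        _ = ((m / ε) ^ 2)⁻¹ := by rw [Real.rpow_neg hx.le]; norm_cast
        _ ≤ 2 * (1 + (m / ε) ^ 2)⁻¹ := by
            rw [← div_eq_mul_inv, inv_eq_one_div, div_le_div_iff₀ (by positivity) (by positivity)]
            nlinarith
    calc m ^ a * |∫ s, iteratedDeriv N (χ ∘ q) s * Ψ s| ≤ m ^ a * ((N.factorial * K2 * (D0 * θ) ^ N) * K' * (2 * A)) := by gcongr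
      _ = (N.factorial * K2 * D0 ^ N * K' * (2 * A)) * (m ^ a * θ ^ N) := by rw [mul_pow]; ring
      _ ≤ (N.factorial * K2 * D0 ^ N * K' * (2 * A)) * (ε ^ a * (2 * (1 + (m / ε) ^ 2)⁻¹)) := by gcongr
      _ = Cb * ε ^ a * (1 + (m / ε) ^ 2)⁻¹ := by rw [hCb]; ring
      _ ≤ (Ca + Cb + Cc) * ε ^ a * (1 + (m / ε) ^ 2)⁻¹ := by gcongr; linarith
  · intro ε v w hε hv
    have : |∫ s, Fv a v (w - ε * s) * iteratedDeriv N Ψ s| ≤ (5:ℝ) ^ a * K * (2 * A) := by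
      refine kb_triv hA0.le hK0 hA hK (fun s hs => ?_) (by positivity)
      rw [abs_of_nonneg (Fv_nonneg _ _ _)]
      apply Fv_le ha (by positivity)
      nlinarith [sq_nonneg (w - ε * s)]
    linarith
  · intro ε v w hε hv hw
    exact far0 ε v w (by linarith) hv (by nlinarith)
end Pent
end

section
open MeasureTheory Metric Set
open scoped ENNReal NNReal FourierTransform ContDiff
namespace Pent
variable {n : ℕ}

/-- surface measure on ℝ^d (not normalized) -/
def sfm (d : ℕ) : Measure (Euc d) := (volume : Measure (Euc d)).toSphere.map Subtype.val

lemma sfm_univ (d : ℕ) : sfm d univ = (volume : Measure (Euc d)).toSphere univ := by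
  rw [sfm, Measure.map_apply measurable_subtype_coe MeasurableSet.univ, preimage_univ]

instance (d : ℕ) : IsFiniteMeasure (sfm d) := by
  unfold sfm; infer_instance

lemma polar_lint {d : ℕ} (hd : 1 ≤ d) {φ : Euc d → ℝ≥0∞} (hφ : Measurable φ) :
    ∫⁻ y, φ y = ∫⁻ s in Ioi (0:ℝ), ENNReal.ofReal (s ^ (d-1)) * ∫⁻ θ, φ (s • θ) ∂(sfm d) := by
  have : Nonempty (Fin d) := ⟨⟨0, hd⟩⟩
  have : Nontrivial (Euc d) := inferInstance
  have mp := (volume : Measure (Euc d)).measurePreserving_homeomorphUnitSphereProd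
  have e1 : ∫⁻ y, φ y = ∫⁻ y : ({0}ᶜ : Set (Euc d)), φ y ∂(volume.comap Subtype.val) := by
    rw [lintegral_subtype_comap (measurableSet_singleton _).compl, restrict_compl_singleton]
  have e2 : ∫⁻ y : ({0}ᶜ : Set (Euc d)), φ y ∂(volume.comap Subtype.val) =
      ∫⁻ p : sphere (0 : Euc d) 1 × Ioi (0:ℝ), φ (p.2.1 • p.1.1) ∂((volume : Measure (Euc d)).toSphere.prod (.volumeIoiPow (Module.finrank ℝ (Euc d) - 1))) := by
    rw [← mp.lintegral_comp (by fun_prop)]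
    congr 1; ext y
    have := homeomorphUnitSphereProd_symm_apply_coe (Euc d) (homeomorphUnitSphereProd (Euc d) y)
    rw [Homeomorph.symm_apply_apply] at this
    rw [← this]
  rw [e1, e2, lintegral_prod_symm' _ (by fun_prop), Measure.volumeIoiPow, lintegral_withDensity_eq_lintegral_mul _ (by fun_prop) ]
  · have : Module.finrank ℝ (Euc d) = d := finrank_euclideanSpace_fin
    rw [this, ← lintegral_subtype_comap measurableSet_Ioi]
    congr 1; ext s
    simp only [Pi.mul_apply]
    congr 1
    rw [sfm, lintegral_map (by fun_prop) (by fun_prop)]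
  · exact Measurable.lintegral_prod_left' (f := fun p : sphere (0 : Euc d) 1 × Ioi (0:ℝ) => φ (p.2.1 • p.1.1)) (by fun_prop)

lemma sfm_ae (d : ℕ) : ∀ᵐ y ∂(sfm d), ‖y‖ = 1 := by
  have hm : MeasurableSet {y : Euc d | ‖y‖ = 1} := (measurableSet_eq_fun measurable_norm measurable_const)
  rw [sfm, ae_map_iff measurable_subtype_coe.aemeasurable hm]
  exact Filter.Eventually.of_forall fun y => by simp

lemma radial_lint (hn : 1 ≤ n) {φ : ℝ → ℝ≥0∞} (hφ : Measurable φ) :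
    ∫⁻ y : Euc n, φ (‖y‖ ^ 2) = ENNReal.ofReal ((sfm n univ).toReal / 2) * ∫⁻ m in Ioi (0:ℝ), ENNReal.ofReal (m ^ (((n:ℝ) - 2) / 2)) * φ m := by
  rw [polar_lint hn (by fun_prop)]
  conv_rhs => rw [subst_lint, ← lintegral_const_mul' _ _ (by simp)]
  apply setLIntegral_congr_fun measurableSet_Ioi
  intro s hs
  have hs : 0 < s := hs
  simp only
  have : ∫⁻ θ, φ (‖s • θ‖ ^ 2) ∂sfm n = φ (s ^ 2) * sfm n univ := by
    rw [← lintegral_const]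
    apply lintegral_congr_ae
    filter_upwards [sfm_ae n] with θ hθ
    rw [norm_smul, hθ, mul_one, Real.norm_eq_abs, sq_abs]
  obtain ⟨S, hS0, hS⟩ : ∃ S : ℝ, 0 ≤ S ∧ sfm n univ = ENNReal.ofReal S := ⟨_, ENNReal.toReal_nonneg, (ENNReal.ofReal_toReal (measure_ne_top (sfm n) univ)).symm⟩
  rw [this, hS, ENNReal.toReal_ofReal hS0]
  rw [mul_comm (φ _), ← mul_assoc, ← mul_assoc, ← mul_assoc, ← ENNReal.ofReal_mul (by positivity),
    ← ENNReal.ofReal_mul (by positivity), ← ENNReal.ofReal_mul (by positivity)]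
  congr 2
  have : (s ^ 2) ^ (((n:ℝ) - 2) / 2) = s ^ (n - 1) / s := by
    rw [← Real.rpow_natCast s 2, ← Real.rpow_mul hs.le, ← Real.rpow_natCast, ← Real.rpow_sub_one hs.ne']
    congr 1
    push_cast [hn]; ring
  rw [this]; field_simp

lemma polar_measure (hn : 1 ≤ n) :
    Measure.map (fun h : Euc (n+1) => (h 0, ‖h‖ ^ 2)) volume =
      ((volume : Measure ℝ).prod volume).withDensity (fun p => ENNReal.ofReal ((sfm n univ).toReal / 2 * Fv (((n:ℝ)-2)/2) p.2 p.1)) := by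
  have hF := Fv_meas (((n:ℝ)-2)/2)
  have hF' : Measurable (fun p : ℝ × ℝ => Fv (((n:ℝ)-2)/2) p.2 p.1) := hF.comp measurable_swap
  have hmap : Measurable (fun h : Euc (n+1) => (h 0, ‖h‖ ^ 2)) := by fun_prop
  apply Measure.ext_of_lintegral
  intro f hf
  rw [lintegral_map hf hmap, lintegral_withDensity_eq_lintegral_mul _ (by fun_prop) hf]
  have mp := (split_mp (0 : Fin (n+1)))
  have e1 : ∫⁻ h : Euc (n+1), f (h 0, ‖h‖ ^ 2) = ∫⁻ p : ℝ × Euc n, f (p.1, p.1 ^ 2 + ‖p.2‖ ^ 2) := by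
    rw [← mp.lintegral_comp (by fun_prop)]
    congr 1; ext h
    rw [split_norm 0, split_fst]
  rw [e1, Measure.volume_eq_prod, lintegral_prod _ (by fun_prop), lintegral_prod _ (by fun_prop)]
  congr 1; ext u
  simp only [Pi.mul_apply]
  rw [radial_lint hn (φ := fun m => f (u, u ^ 2 + m)) (by fun_prop), ← lintegral_const_mul' _ _ (by simp),
    ← lintegral_indicator measurableSet_Ioi, ← lintegral_add_left_eq_self (fun v => ENNReal.ofReal ((sfm n univ).toReal / 2 * Fv (((n:ℝ)-2)/2) v u) * f (u, v)) (u ^ 2)]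
  congr 1; ext m
  simp only [indicator, mem_Ioi, Fv, lt_add_iff_pos_right, add_sub_cancel_left]
  split_ifs with h
  · rw [ENNReal.ofReal_mul (by positivity), mul_assoc]
  · simp
end Pent
end

section
open MeasureTheory Metric Set
open scoped ENNReal NNReal FourierTransform ContDiff
namespace Pent
variable {n : ℕ}

lemma enn_amgm (a b : ℝ≥0∞) : a * b ≤ a ^ 2 + b ^ 2 := by
  rcases le_total a b with h | h
  · calc a * b ≤ b * b := by gcongr
      _ = b ^ 2 := (sq b).symm
      _ ≤ _ := le_add_self
  · calc a * b ≤ a * a := by gcongr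
      _ = a ^ 2 := (sq a).symm
      _ ≤ _ := le_self_add

/-- Schur test in AM-GM form -/
lemma schur {α β : Type*} [MeasurableSpace α] [MeasurableSpace β] {μ : Measure α} {ν : Measure β} [SFinite μ] [SFinite ν]
    {f : α → ℝ≥0∞} {g : β → ℝ≥0∞} {Q : α × β → ℝ≥0∞} (hf : Measurable f) (hg : Measurable g) (hQ : Measurable Q) {S : ℝ≥0∞}
    (h1 : ∀ x, f x ≠ 0 → ∫⁻ y, Q (x, y) ∂ν ≤ S) (h2 : ∀ y, g y ≠ 0 → ∫⁻ x, Q (x, y) ∂μ ≤ S) :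
    ∫⁻ x, ∫⁻ y, f x * g y * Q (x, y) ∂ν ∂μ ≤ S * (∫⁻ x, f x ^ 2 ∂μ + ∫⁻ y, g y ^ 2 ∂ν) := by
  have hQx : ∀ x, Measurable fun y => Q (x, y) := fun x => hQ.comp (by fun_prop)
  have hQy : ∀ y, Measurable fun x => Q (x, y) := fun y => hQ.comp (by fun_prop)
  calc ∫⁻ x, ∫⁻ y, f x * g y * Q (x, y) ∂ν ∂μ
      ≤ ∫⁻ x, ∫⁻ y, (f x ^ 2 * Q (x, y) + g y ^ 2 * Q (x, y)) ∂ν ∂μ := by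
        gcongr with x y
        rw [← add_mul]; gcongr; exact enn_amgm _ _
    _ = ∫⁻ x, ∫⁻ y, f x ^ 2 * Q (x, y) ∂ν ∂μ + ∫⁻ x, ∫⁻ y, g y ^ 2 * Q (x, y) ∂ν ∂μ := by
        rw [← lintegral_add_left]
        · congr 1; ext x
          rw [lintegral_add_left]
          exact (hQx x).const_mul _
        · exact Measurable.lintegral_prod_right' (f := fun p : α × β => f p.1 ^ 2 * Q p) (by fun_prop)
    _ ≤ ∫⁻ x, S * f x ^ 2 ∂μ + ∫⁻ y, S * g y ^ 2 ∂ν := by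
        gcongr ?_ + ?_
        · apply lintegral_mono; intro x
          simp only
          rw [lintegral_const_mul _ (hQx x), mul_comm]
          by_cases h : f x = 0
          · simp [h]
          · gcongr; exact h1 x h
        · rw [lintegral_lintegral_swap (f := fun x y => g y ^ 2 * Q (x, y)) (by fun_prop)]
          apply lintegral_mono; intro y
          simp only
          rw [lintegral_const_mul _ (hQy y), mul_comm]
          by_cases h : g y = 0
          · simp [h]
          · gcongr; exact h2 y h
    _ = _ := by
        rw [lintegral_const_mul _ (by fun_prop), lintegral_const_mul _ (by fun_prop), mul_add]

lemma lint_comp_mul {c : ℝ} (hc : 0 < c) (q : ℝ → ℝ≥0∞) :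
    ∫⁻ x, q (c * x) = ENNReal.ofReal c⁻¹ * ∫⁻ x, q x := by
  have hemb : MeasurableEmbedding (fun x : ℝ => c * x) :=
    (Homeomorph.mulLeft₀ c hc.ne').measurableEmbedding
  have h := hemb.lintegral_map q (μ := volume)
  rw [← h, Real.map_volume_mul_left hc.ne', lintegral_smul_measure, abs_of_pos (inv_pos.2 hc), smul_eq_mul]

lemma lint_aff {t : ℝ} (ht : 0 < t) (c : ℝ) (q : ℝ → ℝ≥0∞) :
    ∫⁻ b, q ((b - c) / t) = ENNReal.ofReal t * ∫⁻ w, q w := by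
  rw [lintegral_sub_right_eq_self (fun b => q (b / t)) c]
  have := lint_comp_mul (inv_pos.2 ht) q
  rw [inv_inv] at this
  rw [← this]
  congr 1; ext b; congr 1; field_simp

lemma lint_aff' {t : ℝ} (ht : 0 < t) (c : ℝ) (q : ℝ → ℝ≥0∞) :
    ∫⁻ b, q ((c - b) / t) = ENNReal.ofReal t * ∫⁻ w, q w := by
  rw [← lint_aff ht 0 q, ← lintegral_sub_left_eq_self (fun b => q ((b - 0) / t)) c]
  simp

lemma int_aff {ε : ℝ} (hε : 0 < ε) (w : ℝ) (φ : ℝ → ℝ) : ∫ u, φ u = ε * ∫ s, φ (w - ε * s) := by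
  have h1 := Measure.integral_comp_mul_left (fun s => φ (w - s)) ε
  rw [h1, integral_sub_left_eq_self, abs_of_pos (inv_pos.2 hε), smul_eq_mul]
  field_simp

lemma lor0 {t : ℝ} (ht : 0 < t) (c : ℝ) :
    ∫⁻ w, ENNReal.ofReal ((1 + ((w - c) / t) ^ 2)⁻¹) = ENNReal.ofReal (t * Real.pi) := by
  rw [lint_aff ht c (fun s => ENNReal.ofReal ((1 + s ^ 2)⁻¹)), ← ofReal_integral_eq_lintegral_ofReal integrable_inv_one_add_sq,
    integral_univ_inv_one_add_sq, ← ENNReal.ofReal_mul ht.le]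
  exact Filter.Eventually.of_forall fun s => by positivity

lemma lor {ε v : ℝ} (hε : 0 < ε) (hv : 3/4 ≤ v) :
    ∫⁻ w, ENNReal.ofReal ((1 + ((v - w ^ 2) / ε) ^ 2)⁻¹) ≤ ENNReal.ofReal (4 * Real.pi * ε) := by
  have hs : 1/2 ≤ √v := Real.le_sqrt_of_sq_le (by linarith)
  have hs2 : √v ^ 2 = v := Real.sq_sqrt (by linarith)
  set c := √v
  have key : ∀ w, ENNReal.ofReal ((1 + ((v - w ^ 2) / ε) ^ 2)⁻¹) ≤
      ENNReal.ofReal ((1 + ((w - c) / (2 * ε)) ^ 2)⁻¹) + ENNReal.ofReal ((1 + ((w - (-c)) / (2 * ε)) ^ 2)⁻¹) := by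
    intro w
    have hm : (v - w ^ 2) ^ 2 = (w - c) ^ 2 * (w + c) ^ 2 := by rw [← hs2]; ring
    rcases le_total 0 w with hw | hw
    · refine le_trans (ENNReal.ofReal_le_ofReal ?_) le_self_add
      gcongr 1
      rw [div_pow, div_pow, hm, mul_pow]
      gcongr 1 + ?_
      rw [div_le_div_iff₀ (by positivity) (by positivity)]
      have h1 : 1 ≤ 2 ^ 2 * (w + c) ^ 2 := by nlinarith
      have := mul_le_mul_of_nonneg_left h1 (by positivity : 0 ≤ (w - c) ^ 2 * ε ^ 2)
      linarith
    · refine le_trans (ENNReal.ofReal_le_ofReal ?_) le_add_self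
      gcongr 1
      rw [div_pow, div_pow, hm, mul_pow, sub_neg_eq_add]
      gcongr 1 + ?_
      rw [div_le_div_iff₀ (by positivity) (by positivity)]
      have h1 : 1 ≤ 2 ^ 2 * (w - c) ^ 2 := by nlinarith
      have := mul_le_mul_of_nonneg_left h1 (by positivity : 0 ≤ (w + c) ^ 2 * ε ^ 2)
      linarith
  refine (lintegral_mono key).trans ?_
  rw [lintegral_add_left (by fun_prop), lor0 (by positivity), lor0 (by positivity), ← ENNReal.ofReal_add (by positivity) (by positivity)]
  apply ENNReal.ofReal_le_ofReal
  linarith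

def Gk (k g : ℝ → ℝ) (v : ℝ) : ℝ := ∫ b, k (b - v) * g b

structure Sg (g : ℝ → ℝ) (M : ℝ) : Prop where
  meas : Measurable g
  bdd : ∀ b, |g b| ≤ M
  supp : ∀ b, b ∉ Icc (1:ℝ) 4 → g b = 0
  l2 : ∫⁻ b, ‖g b‖ₑ ^ 2 ≤ 1

lemma Gk_meas {k g : ℝ → ℝ} (hk : Continuous k) (hg : Measurable g) : Measurable (Gk k g) := by
  have : StronglyMeasurable (fun q : ℝ × ℝ => k (q.2 - q.1) * g q.2) := by
    apply Measurable.stronglyMeasurable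
    exact Measurable.mul (hk.measurable.comp (by fun_prop)) (by fun_prop)
  exact this.integral_prod_right.measurable

lemma young {k g : ℝ → ℝ} (hk : Continuous k) (hg : Measurable g) {I : ℝ≥0∞} (hI : ∫⁻ s, ‖k s‖ₑ ≤ I) :
    ∫⁻ v, ‖Gk k g v‖ₑ ^ 2 ≤ 2 * I ^ 2 * ∫⁻ b, ‖g b‖ₑ ^ 2 := by
  have hk' := hk.measurable
  have e0 : ∀ v, ∫⁻ b, ‖k (b - v)‖ₑ = ∫⁻ s, ‖k s‖ₑ := fun v => lintegral_sub_right_eq_self (fun s => ‖k s‖ₑ) v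
  have e0' : ∀ b, ∫⁻ v, ‖k (b - v)‖ₑ = ∫⁻ s, ‖k s‖ₑ := fun b => lintegral_sub_left_eq_self (fun s => ‖k s‖ₑ) b
  have h1 : ∀ v, ‖Gk k g v‖ₑ ^ 2 ≤ 2 * I * ∫⁻ b, ‖k (b - v)‖ₑ * ‖g b‖ₑ ^ 2 := by
    intro v
    calc ‖Gk k g v‖ₑ ^ 2 ≤ (∫⁻ b, ‖k (b - v)‖ₑ * ‖g b‖ₑ) ^ 2 := by
          gcongr
          refine (enorm_integral_le_lintegral_enorm _).trans (le_of_eq ?_)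
          simp_rw [enorm_mul]
      _ = ∫⁻ b, ∫⁻ c, ‖g b‖ₑ * ‖g c‖ₑ * (‖k (b - v)‖ₑ * ‖k (c - v)‖ₑ) := by
          rw [sq, ← lintegral_mul_const _ (by fun_prop)]
          congr 1; ext b
          rw [← lintegral_const_mul _ (by fun_prop)]
          congr 1; ext c; ring
      _ ≤ ∫⁻ b, ∫⁻ c, ((‖k (b - v)‖ₑ * ‖g b‖ₑ ^ 2) * ‖k (c - v)‖ₑ + ‖k (b - v)‖ₑ * (‖k (c - v)‖ₑ * ‖g c‖ₑ ^ 2)) := by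
          gcongr with b c
          calc _ ≤ (‖g b‖ₑ ^ 2 + ‖g c‖ₑ ^ 2) * (‖k (b - v)‖ₑ * ‖k (c - v)‖ₑ) := by gcongr; exact enn_amgm _ _
            _ = _ := by ring
      _ = 2 * (∫⁻ s, ‖k s‖ₑ) * ∫⁻ b, ‖k (b - v)‖ₑ * ‖g b‖ₑ ^ 2 := by
          have : ∀ b, ∫⁻ c, ((‖k (b - v)‖ₑ * ‖g b‖ₑ ^ 2) * ‖k (c - v)‖ₑ + ‖k (b - v)‖ₑ * (‖k (c - v)‖ₑ * ‖g c‖ₑ ^ 2))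
            = (‖k (b - v)‖ₑ * ‖g b‖ₑ ^ 2) * (∫⁻ s, ‖k s‖ₑ) + ‖k (b - v)‖ₑ * ∫⁻ c, ‖k (c - v)‖ₑ * ‖g c‖ₑ ^ 2 := by
            intro b
            rw [lintegral_add_left (by fun_prop), lintegral_const_mul _ (by fun_prop), lintegral_const_mul _ (by fun_prop), e0]
          simp_rw [this]
          rw [lintegral_add_left (by fun_prop), lintegral_mul_const _ (by fun_prop), lintegral_mul_const _ (by fun_prop), e0]
          ring
      _ ≤ _ := by gcongr
  refine (lintegral_mono h1).trans ?_
  rw [lintegral_const_mul _ (Measurable.lintegral_prod_right' (f := fun p : ℝ × ℝ => ‖k (p.2 - p.1)‖ₑ * ‖g p.2‖ₑ ^ 2) (by fun_prop)),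
    lintegral_lintegral_swap (f := fun v b => ‖k (b - v)‖ₑ * ‖g b‖ₑ ^ 2) (by fun_prop)]
  have : ∀ b, ∫⁻ v, ‖k (b - v)‖ₑ * ‖g b‖ₑ ^ 2 = (∫⁻ s, ‖k s‖ₑ) * ‖g b‖ₑ ^ 2 := fun b => by
    rw [lintegral_mul_const _ (by fun_prop), e0']
  simp_rw [this]
  rw [lintegral_const_mul _ (by fun_prop)]
  calc _ ≤ 2 * I * (I * ∫⁻ b, ‖g b‖ₑ ^ 2) := by gcongr
    _ = _ := by ring

lemma dil_l1 {κ : ℝ → ℝ} {L : ℝ} (hL : 0 < L) : ∫⁻ s, ‖dil L κ s‖ₑ = ∫⁻ s, ‖κ s‖ₑ := by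
  have := lint_comp_mul hL (fun s => ‖κ s‖ₑ)
  simp only [dil, enorm_mul]
  rw [lintegral_const_mul' _ _ (by simp), this, ← mul_assoc]
  rw [← ofReal_norm, Real.norm_of_nonneg hL.le, ← ENNReal.ofReal_mul hL.le, mul_inv_cancel₀ hL.ne']; simp
end Pent
end

section
open MeasureTheory Metric Set
open scoped ENNReal NNReal FourierTransform ContDiff
namespace Pent
variable {n : ℕ}

/-- rotation so that the difference vector is along `e_0` -/
lemma exists_rot (w : Euc (n+1)) : ∃ U : Euc (n+1) ≃ₗᵢ[ℝ] Euc (n+1),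
    U (‖w‖ • EuclideanSpace.single 0 1) = w := by
  set v : Euc (n+1) := ‖w‖ • EuclideanSpace.single 0 1
  have hv : ‖v‖ = ‖w‖ := by simp [v, norm_smul]
  exact ⟨_, Submodule.reflection_sub hv⟩

lemma rot_int (G G' : ℝ → ℝ) (x x' : Euc (n+1)) :
    ∫ y, G (‖x - y‖ ^ 2) * G' (‖x' - y‖ ^ 2) =
      ∫ h : Euc (n+1), G (‖h‖ ^ 2) * G' (‖h‖ ^ 2 + 2 * ‖x - x'‖ * h 0 + ‖x - x'‖ ^ 2) := by
  obtain ⟨U, hU⟩ := exists_rot (x - x')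
  set z := ‖x - x'‖
  have h1 : ∫ y, G (‖x - y‖ ^ 2) * G' (‖x' - y‖ ^ 2) = ∫ y, G (‖y‖ ^ 2) * G' (‖(x - x') + y‖ ^ 2) := by
    rw [← integral_add_left_eq_self _ x]
    congr 1; ext y
    have e1 : x - (x + y) = - y := by abel
    have e2 : x' - (x + y) = - ((x - x') + y) := by abel
    rw [e1, e2, norm_neg, norm_neg]
  rw [h1, ← U.measurePreserving.integral_comp U.toHomeomorph.measurableEmbedding]
  congr 1; ext h
  rw [← hU, ← map_add, U.norm_map, U.norm_map]
  congr 2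
  rw [norm_add_sq_real, inner_smul_left, EuclideanSpace.inner_single_left]
  simp [norm_smul]
  have : z ^ 2 = z ^ 2 := rfl
  ring

lemma polar_int (hn : 1 ≤ n) (Φ : ℝ × ℝ → ℝ) (hΦ : Measurable Φ) :
    ∫ h : Euc (n+1), Φ (h 0, ‖h‖ ^ 2) =
      ∫ p : ℝ × ℝ, ((sfm n univ).toReal / 2 * Fv (((n:ℝ)-2)/2) p.2 p.1) * Φ p := by
  have hc : 0 ≤ (sfm n univ).toReal / 2 := by positivity
  have hF : Measurable (fun p : ℝ × ℝ => Fv (((n:ℝ)-2)/2) p.2 p.1) := (Fv_meas _).comp measurable_swap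
  have hm : Measurable (fun h : Euc (n+1) => (h 0, ‖h‖ ^ 2)) := by fun_prop
  rw [← integral_map (μ := volume) (f := Φ) hm.aemeasurable hΦ.aestronglyMeasurable, polar_measure hn,
    integral_withDensity_eq_integral_toReal_smul (by fun_prop) (by simp)]
  congr 1; ext p
  rw [ENNReal.toReal_ofReal (mul_nonneg hc (Fv_nonneg _ _ _)), smul_eq_mul]

lemma Fv_int {a : ℝ} (ha : 0 ≤ a) (v : ℝ) : Integrable (fun u => Fv a v u) := by
  refine integrable_bdd (M := |v| ^ a) (s := Icc (-(|v|+1)) (|v|+1)) ?_ ?_ (by simp) ?_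
  · exact ((Fv_meas a).comp (by fun_prop : Measurable fun u : ℝ => (v, u))).aestronglyMeasurable
  · intro u
    rw [Real.norm_of_nonneg (Fv_nonneg _ _ _)]
    exact Fv_le ha (abs_nonneg _) (by nlinarith [le_abs_self v, sq_nonneg u])
  · intro u hu
    rw [Fv, if_neg]
    intro h
    apply hu
    have h2 := le_abs_self v
    have h3 : u ^ 2 ≤ (|v| + 1) ^ 2 := by nlinarith [abs_nonneg v]
    rw [mem_Icc, ← abs_le]
    exact abs_le_of_sq_le_sq h3 (by positivity)

lemma far_core (hn : 2 ≤ n) {z : ℝ} {k g G : ℝ → ℝ} {M Kb : ℝ} (hk : Continuous k) (hKb : ∀ s, |k s| ≤ Kb) (hg : Sg g M)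
    (hG : Measurable G) (hGs : ∀ v, G v ≠ 0 → 3/4 ≤ v ∧ v ≤ 5) {Q : ℝ × ℝ → ℝ≥0∞} (hQ : Measurable Q) {D S : ℝ≥0∞}
    (hD : D ≠ ⊤)
    (hK : ∀ v b, 3/4 ≤ v → v ≤ 5 → ‖∫ u, Fv (((n:ℝ)-2)/2) v u * k (b - (v + 2 * z * u + z ^ 2))‖ₑ ≤ D * Q (v, b))
    (h1 : ∀ v, 3/4 ≤ v → ∫⁻ b, Q (v, b) ≤ S) (h2 : ∀ b, 1 ≤ b → ∫⁻ v, Q (v, b) ≤ S) :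
    ‖∫ h : Euc (n+1), G (‖h‖ ^ 2) * Gk k g (‖h‖ ^ 2 + 2 * z * h 0 + z ^ 2)‖ₑ ≤
      ENNReal.ofReal ((sfm n univ).toReal / 2) * D * (S * ((∫⁻ v, ‖G v‖ₑ ^ 2) + ∫⁻ b, ‖g b‖ₑ ^ 2)) := by
  set a : ℝ := ((n:ℝ)-2)/2 with hadef
  have ha : 0 ≤ a := by
    have : (2:ℝ) ≤ n := by exact_mod_cast hn
    rw [hadef]; linarith
  set c := (sfm n univ).toReal / 2 with hc
  have hc0 : 0 ≤ c := by positivity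
  have hG' := Gk_meas hk hg.meas
  have hgint : Integrable g := integrable_bdd (s := Icc 1 4) hg.meas.aestronglyMeasurable hg.bdd (by simp) hg.supp
  have hP := polar_int (by lia : 1 ≤ n) (fun p => G p.2 * Gk k g (p.2 + 2 * z * p.1 + z ^ 2)) (by fun_prop)
  simp only at hP
  rw [hP]
  by_cases hIntg : Integrable (fun p : ℝ × ℝ => (c * Fv a p.2 p.1) * (G p.2 * Gk k g (p.2 + 2 * z * p.1 + z ^ 2)))
  swap
  · rw [integral_undef hIntg]; simp
  rw [Measure.volume_eq_prod, integral_prod_symm _ (by rwa [← Measure.volume_eq_prod])]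
  have inner : ∀ v, ∫ u, (c * Fv a v u) * (G v * Gk k g (v + 2 * z * u + z ^ 2)) =
      c * G v * ∫ b, g b * ∫ u, Fv a v u * k (b - (v + 2 * z * u + z ^ 2)) := by
    intro v
    have e1 : ∀ u, (c * Fv a v u) * (G v * Gk k g (v + 2 * z * u + z ^ 2)) =
        c * G v * ∫ b, Fv a v u * (k (b - (v + 2 * z * u + z ^ 2)) * g b) := by
      intro u
      rw [integral_const_mul, Gk]; ring
    simp_rw [e1]
    rw [integral_const_mul, integral_integral_swap]
    · congr 2; ext b
      rw [← integral_const_mul]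
      congr 1; ext u; ring
    · have h3 := (Fv_int ha v).mul_prod hgint
      have h4 := h3.bdd_mul (c := Kb) (f := fun q : ℝ × ℝ => k (q.2 - (v + 2 * z * q.1 + z ^ 2)))
        (hk.comp (by fun_prop)).aestronglyMeasurable (Filter.Eventually.of_forall fun q => hKb _)
      refine h4.congr (Filter.Eventually.of_forall fun q => ?_)
      simp only [Function.uncurry]; ring
  rw [integral_congr_ae (Filter.Eventually.of_forall inner)]
  have hb : ∀ v, ‖c * G v * ∫ b, g b * ∫ u, Fv a v u * k (b - (v + 2 * z * u + z ^ 2))‖ₑ ≤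
      ENNReal.ofReal c * D * ∫⁻ b, ‖G v‖ₑ * ‖g b‖ₑ * Q (v, b) := by
    intro v
    by_cases hv : G v = 0
    · simp [hv]
    obtain ⟨v1, v2⟩ := hGs v hv
    rw [enorm_mul, enorm_mul, ← ofReal_norm c, Real.norm_of_nonneg hc0]
    calc _ ≤ ENNReal.ofReal c * ‖G v‖ₑ * ∫⁻ b, ‖g b‖ₑ * (D * Q (v, b)) := by
          gcongr
          refine (enorm_integral_le_lintegral_enorm _).trans ?_
          gcongr with b
          rw [enorm_mul]; gcongr
          exact hK v b v1 v2
      _ = ENNReal.ofReal c * D * ∫⁻ b, ‖G v‖ₑ * ‖g b‖ₑ * Q (v, b) := by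
          rw [mul_assoc, mul_assoc, ← lintegral_const_mul' _ _ (by simp), ← lintegral_const_mul' _ _ hD]
          congr 2; ext b; ring
  refine (enorm_integral_le_lintegral_enorm _).trans ((lintegral_mono hb).trans ?_)
  rw [lintegral_const_mul' _ _ (ENNReal.mul_ne_top (by simp) hD)]
  gcongr
  refine schur (f := fun v => ‖G v‖ₑ) (g := fun b => ‖g b‖ₑ) (by fun_prop) (by have := hg.meas; fun_prop) hQ ?_ ?_
  · intro v hv
    exact h1 v (hGs v (by simpa using hv)).1
  · intro b hb
    refine h2 b ?_
    by_contra h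
    exact hb (by rw [hg.supp b (fun h' => h h'.1)]; simp)

/-- FAR estimate -/
lemma far (hn : 2 ≤ n) {κ : ℝ → ℝ} (hκ : IsKer (n+1) κ) :
    ∃ C L0 : ℝ, 0 ≤ C ∧ 0 < L0 ∧ ∀ L ≥ L0, ∀ g g' M, Sg g M → Sg g' M → ∀ x x' : Euc (n+1), x ≠ x' →
      |∫ y, Gk (dil L κ) g (‖x - y‖ ^ 2) * Gk (dil L κ) g' (‖x' - y‖ ^ 2)| ≤ C * (L * ‖x - x'‖) ^ (-((n:ℝ)/2)) := by
  set a : ℝ := ((n:ℝ)-2)/2 with hadef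
  have hn' : (2:ℝ) ≤ n := by exact_mod_cast hn
  have ha : 0 ≤ a := by rw [hadef]; linarith
  obtain ⟨C, A, hC0, hA0, kb1, kb2, kb3⟩ := kb (N := n+1) ha (by rw [hadef]; push_cast; linarith) hκ
  obtain ⟨K, hK0, hK⟩ := test_bdd hκ.smooth.1.continuous hκ.smooth.2
  obtain ⟨A1, hA10, hA1⟩ := test_supp hκ.smooth.2
  have hI : ∫⁻ s, ‖κ s‖ₑ ≠ ⊤ := (hκ.smooth.1.continuous.integrable_of_hasCompactSupport hκ.smooth.2).2.ne
  set I := ∫⁻ s, ‖κ s‖ₑ with hIdef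
  set c := (sfm n univ).toReal / 2 with hc
  have hc0 : 0 ≤ c := by positivity
  set T : ℝ := (2 * I ^ 2 + 1).toReal with hT
  have hTI : 2 * I ^ 2 + 1 = ENNReal.ofReal T := by
    rw [hT, ENNReal.ofReal_toReal]
    exact ENNReal.add_ne_top.2 ⟨ENNReal.mul_ne_top (by simp) (ENNReal.pow_ne_top hI), by simp⟩
  have hT0 : 0 ≤ T := ENNReal.toReal_nonneg
  set P : ℝ := 4 * Real.pi + 2 * A with hP
  have hP0 : 0 ≤ P := by positivity
  refine ⟨c * C * P * T * 2 ^ (-((n:ℝ)/2)), max 1 (4 * A1), by positivity, by positivity, ?_⟩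
  intro L hL g g' M hg hg' x x' hx
  have hL1 : 1 ≤ L := (le_max_left _ _).trans hL
  have hL2 : 4 * A1 ≤ L := (le_max_right _ _).trans hL
  have hL0 : 0 < L := by linarith
  have hz : 0 < ‖x - x'‖ := norm_pos_iff.2 (sub_ne_zero.2 hx)
  rw [rot_int]
  set z := ‖x - x'‖
  obtain ⟨dc, db, ds⟩ := dil_props hL0 hκ.smooth.1.continuous hK hA1
  set ε : ℝ := 1 / (2 * L * z) with hε
  have hε0 : 0 < ε := by positivity
  have hεz : 2 * z * ε = 1 / L := by rw [hε]; field_simp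
  have hGs : ∀ v, Gk (dil L κ) g v ≠ 0 → 3/4 ≤ v ∧ v ≤ 5 := by
    intro v hv
    have : ∃ b, dil L κ (b - v) * g b ≠ 0 := by
      by_contra h
      push Not at h
      exact hv (by rw [Gk]; simp [h])
    obtain ⟨b, hb⟩ := this
    have hb1 : b ∈ Icc (1:ℝ) 4 := by
      by_contra h
      exact hb (by rw [hg.supp b h, mul_zero])
    have hb2 : |b - v| ≤ A1 / L := by
      by_contra h
      exact hb (by rw [ds _ (not_le.1 h), zero_mul])
    have hb3 : A1 / L ≤ 1/4 := by rw [div_le_iff₀ hL0]; linarith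
    have := abs_le.1 hb2
    constructor <;> linarith [hb1.1, hb1.2]
  -- the inner kernel
  have hker : ∀ v b, ∫ u, Fv a v u * dil L κ (b - (v + 2 * z * u + z ^ 2)) =
      L * ε * ∫ s, Fv a v ((b - (v + z ^ 2)) / (2 * z) - ε * s) * κ s := by
    intro v b
    rw [int_aff hε0 ((b - (v + z ^ 2)) / (2 * z)), mul_comm L ε, mul_assoc, ← integral_const_mul L]
    congr 1
    refine integral_congr_ae (Filter.Eventually.of_forall fun s => ?_)
    have : L * (b - (v + 2 * z * ((b - (v + z ^ 2)) / (2 * z) - ε * s) + z ^ 2)) = s := by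
      rw [hε]; field_simp; ring
    simp only [dil]
    rw [this]; ring
  have main : ∀ (Q : ℝ × ℝ → ℝ≥0∞) (E S : ℝ), Measurable Q → 0 ≤ E → 0 ≤ S →
      (∀ v b, 3/4 ≤ v → v ≤ 5 → ENNReal.ofReal |∫ s, Fv a v ((b - (v + z ^ 2)) / (2 * z) - ε * s) * κ s| ≤ ENNReal.ofReal E * Q (v, b)) →
      (∀ v, 3/4 ≤ v → ∫⁻ b, Q (v, b) ≤ ENNReal.ofReal S) → (∀ b, 1 ≤ b → ∫⁻ v, Q (v, b) ≤ ENNReal.ofReal S) →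
      |∫ h : Euc (n+1), Gk (dil L κ) g (‖h‖ ^ 2) * Gk (dil L κ) g' (‖h‖ ^ 2 + 2 * z * h 0 + z ^ 2)| ≤
        c * (L * ε * E) * (S * T) := by
    intro Q E S hQ hE hS q1 q2 q3
    have := far_core (G := Gk (dil L κ) g) hn (z := z) dc db hg' (Gk_meas dc hg.meas) hGs hQ (D := ENNReal.ofReal (L * ε * E)) (S := ENNReal.ofReal S)
      (by simp) (by
        intro v b v1 v2
        rw [hker, enorm_mul, ← ofReal_norm, Real.norm_of_nonneg (by positivity), ENNReal.ofReal_mul (by positivity : 0 ≤ L * ε), mul_assoc,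
          ← ofReal_norm, Real.norm_eq_abs]
        exact mul_le_mul_right (q1 v b v1 v2) _) q2 q3
    have hy := young (g := g) dc hg.meas (dil_l1 (κ := κ) hL0).le
    have h4 : (∫⁻ v, ‖Gk (dil L κ) g v‖ₑ ^ 2) + ∫⁻ b, ‖g' b‖ₑ ^ 2 ≤ ENNReal.ofReal T := by
      rw [← hTI]
      gcongr
      · refine hy.trans ?_
        calc 2 * I ^ 2 * ∫⁻ b, ‖g b‖ₑ ^ 2 ≤ 2 * I ^ 2 * 1 := by gcongr; exact hg.l2
          _ = _ := by simp
      · exact hg'.l2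
    have h5 := this.trans (mul_le_mul_right (mul_le_mul_right h4 _) _)
    rw [← ofReal_norm, ← ENNReal.ofReal_mul hc0, ← ENNReal.ofReal_mul hS, ← ENNReal.ofReal_mul (by positivity)] at h5
    exact (ENNReal.ofReal_le_ofReal_iff (by positivity)).1 h5
  have fin : c * (L * ε * (C * ε ^ a)) * (P / L * T) = c * C * P * T * 2 ^ (-((n:ℝ)/2)) * (L * z) ^ (-((n:ℝ)/2)) := by
    have e1 : ε ^ a * ε = 2 ^ (-((n:ℝ)/2)) * (L * z) ^ (-((n:ℝ)/2)) := by
      rw [← Real.mul_rpow (by positivity) (by positivity), Real.rpow_neg (by positivity), ← Real.inv_rpow (by positivity)]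
      have : (2 * (L * z))⁻¹ = ε := by rw [hε, one_div, mul_assoc]
      rw [this]
      nth_rw 2 [← Real.rpow_one ε]
      rw [← Real.rpow_add hε0]
      congr 1; rw [hadef]; ring
    calc _ = c * C * P * T * (ε ^ a * ε) * (L / L) := by ring
      _ = _ := by rw [e1, div_self hL0.ne']; ring
  rw [← fin]
  rcases le_or_gt ε 1 with h1 | h1
  · refine (main (fun p => ENNReal.ofReal (1 + ((p.1 - ((p.2 - (p.1 + z ^ 2)) / (2 * z)) ^ 2) / ε) ^ 2)⁻¹) (C * ε ^ a) (4 * Real.pi / L)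
      (by fun_prop) (by positivity) (by positivity) ?_ ?_ ?_).trans ?_
    · intro v b v1 v2
      rw [← ENNReal.ofReal_mul (by positivity)]
      exact ENNReal.ofReal_le_ofReal (kb1 ε v _ hε0 h1 v2)
    · intro v hv
      simp only
      rw [lint_aff (by positivity) (v + z ^ 2) (fun w => ENNReal.ofReal (1 + ((v - w ^ 2) / ε) ^ 2)⁻¹)]
      refine (mul_le_mul_right (lor hε0 hv) _).trans ?_
      rw [← ENNReal.ofReal_mul (by positivity)]
      apply ENNReal.ofReal_le_ofReal
      apply le_of_eq
      calc _ = 4 * Real.pi * (2 * z * ε) := by ring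
        _ = _ := by rw [hεz]; ring
    · intro b hb
      simp only
      have e : ∀ v, v - ((b - (v + z ^ 2)) / (2 * z)) ^ 2 = b - (((b + z ^ 2) - v) / (2 * z)) ^ 2 := by
        intro v; field_simp; ring
      simp_rw [e]
      rw [lint_aff' (by positivity) (b + z ^ 2) (fun w => ENNReal.ofReal (1 + ((b - w ^ 2) / ε) ^ 2)⁻¹)]
      refine (mul_le_mul_right (lor hε0 (by linarith)) _).trans ?_
      rw [← ENNReal.ofReal_mul (by positivity)]
      apply ENNReal.ofReal_le_ofReal
      apply le_of_eq
      calc _ = 4 * Real.pi * (2 * z * ε) := by ring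
        _ = _ := by rw [hεz]; ring
    · gcongr
      rw [hP]; linarith
  · have hvol : ∫⁻ w : ℝ, (Icc (-(A * ε)) (A * ε)).indicator (fun _ => (1:ℝ≥0∞)) w = ENNReal.ofReal (2 * A * ε) := by
      rw [lintegral_indicator measurableSet_Icc]; simp; congr 1; ring
    have hval : ENNReal.ofReal (2 * z) * ENNReal.ofReal (2 * A * ε) = ENNReal.ofReal (2 * A / L) := by
      rw [← ENNReal.ofReal_mul (by positivity)]
      congr 1
      calc _ = 2 * A * (2 * z * ε) := by ring
        _ = _ := by rw [hεz]; ring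
    refine (main (fun p => (Icc (-(A * ε)) (A * ε)).indicator (fun _ => (1:ℝ≥0∞)) ((p.2 - (p.1 + z ^ 2)) / (2 * z))) C (2 * A / L)
      ?_ (by positivity) (by positivity) ?_ ?_ ?_).trans ?_
    · exact (measurable_const.indicator measurableSet_Icc).comp (by fun_prop)
    · intro v b v1 v2
      by_cases hw : (b - (v + z ^ 2)) / (2 * z) ∈ Icc (-(A * ε)) (A * ε)
      · simp only [indicator_of_mem hw, mul_one]
        exact ENNReal.ofReal_le_ofReal (kb2 ε v _ h1 v2)
      · rw [kb3 ε v _ h1 v2]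
        · simp
        · rw [mem_Icc, ← abs_le] at hw
          exact not_le.1 hw
    · intro v hv
      simp only
      rw [lint_aff (by positivity) (v + z ^ 2), hvol, hval]
    · intro b hb
      simp only
      have e : ∀ v, (b - (v + z ^ 2)) / (2 * z) = ((b - z ^ 2) - v) / (2 * z) := by
        intro v; ring
      simp_rw [e]
      rw [lint_aff' (by positivity) (b - z ^ 2), hvol, hval]
    · have : 1 ≤ ε ^ a := Real.one_le_rpow h1.le ha
      have : C ≤ C * ε ^ a := le_mul_of_one_le_right hC0 this
      gcongr
      rw [hP]; linarith [Real.pi_pos]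
end Pent
end

section
open MeasureTheory Metric Set
open scoped ENNReal NNReal FourierTransform ContDiff
namespace Pent
variable {n : ℕ}

/-- the small ball -/
def SB (d : ℕ) : Set (Euc d) := closedBall 0 (1 / (4 * d))

structure Kn (k : ℝ → ℝ) (Kb : ℝ) : Prop where
  cont : Continuous k
  bdd : ∀ s, |k s| ≤ Kb
  supp : ∀ s, 1/4 < |s| → k s = 0

structure Wt {d : ℕ} (w : Euc d × ℝ → ℝ) (S : Set (Euc d)) (M : ℝ) : Prop where
  meas : Measurable w
  bdd : ∀ p, |w p| ≤ M
  supp : ∀ p, w p ≠ 0 → p.1 ∈ S ∧ p.2 ∈ Icc (1:ℝ) 4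
  l2 : ∀ x, ∫⁻ b, ‖w (x, b)‖ₑ ^ 2 ≤ 1
  mS : MeasurableSet S
  sub : S ⊆ SB d

variable {d : ℕ} {k : ℝ → ℝ} {Kb M : ℝ} {w w' : Euc d × ℝ → ℝ} {S S' : Set (Euc d)}

def Uw (k : ℝ → ℝ) (w : Euc d × ℝ → ℝ) (y : Euc d) : ℝ := ∫ p : Euc d × ℝ, k (p.2 - ‖p.1 - y‖ ^ 2) * w p

lemma SB_fin (d : ℕ) : volume (SB d) ≠ ⊤ := (measure_closedBall_lt_top).ne

lemma Wt.fin (h : Wt w S M) : volume S ≠ ⊤ := ne_top_of_le_ne_top (SB_fin d) (measure_mono h.sub)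

lemma Wt.finp (h : Wt w S M) : volume (S ×ˢ Icc (1:ℝ) 4) ≠ ⊤ := by
  rw [Measure.volume_eq_prod, Measure.prod_prod]
  exact ENNReal.mul_ne_top h.fin (by simp)

lemma Wt.int (h : Wt w S M) : Integrable w :=
  integrable_bdd (s := S ×ˢ Icc (1:ℝ) 4) h.meas.aestronglyMeasurable h.bdd h.finp (fun p hp => by
    by_contra h0; exact hp (h.supp p h0))

lemma Wt.sg (h : Wt w S M) (x : Euc d) : Sg (fun b => w (x, b)) M where
  meas := h.meas.comp (by fun_prop)
  bdd := fun b => h.bdd _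
  supp := fun b hb => by by_contra h0; exact hb (h.supp _ h0).2
  l2 := h.l2 x

lemma Wt.res (h : Wt w S M) (hS' : MeasurableSet S') (hs : S' ⊆ S) : Wt ((S' ×ˢ univ).indicator w) S' M where
  meas := h.meas.indicator (hS'.prod MeasurableSet.univ)
  bdd := fun p => (by
    refine le_trans ?_ (h.bdd p)
    exact norm_indicator_le_norm_self w p)
  supp := fun p hp => by
    rw [indicator_apply_ne_zero] at hp
    exact ⟨hp.1.1, (h.supp p hp.2).2⟩
  l2 := fun x => by
    refine le_trans ?_ (h.l2 x)
    gcongr with b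
    exact enorm_indicator_le_enorm_self w (x, b)
  mS := hS'
  sub := hs.trans h.sub

lemma Wt.joint (h : Wt w S M) (hk : Kn k Kb) {f : Euc d → ℝ} (hf : Integrable f) :
    Integrable (fun q : Euc d × (Euc d × ℝ) => f q.1 * (k (q.2.2 - ‖q.2.1 - q.1‖ ^ 2) * w q.2)) := by
  have h3 := hf.mul_prod h.int
  have h4 := h3.bdd_mul (c := Kb) (f := fun q : Euc d × (Euc d × ℝ) => k (q.2.2 - ‖q.2.1 - q.1‖ ^ 2))
        (hk.cont.comp (by fun_prop)).aestronglyMeasurable (Filter.Eventually.of_forall fun q => hk.bdd _)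
  refine h4.congr (Filter.Eventually.of_forall fun q => ?_)
  simp only; ring

lemma Uw_pair (h : Wt w S M) (hk : Kn k Kb) {f : Euc d → ℝ} (hf : Integrable f) :
    ∫ y, f y * Uw k w y = ∫ p, w p * av k f p.1 p.2 := by
  simp only [Uw, ← integral_const_mul]
  rw [integral_integral_swap (h.joint hk hf)]
  congr 1; ext p
  rw [av, ← integral_const_mul]
  congr 1; ext y; ring

lemma Uw_meas (h : Wt w S M) (hk : Kn k Kb) : Measurable (Uw k w) := by
  have : StronglyMeasurable (fun q : Euc d × (Euc d × ℝ) => k (q.2.2 - ‖q.2.1 - q.1‖ ^ 2) * w q.2) := by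
    apply Measurable.stronglyMeasurable
    exact Measurable.mul (hk.cont.measurable.comp (by fun_prop)) (h.meas.comp measurable_snd)
  exact this.integral_prod_right.measurable

lemma Gx_meas (h : Wt w S M) (hk : Kn k Kb) :
    Measurable (fun q : Euc d × Euc d => Gk k (fun b => w (q.1, b)) (‖q.1 - q.2‖ ^ 2)) := by
  have : StronglyMeasurable (fun q : (Euc d × Euc d) × ℝ => k (q.2 - ‖q.1.1 - q.1.2‖ ^ 2) * w (q.1.1, q.2)) := by
    apply Measurable.stronglyMeasurable
    exact Measurable.mul (hk.cont.measurable.comp (by fun_prop)) (h.meas.comp (by fun_prop))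
  exact this.integral_prod_right.measurable

lemma Uw_eq (h : Wt w S M) (hk : Kn k Kb) (y : Euc d) :
    Uw k w y = ∫ x, Gk k (fun b => w (x, b)) (‖x - y‖ ^ 2) := by
  rw [Uw, Measure.volume_eq_prod, integral_prod]
  · rfl
  · exact h.int.bdd_mul (c := Kb) (hk.cont.comp (by fun_prop)).aestronglyMeasurable (Filter.Eventually.of_forall fun q => hk.bdd _)

/-- location of `y`  -/
lemma loc (hd : 1 ≤ d) {x y : Euc d} {b : ℝ} (hx : x ∈ SB d) (hb : b ∈ Icc (1:ℝ) 4) (h : |b - ‖x - y‖ ^ 2| ≤ 1/4) :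
    1/2 ≤ ‖y‖ ∧ ‖y‖ ≤ 3 := by
  have hx' : ‖x‖ ≤ 1/4 := by
    have : ‖x‖ ≤ 1 / (4 * d) := by simpa [SB] using hx
    refine this.trans ?_
    have : (1:ℝ) ≤ d := by exact_mod_cast hd
    gcongr; linarith
  have := abs_le.1 h
  have h1 := hb.1
  have h2 := hb.2
  have h3 : ‖x - y‖ ≤ ‖x‖ + ‖y‖ := norm_sub_le x y
  have h4 : ‖y‖ - ‖x‖ ≤ ‖x - y‖ := by rw [norm_sub_rev]; exact norm_sub_norm_le y x
  have h5 := norm_nonneg (x - y)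
  constructor <;> by_contra hh <;> push Not at hh <;> nlinarith

lemma Gx_zero (hd : 1 ≤ d) (h : Wt w S M) (hk : Kn k Kb) {x y : Euc d} (hne : Gk k (fun b => w (x, b)) (‖x - y‖ ^ 2) ≠ 0) :
    x ∈ S ∧ 1/2 ≤ ‖y‖ ∧ ‖y‖ ≤ 3 := by
  have : ∃ b, k (b - ‖x - y‖ ^ 2) * w (x, b) ≠ 0 := by
    by_contra h'
    push Not at h'
    exact hne (by rw [Gk]; simp [h'])
  obtain ⟨b, hb⟩ := this
  have hb1 := h.supp _ (right_ne_zero_of_mul hb)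
  have hb2 : |b - ‖x - y‖ ^ 2| ≤ 1/4 := by
    by_contra h'
    exact left_ne_zero_of_mul hb (hk.supp _ (not_le.1 h'))
  exact ⟨hb1.1, loc hd (h.sub hb1.1) hb1.2 hb2⟩

lemma Gx_bdd (h : Wt w S M) (hk : Kn k Kb) (x : Euc d) (v : ℝ) : |Gk k (fun b => w (x, b)) v| ≤ Kb * M * 3 := by
  have hK0 : 0 ≤ Kb := (abs_nonneg _).trans (hk.bdd 0)
  have hM0 : 0 ≤ M := (abs_nonneg _).trans (h.bdd (0, 0))
  have : Gk k (fun b => w (x, b)) v = ∫ b in Icc (1:ℝ) 4, k (b - v) * w (x, b) := by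
    rw [Gk, setIntegral_eq_integral_of_forall_compl_eq_zero]
    intro b hb
    rw [(h.sg x).supp b hb, mul_zero]
  rw [this]
  have := norm_setIntegral_le_of_norm_le_const (μ := volume) (s := Icc (1:ℝ) 4) (f := fun b => k (b - v) * w (x, b)) (C := Kb * M) (by simp)
    (fun b _ => by rw [norm_mul]; exact mul_le_mul (hk.bdd _) (h.bdd _) (norm_nonneg _) hK0)
  simp only [Real.norm_eq_abs] at this
  refine this.trans (le_of_eq ?_)
  simp [Measure.real]; left; norm_num

lemma Uw_zero (hd : 1 ≤ d) (h : Wt w S M) (hk : Kn k Kb) (y : Euc d) (hy : ‖y‖ < 1/2 ∨ 3 < ‖y‖) : Uw k w y = 0 := by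
  rw [Uw_eq h hk]
  refine integral_eq_zero_of_ae (Filter.Eventually.of_forall fun x => ?_)
  by_contra hne
  have := Gx_zero hd h hk hne
  rcases hy with hy | hy <;> linarith [this.2.1, this.2.2]

lemma Uw_Bf (hd : 1 ≤ d) (h : Wt w S M) (hk : Kn k Kb) : Bf (Uw k w) (Kb * ∫ p, |w p|) 3 where
  meas := Uw_meas h hk
  bdd := fun y => by
    rw [Uw, ← integral_const_mul, ← Real.norm_eq_abs]
    refine norm_integral_le_of_norm_le (h.int.abs.const_mul _) (Filter.Eventually.of_forall fun p => ?_)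
    rw [norm_mul]
    exact mul_le_mul_of_nonneg_right (hk.bdd _) (norm_nonneg _)
  supp := fun y hy => Uw_zero hd h hk y (Or.inr hy)

lemma far_abs {Φ Φ' : Euc d × Euc d → ℝ} {Mb : ℝ} (m1 : Measurable Φ) (m2 : Measurable Φ') (b1 : ∀ q, |Φ q| ≤ Mb) (b2 : ∀ q, |Φ' q| ≤ Mb)
    (fS : volume S ≠ ⊤) (fS' : volume S' ≠ ⊤)
    (s1 : ∀ q, Φ q ≠ 0 → q.1 ∈ S ∧ ‖q.2‖ ≤ 3) (s2 : ∀ q, Φ' q ≠ 0 → q.1 ∈ S' ∧ ‖q.2‖ ≤ 3) {F : ℝ}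
    (hF : ∀ x ∈ S, ∀ x' ∈ S', |∫ y, Φ (x, y) * Φ' (x', y)| ≤ F) :
    ∫ y, (∫ x, Φ (x, y)) * (∫ x, Φ' (x, y)) ≤ F * (volume.real S * volume.real S') := by
  have hM0 : 0 ≤ Mb := (abs_nonneg _).trans (b1 (0, 0))
  have e1 : ∀ y, (∫ x, Φ (x, y)) * (∫ x, Φ' (x, y)) = ∫ q : Euc d × Euc d, Φ (q.1, y) * Φ' (q.2, y) := by
    intro y
    rw [Measure.volume_eq_prod]
    exact (integral_prod_mul (fun x => Φ (x, y)) (fun x => Φ' (x, y))).symm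
  simp_rw [e1]
  have hm : Measurable (fun q : Euc d × (Euc d × Euc d) => Φ (q.2.1, q.1) * Φ' (q.2.2, q.1)) := by fun_prop
  rw [integral_integral_swap]
  swap
  · refine integrable_bdd (M := Mb * Mb) (s := closedBall 0 3 ×ˢ (S ×ˢ S')) hm.aestronglyMeasurable ?_ ?_ ?_
    · intro q
      simp only [Function.uncurry, norm_mul]
      exact mul_le_mul (b1 _) (b2 _) (norm_nonneg _) hM0
    · rw [Measure.prod_prod, Measure.volume_eq_prod, Measure.prod_prod]
      exact ENNReal.mul_ne_top measure_closedBall_lt_top.ne (ENNReal.mul_ne_top fS fS')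
    · intro q hq
      by_contra hne
      simp only [Function.uncurry] at hne
      have a1 := s1 _ (left_ne_zero_of_mul hne)
      have a2 := s2 _ (right_ne_zero_of_mul hne)
      exact hq ⟨by simpa using a1.2, a1.1, a2.1⟩
  · have e2 : ∫ q : Euc d × Euc d, ∫ y, Φ (q.1, y) * Φ' (q.2, y) = ∫ q in S ×ˢ S', ∫ y, Φ (q.1, y) * Φ' (q.2, y) := by
      rw [setIntegral_eq_integral_of_forall_compl_eq_zero]
      intro q hq
      refine integral_eq_zero_of_ae (Filter.Eventually.of_forall fun y => ?_)
      by_contra hne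
      exact hq ⟨(s1 _ (left_ne_zero_of_mul hne)).1, (s2 _ (right_ne_zero_of_mul hne)).1⟩
    rw [e2]
    have hv : volume (S ×ˢ S') = volume S * volume S' := by rw [Measure.volume_eq_prod, Measure.prod_prod]
    have := norm_setIntegral_le_of_norm_le_const (μ := volume) (s := S ×ˢ S') (C := F)
      (f := fun q : Euc d × Euc d => ∫ y, Φ (q.1, y) * Φ' (q.2, y))
      (by rw [hv]; exact (ENNReal.mul_lt_top fS.lt_top fS'.lt_top)) (fun q hq => hF q.1 hq.1 q.2 hq.2)
    refine (le_abs_self _).trans (this.trans (le_of_eq ?_))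
    rw [Measure.real, hv, ENNReal.toReal_mul]; rfl

lemma Uw_far (hd : 1 ≤ d) (h : Wt w S M) (h' : Wt w' S' M) (hk : Kn k Kb) {F : ℝ}
    (hF : ∀ x ∈ S, ∀ x' ∈ S', |∫ y, Gk k (fun b => w (x, b)) (‖x - y‖ ^ 2) * Gk k (fun b => w' (x', b)) (‖x' - y‖ ^ 2)| ≤ F) :
    ∫ y, Uw k w y * Uw k w' y ≤ F * (volume.real S * volume.real S') := by
  simp_rw [Uw_eq h hk, Uw_eq h' hk]
  exact far_abs (Φ := fun q => Gk k (fun b => w (q.1, b)) (‖q.1 - q.2‖ ^ 2)) (Φ' := fun q => Gk k (fun b => w' (q.1, b)) (‖q.1 - q.2‖ ^ 2))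
    (Gx_meas h hk) (Gx_meas h' hk) (fun q => Gx_bdd h hk _ _) (fun q => Gx_bdd h' hk _ _) h.fin h'.fin
    (fun q hq => ⟨(Gx_zero hd h hk hq).1, (Gx_zero hd h hk hq).2.2⟩) (fun q hq => ⟨(Gx_zero hd h' hk hq).1, (Gx_zero hd h' hk hq).2.2⟩) hF
end Pent
end

section
open MeasureTheory Metric Set
open scoped ENNReal NNReal FourierTransform ContDiff
namespace Pent
variable {n : ℕ}

lemma l2conv {α : Type*} [MeasurableSpace α] {μ : Measure α} {g : α → ℝ} (hg : Integrable (fun x => g x ^ 2) μ) :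
    ∫⁻ x, ‖g x‖ₑ ^ 2 ∂μ = ENNReal.ofReal (∫ x, g x ^ 2 ∂μ) := by
  rw [ofReal_integral_eq_lintegral_ofReal hg (Filter.Eventually.of_forall fun x => sq_nonneg _)]
  congr 1; ext x
  rw [← ofReal_norm, ← ENNReal.ofReal_pow (norm_nonneg _), Real.norm_eq_abs, sq_abs]

lemma Bf.sq_int {d : ℕ} {f : Euc d → ℝ} {M ρ : ℝ} (hf : Bf f M ρ) : Integrable (fun y => f y ^ 2) := by
  refine integrable_bdd (M := M ^ 2) (s := closedBall 0 ρ) (hf.meas.pow_const 2).aestronglyMeasurable ?_ measure_closedBall_lt_top.ne ?_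
  · intro y
    rw [norm_pow]
    exact pow_le_pow_left₀ (norm_nonneg _) (hf.bdd y) 2
  · intro y hy
    rw [hf.supp y (by simpa using hy)]; simp

lemma av_bdd {d : ℕ} {k : ℝ → ℝ} {Kb : ℝ} (hk : ∀ s, |k s| ≤ Kb) {f : Euc d → ℝ} (hf : Integrable f) (x : Euc d) (b : ℝ) :
    |av k f x b| ≤ Kb * ∫ y, |f y| := by
  rw [av, ← integral_const_mul, ← Real.norm_eq_abs]
  refine norm_integral_le_of_norm_le (hf.abs.const_mul _) (Filter.Eventually.of_forall fun y => ?_)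
  rw [norm_mul]
  exact mul_le_mul_of_nonneg_right (hk _) (norm_nonneg _)

lemma lint_box {d : ℕ} {φ : Euc d × ℝ → ℝ≥0∞} (hφ : Measurable φ) (S : Set (Euc d)) (I : Set ℝ) :
    ∫⁻ p in S ×ˢ I, φ p = ∫⁻ x in S, ∫⁻ b in I, φ (x, b) := by
  rw [Measure.volume_eq_prod, ← Measure.prod_restrict, lintegral_prod _ hφ.aemeasurable]

variable {k : ℝ → ℝ} {Kb M : ℝ}

lemma Uw_near {w : Euc (n+1) × ℝ → ℝ} {S : Set (Euc (n+1))} (h : Wt w S M) (hk : Kn k Kb) {D : ℝ} (hD : 0 < D)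
    (hnear : ∫⁻ x in S, ∫⁻ b, ‖av k (Uw k w) x b‖ₑ ^ 2 ≤ ENNReal.ofReal D * ∫⁻ y, ‖Uw k w y‖ₑ ^ 2) :
    ∫ y, Uw k w y ^ 2 ≤ D * volume.real S := by
  have hU := Uw_Bf (by lia) h hk
  set U := Uw k w with hUd
  set T := S ×ˢ Icc (1:ℝ) 4
  have hT : MeasurableSet T := h.mS.prod measurableSet_Icc
  have hTf : volume T ≠ ⊤ := h.finp
  have : IsFiniteMeasure (volume.restrict T) := ⟨by rw [Measure.restrict_apply_univ]; exact hTf.lt_top⟩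
  have avm := av_meas hk.cont hU.meas
  set a : Euc (n+1) × ℝ → ℝ := fun p => av k U p.1 p.2 with ha
  have ab : ∀ p, |a p| ≤ Kb * ∫ y, |U y| := fun p => av_bdd hk.bdd hU.integrable _ _
  have i1 : IntegrableOn (fun p => w p ^ 2) T := by
    refine Integrable.of_bound (h.meas.pow_const 2).aestronglyMeasurable (M ^ 2) (Filter.Eventually.of_forall fun p => ?_)
    rw [norm_pow]; exact pow_le_pow_left₀ (norm_nonneg _) (h.bdd p) 2
  have i2 : IntegrableOn (fun p => a p ^ 2) T := by
    refine Integrable.of_bound (avm.pow_const 2).aestronglyMeasurable ((Kb * ∫ y, |U y|) ^ 2) (Filter.Eventually.of_forall fun p => ?_)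
    rw [norm_pow]; exact pow_le_pow_left₀ (norm_nonneg _) (ab p) 2
  have i3 : IntegrableOn (fun p => w p * a p) T := by
    refine Integrable.of_bound (h.meas.mul avm).aestronglyMeasurable (M * (Kb * ∫ y, |U y|)) (Filter.Eventually.of_forall fun p => ?_)
    rw [norm_mul]; exact mul_le_mul (h.bdd p) (ab p) (norm_nonneg _) ((abs_nonneg _).trans (h.bdd p))
  have e1 : ∫ y, U y ^ 2 = ∫ p in T, w p * a p := by
    rw [setIntegral_eq_integral_of_forall_compl_eq_zero]
    · rw [← Uw_pair h hk hU.integrable]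
      congr 1; ext y; rw [sq]
    · intro p hp
      have : w p = 0 := by by_contra h0; exact hp (h.supp p h0)
      rw [this, zero_mul]
  have b1 : ∫ p in T, w p ^ 2 ≤ volume.real S := by
    have := l2conv i1
    have h2 : ∫⁻ p in T, ‖w p‖ₑ ^ 2 ≤ volume S := by
      rw [lint_box (h.meas.enorm.pow_const 2)]
      calc _ ≤ ∫⁻ x in S, 1 := by
            gcongr with x
            exact (setLIntegral_le_lintegral _ _).trans (h.l2 x)
        _ = _ := by simp
    rw [this] at h2
    exact (ENNReal.ofReal_le_iff_le_toReal h.fin).1 h2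
  have b2 : ∫ p in T, a p ^ 2 ≤ D * ∫ y, U y ^ 2 := by
    have := l2conv i2
    have h2 : ∫⁻ p in T, ‖a p‖ₑ ^ 2 ≤ ENNReal.ofReal D * ∫⁻ y, ‖U y‖ₑ ^ 2 := by
      rw [lint_box (avm.enorm.pow_const 2)]
      refine le_trans ?_ hnear
      gcongr with x
      exact Measure.restrict_le_self
    rw [this, l2conv hU.sq_int, ← ENNReal.ofReal_mul hD.le] at h2
    exact (ENNReal.ofReal_le_ofReal_iff (mul_nonneg hD.le (integral_nonneg fun y => sq_nonneg _))).1 h2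
  have e3 : ∫ p in T, w p * a p ≤ ∫ p in T, (D / 2 * w p ^ 2 + (2 * D)⁻¹ * a p ^ 2) := by
    refine setIntegral_mono i3 ((i1.const_mul _).add (i2.const_mul _)) fun p => ?_
    have : D / 2 * w p ^ 2 + (2 * D)⁻¹ * a p ^ 2 - w p * a p = (2 * D)⁻¹ * (D * w p - a p) ^ 2 := by
      field_simp; ring
    have : 0 ≤ (2 * D)⁻¹ * (D * w p - a p) ^ 2 := by positivity
    simp only
    linarith
  rw [integral_add (i1.const_mul _) (i2.const_mul _), integral_const_mul, integral_const_mul] at e3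
  have b3 : (2 * D)⁻¹ * ∫ p in T, a p ^ 2 ≤ (2 * D)⁻¹ * (D * ∫ y, U y ^ 2) := by gcongr
  have b4 : D / 2 * ∫ p in T, w p ^ 2 ≤ D / 2 * volume.real S := by gcongr
  have b5 : (2 * D)⁻¹ * (D * ∫ y, U y ^ 2) = (∫ y, U y ^ 2) / 2 := by field_simp
  rw [e1] at *
  linarith

def cub {d : ℕ} (R : ℝ) (x : Euc d) : Fin d → ℤ := fun i => ⌊x i / R⌋

lemma cub_meas {d : ℕ} (R : ℝ) : Measurable (cub (d := d) R) := by
  refine measurable_pi_lambda _ fun i => ?_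
  exact Int.measurable_floor.comp (by fun_prop)

lemma cub_near {d : ℕ} {R : ℝ} (hR : 0 < R) {x : Euc d} {c : Fin d → ℤ} (h : cub R x = c) (i : Fin d) : |x i - R * c i| ≤ R := by
  have h1 : ⌊x i / R⌋ = c i := congrFun h i
  have h2 := Int.floor_le (x i / R)
  have h3 := Int.lt_floor_add_one (x i / R)
  rw [h1] at h2 h3
  rw [le_div_iff₀ hR] at h2
  rw [div_lt_iff₀ hR] at h3
  rw [abs_le]; constructor <;> linarith

lemma cub_far {d : ℕ} {R : ℝ} (hR : 0 < R) {x x' : Euc d} {i : Fin d} (h : 2 ≤ |cub R x i - cub R x' i|) : R ≤ ‖x - x'‖ := by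
  have h1 : ‖(x - x') i‖ ≤ ‖x - x'‖ := PiLp.norm_apply_le (x - x') i
  refine le_trans ?_ h1
  have a1 := Int.floor_le (x i / R)
  have a2 := Int.lt_floor_add_one (x i / R)
  have b1 := Int.floor_le (x' i / R)
  have b2 := Int.lt_floor_add_one (x' i / R)
  rw [le_div_iff₀ hR] at a1 b1
  rw [div_lt_iff₀ hR] at a2 b2
  have e : (x - x') i = x i - x' i := rfl
  rw [e, Real.norm_eq_abs]
  simp only [cub] at h
  rcases le_abs'.1 h with h | h
  · have : ((⌊x i / R⌋ - ⌊x' i / R⌋ : ℤ) : ℝ) ≤ -2 := by exact_mod_cast h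
    push_cast at this
    rw [le_abs']; left; nlinarith
  · have : (2:ℝ) ≤ ((⌊x i / R⌋ - ⌊x' i / R⌋ : ℤ) : ℝ) := by exact_mod_cast h
    push_cast at this
    rw [le_abs']; right; nlinarith

lemma adj_card {d : ℕ} (K : Finset (Fin d → ℤ)) (c : Fin d → ℤ) :
    ((K.filter fun l => ∀ i, |c i - l i| ≤ 1).card : ℝ) ≤ 3 ^ d := by
  have : (K.filter fun l => ∀ i, |c i - l i| ≤ 1) ⊆ Fintype.piFinset (fun i => Finset.Icc (c i - 1) (c i + 1)) := by
    intro l hl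
    rw [Fintype.mem_piFinset]
    intro i
    have := (Finset.mem_filter.1 hl).2 i
    rw [abs_le] at this
    rw [Finset.mem_Icc]; constructor <;> linarith
  have h2 := Finset.card_le_card this
  rw [Fintype.card_piFinset] at h2
  have h3 : ∏ i : Fin d, (Finset.Icc (c i - 1) (c i + 1)).card = 3 ^ d := by
    have : ∀ i, (Finset.Icc (c i - 1) (c i + 1)).card = 3 := by intro i; rw [Int.card_Icc]; lia
    simp [this]
  rw [h3] at h2
  exact_mod_cast h2
end Pent
end

section
open MeasureTheory Metric Set
open scoped ENNReal NNReal FourierTransform ContDiff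
namespace Pent
variable {n : ℕ}

/-- combination over cubes -/
lemma tt_comb {k : ℝ → ℝ} {Kb M : ℝ} {w : Euc (n+1) × ℝ → ℝ} {S : Set (Euc (n+1))} (h : Wt w S M) (hk : Kn k Kb) {D F R : ℝ}
    (hR : 0 < R) (hD : 0 < D) (hF : 0 ≤ F)
    (hnear : ∀ w' S', Wt (d := n+1) w' S' M → (∀ i, ∃ ξ, ∀ x ∈ S', |x i - ξ| ≤ R) → ∫ y, Uw k w' y ^ 2 ≤ D * volume.real S')
    (hfar : ∀ w₁ S₁ w₂ S₂, Wt (d := n+1) w₁ S₁ M → Wt (d := n+1) w₂ S₂ M → (∀ x ∈ S₁, ∀ x' ∈ S₂, R ≤ ‖x - x'‖) →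
      ∫ y, Uw k w₁ y * Uw k w₂ y ≤ F * (volume.real S₁ * volume.real S₂)) :
    ∫ y, Uw k w y ^ 2 ≤ 3 ^ (n+1) * D * volume.real S + F * volume.real S ^ 2 := by
  classical
  set m : ℤ := ⌈1 / R⌉
  set K : Finset (Fin (n+1) → ℤ) := Fintype.piFinset (fun _ => Finset.Icc (-m) m) with hK
  set E : (Fin (n+1) → ℤ) → Set (Euc (n+1)) := fun c => S ∩ cub R ⁻¹' {c} with hE
  have hmem : ∀ x ∈ S, cub R x ∈ K := by
    intro x hx
    rw [hK, Fintype.mem_piFinset]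
    intro i
    have h1 : |x i| ≤ 1 := by
      have h2 : ‖x i‖ ≤ ‖x‖ := PiLp.norm_apply_le x i
      have h3 : ‖x‖ ≤ 1 / (4 * ((n+1:ℕ):ℝ)) := by simpa [SB] using h.sub hx
      have h4 : 1 / (4 * ((n+1:ℕ):ℝ)) ≤ 1 := by
        rw [div_le_one (by positivity)]
        push_cast
        have : (0:ℝ) ≤ n := Nat.cast_nonneg n
        linarith
      exact h2.trans (h3.trans h4)
    have hc := Int.le_ceil (1 / R)
    rw [abs_le] at h1
    have u1 : x i / R ≤ 1 / R := by gcongr; exact h1.2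
    have u2 : -(1 / R) ≤ x i / R := by rw [← neg_div]; gcongr; exact h1.1
    rw [Finset.mem_Icc]
    constructor
    · rw [cub, Int.le_floor]; push_cast; linarith
    · have := Int.floor_le (x i / R)
      have h5 : ((⌊x i / R⌋ : ℤ) : ℝ) ≤ (m : ℝ) := by linarith
      exact_mod_cast h5
  have hEm : ∀ c, MeasurableSet (E c) := fun c => h.mS.inter (cub_meas R (measurableSet_singleton c))
  have hW : ∀ c, Wt ((E c ×ˢ univ).indicator w) (E c) M := fun c => h.res (hEm c) inter_subset_left
  set u : (Fin (n+1) → ℤ) → Euc (n+1) → ℝ := fun c => Uw k ((E c ×ˢ univ).indicator w) with hu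
  have hsum : ∀ p, w p = ∑ c ∈ K, (E c ×ˢ univ).indicator w p := by
    intro p
    by_cases hp : p.1 ∈ S
    · rw [Finset.sum_eq_single (cub R p.1)]
      · rw [indicator_of_mem]; exact ⟨⟨hp, rfl⟩, trivial⟩
      · intro c _ hc
        rw [indicator_of_notMem]; rintro ⟨⟨_, h2⟩, _⟩; exact hc h2.symm
      · intro h'; exact absurd (hmem _ hp) h'
    · have h0 : w p = 0 := by by_contra h'; exact hp (h.supp p h').1
      rw [h0, Finset.sum_eq_zero]
      intro c _
      rw [indicator_of_notMem]; rintro ⟨⟨h1, _⟩, _⟩; exact hp h1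
  have hU : ∀ y, Uw k w y = ∑ c ∈ K, u c y := by
    intro y
    simp only [hu, Uw]
    rw [← integral_finsetSum]
    · congr 1; ext p; rw [← Finset.mul_sum, ← hsum]
    · intro c _
      exact (hW c).int.bdd_mul (c := Kb) (hk.cont.comp (by fun_prop)).aestronglyMeasurable (Filter.Eventually.of_forall fun q => hk.bdd _)
  have hvol : ∑ c ∈ K, volume.real (E c) = volume.real S := by
    have hS : S = ⋃ c ∈ K, E c := by
      ext x; constructor
      · intro hx; exact mem_biUnion (hmem x hx) ⟨hx, rfl⟩
      · intro hx; obtain ⟨c, _, hc⟩ := mem_iUnion₂.1 hx; exact hc.1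
    conv_rhs => rw [hS]
    rw [measureReal_biUnion_finset (h := fun c _ => (hW c).fin)]
    · intro c _ c' _ hcc
      rw [Function.onFun, disjoint_left]
      rintro x ⟨_, h1⟩ ⟨_, h2⟩
      exact hcc (h1.symm.trans h2)
    · intro c _; exact hEm c
  have huB : ∀ c, Bf (u c) _ 3 := fun c => Uw_Bf (by lia) (hW c) hk
  have hprod : ∀ c l, Integrable (fun y => u c y * u l y) := fun c l =>
    (huB l).integrable.bdd_mul (huB c).meas.aestronglyMeasurable (Filter.Eventually.of_forall fun y => (huB c).bdd y)
  have hu2 : ∀ c, ∫ y, u c y ^ 2 ≤ D * volume.real (E c) := fun c =>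
    hnear _ _ (hW c) (fun i => ⟨R * c i, fun x hx => cub_near hR hx.2 i⟩)
  set v : (Fin (n+1) → ℤ) → ℝ := fun c => volume.real (E c) with hv
  have hv0 : ∀ c, 0 ≤ v c := fun c => measureReal_nonneg
  have hpair : ∀ c l, ∫ y, u c y * u l y ≤ (if ∀ i, |c i - l i| ≤ 1 then D / 2 * (v c + v l) else 0) + F * (v c * v l) := by
    intro c l
    split_ifs with hcl
    · have h1 : ∫ y, u c y * u l y ≤ ∫ y, (1/2 * u c y ^ 2 + 1/2 * u l y ^ 2) := by
        refine integral_mono (hprod c l) (((huB c).sq_int.const_mul _).add ((huB l).sq_int.const_mul _)) fun y => ?_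
        have := sq_nonneg (u c y - u l y)
        simp only; nlinarith
      rw [integral_add ((huB c).sq_int.const_mul _) ((huB l).sq_int.const_mul _), integral_const_mul, integral_const_mul] at h1
      have h2 := hu2 c
      have h3 := hu2 l
      have h4 : 0 ≤ F * (v c * v l) := mul_nonneg hF (mul_nonneg (hv0 c) (hv0 l))
      simp only [hv] at h4 ⊢
      linarith
    · push Not at hcl
      obtain ⟨i, hi⟩ := hcl
      rw [zero_add]
      refine hfar _ _ _ _ (hW c) (hW l) ?_
      intro x hx x' hx'
      refine cub_far (i := i) hR ?_
      rw [hx.2, hx'.2]; lia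
  have e1 : ∫ y, Uw k w y ^ 2 = ∑ c ∈ K, ∑ l ∈ K, ∫ y, u c y * u l y := by
    have : ∀ y, Uw k w y ^ 2 = ∑ c ∈ K, ∑ l ∈ K, u c y * u l y := by
      intro y; rw [hU, sq, Finset.sum_mul_sum]
    simp_rw [this]
    rw [integral_finsetSum]
    · refine Finset.sum_congr rfl fun c _ => ?_
      rw [integral_finsetSum]
      intro l _; exact hprod c l
    · intro c _; exact integrable_finsetSum _ fun l _ => hprod c l
  have hadj : ∑ c ∈ K, ∑ l ∈ K, (if ∀ i, |c i - l i| ≤ 1 then D / 2 * v c else 0) ≤ 3 ^ (n+1) * (D / 2) * volume.real S := by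
    rw [← hvol, Finset.mul_sum]
    refine Finset.sum_le_sum fun c _ => ?_
    rw [← Finset.sum_filter, Finset.sum_const, nsmul_eq_mul]
    have := mul_le_mul_of_nonneg_right (adj_card K c) (mul_nonneg (by positivity : 0 ≤ D / 2) (hv0 c))
    simp only [hv] at this ⊢
    linarith
  have hadj' : ∑ c ∈ K, ∑ l ∈ K, (if ∀ i, |c i - l i| ≤ 1 then D / 2 * v l else 0) ≤ 3 ^ (n+1) * (D / 2) * volume.real S := by
    rw [Finset.sum_comm]
    refine le_trans (le_of_eq ?_) hadj
    refine Finset.sum_congr rfl fun c _ => Finset.sum_congr rfl fun l _ => ?_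
    simp only [abs_sub_comm (l _) (c _)]
  have hF2 : ∑ c ∈ K, ∑ l ∈ K, F * (v c * v l) = F * volume.real S ^ 2 := by
    rw [← hvol, sq, Finset.sum_mul_sum, Finset.mul_sum]
    refine Finset.sum_congr rfl fun c _ => ?_
    rw [Finset.mul_sum]
  rw [e1]
  calc _ ≤ ∑ c ∈ K, ∑ l ∈ K, ((if ∀ i, |c i - l i| ≤ 1 then D / 2 * v c else 0) + (if ∀ i, |c i - l i| ≤ 1 then D / 2 * v l else 0) + F * (v c * v l)) := by
        refine Finset.sum_le_sum fun c _ => Finset.sum_le_sum fun l _ => (hpair c l).trans (le_of_eq ?_)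
        split_ifs <;> ring
    _ ≤ _ := by
        simp only [Finset.sum_add_distrib]
        rw [hF2]
        linarith

theorem tt (hn : 2 ≤ n) {κ : ℝ → ℝ} (hκ : IsKer (n+1) κ) : ∃ C L0 : ℝ, 0 < C ∧ 1 ≤ L0 ∧
    (∀ L ≥ L0, ∃ Kb, Kn (dil L κ) Kb) ∧ ∀ L ≥ L0, ∀ w S M, Wt (d := n+1) w S M → ∀ R > 0,
    ∫ y, Uw (dil L κ) w y ^ 2 ≤ C * (R * (L ^ n)⁻¹ * volume.real S + (L * R) ^ (-((n:ℝ)/2)) * volume.real S ^ 2) := by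
  obtain ⟨C1, hC1, near⟩ := near_final (n := n) hκ (by lia)
  obtain ⟨C2, L1, hC2, hL1, far⟩ := far hn hκ
  obtain ⟨K, hK0, hK⟩ := test_bdd hκ.smooth.1.continuous hκ.smooth.2
  obtain ⟨A1, hA10, hA1⟩ := test_supp hκ.smooth.2
  set L0 := max (max 1 L1) (4 * A1) with hL0
  have hkn : ∀ L ≥ L0, Kn (dil L κ) (L * K) := by
    intro L hL
    have h1 : 1 ≤ L := ((le_max_left _ _).trans (le_max_left _ _)).trans hL
    obtain ⟨dc, db, ds⟩ := dil_props (by linarith : 0 < L) hκ.smooth.1.continuous hK hA1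
    refine ⟨dc, db, fun s hs => ds s (lt_of_le_of_lt ?_ hs)⟩
    rw [div_le_iff₀ (by linarith)]
    have : 4 * A1 ≤ L := (le_max_right _ _).trans hL
    linarith
  refine ⟨3 ^ (n+1) * (C1 + 1) + C2, L0, by positivity, (le_max_left _ _).trans (le_max_left _ _), fun L hL => ⟨_, hkn L hL⟩, ?_⟩
  intro L hL w S M h R hR
  have hL1 : 1 ≤ L := ((le_max_left _ _).trans (le_max_left _ _)).trans hL
  have hLf : L1 ≤ L := ((le_max_right _ _).trans (le_max_left _ _)).trans hL
  have hLp : 0 < L := by linarith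
  have hk := hkn L hL
  have := tt_comb (D := (C1 + 1) * R * (L ^ n)⁻¹) (F := C2 * (L * R) ^ (-((n:ℝ)/2))) (R := R) h hk hR (by positivity) (by positivity) ?_ ?_
  · refine this.trans ?_
    have e1 : 0 ≤ R * (L ^ n)⁻¹ * volume.real S := by positivity
    have e2 : 0 ≤ (L * R) ^ (-((n:ℝ)/2)) * volume.real S ^ 2 := by positivity
    have e3 : 0 ≤ C2 * (R * (L ^ n)⁻¹ * volume.real S) := by positivity
    have e4 : 0 ≤ 3 ^ (n+1) * (C1 + 1) * ((L * R) ^ (-((n:ℝ)/2)) * volume.real S ^ 2) := by positivity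
    linarith
  · intro w' S' h' hS'
    refine Uw_near h' hk (by positivity) ?_
    have hsub : S' ⊆ closedBall 0 (1 / (4 * ((n:ℝ) + 1))) := by
      have := h'.sub
      simpa [SB] using this
    refine (near L hLp _ _ 3 (Uw_Bf (by lia) h' hk) (fun y hy => Uw_zero (by lia) h' hk y (Or.inl hy)) S' R hR.le hsub hS').trans ?_
    gcongr; linarith
  · intro w₁ S₁ w₂ S₂ h₁ h₂ hsep
    refine Uw_far (by lia) h₁ h₂ hk ?_
    intro x hx x' hx'
    have hz := hsep x hx x' hx'
    have hne : x ≠ x' := by rintro rfl; simp at hz; linarith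
    refine (far L hLf _ _ M (h₁.sg x) (h₂.sg x') x x' hne).trans ?_
    gcongr C2 * ?_
    refine Real.rpow_le_rpow_of_nonpos (by positivity) (by gcongr) ?_
    have : (0:ℝ) ≤ n := Nat.cast_nonneg n
    linarith
end Pent
end

section
open MeasureTheory Metric Set
open scoped ENNReal NNReal FourierTransform ContDiff
namespace Pent
variable {n : ℕ}

lemma cs {α : Type*} [MeasurableSpace α] {μ : Measure α} {f g : α → ℝ} (h1 : Integrable (fun x => f x ^ 2) μ)
    (h2 : Integrable (fun x => g x ^ 2) μ) (h3 : Integrable (fun x => f x * g x) μ) :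
    (∫ x, f x * g x ∂μ) ^ 2 ≤ (∫ x, f x ^ 2 ∂μ) * ∫ x, g x ^ 2 ∂μ := by
  have : ∀ t : ℝ, 0 ≤ (∫ x, f x ^ 2 ∂μ) * (t * t) + (2 * ∫ x, f x * g x ∂μ) * t + ∫ x, g x ^ 2 ∂μ := by
    intro t
    have h : ∫ x, (t * f x + g x) ^ 2 ∂μ = (∫ x, f x ^ 2 ∂μ) * (t * t) + (2 * ∫ x, f x * g x ∂μ) * t + ∫ x, g x ^ 2 ∂μ := by
      have e : ∀ x, (t * f x + g x) ^ 2 = (t * t) * f x ^ 2 + (2 * t) * (f x * g x) + g x ^ 2 := fun x => by ring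
      simp_rw [e]
      have hi : Integrable (fun x => (t * t) * f x ^ 2 + (2 * t) * (f x * g x)) μ := (h1.const_mul _).add (h3.const_mul _)
      rw [integral_add hi h2, integral_add (h1.const_mul _) (h3.const_mul _),
        integral_const_mul, integral_const_mul]
      ring
    rw [← h]
    exact integral_nonneg fun x => sq_nonneg _
  have h := discrim_le_zero this
  rw [discrim] at h
  nlinarith

/-- square function -/
def N2 {d : ℕ} (k : ℝ → ℝ) (f : Euc d → ℝ) (x : Euc d) : ℝ≥0∞ := ∫⁻ b in Icc (1:ℝ) 4, ‖av k f x b‖ₑ ^ 2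

lemma N2_meas {d : ℕ} {k : ℝ → ℝ} (hk : Continuous k) {f : Euc d → ℝ} (hf : Measurable f) : Measurable (N2 k f) := by
  have : Measurable (fun q : Euc d × ℝ => ‖av k f q.1 q.2‖ₑ ^ 2) := (av_meas hk hf).enorm.pow_const 2
  exact this.lintegral_prod_right'

lemma N2_fin {d : ℕ} {k : ℝ → ℝ} {Kb : ℝ} (hk : Kn k Kb) {f : Euc d → ℝ} (hf : Integrable f) (x : Euc d) : N2 k f x ≠ ⊤ := by
  refine ne_top_of_le_ne_top ?_ (setLIntegral_mono (g := fun _ => ENNReal.ofReal (Kb * ∫ y, |f y|) ^ 2) measurable_const fun b _ => ?_)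
  · rw [setLIntegral_const]
    exact ENNReal.mul_ne_top (by simp) (by simp)
  · gcongr
    rw [← ofReal_norm]
    exact ENNReal.ofReal_le_ofReal (av_bdd hk.bdd hf x b)

lemma exists_w {d : ℕ} {k : ℝ → ℝ} {Kb : ℝ} (hk : Kn k Kb) {f : Euc d → ℝ} {M ρ : ℝ} (hf : Bf f M ρ) {l : ℝ} (hl : 0 < l)
    {E : Set (Euc d)} (hE : MeasurableSet E) (hES : E ⊆ SB d) (h : ∀ x ∈ E, ENNReal.ofReal (l ^ 2) ≤ N2 k f x) :
    ∃ w M', Wt w E M' ∧ l * volume.real E ≤ ∫ p, w p * av k f p.1 p.2 := by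
  set I := Icc (1:ℝ) 4 with hI
  have am := av_meas hk.cont hf.meas
  set a : Euc d × ℝ → ℝ := fun p => av k f p.1 p.2 with ha
  set N : Euc d → ℝ := fun x => Real.sqrt (N2 k f x).toReal with hN
  have Nm : Measurable N := ((N2_meas hk.cont hf.meas).ennreal_toReal).sqrt
  have hN2 : ∀ x, ENNReal.ofReal (N x ^ 2) = N2 k f x := by
    intro x
    rw [hN]; simp only
    rw [Real.sq_sqrt ENNReal.toReal_nonneg, ENNReal.ofReal_toReal (N2_fin hk hf.integrable x)]
  have hNl : ∀ x ∈ E, l ≤ N x := by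
    intro x hx
    have := h x hx
    rw [← hN2, ENNReal.ofReal_le_ofReal_iff (sq_nonneg _)] at this
    exact le_of_sq_le_sq this (Real.sqrt_nonneg _)
  set w : Euc d × ℝ → ℝ := (E ×ˢ I).indicator (fun p => a p / N p.1) with hw
  have hET : MeasurableSet (E ×ˢ I) := hE.prod measurableSet_Icc
  have wm : Measurable w := (am.div (Nm.comp measurable_fst)).indicator hET
  set A := Kb * ∫ y, |f y| with hA
  have ab : ∀ p, |a p| ≤ A := fun p => av_bdd hk.bdd hf.integrable _ _
  have hA0 : 0 ≤ A := (abs_nonneg _).trans (ab (0, 0))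
  have hwt : Wt w E (A / l) := by
    refine ⟨wm, ?_, ?_, ?_, hE, hES⟩
    · intro p
      by_cases hp : p ∈ E ×ˢ I
      · rw [hw, indicator_of_mem hp, abs_div]
        have := hNl p.1 hp.1
        rw [abs_of_pos (by linarith : 0 < N p.1)]
        exact div_le_div₀ hA0 (ab p) hl this
      · rw [hw, indicator_of_notMem hp, abs_zero]; positivity
    · intro p hp
      rw [hw, indicator_apply_ne_zero] at hp
      exact hp.1
    · intro x
      by_cases hx : x ∈ E
      · have hNx : 0 < N x := hl.trans_le (hNl x hx)
        have e : ∀ b, ‖w (x, b)‖ₑ ^ 2 = I.indicator (fun b => ENNReal.ofReal ((N x ^ 2)⁻¹) * ‖a (x, b)‖ₑ ^ 2) b := by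
          intro b
          by_cases hb : b ∈ I
          · rw [indicator_of_mem hb, hw, indicator_of_mem (show (x, b) ∈ E ×ˢ I from ⟨hx, hb⟩)]
            simp only
            rw [div_eq_mul_inv, enorm_mul, mul_pow, mul_comm]
            congr 1
            rw [← ofReal_norm, ← ENNReal.ofReal_pow (norm_nonneg _), norm_inv, Real.norm_of_nonneg hNx.le, inv_pow]
          · rw [indicator_of_notMem hb, hw, indicator_of_notMem (fun h' => hb h'.2)]; simp
        simp_rw [e]
        rw [lintegral_indicator measurableSet_Icc, lintegral_const_mul' _ _ (by simp)]
        have : ∫⁻ b in I, ‖a (x, b)‖ₑ ^ 2 = ENNReal.ofReal (N x ^ 2) := (hN2 x).symm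
        rw [this, ← ENNReal.ofReal_mul (by positivity), inv_mul_cancel₀ (by positivity)]; simp
      · have e : ∀ b, w (x, b) = 0 := fun b => by rw [hw, indicator_of_notMem (fun h' => hx h'.1)]
        simp [e]
  refine ⟨w, A / l, hwt, ?_⟩
  have wa0 : ∀ p, 0 ≤ w p * a p := by
    intro p
    by_cases hp : p ∈ E ×ˢ I
    · rw [hw, indicator_of_mem hp, div_mul_eq_mul_div, ← sq]
      exact div_nonneg (sq_nonneg _) (Real.sqrt_nonneg _)
    · rw [hw, indicator_of_notMem hp, zero_mul]
  have wai : Integrable (fun p => w p * a p) := by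
    have := hwt.int.bdd_mul (c := A) am.aestronglyMeasurable (Filter.Eventually.of_forall ab)
    refine this.congr (Filter.Eventually.of_forall fun p => mul_comm _ _)
  have key : ENNReal.ofReal (l * volume.real E) ≤ ENNReal.ofReal (∫ p, w p * a p) := by
    rw [ofReal_integral_eq_lintegral_ofReal wai (Filter.Eventually.of_forall wa0), ENNReal.ofReal_mul hl.le, Measure.real,
      ENNReal.ofReal_toReal hwt.fin]
    have e : ∫⁻ p in E ×ˢ I, ENNReal.ofReal (w p * a p) = ∫⁻ x in E, ∫⁻ b in I, ENNReal.ofReal (w (x, b) * a (x, b)) :=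
      lint_box (by fun_prop) E I
    refine le_trans ?_ (setLIntegral_le_lintegral (E ×ˢ I) _)
    rw [e, ← setLIntegral_const]
    refine setLIntegral_mono' hE fun x hx => ?_
    have hNx : 0 < N x := hl.trans_le (hNl x hx)
    have e2 : ∫⁻ b in I, ENNReal.ofReal (w (x, b) * a (x, b)) = ∫⁻ b in I, ENNReal.ofReal ((N x)⁻¹) * ‖a (x, b)‖ₑ ^ 2 := by
      refine setLIntegral_congr_fun measurableSet_Icc fun b hb => ?_
      rw [hw, indicator_of_mem (show (x, b) ∈ E ×ˢ I from ⟨hx, hb⟩), ← ofReal_norm, ← ENNReal.ofReal_pow (norm_nonneg _),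
        ← ENNReal.ofReal_mul (by positivity), Real.norm_eq_abs, sq_abs]
      congr 1; ring
    rw [e2, lintegral_const_mul' _ _ (by simp)]
    have : ∫⁻ b in I, ‖a (x, b)‖ₑ ^ 2 = ENNReal.ofReal (N x ^ 2) := (hN2 x).symm
    rw [this, ← ENNReal.ofReal_mul (by positivity), sq, inv_mul_cancel_left₀ hNx.ne']
    exact ENNReal.ofReal_le_ofReal (hNl x hx)
  exact (ENNReal.ofReal_le_ofReal_iff (integral_nonneg wa0)).1 key

lemma av_trunc {d : ℕ} (hd : 1 ≤ d) {k : ℝ → ℝ} {Kb : ℝ} (hk : Kn k Kb) (f : Euc d → ℝ) {x : Euc d} (hx : x ∈ SB d) {b : ℝ}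
    (hb : b ∈ Icc (1:ℝ) 4) : av k ({y : Euc d | 1/2 ≤ ‖y‖}.indicator f) x b = av k f x b := by
  rw [av, av]
  congr 1; ext y
  by_cases hy : 1/2 ≤ ‖y‖
  · rw [indicator_of_mem (show y ∈ {y : Euc d | 1/2 ≤ ‖y‖} from hy)]
  · have : k (b - ‖x - y‖ ^ 2) = 0 := by
      by_contra h0
      have : |b - ‖x - y‖ ^ 2| ≤ 1/4 := by
        by_contra h1; exact h0 (hk.supp _ (not_le.1 h1))
      exact hy (loc hd hx hb this).1
    rw [this, zero_mul, zero_mul]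

theorem weak (hn : 2 ≤ n) {κ : ℝ → ℝ} (hκ : IsKer (n+1) κ) : ∃ C L0 : ℝ, 0 < C ∧ 1 ≤ L0 ∧
    (∀ L ≥ L0, ∃ Kb, Kn (dil L κ) Kb) ∧ ∀ τ : ℝ, (n:ℝ)/(n+2) ≤ τ → τ ≤ 1 → ∀ L ≥ L0, ∀ (f : Euc (n+1) → ℝ) M ρ, Bf f M ρ → ∀ l > 0,
    ∀ E, MeasurableSet E → E ⊆ SB (n+1) → (∀ x ∈ E, ENNReal.ofReal (l ^ 2) ≤ N2 (dil L κ) f x) →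
    volume.real E ^ τ ≤ C * L ^ (-((n:ℝ) * (1 + τ) / 2)) * (∫ y, f y ^ 2) / l ^ 2 := by
  obtain ⟨C1, hC1, near⟩ := near_final (n := n) hκ (by lia)
  obtain ⟨C2, L0, hC2, hL0, hkn, htt⟩ := tt hn hκ
  refine ⟨C1 + 2 * C2, L0, by positivity, hL0, hkn, ?_⟩
  intro τ hτ1 hτ2 L hL f M ρ hf l hl E hE hES hN
  obtain ⟨Kb, hk⟩ := hkn L hL
  have hLp : 0 < L := by linarith
  have hn' : (2:ℝ) ≤ n := by exact_mod_cast hn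
  -- truncation
  set f0 := {y : Euc (n+1) | 1/2 ≤ ‖y‖}.indicator f with hf0
  have hB : Bf f0 M ρ := by
    refine ⟨hf.meas.indicator (measurableSet_le measurable_const measurable_norm), fun y => ?_, fun y hy => ?_⟩
    · exact (norm_indicator_le_norm_self f y).trans (hf.bdd y)
    · rw [hf0, indicator_apply]; split_ifs
      · exact hf.supp y hy
      · rfl
  have hz : ∀ y, ‖y‖ < 1/2 → f0 y = 0 := fun y hy => indicator_of_notMem (show y ∉ {y : Euc (n+1) | 1/2 ≤ ‖y‖} from not_le.2 hy) _
  have hle : ∫ y, f0 y ^ 2 ≤ ∫ y, f y ^ 2 := by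
    refine integral_mono hB.sq_int hf.sq_int fun y => ?_
    simp only [hf0, indicator_apply]; split_ifs
    · exact le_rfl
    · nlinarith [sq_nonneg (f y)]
  have hN0 : ∀ x ∈ E, ENNReal.ofReal (l ^ 2) ≤ N2 (dil L κ) f0 x := by
    intro x hx
    refine (hN x hx).trans (le_of_eq ?_)
    refine setLIntegral_congr_fun measurableSet_Icc fun b hb => ?_
    rw [av_trunc (by lia) hk f (hES hx) hb]
  set P := ∫ y, f y ^ 2 with hP
  have hP0 : 0 ≤ P := integral_nonneg fun y => sq_nonneg _
  set e := volume.real E with he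
  have he0 : 0 ≤ e := measureReal_nonneg
  have hEf : volume E ≠ ⊤ := ne_top_of_le_ne_top (SB_fin _) (measure_mono hES)
  -- strong 2 estimate
  have w2 : l ^ 2 * e ≤ C1 * (L ^ n)⁻¹ * P := by
    have hsub : E ⊆ closedBall 0 (1 / (4 * ((n:ℝ) + 1))) := by simpa [SB] using hES
    have h1 := near L hLp f0 M ρ hB hz E 1 zero_le_one hsub (by
      intro i
      refine ⟨0, fun x hx => ?_⟩
      have h2 : ‖x i‖ ≤ ‖x‖ := PiLp.norm_apply_le x i
      have h3 : ‖x‖ ≤ 1 / (4 * ((n:ℝ)+1)) := by simpa using hsub hx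
      have h4 : 1 / (4 * ((n:ℝ)+1)) ≤ 1 := by
        rw [div_le_one (by positivity)]; linarith
      rw [sub_zero]
      exact h2.trans (h3.trans h4))
    have h2 : ENNReal.ofReal (l ^ 2) * volume E ≤ ∫⁻ x in E, ∫⁻ b, ‖av (dil L κ) f0 x b‖ₑ ^ 2 := by
      rw [← setLIntegral_const]
      exact setLIntegral_mono' hE fun x hx => (hN0 x hx).trans (setLIntegral_le_lintegral _ _)
    have h3 := h2.trans h1
    rw [l2conv hB.sq_int, ← ENNReal.ofReal_mul (by positivity), ← ENNReal.ofReal_toReal hEf, ← ENNReal.ofReal_mul (by positivity),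
      ENNReal.ofReal_le_ofReal_iff (mul_nonneg (by positivity) (integral_nonneg fun y => sq_nonneg _))] at h3
    calc _ ≤ _ := h3
      _ ≤ C1 * 1 * (L ^ n)⁻¹ * P := by gcongr
      _ = _ := by ring
  have wtt : ∀ R > 0, l ^ 2 * e ^ 2 ≤ C2 * P * (R * (L ^ n)⁻¹ * e + (L * R) ^ (-((n:ℝ)/2)) * e ^ 2) := by
    intro R hR
    obtain ⟨w, M', hw, hlw⟩ := exists_w hk hB hl hE hES hN0
    have hU := Uw_Bf (by lia) hw hk
    rw [← Uw_pair hw hk hB.integrable] at hlw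
    have h1 := cs hB.sq_int hU.sq_int
      (hU.integrable.bdd_mul hB.meas.aestronglyMeasurable (Filter.Eventually.of_forall fun y => hB.bdd y))
    have h2 := htt L hL w E M' hw R hR
    calc l ^ 2 * e ^ 2 = (l * e) ^ 2 := by ring
      _ ≤ (∫ y, f0 y * Uw (dil L κ) w y) ^ 2 := by gcongr
      _ ≤ _ := h1
      _ ≤ P * (C2 * (R * (L ^ n)⁻¹ * e + (L * R) ^ (-((n:ℝ)/2)) * e ^ 2)) := by
          refine mul_le_mul hle h2 (integral_nonneg fun y => sq_nonneg _) hP0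
      _ = _ := by ring
  have hτ0 : 0 < τ := lt_of_lt_of_le (by positivity) hτ1
  rcases he0.eq_or_lt with he1 | he1
  · rw [← he1, Real.zero_rpow hτ0.ne']; positivity
  have hPp : 0 < P := by
    rcases hP0.eq_or_lt with h | h
    · exfalso
      have := wtt 1 one_pos
      rw [← h] at this
      have : 0 < l ^ 2 * e ^ 2 := by positivity
      linarith
    · exact h
  set X := (C1 + 2 * C2) * P / l ^ 2 with hX
  have hXp : 0 < X := by positivity
  have b2 : e ≤ X * L ^ (-(n:ℝ)) := by
    rw [Real.rpow_neg hLp.le, Real.rpow_natCast, hX, div_mul_eq_mul_div, le_div_iff₀ (by positivity)]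
    calc e * l ^ 2 = l ^ 2 * e := by ring
      _ ≤ _ := w2
      _ ≤ (C1 + 2 * C2) * (L ^ n)⁻¹ * P := by gcongr; linarith
      _ = _ := by ring
  have bd : e ≤ X ^ (((n:ℝ)+2)/n) * L ^ (-((n:ℝ)+1)) := by
    have hR : 0 < X ^ (2/(n:ℝ)) / L := by positivity
    have h1 := wtt _ hR
    have e1 : L * (X ^ (2/(n:ℝ)) / L) = X ^ (2/(n:ℝ)) := by field_simp
    have e2 : (X ^ (2/(n:ℝ))) ^ (-((n:ℝ)/2)) = X⁻¹ := by
      rw [← Real.rpow_mul hXp.le, ← Real.rpow_neg_one]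
      congr 1; field_simp
    rw [e1, e2] at h1
    have e3 : C2 * P * X⁻¹ ≤ l ^ 2 / 2 := by
      rw [hX, inv_div, ← mul_div_assoc, div_le_div_iff₀ (by positivity) (by positivity)]
      have : 0 ≤ C1 * P * l ^ 2 := by positivity
      linarith
    have e4 : C2 * P * X⁻¹ * e ^ 2 ≤ l ^ 2 / 2 * e ^ 2 := by gcongr
    have h2 : l ^ 2 * e ^ 2 ≤ 2 * C2 * P * (X ^ (2/(n:ℝ)) / L * (L ^ n)⁻¹ * e) := by linarith
    have h3 : l ^ 2 * e ≤ 2 * C2 * P * (X ^ (2/(n:ℝ)) / L * (L ^ n)⁻¹) := by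
      refine le_of_mul_le_mul_right ?_ he1
      linarith
    have e5 : X ^ (((n:ℝ)+2)/n) = X ^ (2/(n:ℝ)) * X := by
      nth_rw 3 [← Real.rpow_one X]
      rw [← Real.rpow_add hXp]; congr 1; field_simp; ring
    have e6 : L ^ (-((n:ℝ)+1)) = (L * L ^ n)⁻¹ := by
      rw [Real.rpow_neg hLp.le, Real.rpow_add_one hLp.ne', Real.rpow_natCast, mul_comm]
    rw [e5, e6]
    have h4 : l ^ 2 * e ≤ l ^ 2 * (X ^ (2/(n:ℝ)) * X * (L * L ^ n)⁻¹) := by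
      refine h3.trans ?_
      have : l ^ 2 * (X ^ (2/(n:ℝ)) * X * (L * L ^ n)⁻¹) = (C1 + 2 * C2) * P * (X ^ (2/(n:ℝ)) / L * (L ^ n)⁻¹) := by
        rw [hX]; field_simp
      rw [this]
      gcongr; linarith
    exact le_of_mul_le_mul_left h4 (by positivity)
  -- interpolation
  have hgoal : e ^ τ ≤ X * L ^ (-((n:ℝ) * (1 + τ) / 2)) := by
    set τ0 : ℝ := (n:ℝ)/(n+2) with hτ0d
    have hτ01 : 1 - τ0 = 2 / (n+2) := by rw [hτ0d]; field_simp; ring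
    have h1τ : 0 < 1 - τ0 := by rw [hτ01]; positivity
    set θ := (τ - τ0) / (1 - τ0) with hθ
    have hθ0 : 0 ≤ θ := div_nonneg (by linarith) h1τ.le
    have hθ1 : θ ≤ 1 := by rw [hθ, div_le_one h1τ]; linarith
    have hτe : τ = τ0 * (1 - θ) + θ := by rw [hθ]; field_simp; ring
    have hτ0p : 0 < τ0 := by positivity
    have c1 : e ^ τ0 ≤ X * L ^ (-((n:ℝ)+1) * τ0) := by
      have := Real.rpow_le_rpow he0 bd hτ0p.le
      rw [Real.mul_rpow (by positivity) (by positivity), ← Real.rpow_mul hXp.le, ← Real.rpow_mul hLp.le] at this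
      have e1 : ((n:ℝ)+2)/n * τ0 = 1 := by rw [hτ0d]; field_simp
      rwa [e1, Real.rpow_one] at this
    calc e ^ τ = (e ^ τ0) ^ (1 - θ) * e ^ θ := by
          rw [← Real.rpow_mul he0, ← Real.rpow_add he1, ← hτe]
      _ ≤ (X * L ^ (-((n:ℝ)+1) * τ0)) ^ (1 - θ) * (X * L ^ (-(n:ℝ))) ^ θ := by
          have : 0 ≤ 1 - θ := by linarith
          gcongr
      _ = X * L ^ (-((n:ℝ) * (1 + τ) / 2)) := by
          rw [Real.mul_rpow (by positivity) (by positivity), Real.mul_rpow (by positivity) (by positivity),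
            ← Real.rpow_mul hLp.le, ← Real.rpow_mul hLp.le]
          have e1 : X ^ (1 - θ) * X ^ θ = X := by rw [← Real.rpow_add hXp]; simp
          have e2 : L ^ (-((n:ℝ)+1) * τ0 * (1 - θ)) * L ^ (-(n:ℝ) * θ) = L ^ (-((n:ℝ) * (1 + τ) / 2)) := by
            rw [← Real.rpow_add hLp]
            congr 1
            rw [hτe]
            have : ((n:ℝ)+1) * τ0 = n * (1 + τ0) / 2 := by rw [hτ0d]; field_simp; ring
            have h' : -((n:ℝ)+1) * τ0 = -(n * (1 + τ0) / 2) := by rw [← this]; ring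
            rw [h']; ring
          calc _ = (X ^ (1 - θ) * X ^ θ) * (L ^ (-((n:ℝ)+1) * τ0 * (1 - θ)) * L ^ (-(n:ℝ) * θ)) := by ring
            _ = _ := by rw [e1, e2]
  refine hgoal.trans (le_of_eq ?_)
  rw [hX]; ring
end Pent
end

section
open MeasureTheory Metric Set
open scoped ENNReal NNReal FourierTransform ContDiff
namespace Pent

lemma lint_pow_le {α : Type*} [MeasurableSpace α] (μ : Measure α) {s : ℝ} (hs : 1 ≤ s) {f : α → ℝ≥0∞} (hf : AEMeasurable f μ) :
    (∫⁻ x, f x ∂μ) ^ s ≤ μ univ ^ (s - 1) * ∫⁻ x, f x ^ s ∂μ := by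
  have hs0 : 0 < s := by linarith
  rcases hs.eq_or_lt with h | h
  · rw [← h]; simp
  have hpq : (s / (s - 1)).HolderConjugate s := (Real.HolderConjugate.conjExponent h).symm
  have := ENNReal.lintegral_mul_le_Lp_mul_Lq μ hpq (f := fun _ => 1) aemeasurable_const hf
  simp only [Pi.mul_apply, one_mul, ENNReal.one_rpow, lintegral_const] at this
  calc _ ≤ (μ univ ^ (1 / (s / (s - 1))) * (∫⁻ x, f x ^ s ∂μ) ^ (1 / s)) ^ s := by gcongr
    _ = _ := by
      rw [ENNReal.mul_rpow_of_nonneg _ _ hs0.le, ← ENNReal.rpow_mul, ← ENNReal.rpow_mul]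
      congr 2
      · have : s - 1 ≠ 0 := by linarith
        field_simp
      · rw [one_div, inv_mul_cancel₀ hs0.ne', ENNReal.rpow_one]

lemma sum_rpow_le {ι : Type*} (F : Finset ι) (a : ι → ℝ≥0∞) {s r : ℝ} (hs : 0 < s) (hsr : s ≤ r) :
    (∑ i ∈ F, a i ^ r) ^ (1 / r) ≤ (∑ i ∈ F, a i ^ s) ^ (1 / s) := by
  have hr : 0 < r := by linarith
  set A := (∑ i ∈ F, a i ^ s) ^ (1 / s) with hA
  have hAs : A ^ s = ∑ i ∈ F, a i ^ s := by
    rw [hA, ← ENNReal.rpow_mul, one_div, inv_mul_cancel₀ hs.ne', ENNReal.rpow_one]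
  have h1 : ∀ i ∈ F, a i ≤ A := by
    intro i hi
    rw [← ENNReal.rpow_le_rpow_iff hs, hAs]
    exact Finset.single_le_sum (f := fun i => a i ^ s) (fun _ _ => zero_le) hi
  have h2 : ∑ i ∈ F, a i ^ r ≤ A ^ r := by
    calc ∑ i ∈ F, a i ^ r ≤ ∑ i ∈ F, a i ^ s * A ^ (r - s) := by
          refine Finset.sum_le_sum fun i hi => ?_
          have : a i ^ r = a i ^ s * a i ^ (r - s) := by
            rw [← ENNReal.rpow_add_of_nonneg _ _ hs.le (by linarith)]; congr 1; ring
          rw [this]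
          have := ENNReal.rpow_le_rpow (h1 i hi) (by linarith : 0 ≤ r - s)
          gcongr
      _ = A ^ r := by
          rw [← Finset.sum_mul, ← hAs, ← ENNReal.rpow_add_of_nonneg _ _ hs.le (by linarith)]; congr 1; ring
  calc _ ≤ (A ^ r) ^ (1 / r) := by gcongr
    _ = A := by rw [← ENNReal.rpow_mul, mul_one_div, div_self hr.ne', ENNReal.rpow_one]

section
variable {w w' : ℝ → ℝ} {s δ : ℝ}

/-- local energy density -/
def en (w w' : ℝ → ℝ) (s δ : ℝ) (t : ℝ) : ℝ≥0∞ := ENNReal.ofReal δ⁻¹ * ‖w t‖ₑ ^ s + ENNReal.ofReal (δ ^ (s - 1)) * ‖w' t‖ₑ ^ s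

lemma ftc {a b : ℝ} (hab : a ≤ b) (hw : ∀ t ∈ Icc a b, HasDerivAt w (w' t) t) (hc : ContinuousOn w' (Icc a b))
    {u v : ℝ} (hu : u ∈ Icc a b) (hv : v ∈ Icc a b) : ‖w v - w u‖ₑ ≤ ∫⁻ t in Ioc a b, ‖w' t‖ₑ := by
  wlog huv : u ≤ v generalizing u v
  · rw [enorm_sub_rev]; exact this hv hu (not_le.1 huv).le
  have hsub : Icc u v ⊆ Icc a b := Icc_subset_Icc hu.1 hv.2
  rw [← intervalIntegral.integral_eq_sub_of_hasDerivAt (f' := w') (fun t ht => hw t (hsub (by rwa [uIcc_of_le huv] at ht)))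
    ((hc.mono (by rwa [uIcc_of_le huv])).intervalIntegrable), intervalIntegral.integral_of_le huv]
  exact (enorm_integral_le_lintegral_enorm _).trans (lintegral_mono_set (Ioc_subset_Ioc hu.1 hv.2))

lemma aem {g : ℝ → ℝ} {a b : ℝ} (hc : ContinuousOn g (Icc a b)) : AEMeasurable (fun t => ‖g t‖ₑ) (volume.restrict (Ioc a b)) :=
  ((hc.mono Ioc_subset_Icc_self).aestronglyMeasurable measurableSet_Ioc).enorm

lemma ftc_pow (hs : 1 ≤ s) {a b : ℝ} (hab : a ≤ b) (hd : b - a ≤ δ) (hδ : 0 < δ) (hc : ContinuousOn w' (Icc a b)) :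
    (∫⁻ t in Ioc a b, ‖w' t‖ₑ) ^ s ≤ ENNReal.ofReal (δ ^ (s - 1)) * ∫⁻ t in Ioc a b, ‖w' t‖ₑ ^ s := by
  refine (lint_pow_le _ hs (aem hc)).trans ?_
  gcongr
  rw [Measure.restrict_apply_univ, Real.volume_Ioc, ENNReal.ofReal_rpow_of_nonneg (by linarith) (by linarith)]
  exact ENNReal.ofReal_le_ofReal (Real.rpow_le_rpow (by linarith) hd (by linarith))

lemma en_ge1 (a b : ℝ) (hs : 1 ≤ s) (hw : ContinuousOn w (Icc a b)) :
    ∫⁻ t in Ioc a b, en w w' s δ t = ENNReal.ofReal δ⁻¹ * (∫⁻ t in Ioc a b, ‖w t‖ₑ ^ s) +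
      ENNReal.ofReal (δ ^ (s - 1)) * ∫⁻ t in Ioc a b, ‖w' t‖ₑ ^ s := by
  simp only [en]
  rw [lintegral_add_left', lintegral_const_mul' _ _ (by simp), lintegral_const_mul' _ _ (by simp)]
  exact ((aem hw).pow_const s).const_mul _

lemma pt_bound (hs : 1 ≤ s) (hδ : 0 < δ) {a : ℝ} (hw : ∀ t ∈ Icc a (a + δ), HasDerivAt w (w' t) t)
    (hc : ContinuousOn w' (Icc a (a + δ))) {u : ℝ} (hu : u ∈ Icc a (a + δ)) :
    ‖w u‖ₑ ^ s ≤ 2 ^ (s - 1) * ∫⁻ t in Ioc a (a + δ), en w w' s δ t := by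
  have hwc : ContinuousOn w (Icc a (a + δ)) := fun t ht => (hw t ht).continuousAt.continuousWithinAt
  have hab : a ≤ a + δ := by linarith
  set D := ∫⁻ t in Ioc a (a + δ), ‖w' t‖ₑ with hD
  have hDs := ftc_pow hs hab (by linarith : a + δ - a ≤ δ) hδ hc
  have h1 : ∀ c ∈ Ioc a (a + δ), ‖w u‖ₑ ^ s ≤ 2 ^ (s - 1) * ‖w c‖ₑ ^ s + 2 ^ (s - 1) * D ^ s := by
    intro c hc'
    have : ‖w u‖ₑ ≤ ‖w c‖ₑ + D := by
      have h2 := ftc hab hw hc (Ioc_subset_Icc_self hc') hu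
      calc ‖w u‖ₑ = ‖w c + (w u - w c)‖ₑ := by congr 1; ring
        _ ≤ _ := enorm_add_le _ _
        _ ≤ _ := by gcongr
    calc _ ≤ (‖w c‖ₑ + D) ^ s := by gcongr
      _ ≤ _ := ENNReal.rpow_add_le_mul_rpow_add_rpow _ _ hs
      _ = _ := by ring
  have h2 := setLIntegral_mono' (μ := volume) measurableSet_Ioc h1
  rw [setLIntegral_const, lintegral_add_right _ measurable_const, setLIntegral_const, Real.volume_Ioc,
    lintegral_const_mul' _ _ (ENNReal.rpow_ne_top_of_nonneg (by linarith) (by simp))] at h2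
  rw [en_ge1 _ _ hs hwc]
  have e : a + δ - a = δ := by ring
  rw [e] at h2
  have e2 : ENNReal.ofReal δ⁻¹ * ENNReal.ofReal δ = 1 := by
    rw [← ENNReal.ofReal_mul (by positivity), inv_mul_cancel₀ hδ.ne', ENNReal.ofReal_one]
  calc ‖w u‖ₑ ^ s = ENNReal.ofReal δ⁻¹ * (‖w u‖ₑ ^ s * ENNReal.ofReal δ) := by
        rw [mul_comm (‖w u‖ₑ ^ s), ← mul_assoc, e2, one_mul]
    _ ≤ _ := mul_le_mul_right h2 _
    _ = 2 ^ (s - 1) * (ENNReal.ofReal δ⁻¹ * ∫⁻ t in Ioc a (a + δ), ‖w t‖ₑ ^ s)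
          + (ENNReal.ofReal δ⁻¹ * ENNReal.ofReal δ) * (2 ^ (s - 1) * D ^ s) := by ring
    _ ≤ _ := by
        rw [e2, one_mul, mul_add]
        gcongr

lemma jump_bound (hs : 1 ≤ s) (hδ : 0 < δ) {a b : ℝ} (hab : a ≤ b) (hw : ∀ t ∈ Icc a b, HasDerivAt w (w' t) t)
    (hc : ContinuousOn w' (Icc a b)) : ‖w b - w a‖ₑ ^ s ≤ 4 ^ s * ∫⁻ t in Ioc a b, en w w' s δ t := by
  have hwc : ContinuousOn w (Icc a b) := fun t ht => (hw t ht).continuousAt.continuousWithinAt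
  rcases le_or_gt (b - a) δ with h | h
  · have h1 := ftc hab hw hc (left_mem_Icc.2 hab) (right_mem_Icc.2 hab)
    calc _ ≤ (∫⁻ t in Ioc a b, ‖w' t‖ₑ) ^ s := by gcongr
      _ ≤ _ := ftc_pow hs hab h hδ hc
      _ ≤ ∫⁻ t in Ioc a b, en w w' s δ t := by rw [en_ge1 _ _ hs hwc]; exact le_add_of_nonneg_left zero_le
      _ ≤ _ := le_mul_of_one_le_left zero_le (ENNReal.one_le_rpow (by norm_num) (by linarith))
  · have s1 : Icc a (a + δ) ⊆ Icc a b := Icc_subset_Icc le_rfl (by linarith)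
    have s2 : Icc (b - δ) (b - δ + δ) ⊆ Icc a b := Icc_subset_Icc (by linarith) (by linarith)
    have h1 := pt_bound hs hδ (fun t ht => hw t (s1 ht)) (hc.mono s1) (left_mem_Icc.2 (by linarith))
    have h2 := pt_bound hs hδ (fun t ht => hw t (s2 ht)) (hc.mono s2) (u := b) ⟨by linarith, by linarith⟩
    have h1' := h1.trans (mul_le_mul_right (lintegral_mono_set (Ioc_subset_Ioc le_rfl (by linarith : a + δ ≤ b))) _)
    have h2' := h2.trans (mul_le_mul_right (lintegral_mono_set (Ioc_subset_Ioc (by linarith : a ≤ b - δ) (by linarith : b - δ + δ ≤ b))) _)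
    calc ‖w b - w a‖ₑ ^ s ≤ (‖w b‖ₑ + ‖w a‖ₑ) ^ s := by gcongr; exact enorm_sub_le
      _ ≤ 2 ^ (s - 1) * (‖w b‖ₑ ^ s + ‖w a‖ₑ ^ s) := ENNReal.rpow_add_le_mul_rpow_add_rpow _ _ hs
      _ ≤ 2 ^ (s - 1) * (2 ^ (s - 1) * (∫⁻ t in Ioc a b, en w w' s δ t) + 2 ^ (s - 1) * ∫⁻ t in Ioc a b, en w w' s δ t) := by
          gcongr
      _ = ((2 ^ (s - 1) * 2 ^ (s - 1)) * 2) * ∫⁻ t in Ioc a b, en w w' s δ t := by ring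
      _ ≤ _ := by
          gcongr
          have : (4:ℝ≥0∞) ^ s = 2 ^ (s - 1) * 2 ^ (s - 1) * (2 * 2) := by
            have e : (4:ℝ≥0∞) = 2 * 2 := by norm_num
            have e2 : (2:ℝ≥0∞) ^ s = 2 ^ (s - 1) * 2 := by
              conv_rhs => rw [← ENNReal.rpow_one 2, ← ENNReal.rpow_mul, one_mul, ← ENNReal.rpow_add _ _ (by simp) (by simp)]
              simp
            rw [e, ENNReal.mul_rpow_of_nonneg _ _ (by linarith), e2]; ring
          rw [this]
          gcongr
          norm_num

theorem var_bound {r : ℝ} (hs : 1 ≤ s) (hsr : s ≤ r) (hδ : 0 < δ) (hw : ∀ t ∈ Icc (1:ℝ) 4, HasDerivAt w (w' t) t)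
    (hc : ContinuousOn w' (Icc (1:ℝ) 4)) :
    rVar r (Icc 1 4) (fun t => (w t : ℂ)) ≤ (4 ^ s * ∫⁻ t in Icc (1:ℝ) 4, en w w' s δ t) ^ (1 / s) := by
  refine iSup_le fun N => iSup_le fun t => iSup_le fun ht => iSup_le fun hm => ?_
  refine (sum_rpow_le _ _ (by linarith) hsr).trans ?_
  gcongr
  have hle : ∀ i : Fin N, t i.castSucc ≤ t i.succ := fun i => (ht Fin.castSucc_lt_succ).le
  have h1 : ∀ i : Fin N, (‖(w (t i.succ) : ℂ) - w (t i.castSucc)‖₊ : ℝ≥0∞) ^ s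
      ≤ 4 ^ s * ∫⁻ u in Ioc (t i.castSucc) (t i.succ), en w w' s δ u := by
    intro i
    have hsub : Icc (t i.castSucc) (t i.succ) ⊆ Icc 1 4 := Icc_subset_Icc (hm _).1 (hm _).2
    have := jump_bound hs hδ (hle i) (fun t ht => hw t (hsub ht)) (hc.mono hsub)
    refine le_trans (le_of_eq ?_) this
    congr 1
    rw [← Complex.ofReal_sub, ← ofReal_norm, ← Complex.norm_real, ofReal_norm]; rfl
  refine (Finset.sum_le_sum fun i _ => h1 i).trans ?_
  rw [← Finset.mul_sum]
  gcongr
  rw [← lintegral_biUnion_finset (fun i _ j _ hij => ?_) (fun i _ => measurableSet_Ioc)]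
  · exact lintegral_mono_set (iUnion₂_subset fun i _ => Ioc_subset_Icc_self.trans (Icc_subset_Icc (hm _).1 (hm _).2))
  · rcases lt_or_gt_of_ne hij with h | h
    · exact Set.disjoint_left.2 fun u hu hv => absurd (hv.1.trans_le hu.2) (not_lt.2 (ht.monotone (by
        rw [Fin.le_def]; simp; exact h)))
    · exact Set.disjoint_left.2 fun u hu hv => absurd (hu.1.trans_le hv.2) (not_lt.2 (ht.monotone (by
        rw [Fin.le_def]; simp; exact h)))

theorem sup_bound (hs : 1 ≤ s) (hδ : 0 < δ) (hδ1 : δ ≤ 1) (hw : ∀ t ∈ Icc (1:ℝ) 4, HasDerivAt w (w' t) t)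
    (hc : ContinuousOn w' (Icc (1:ℝ) 4)) {b : ℝ} (hb : b ∈ Icc (1:ℝ) 4) :
    ‖w b‖ₑ ≤ (4 ^ s * ∫⁻ t in Icc (1:ℝ) 4, en w w' s δ t) ^ (1 / s) := by
  have hs0 : 0 < s := by linarith
  have key : ‖w b‖ₑ ^ s ≤ 4 ^ s * ∫⁻ t in Icc (1:ℝ) 4, en w w' s δ t := by
    obtain ⟨a, ha1, ha2, hba⟩ : ∃ a, 1 ≤ a ∧ a + δ ≤ 4 ∧ b ∈ Icc a (a + δ) := by
      rcases le_or_gt b 2 with h | h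
      · exact ⟨b, hb.1, by linarith, le_rfl, by linarith⟩
      · exact ⟨b - δ, by linarith, by linarith [hb.2], by linarith, by linarith⟩
    have s1 : Icc a (a + δ) ⊆ Icc 1 4 := Icc_subset_Icc ha1 ha2
    refine (pt_bound hs hδ (fun t ht => hw t (s1 ht)) (hc.mono s1) hba).trans ?_
    refine mul_le_mul' ?_ (lintegral_mono_set (Ioc_subset_Icc_self.trans s1))
    calc (2:ℝ≥0∞) ^ (s - 1) ≤ 2 ^ s := ENNReal.rpow_le_rpow_of_exponent_le (by norm_num) (by linarith)
      _ ≤ 4 ^ s := by gcongr; norm_num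
  calc ‖w b‖ₑ = (‖w b‖ₑ ^ s) ^ (1 / s) := by rw [← ENNReal.rpow_mul, mul_one_div, div_self hs0.ne', ENNReal.rpow_one]
    _ ≤ _ := by gcongr
end
end Pent
end

section
open MeasureTheory Metric Set
open scoped ENNReal NNReal FourierTransform ContDiff
namespace Pent

lemma prim {g : ℝ → ℝ} (hg : ContDiff ℝ ∞ g) (hc : HasCompactSupport g) (h0 : ∫ x, g x = 0) :
    ∃ Φ : ℝ → ℝ, ContDiff ℝ ∞ Φ ∧ HasCompactSupport Φ ∧ deriv Φ = g := by
  obtain ⟨A, hA, hs⟩ := test_supp hc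
  have hd : ∀ x, HasDerivAt (fun x => ∫ t in (-A)..x, g t) (g x) x := fun x =>
    intervalIntegral.integral_hasDerivAt_right (hg.continuous.intervalIntegrable _ _)
      hg.continuous.stronglyMeasurable.stronglyMeasurableAtFilter hg.continuous.continuousAt
  have hde : deriv (fun x => ∫ t in (-A)..x, g t) = g := by ext x; exact (hd x).deriv
  refine ⟨fun x => ∫ t in (-A)..x, g t, ?_, ?_, hde⟩
  · rw [contDiff_infty_iff_deriv, hde]
    exact ⟨fun x => (hd x).differentiableAt, hg⟩
  · refine HasCompactSupport.intro (isCompact_Icc (a := -A) (b := A)) fun x hx => ?_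
    rw [mem_Icc, not_and_or, not_le, not_le] at hx
    rcases hx with h | h
    · refine intervalIntegral.integral_zero_ae ?_
      have : ∀ t : ℝ, t ≠ -A → t ∈ uIoc (-A) x → g t = 0 := by
        intro t h1 h2
        rw [uIoc_of_ge h.le] at h2
        have : t < -A := lt_of_le_of_ne h2.2 h1
        refine hs t ?_
        rw [abs_of_neg (by linarith)]; linarith
      filter_upwards [compl_mem_ae_iff.2 (measure_singleton (-A))] with t ht
      exact this t ht
    · rw [intervalIntegral.integral_of_le (by linarith), setIntegral_eq_integral_of_ae_compl_eq_zero, h0]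
      filter_upwards [compl_mem_ae_iff.2 (measure_singleton (-A))] with t ht h2
      have ht' : t ≠ -A := ht
      refine hs t ?_
      rw [mem_Ioc, not_and_or, not_lt, not_le] at h2
      rcases h2 with h2 | h2
      · have : t < -A := lt_of_le_of_ne h2 ht'
        rw [abs_of_neg (by linarith)]; linarith
      · rw [abs_of_pos (by linarith)]; linarith

lemma int_dil2 (g : ℝ → ℝ) : ∫ x, dil 2 g x = ∫ x, g x := by
  simp only [dil]
  rw [integral_const_mul, Measure.integral_comp_mul_left g 2, abs_of_pos (by norm_num : (0:ℝ) < 2⁻¹), smul_eq_mul]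
  ring

lemma dil2_smooth {g : ℝ → ℝ} (hg : ContDiff ℝ ∞ g) (hc : HasCompactSupport g) :
    ContDiff ℝ ∞ (dil 2 g) ∧ HasCompactSupport (dil 2 g) := by
  refine ⟨contDiff_const.mul (hg.comp (contDiff_const.mul contDiff_id)), ?_⟩
  have : HasCompactSupport (fun x => g (2 * x)) := by
    have := hc.comp_smul (c := (2:ℝ)) (by norm_num)
    simpa using this
  exact this.mul_left

lemma comb_smooth {g h : ℝ → ℝ} (hg : ContDiff ℝ ∞ g) (hc : HasCompactSupport g) (hh : ContDiff ℝ ∞ h) (hc' : HasCompactSupport h) (α β : ℝ) :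
    ContDiff ℝ ∞ (fun x => α * g x + β * h x) ∧ HasCompactSupport (fun x => α * g x + β * h x) := by
  refine ⟨by fun_prop, ?_⟩
  exact (hc.mul_left (f' := g) (f := fun _ => α)).add (hc'.mul_left (f := fun _ => β))

lemma iter_comb {g h : ℝ → ℝ} (hg : ContDiff ℝ ∞ g) (hh : ContDiff ℝ ∞ h) (m : ℕ) (α β : ℝ) (x : ℝ) :
    iteratedDeriv m (fun x => α * dil 2 g x + β * h x) x = α * 2 ^ m * dil 2 (iteratedDeriv m g) x + β * iteratedDeriv m h x := by
  have hg' : ContDiff ℝ m g := hg.of_le (by exact_mod_cast le_top)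
  have hh' : ContDiff ℝ m h := hh.of_le (by exact_mod_cast le_top)
  have h1 : ContDiff ℝ m (fun x => g (2 * x)) := hg'.comp (contDiff_const.mul contDiff_id)
  have e : (fun x => α * dil 2 g x + β * h x) = fun x => (fun x => (α * 2) * (fun x => g (2 * x)) x) x + (fun x => β * h x) x := by
    ext x; simp only [dil]; ring
  rw [e, iteratedDeriv_fun_add (by fun_prop) (by fun_prop), iteratedDeriv_const_mul_field, iteratedDeriv_const_mul_field,
    iteratedDeriv_comp_const_mul hg']
  simp only [dil]; ring

theorem exists_phi (m : ℕ) : ∃ φ : ℝ → ℝ, ContDiff ℝ ∞ φ ∧ HasCompactSupport φ ∧ ∫ x, φ x = 1 ∧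
    IsKer (m+1) (fun x => dil 2 φ x - φ x) := by
  induction m with
  | zero =>
    let b : ContDiffBump (0:ℝ) := ⟨1, 2, by norm_num, by norm_num⟩
    have h1 : ContDiff ℝ ∞ (b.normed volume) := b.contDiff_normed
    have h2 : HasCompactSupport (b.normed volume) := b.hasCompactSupport_normed
    have h3 := b.integral_normed (μ := volume)
    have hd := dil2_smooth h1 h2
    refine ⟨b.normed volume, h1, h2, h3, ?_⟩
    have hs := comb_smooth hd.1 hd.2 h1 h2 1 (-1)
    have e : (fun x => 1 * dil 2 (b.normed volume) x + -1 * b.normed volume x) = fun x => dil 2 (b.normed volume) x - b.normed volume x := by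
      ext x; ring
    rw [e] at hs
    obtain ⟨Φ, p1, p2, p3⟩ := prim hs.1 hs.2 (by
      rw [integral_sub (hd.1.continuous.integrable_of_hasCompactSupport hd.2) (h1.continuous.integrable_of_hasCompactSupport h2), int_dil2]
      ring)
    exact ⟨Φ, p1, p2, by rw [zero_add, iteratedDeriv_one, p3]⟩
  | succ m ih =>
    obtain ⟨φ, h1, h2, h3, Ψ, q1, q2, q3⟩ := ih
    have hpow : (1:ℝ) < 2 ^ (m+1) := one_lt_pow₀ (by norm_num) (by lia)
    set α : ℝ := 2 ^ (m+1) / (2 ^ (m+1) - 1) with hα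
    have hαe : α * (1 / 2 ^ (m+1)) + (1 - α) = 0 := by
      rw [hα]; have : (2:ℝ) ^ (m+1) - 1 ≠ 0 := by linarith
      field_simp; ring
    have hd := dil2_smooth h1 h2
    have hs := comb_smooth hd.1 hd.2 h1 h2 α (1 - α)
    refine ⟨_, hs.1, hs.2, ?_, ?_⟩
    · rw [integral_add ((hd.1.continuous.integrable_of_hasCompactSupport hd.2).const_mul _)
        ((h1.continuous.integrable_of_hasCompactSupport h2).const_mul _), integral_const_mul, integral_const_mul, int_dil2, h3]
      ring
    · have hΨ := dil2_smooth q1 q2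
      have hs2 := comb_smooth hΨ.1 hΨ.2 q1 q2 (α * (1 / 2 ^ (m+1))) (1 - α)
      obtain ⟨Φ, p1, p2, p3⟩ := prim hs2.1 hs2.2 (by
        rw [integral_add ((hΨ.1.continuous.integrable_of_hasCompactSupport hΨ.2).const_mul _)
          ((q1.continuous.integrable_of_hasCompactSupport q2).const_mul _), integral_const_mul, integral_const_mul, int_dil2,
          ← add_mul, hαe, zero_mul])
      refine ⟨Φ, p1, p2, ?_⟩
      rw [iteratedDeriv_succ', p3]
      ext x
      rw [iter_comb q1 q1, ← q3]
      simp only [dil]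
      field_simp; ring
end Pent
end

section
open MeasureTheory Metric Set
open scoped ENNReal NNReal FourierTransform ContDiff
namespace Pent
variable {d : ℕ}

lemma av_enorm_le (k : ℝ → ℝ) (f : Euc d → ℝ) (x : Euc d) (b : ℝ) :
    ‖av k f x b‖ₑ ≤ ∫⁻ y, ‖k (b - ‖x - y‖ ^ 2)‖ₑ * ‖f y‖ₑ := by
  refine (enorm_integral_le_lintegral_enorm _).trans (le_of_eq ?_)
  simp_rw [enorm_mul]

lemma av_l1 {k : ℝ → ℝ} (hk : Continuous k) {f : Euc d → ℝ} (hf : Measurable f) (x : Euc d) :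
    ∫⁻ b, ‖av k f x b‖ₑ ≤ (∫⁻ s, ‖k s‖ₑ) * ∫⁻ y, ‖f y‖ₑ := by
  refine (lintegral_mono fun b => av_enorm_le k f x b).trans ?_
  have hkm := hk.measurable
  rw [lintegral_lintegral_swap (by fun_prop)]
  have : ∀ y, ∫⁻ b, ‖k (b - ‖x - y‖ ^ 2)‖ₑ * ‖f y‖ₑ = (∫⁻ s, ‖k s‖ₑ) * ‖f y‖ₑ := by
    intro y
    rw [lintegral_mul_const _ (by fun_prop), lintegral_sub_right_eq_self (fun b => ‖k b‖ₑ)]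
  simp_rw [this]
  rw [lintegral_const_mul _ (by fun_prop)]

lemma ker_rad (hd : 2 ≤ d) {k : ℝ → ℝ} {Kb : ℝ} (hk : Kn k Kb) (x : Euc d) {b : ℝ} (hb : b ∈ Icc (1:ℝ) 4) :
    ∫⁻ y, ‖k (b - ‖x - y‖ ^ 2)‖ₑ ≤ ENNReal.ofReal ((sfm d univ).toReal / 2 * 5 ^ (((d:ℝ) - 2) / 2)) * ∫⁻ s, ‖k s‖ₑ := by
  have hkm := hk.cont.measurable
  rw [lintegral_sub_left_eq_self (fun y => ‖k (b - ‖y‖ ^ 2)‖ₑ) x]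
  rw [radial_lint (by lia) (φ := fun m => ‖k (b - m)‖ₑ) (by fun_prop), ENNReal.ofReal_mul (by positivity), mul_assoc]
  gcongr
  rw [← lintegral_sub_left_eq_self (fun b => ‖k b‖ₑ) b, ← lintegral_const_mul' _ _ (by simp)]
  refine (setLIntegral_mono' measurableSet_Ioi fun m hm => ?_).trans (setLIntegral_le_lintegral _ _)
  by_cases h : k (b - m) = 0
  · simp [h]
  have : |b - m| ≤ 1/4 := by
    by_contra h1; exact h (hk.supp _ (not_le.1 h1))
  gcongr
  · exact (mem_Ioi.1 hm).le
  · have : (2:ℝ) ≤ d := by exact_mod_cast hd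
    linarith
  · rw [abs_le] at this; linarith [hb.2]

lemma av_sup (hd : 2 ≤ d) {k : ℝ → ℝ} {Kb : ℝ} (hk : Kn k Kb) {f : Euc d → ℝ} (hf : ∀ y, |f y| ≤ 1) (x : Euc d) {b : ℝ} (hb : b ∈ Icc (1:ℝ) 4) :
    ‖av k f x b‖ₑ ≤ ENNReal.ofReal ((sfm d univ).toReal / 2 * 5 ^ (((d:ℝ) - 2) / 2)) * ∫⁻ s, ‖k s‖ₑ := by
  refine (av_enorm_le k f x b).trans (le_trans (lintegral_mono fun y => ?_) (ker_rad hd hk x hb))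
  refine mul_le_of_le_one_right zero_le ?_
  rw [← ofReal_norm, ← ENNReal.ofReal_one]
  exact ENNReal.ofReal_le_ofReal (hf y)

/-- inner energy -/
def Se (s : ℝ) (k : ℝ → ℝ) (f : Euc d → ℝ) (x : Euc d) : ℝ≥0∞ := ∫⁻ b in Icc (1:ℝ) 4, ‖av k f x b‖ₑ ^ s

lemma Se_meas {s : ℝ} {k : ℝ → ℝ} (hk : Continuous k) {f : Euc d → ℝ} (hf : Measurable f) : Measurable (Se s k f) := by
  have : Measurable (fun q : Euc d × ℝ => ‖av k f q.1 q.2‖ₑ ^ s) := (av_meas hk hf).enorm.pow_const s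
  exact this.lintegral_prod_right'

lemma Se_fin {s : ℝ} (hs : 0 ≤ s) {k : ℝ → ℝ} {Kb : ℝ} (hk : Kn k Kb) {f : Euc d → ℝ} (hf : Integrable f) (x : Euc d) : Se s k f x ≠ ⊤ := by
  refine ne_top_of_le_ne_top ?_ (setLIntegral_mono (g := fun _ => ENNReal.ofReal (Kb * ∫ y, |f y|) ^ s) measurable_const fun b _ => ?_)
  · rw [setLIntegral_const]
    exact ENNReal.mul_ne_top (ENNReal.rpow_ne_top_of_nonneg hs (by simp)) (by simp)
  · gcongr
    rw [← ofReal_norm]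
    exact ENNReal.ofReal_le_ofReal (av_bdd hk.bdd hf x b)

lemma holder_interp {α : Type*} [MeasurableSpace α] (μ : Measure α) {a : α → ℝ≥0∞} (ha : Measurable a) {β : ℝ} (h0 : 0 < β) (h1 : β ≤ 1) :
    ∫⁻ b, a b ^ (1 + β) ∂μ ≤ (∫⁻ b, a b ∂μ) ^ (1 - β) * (∫⁻ b, a b ^ 2 ∂μ) ^ β := by
  have := ENNReal.lintegral_mul_norm_pow_le (μ := μ) (f := a) (g := fun b => a b ^ 2) ha.aemeasurable (by fun_prop)
    (by linarith : 0 ≤ 1 - β) h0.le (by ring)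
  refine le_trans (le_of_eq ?_) this
  congr 1; ext b
  rw [← ENNReal.rpow_natCast, ← ENNReal.rpow_mul, ← ENNReal.rpow_add_of_nonneg _ _ (by linarith) (by positivity)]
  congr 1; push_cast; ring

lemma Se_le {s β : ℝ} (h0 : 0 < β) (h1 : β ≤ 1) (hs : 1 + β ≤ s) {k : ℝ → ℝ} (hk : Continuous k) {f : Euc d → ℝ} (hf : Measurable f)
    {A B : ℝ≥0∞} {x : Euc d} (hA : ∀ b ∈ Icc (1:ℝ) 4, ‖av k f x b‖ₑ ≤ A) (hB : ∫⁻ b, ‖av k f x b‖ₑ ≤ B) :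
    Se s k f x ≤ A ^ (s - 1 - β) * B ^ (1 - β) * N2 k f x ^ β := by
  have ham : Measurable (fun b => ‖av k f x b‖ₑ) := ((av_meas hk hf).comp (measurable_const.prodMk measurable_id)).enorm
  calc Se s k f x ≤ ∫⁻ b in Icc (1:ℝ) 4, A ^ (s - 1 - β) * ‖av k f x b‖ₑ ^ (1 + β) := by
        refine setLIntegral_mono' measurableSet_Icc fun b hb => ?_
        have : ‖av k f x b‖ₑ ^ s = ‖av k f x b‖ₑ ^ (s - 1 - β) * ‖av k f x b‖ₑ ^ (1 + β) := by
          rw [← ENNReal.rpow_add_of_nonneg _ _ (by linarith) (by linarith)]; congr 1; ring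
        rw [this]
        have := ENNReal.rpow_le_rpow (hA b hb) (by linarith : 0 ≤ s - 1 - β)
        gcongr
    _ = A ^ (s - 1 - β) * ∫⁻ b in Icc (1:ℝ) 4, ‖av k f x b‖ₑ ^ (1 + β) := lintegral_const_mul _ (by fun_prop)
    _ ≤ A ^ (s - 1 - β) * ((∫⁻ b in Icc (1:ℝ) 4, ‖av k f x b‖ₑ) ^ (1 - β) * (N2 k f x) ^ β) := by
        gcongr
        exact holder_interp _ ham h0 h1
    _ ≤ A ^ (s - 1 - β) * (B ^ (1 - β) * (N2 k f x) ^ β) := by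
        have := (setLIntegral_le_lintegral (Icc (1:ℝ) 4) (fun b => ‖av k f x b‖ₑ)).trans hB
        have := ENNReal.rpow_le_rpow this (by linarith : 0 ≤ 1 - β)
        gcongr
    _ = _ := by ring

/-- weak to strong on a finite measure space -/
lemma weak_strong {α : Type*} [MeasurableSpace α] {μ : Measure α} [IsFiniteMeasure μ] {S : α → ℝ} (hS : Measurable S) (h0 : ∀ x, 0 ≤ S x)
    {B m θ : ℝ} (hB : 0 < B) (hθ : 0 < θ) (hm : θ < m) (h : ∀ t > 0, μ {x | t < S x} ≤ ENNReal.ofReal ((B / t) ^ m)) :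
    ∫⁻ x, ENNReal.ofReal (S x ^ θ) ∂μ ≤ ENNReal.ofReal ((μ.real univ + θ / (m - θ)) * B ^ θ) := by
  rw [lintegral_rpow_eq_lintegral_meas_lt_mul μ (Filter.Eventually.of_forall h0) hS.aemeasurable hθ]
  have i1 : IntegrableOn (fun t : ℝ => t ^ (θ - 1)) (Ioc 0 B) := by
    have := intervalIntegral.intervalIntegrable_rpow' (a := 0) (b := B) (by linarith : -1 < θ - 1)
    rwa [intervalIntegrable_iff_integrableOn_Ioc_of_le hB.le] at this
  have i2 : IntegrableOn (fun t : ℝ => t ^ (θ - 1 - m)) (Ioi B) := integrableOn_Ioi_rpow_of_lt (by linarith) hB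
  have e1 : ∫ t in Ioc 0 B, t ^ (θ - 1) = B ^ θ / θ := by
    rw [← intervalIntegral.integral_of_le hB.le, integral_rpow (Or.inl (by linarith))]
    simp [Real.zero_rpow hθ.ne']
  have e2 : ∫ t in Ioi B, t ^ (θ - 1 - m) = B ^ (θ - m) / (m - θ) := by
    rw [integral_Ioi_rpow_of_lt (by linarith) hB]
    have : θ - 1 - m + 1 = -(m - θ) := by ring
    rw [this, div_neg, neg_div, neg_neg, neg_sub]
  have b1 : ∫⁻ t in Ioc 0 B, μ {x | t < S x} * ENNReal.ofReal (t ^ (θ - 1)) ≤ ENNReal.ofReal (μ.real univ * (B ^ θ / θ)) := by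
    rw [← e1, ENNReal.ofReal_mul measureReal_nonneg, ofReal_integral_eq_lintegral_ofReal i1 ((ae_restrict_iff' measurableSet_Ioc).2
      (Filter.Eventually.of_forall fun t ht => Real.rpow_nonneg ht.1.le _)), ← lintegral_const_mul' _ _ (by simp)]
    refine lintegral_mono fun t => ?_
    gcongr
    rw [Measure.real, ENNReal.ofReal_toReal (measure_ne_top _ _)]
    exact measure_mono (subset_univ _)
  have b2 : ∫⁻ t in Ioi B, μ {x | t < S x} * ENNReal.ofReal (t ^ (θ - 1)) ≤ ENNReal.ofReal (B ^ m * (B ^ (θ - m) / (m - θ))) := by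
    rw [← e2, ENNReal.ofReal_mul (by positivity), ofReal_integral_eq_lintegral_ofReal i2 ((ae_restrict_iff' measurableSet_Ioi).2
      (Filter.Eventually.of_forall fun t ht => Real.rpow_nonneg (hB.trans ht).le _)), ← lintegral_const_mul' _ _ (by simp)]
    refine setLIntegral_mono' measurableSet_Ioi fun t ht => ?_
    have ht0 : 0 < t := hB.trans ht
    refine (mul_le_mul_left (h t ht0) _).trans ?_
    rw [← ENNReal.ofReal_mul (by positivity), ← ENNReal.ofReal_mul (by positivity)]
    refine ENNReal.ofReal_le_ofReal (le_of_eq ?_)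
    rw [Real.div_rpow hB.le ht0.le, Real.rpow_sub ht0 (θ - 1) m]; ring
  have hu : Ioi (0:ℝ) = Ioc 0 B ∪ Ioi B := (Ioc_union_Ioi_eq_Ioi hB.le).symm
  rw [hu]
  calc _ ≤ ENNReal.ofReal θ * (ENNReal.ofReal (μ.real univ * (B ^ θ / θ)) + ENNReal.ofReal (B ^ m * (B ^ (θ - m) / (m - θ)))) := by
        gcongr
        exact (lintegral_union_le _ _ _).trans (add_le_add b1 b2)
    _ = _ := by
        have hmθ : 0 < m - θ := by linarith
        rw [← ENNReal.ofReal_add (by positivity) (by positivity), ← ENNReal.ofReal_mul hθ.le]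
        congr 1
        rw [← mul_div_assoc, ← mul_div_assoc, ← Real.rpow_add hB]
        have : m + (θ - m) = θ := by ring
        rw [this]; field_simp
end Pent
end

section
open MeasureTheory Metric Set
open scoped ENNReal NNReal FourierTransform ContDiff
namespace Pent
variable {d n : ℕ}

lemma SB_meas (d : ℕ) : MeasurableSet (SB d) := measurableSet_closedBall

lemma ker_fin {κ : ℝ → ℝ} (h : Continuous κ) (hc : HasCompactSupport κ) : ∫⁻ s, ‖κ s‖ₑ ≠ ⊤ :=
  (h.integrable_of_hasCompactSupport hc).2.ne

theorem rwt (hn : 2 ≤ n) {κ : ℝ → ℝ} (hκ : IsKer (n+1) κ) {τ β s q : ℝ} (hτ : (n:ℝ)/(n+2) ≤ τ) (hτ1 : τ ≤ 1) (hβ : 0 < β) (hβ1 : β ≤ 1)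
    (hs : 1 + β ≤ s) (hq : 0 < q) (hqs : q * (β * τ) < s) : ∃ C L0 : ℝ, 0 < C ∧ 1 ≤ L0 ∧
    (∀ L ≥ L0, ∃ Kb, Kn (dil L κ) Kb) ∧ ∀ L ≥ L0, ∀ f : Euc (n+1) → ℝ, Bf f 1 3 →
    ∫⁻ x in SB (n+1), Se s (dil L κ) f x ^ (q / s) ≤
      ENNReal.ofReal ((C * L ^ (-(β * ((n:ℝ) * (1 + τ) / 2))) * volume.real {y | f y ≠ 0}) ^ (q / s)) := by
  obtain ⟨C1, L0, hC1, hL0, hkn, hw⟩ := weak hn hκ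
  have hn' : (2:ℝ) ≤ n := by exact_mod_cast hn
  have hτ0 : 0 < τ := lt_of_lt_of_le (by positivity) hτ
  have hs0 : 0 < s := by linarith
  set I : ℝ := (∫⁻ s, ‖κ s‖ₑ).toReal + 1 with hI
  have hIp : 0 < I := by positivity
  have hIe : ∫⁻ s, ‖κ s‖ₑ ≤ ENNReal.ofReal I := by
    rw [← ENNReal.ofReal_toReal (ker_fin hκ.smooth.1.continuous hκ.smooth.2)]
    exact ENNReal.ofReal_le_ofReal (by rw [hI]; linarith)
  set A : ℝ := (sfm (n+1) univ).toReal / 2 * 5 ^ ((((n+1:ℕ):ℝ) - 2) / 2) * I + 1 with hA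
  have hAp : 0 < A := by positivity
  set m : ℝ := 1 / (β * τ) with hm
  set θ := q / s with hθ
  have hθ0 : 0 < θ := by positivity
  have hθm : θ < m := by
    rw [hθ, hm, div_lt_div_iff₀ hs0 (by positivity)]; linarith
  set γ := β * ((n:ℝ) * (1 + τ) / 2) with hγ
  set C2 := C1 ^ β * (A ^ (s - 1 - β) * I ^ (1 - β)) with hC2
  have hC2p : 0 < C2 := by positivity
  have hmθ : 0 < m - θ := by linarith
  set C3 := (volume.real (SB (n+1)) + θ / (m - θ)) with hC3
  have hC3p : 0 < C3 := by
    have : 0 ≤ volume.real (SB (n+1)) := measureReal_nonneg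
    positivity
  refine ⟨C3 ^ (1 / θ) * C2, L0, by positivity, hL0, hkn, ?_⟩
  intro L hL f hf
  obtain ⟨Kb, hk⟩ := hkn L hL
  have hLp : 0 < L := by linarith
  set F := {y | f y ≠ 0} with hF
  have hFm : MeasurableSet F := hf.meas (measurableSet_singleton 0).compl
  have hFf : volume F ≠ ⊤ := by
    refine ne_top_of_le_ne_top (measure_closedBall_lt_top (x := (0 : Euc (n+1))) (r := 3)).ne (measure_mono fun y hy => ?_)
    rw [mem_closedBall, dist_zero_right]
    by_contra h; exact hy (hf.supp y (not_le.1 h))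
  set V := volume.real F with hV
  have hVe : ENNReal.ofReal V = volume F := by rw [hV, Measure.real, ENNReal.ofReal_toReal hFf]
  have hle1 : ∀ y, ‖f y‖ₑ ≤ F.indicator 1 y := by
    intro y
    by_cases h : f y = 0
    · simp [h]
    · rw [indicator_of_mem (show y ∈ F from h), ← ofReal_norm, Pi.one_apply, ← ENNReal.ofReal_one]
      exact ENNReal.ofReal_le_ofReal (hf.bdd y)
  have hL1 : ∫⁻ y, ‖f y‖ₑ ≤ ENNReal.ofReal V := by
    rw [hVe, ← lintegral_indicator_one hFm]
    exact lintegral_mono hle1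
  have hP : ∫ y, f y ^ 2 ≤ V := by
    rw [← ENNReal.ofReal_le_ofReal_iff measureReal_nonneg, ← l2conv hf.sq_int, hVe, ← lintegral_indicator_one hFm]
    refine lintegral_mono fun y => ?_
    refine le_trans ?_ (hle1 y)
    rw [sq]
    refine mul_le_of_le_one_right zero_le ((hle1 y).trans (indicator_le_self' (fun _ _ => zero_le) y))
  have hkI : ∫⁻ s, ‖dil L κ s‖ₑ ≤ ENNReal.ofReal I := by rw [dil_l1 hLp]; exact hIe
  have hSe : ∀ x, Se s (dil L κ) f x ≤ ENNReal.ofReal (A ^ (s - 1 - β) * (I * V) ^ (1 - β)) * N2 (dil L κ) f x ^ β := by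
    intro x
    have := Se_le hβ hβ1 hs hk.cont hf.meas (x := x) (A := ENNReal.ofReal A) (B := ENNReal.ofReal (I * V)) (fun b hb => ?_) ?_
    · refine this.trans (le_of_eq ?_)
      rw [ENNReal.ofReal_rpow_of_nonneg hAp.le (by linarith), ENNReal.ofReal_rpow_of_nonneg (by positivity) (by linarith),
        ← ENNReal.ofReal_mul (by positivity)]
    · refine (av_sup (by lia) hk hf.bdd x hb).trans ((mul_le_mul_right hkI _).trans ?_)
      rw [← ENNReal.ofReal_mul (by positivity)]
      exact ENNReal.ofReal_le_ofReal (by rw [hA]; linarith)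
    · refine (av_l1 hk.cont hf.meas x).trans ?_
      rw [ENNReal.ofReal_mul hIp.le]
      gcongr
  rcases (measureReal_nonneg (μ := volume) (s := F)).eq_or_lt with hV0 | hVp
  · have hz : ∀ x, Se s (dil L κ) f x = 0 := by
      intro x
      have h0 : volume F = 0 := by rw [← hVe, hV, ← hV0]; simp
      have : f =ᵐ[volume] 0 := by
        rw [Filter.EventuallyEq, ae_iff]; exact h0
      have h1 : ∀ b, av (dil L κ) f x b = 0 := by
        intro b
        refine integral_eq_zero_of_ae ?_
        filter_upwards [this] with y hy
        rw [hy]; simp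
      simp [Se, h1, ENNReal.zero_rpow_of_pos hs0]
    simp [hz, ENNReal.zero_rpow_of_pos hθ0]
  have hVp' : 0 < V := hVp
  set B := C2 * L ^ (-γ) * V with hB
  have hBp : 0 < B := by positivity
  have hfin := fun x => Se_fin hs0.le hk hf.integrable x
  set S : Euc (n+1) → ℝ := fun x => (Se s (dil L κ) f x).toReal with hS
  have hSm : Measurable S := (Se_meas hk.cont hf.meas).ennreal_toReal
  have hfm : IsFiniteMeasure (volume.restrict (SB (n+1))) := ⟨by rw [Measure.restrict_apply_univ]; exact (SB_fin _).lt_top⟩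
  have main := weak_strong (μ := volume.restrict (SB (n+1))) hSm (fun x => ENNReal.toReal_nonneg) hBp hθ0 hθm (by
    intro t ht
    set E := {x | t < S x} ∩ SB (n+1) with hE
    have hEm0 : MeasurableSet {x | t < S x} := measurableSet_lt measurable_const hSm
    have hEm : MeasurableSet E := hEm0.inter (SB_meas _)
    rw [Measure.restrict_apply hEm0]
    have hEf : volume E ≠ ⊤ := ne_top_of_le_ne_top (SB_fin _) (measure_mono inter_subset_right)
    set K := A ^ (s - 1 - β) * (I * V) ^ (1 - β) with hK
    have hKp : 0 < K := by positivity
    set l := (t / K) ^ (1 / (2 * β)) with hl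
    have hlp : 0 < l := by positivity
    have hl2 : l ^ 2 = (t / K) ^ (1 / β) := by
      rw [hl, ← Real.rpow_natCast, ← Real.rpow_mul (by positivity)]; congr 1; push_cast; field_simp
    have hlβ : (l ^ 2) ^ β = t / K := by
      rw [hl2, ← Real.rpow_mul (by positivity), one_div, inv_mul_cancel₀ hβ.ne', Real.rpow_one]
    have h1 := hw τ hτ hτ1 L hL f 1 3 hf l hlp E hEm inter_subset_right (by
      intro x hx
      have hx1 : t < S x := hx.1
      have h2 : ENNReal.ofReal t ≤ ENNReal.ofReal K * N2 (dil L κ) f x ^ β := by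
        refine le_trans ?_ (hSe x)
        rw [← ENNReal.ofReal_toReal (hfin x)]
        exact ENNReal.ofReal_le_ofReal hx1.le
      rw [← ENNReal.rpow_le_rpow_iff hβ, ENNReal.ofReal_rpow_of_nonneg (by positivity) hβ.le, hlβ, ENNReal.ofReal_div_of_pos hKp]
      exact ENNReal.div_le_of_le_mul' h2)
    set e := volume.real E with he
    have he0 : 0 ≤ e := measureReal_nonneg
    have h2 : e ^ τ ≤ C1 * L ^ (-((n:ℝ) * (1 + τ) / 2)) * V / l ^ 2 := h1.trans (by gcongr)
    have h3 : (e ^ τ) ^ β ≤ B / t := by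
      refine (Real.rpow_le_rpow (by positivity) h2 hβ.le).trans (le_of_eq ?_)
      rw [Real.div_rpow (by positivity) (by positivity), hlβ, Real.mul_rpow (by positivity) (by positivity),
        Real.mul_rpow (by positivity) (by positivity), ← Real.rpow_mul hLp.le, hB, hC2, hK, Real.mul_rpow hIp.le hVp'.le]
      have e1 : -((n:ℝ) * (1 + τ) / 2) * β = -γ := by rw [hγ]; ring
      have e2 : V = V ^ β * V ^ (1 - β) := by rw [← Real.rpow_add hVp']; simp
      rw [e1]
      conv_rhs => rw [e2]
      field_simp
    have h4 : e ≤ (B / t) ^ m := by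
      have := Real.rpow_le_rpow (by positivity) h3 (by positivity : 0 ≤ m)
      rwa [← Real.rpow_mul he0, ← Real.rpow_mul he0, hm, show τ * β * (1 / (β * τ)) = 1 by field_simp, Real.rpow_one] at this
    rw [← ENNReal.ofReal_toReal hEf]
    exact ENNReal.ofReal_le_ofReal h4)
  calc ∫⁻ x in SB (n+1), Se s (dil L κ) f x ^ θ = ∫⁻ x in SB (n+1), ENNReal.ofReal (S x ^ θ) := by
        refine lintegral_congr fun x => ?_
        rw [← ENNReal.ofReal_rpow_of_nonneg ENNReal.toReal_nonneg hθ0.le, ENNReal.ofReal_toReal (hfin x)]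
    _ ≤ _ := main
    _ = _ := by
        congr 1
        rw [measureReal_restrict_apply_univ, ← hC3, hB, mul_assoc (C3 ^ (1/θ)), mul_assoc (C3 ^ (1/θ)), Real.mul_rpow (x := C3 ^ (1/θ)) (by positivity) (by positivity),
          ← Real.rpow_mul hC3p.le, one_div, inv_mul_cancel₀ hθ0.ne', Real.rpow_one]
end Pent
end

section
open MeasureTheory Metric Set
open scoped ENNReal NNReal FourierTransform ContDiff
namespace Pent
variable {d n : ℕ}

/-- mixed norm of a nonnegative function on SB × [1,4] -/
def Mx (q s : ℝ) (a : Euc d × ℝ → ℝ≥0∞) : ℝ≥0∞ := (∫⁻ x in SB d, (∫⁻ b in Icc (1:ℝ) 4, a (x, b) ^ s) ^ (q / s)) ^ (1 / q)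

lemma Mx_mono {q s : ℝ} (hq : 0 < q) (hs : 0 < s) {a a' : Euc d × ℝ → ℝ≥0∞} (h : ∀ x ∈ SB d, ∀ b ∈ Icc (1:ℝ) 4, a (x, b) ≤ a' (x, b)) :
    Mx q s a ≤ Mx q s a' := by
  unfold Mx
  gcongr ?_ ^ _
  refine setLIntegral_mono' (SB_meas d) fun x hx => ?_
  gcongr ?_ ^ _
  refine setLIntegral_mono' measurableSet_Icc fun b hb => ?_
  gcongr
  exact h x hx b hb

lemma Mx_add {q s : ℝ} (hq : 1 ≤ q) (hs : 1 ≤ s) {a a' : Euc d × ℝ → ℝ≥0∞} (ha : Measurable a) (ha' : Measurable a') :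
    Mx q s (fun z => a z + a' z) ≤ Mx q s a + Mx q s a' := by
  have hs0 : 0 < s := by linarith
  have key : ∀ c : Euc d × ℝ → ℝ≥0∞, Mx q s c = (∫⁻ x in SB d, ((∫⁻ b in Icc (1:ℝ) 4, c (x, b) ^ s) ^ (1 / s)) ^ q) ^ (1 / q) := by
    intro c
    unfold Mx
    congr 2; ext x
    rw [← ENNReal.rpow_mul]; congr 1; ring
  have hm : ∀ c : Euc d × ℝ → ℝ≥0∞, Measurable c → Measurable (fun x => (∫⁻ b in Icc (1:ℝ) 4, c (x, b) ^ s) ^ (1 / s)) := by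
    intro c hc
    have : Measurable (fun z : Euc d × ℝ => c z ^ s) := hc.pow_const s
    exact (this.lintegral_prod_right').pow_const _
  rw [key, key, key]
  refine le_trans ?_ (ENNReal.lintegral_Lp_add_le (hm a ha).aemeasurable (hm a' ha').aemeasurable hq)
  gcongr ?_ ^ _
  refine lintegral_mono fun x => ?_
  gcongr ?_ ^ _
  have h1 : Measurable (fun b => a (x, b)) := ha.comp measurable_prodMk_left
  have h2 : Measurable (fun b => a' (x, b)) := ha'.comp measurable_prodMk_left
  exact ENNReal.lintegral_Lp_add_le h1.aemeasurable h2.aemeasurable hs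

lemma Mx_const {q s : ℝ} (hq : 0 < q) (hs : 0 < s) (a : Euc d × ℝ → ℝ≥0∞) {c : ℝ≥0∞} (hc : c ≠ ⊤) :
    Mx q s (fun z => c * a z) = c * Mx q s a := by
  unfold Mx
  have h1 : ∀ x, ∫⁻ b in Icc (1:ℝ) 4, (c * a (x, b)) ^ s = c ^ s * ∫⁻ b in Icc (1:ℝ) 4, a (x, b) ^ s := by
    intro x
    simp_rw [ENNReal.mul_rpow_of_nonneg _ _ hs.le]
    rw [lintegral_const_mul' _ _ (ENNReal.rpow_ne_top_of_nonneg hs.le hc)]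
  simp_rw [h1, ENNReal.mul_rpow_of_nonneg _ _ (by positivity : 0 ≤ q / s), ← ENNReal.rpow_mul]
  have e : s * (q / s) = q := by field_simp
  rw [e, lintegral_const_mul' _ _ (ENNReal.rpow_ne_top_of_nonneg hq.le hc), ENNReal.mul_rpow_of_nonneg _ _ (by positivity), ← ENNReal.rpow_mul,
    mul_one_div, div_self hq.ne', ENNReal.rpow_one]

/-- mixed norm of av -/
def Nm (q s : ℝ) (k : ℝ → ℝ) (f : Euc d → ℝ) : ℝ≥0∞ := Mx q s (fun z => ‖av k f z.1 z.2‖ₑ)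

lemma av_int {k : ℝ → ℝ} {Kb : ℝ} (hk : Continuous k) (hb : ∀ s, |k s| ≤ Kb) {f : Euc d → ℝ} (hf : Integrable f) (x : Euc d) (b : ℝ) :
    Integrable (fun y => k (b - ‖x - y‖ ^ 2) * f y) :=
  hf.bdd_mul (c := Kb) (hk.comp (by fun_prop)).aestronglyMeasurable (Filter.Eventually.of_forall fun y => hb _)

lemma Nm_add {q s : ℝ} (hq : 1 ≤ q) (hs : 1 ≤ s) {k : ℝ → ℝ} {Kb : ℝ} (hk : Kn k Kb) {f g : Euc d → ℝ} (hf : Integrable f) (hg : Integrable g)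
    (hfm : Measurable f) (hgm : Measurable g) : Nm q s k (fun y => f y + g y) ≤ Nm q s k f + Nm q s k g := by
  refine le_trans (Mx_mono (by linarith) (by linarith) fun x _ b _ => ?_) (Mx_add hq hs (av_meas hk.cont hfm).enorm (av_meas hk.cont hgm).enorm)
  have : av k (fun y => f y + g y) x b = av k f x b + av k g x b := by
    unfold av
    rw [← integral_add (av_int hk.cont hk.bdd hf x b) (av_int hk.cont hk.bdd hg x b)]
    congr 1; ext y; ring
  simp only [this]
  exact enorm_add_le _ _

lemma Nm_zero {q s : ℝ} (hq : 0 < q) (hs : 0 < s) (k : ℝ → ℝ) : Nm q s k (fun _ : Euc d => 0) = 0 := by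
  simp [Nm, Mx, av, ENNReal.zero_rpow_of_pos hs, ENNReal.zero_rpow_of_pos hq, ENNReal.zero_rpow_of_pos (div_pos hq hs), ENNReal.zero_rpow_of_pos (inv_pos.2 hq)]

lemma Nm_sum {q s : ℝ} (hq : 1 ≤ q) (hs : 1 ≤ s) {k : ℝ → ℝ} {Kb : ℝ} (hk : Kn k Kb) {ι : Type*} (F : Finset ι) {g : ι → Euc d → ℝ}
    (hg : ∀ i, Integrable (g i)) (hgm : ∀ i, Measurable (g i)) : Nm q s k (fun y => ∑ i ∈ F, g i y) ≤ ∑ i ∈ F, Nm q s k (g i) := by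
  classical
  induction F using Finset.induction_on with
  | empty => simp [Nm_zero (by linarith : 0 < q) (by linarith : 0 < s)]
  | insert a F ha ih =>
    simp_rw [Finset.sum_insert ha]
    refine (Nm_add hq hs hk (hg a) (integrable_finsetSum _ fun i _ => hg i) (hgm a) (Finset.measurable_fun_sum _ fun i _ => hgm i)).trans ?_
    gcongr

lemma Nm_const {q s : ℝ} (hq : 0 < q) (hs : 0 < s) (k : ℝ → ℝ) (f : Euc d → ℝ) {c : ℝ} (hc : 0 ≤ c) :
    Nm q s k (fun y => c * f y) = ENNReal.ofReal c * Nm q s k f := by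
  rw [Nm, Nm, ← Mx_const hq hs _ (by simp)]
  congr 1; ext z
  have : av k (fun y => c * f y) z.1 z.2 = c * av k f z.1 z.2 := by
    unfold av; rw [← integral_const_mul]; congr 1; ext y; ring
  rw [this, enorm_mul, Real.enorm_of_nonneg hc]

/-- truncation -/
def tr (A : ℝ) (f : Euc d → ℝ) (j : ℕ) (y : Euc d) : ℝ := {y | |f y| ≤ 2 ^ j * A}.indicator f y

lemma tr_Bf {A M ρ : ℝ} (hA : 0 < A) {f : Euc d → ℝ} (hf : Bf f M ρ) (j : ℕ) : Bf (tr A f j) (2 ^ j * A) ρ := by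
  refine ⟨hf.meas.indicator (measurableSet_le (continuous_abs.measurable.comp hf.meas) measurable_const), fun y => ?_, fun y hy => ?_⟩
  · rw [tr, indicator_apply]; split_ifs with h
    · exact h
    · rw [abs_zero]; positivity
  · rw [tr, indicator_apply]; split_ifs
    · exact hf.supp y hy
    · rfl

lemma Bf.sub {M M' ρ : ℝ} {f g : Euc d → ℝ} (hf : Bf f M ρ) (hg : Bf g M' ρ) : Bf (fun y => f y - g y) (M + M') ρ :=
  ⟨hf.meas.sub hg.meas, fun y => (abs_sub _ _).trans (add_le_add (hf.bdd y) (hg.bdd y)), fun y hy => by rw [hf.supp y hy, hg.supp y hy, sub_zero]⟩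

theorem strong (hn : 2 ≤ n) {κ : ℝ → ℝ} (hκ : IsKer (n+1) κ) {τ β s q p : ℝ} (hτ : (n:ℝ)/(n+2) ≤ τ) (hτ1 : τ ≤ 1) (hβ : 0 < β) (hβ1 : β ≤ 1)
    (hs : 1 + β ≤ s) (hq : 1 ≤ q) (hqs : q * (β * τ) < s) (hp : s < p) : ∃ C L0 : ℝ, 0 < C ∧ 1 ≤ L0 ∧
    (∀ L ≥ L0, ∃ Kb, Kn (dil L κ) Kb) ∧ ∀ L ≥ L0, ∀ (f : Euc (n+1) → ℝ) M, Bf f M 3 → ∀ A > 0, ∫⁻ y, ‖f y‖ₑ ^ p ≤ ENNReal.ofReal (A ^ p) →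
    Nm q s (dil L κ) f ≤ ENNReal.ofReal (C * L ^ (-(β * ((n:ℝ) * (1 + τ) / 2) / s)) * A) := by
  obtain ⟨C1, L0, hC1, hL0, hkn, hw⟩ := rwt hn hκ hτ hτ1 hβ hβ1 hs (by linarith) hqs
  have hs0 : 0 < s := by linarith
  have hq0 : 0 < q := by linarith
  set γ := β * ((n:ℝ) * (1 + τ) / 2) with hγ
  set ρ : ℝ := 2 ^ (1 - p / s) with hρ
  have hρ1 : ρ < 1 := Real.rpow_lt_one_of_one_lt_of_neg (by norm_num) (by rw [sub_neg, lt_div_iff₀ hs0]; linarith)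
  have hρ0 : 0 < ρ := by positivity
  set VB := volume.real (closedBall (0 : Euc (n+1)) 3) with hVB
  have hVB0 : 0 ≤ VB := measureReal_nonneg
  set C2 := C1 ^ (1/s) * (VB ^ (1/s) + 4 * (1 - ρ)⁻¹) with hC2
  have h1ρ : 0 < 1 - ρ := by linarith
  refine ⟨C2, L0, by positivity, hL0, hkn, ?_⟩
  intro L hL f M hf A hA hfA
  obtain ⟨Kb, hk⟩ := hkn L hL
  have hLp : 0 < L := by linarith
  -- scaled restricted estimate
  have rs : ∀ (g : Euc (n+1) → ℝ) H, 0 < H → Bf g H 3 → ∀ V, volume {y | g y ≠ 0} ≤ ENNReal.ofReal V → 0 ≤ V →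
      Nm q s (dil L κ) g ≤ ENNReal.ofReal (H * (C1 ^ (1/s) * L ^ (-(γ/s)) * V ^ (1/s))) := by
    intro g H hH hg V hV hV0
    have hB : Bf (fun y => H⁻¹ * g y) 1 3 := by
      refine ⟨hg.meas.const_mul _, fun y => ?_, fun y hy => by rw [hg.supp y hy, mul_zero]⟩
      rw [abs_mul, abs_of_pos (inv_pos.2 hH), inv_mul_le_one₀ hH]
      exact hg.bdd y
    have e : g = fun y => H * (H⁻¹ * g y) := by ext y; field_simp
    have h1 := hw L hL _ hB
    have hset : {y | H⁻¹ * g y ≠ 0} = {y | g y ≠ 0} := by ext y; simp [hH.ne']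
    rw [hset] at h1
    rw [e, Nm_const hq0 hs0 _ _ hH.le, ENNReal.ofReal_mul hH.le]
    gcongr
    have h2 : Nm q s (dil L κ) (fun y => H⁻¹ * g y) = (∫⁻ x in SB (n+1), Se s (dil L κ) (fun y => H⁻¹ * g y) x ^ (q / s)) ^ (1/q) := rfl
    rw [h2]
    refine (ENNReal.rpow_le_rpow h1 (by positivity)).trans ?_
    rw [ENNReal.ofReal_rpow_of_nonneg (by positivity) (by positivity), ← Real.rpow_mul (by positivity)]
    refine ENNReal.ofReal_le_ofReal ?_
    have hVr : volume.real {y | g y ≠ 0} ≤ V := ENNReal.toReal_le_of_le_ofReal hV0 hV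
    have e2 : q / s * (1 / q) = 1 / s := by field_simp
    rw [e2, Real.mul_rpow (by positivity) (by positivity), Real.mul_rpow (by positivity) (by positivity), ← Real.rpow_mul hLp.le]
    have e3 : -γ * (1 / s) = -(γ / s) := by ring
    rw [e3]
    gcongr
  obtain ⟨K, hK⟩ : ∃ K : ℕ, M ≤ 2 ^ K * A := by
    obtain ⟨K, hK⟩ := pow_unbounded_of_one_lt (M / A) (one_lt_two)
    exact ⟨K, by rw [div_lt_iff₀ hA] at hK; exact hK.le⟩
  have hdec : f = fun y => tr A f 0 y + ∑ j ∈ Finset.range K, (tr A f (j+1) y - tr A f j y) := by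
    ext y
    rw [Finset.sum_range_sub (fun j => tr A f j y)]
    have : tr A f K y = f y := indicator_of_mem (show y ∈ {y | |f y| ≤ 2 ^ K * A} from (hf.bdd y).trans hK) _
    rw [this]; ring
  have hBj := fun j => (tr_Bf hA hf (j+1)).sub (tr_Bf hA hf j)
  have h0 : Nm q s (dil L κ) (tr A f 0) ≤ ENNReal.ofReal (A * (C1 ^ (1/s) * L ^ (-(γ/s)) * VB ^ (1/s))) := by
    refine rs _ A hA (by simpa using tr_Bf hA hf 0) VB ?_ hVB0
    rw [hVB, Measure.real, ENNReal.ofReal_toReal measure_closedBall_lt_top.ne]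
    refine measure_mono fun y hy => ?_
    rw [mem_closedBall, dist_zero_right]
    by_contra h; exact hy ((tr_Bf hA hf 0).supp y (not_le.1 h))
  have hj : ∀ j, Nm q s (dil L κ) (fun y => tr A f (j+1) y - tr A f j y) ≤
      ENNReal.ofReal (4 * A * (C1 ^ (1/s) * L ^ (-(γ/s))) * ρ ^ j) := by
    intro j
    have hV : volume {y | tr A f (j+1) y - tr A f j y ≠ 0} ≤ ENNReal.ofReal ((2:ℝ) ^ (-(j * p))) := by
      have hsub : {y | tr A f (j+1) y - tr A f j y ≠ 0} ⊆ {y | ENNReal.ofReal ((2 ^ j * A) ^ p) ≤ ‖f y‖ₑ ^ p} := by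
        intro y hy
        have h1 : 2 ^ j * A < |f y| := by
          by_contra h
          rw [not_lt] at h
          apply hy
          have a1 : tr A f j y = f y := indicator_of_mem (show y ∈ {y | |f y| ≤ 2 ^ j * A} from h) _
          have a2 : tr A f (j+1) y = f y := indicator_of_mem (show y ∈ {y | |f y| ≤ 2 ^ (j+1) * A} from h.trans (by gcongr; norm_num; lia)) _
          rw [a1, a2, sub_self]
        show ENNReal.ofReal ((2 ^ j * A) ^ p) ≤ ‖f y‖ₑ ^ p
        rw [← ENNReal.ofReal_rpow_of_nonneg (by positivity) (by linarith), ← ofReal_norm]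
        refine ENNReal.rpow_le_rpow (ENNReal.ofReal_le_ofReal h1.le) (by linarith)
      have hch := mul_meas_ge_le_lintegral (μ := volume) (f := fun y => ‖f y‖ₑ ^ p) (hf.meas.enorm.pow_const p) (ENNReal.ofReal ((2 ^ j * A) ^ p))
      have h2 := hch.trans hfA
      refine (measure_mono hsub).trans ?_
      have hpos : 0 < (2 ^ j * A) ^ p := by positivity
      rw [mul_comm, ← ENNReal.le_div_iff_mul_le (Or.inl (by simpa using hpos)) (Or.inl (by simp)), ← ENNReal.ofReal_div_of_pos hpos] at h2
      refine h2.trans (ENNReal.ofReal_le_ofReal (le_of_eq ?_))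
      rw [Real.mul_rpow (by positivity) hA.le, ← Real.rpow_natCast, ← Real.rpow_mul (by norm_num), Real.rpow_neg (by norm_num)]
      have := (Real.rpow_pos_of_pos hA p).ne'
      field_simp
    have hH : 2 ^ (j+1) * A + 2 ^ j * A ≤ 4 * (2 ^ j * A) := by
      rw [pow_succ]; have : 0 < 2 ^ j * A := by positivity
      nlinarith
    have hBf : Bf (fun y => tr A f (j+1) y - tr A f j y) (4 * (2 ^ j * A)) 3 :=
      ⟨(hBj j).meas, fun y => ((hBj j).bdd y).trans hH, (hBj j).supp⟩
    refine (rs _ _ (by positivity) hBf _ hV (by positivity)).trans (ENNReal.ofReal_le_ofReal (le_of_eq ?_))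
    have e1 : ((2:ℝ) ^ (-(j * p))) ^ (1/s) * 2 ^ j = ρ ^ j := by
      rw [hρ, ← Real.rpow_mul (by norm_num), ← Real.rpow_natCast, ← Real.rpow_natCast, ← Real.rpow_mul (by norm_num), ← Real.rpow_add (by norm_num)]
      congr 1; ring
    rw [← e1]; ring
  rw [hdec]
  refine (Nm_add hq (by linarith) hk (tr_Bf hA hf 0).integrable (integrable_finsetSum _ fun j _ => (hBj j).integrable) (tr_Bf hA hf 0).meas
    (Finset.measurable_fun_sum _ fun j _ => (hBj j).meas)).trans ?_
  have hsum := (Nm_sum hq (by linarith) hk (Finset.range K) (fun j => (hBj j).integrable) (fun j => (hBj j).meas)).trans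
    (Finset.sum_le_sum fun j _ => hj j)
  refine (add_le_add h0 hsum).trans ?_
  rw [← ENNReal.ofReal_sum_of_nonneg (fun j _ => by positivity), ← ENNReal.ofReal_add (by positivity) (Finset.sum_nonneg fun j _ => by positivity)]
  refine ENNReal.ofReal_le_ofReal ?_
  rw [← Finset.mul_sum]
  have hg : ∑ j ∈ Finset.range K, ρ ^ j ≤ (1 - ρ)⁻¹ := by
    rw [← tsum_geometric_of_lt_one hρ0.le hρ1]
    exact (summable_geometric_of_lt_one hρ0.le hρ1).sum_le_tsum _ (fun j _ => by positivity)
  calc _ ≤ A * (C1 ^ (1/s) * L ^ (-(γ/s)) * VB ^ (1/s)) + 4 * A * (C1 ^ (1/s) * L ^ (-(γ/s))) * (1 - ρ)⁻¹ := by gcongr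
    _ = _ := by rw [hC2]; ring
end Pent
end

section
open MeasureTheory Metric Set
open scoped ENNReal NNReal FourierTransform ContDiff
namespace Pent
variable {d n : ℕ}

lemma polar_vol (hd : 1 ≤ d) : (volume : Measure (Euc d)) =
    Measure.map (fun p : ℝ × Euc d => p.1 • p.2) (((volume.restrict (Ioi (0:ℝ))).withDensity (fun s => ENNReal.ofReal (s ^ (d-1)))).prod (sfm d)) := by
  apply Measure.ext_of_lintegral
  intro φ hφ
  have hm : Measurable (fun p : ℝ × Euc d => φ (p.1 • p.2)) := by fun_prop
  rw [lintegral_map hφ (by fun_prop), lintegral_prod _ hm.aemeasurable, lintegral_withDensity_eq_lintegral_mul _ (by fun_prop) hm.lintegral_prod_right',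
    polar_lint hd hφ]
  rfl

lemma polar_intR (hd : 1 ≤ d) {φ : Euc d → ℝ} (hφ : Integrable φ) :
    ∫ y, φ y = ∫ s in Ioi (0:ℝ), s ^ (d-1) * ∫ θ, φ (s • θ) ∂(sfm d) := by
  have hi := hφ
  rw [polar_vol hd] at hi
  have hi' : Integrable (fun p : ℝ × Euc d => φ (p.1 • p.2)) _ := (integrable_map_measure hi.1 (by fun_prop)).1 hi
  conv_lhs => rw [polar_vol hd]
  rw [integral_map (by fun_prop) hi.1, integral_prod _ hi', integral_withDensity_eq_integral_toReal_smul (by fun_prop) (Filter.Eventually.of_forall fun _ => by simp)]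
  refine setIntegral_congr_fun measurableSet_Ioi fun s hs => ?_
  have hs : 0 < s := hs
  simp only [smul_eq_mul]
  rw [ENNReal.toReal_ofReal (by positivity)]

/-- real spherical average -/
def SA (f : Euc d → ℝ) (t : ℝ) (x : Euc d) : ℝ := ∫ y, f (x - t • y) ∂(sphereMeasure d)

lemma sphAvg_real (f : Euc d → ℝ) (t : ℝ) (x : Euc d) : sphAvg (fun y => (f y : ℂ)) t x = (SA f t x : ℂ) := by
  rw [sphAvg, SA, ← integral_complex_ofReal]

lemma sfm_int (hd : 3 ≤ d) (g : Euc d → ℝ) : ∫ y, g y ∂(sfm d) = (sfm d univ).toReal * ∫ y, g y ∂(sphereMeasure d) := by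
  have h0 := toSphere_univ_ne_zero hd
  have h1 := toSphere_univ_ne_top (d := d)
  rw [sphereMeasure, integral_smul_measure, smul_eq_mul, sfm_univ, ENNReal.toReal_inv, ← mul_assoc, mul_inv_cancel₀, one_mul]
  · rfl
  · exact ENNReal.toReal_ne_zero.2 ⟨h0, h1⟩

lemma sfm_pos (hd : 3 ≤ d) : 0 < (sfm d univ).toReal := by
  rw [sfm_univ]; exact ENNReal.toReal_pos (toSphere_univ_ne_zero hd) toSphere_univ_ne_top

lemma SA_cont (hd : 3 ≤ d) {f : Euc d → ℝ} (hf : Continuous f) {M : ℝ} (hM : ∀ y, |f y| ≤ M) :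
    Continuous (fun p : ℝ × Euc d => SA f p.1 p.2) := by
  have := sphereMeasure_prob hd
  refine continuous_of_dominated (bound := fun _ => M) (fun p => (Continuous.aestronglyMeasurable (by fun_prop))) (fun p => Filter.Eventually.of_forall fun y => hM _)
    (integrable_const _) (Filter.Eventually.of_forall fun y => by fun_prop)

lemma SA_bdd (hd : 3 ≤ d) {f : Euc d → ℝ} {M : ℝ} (hM : ∀ y, |f y| ≤ M) (t : ℝ) (x : Euc d) : |SA f t x| ≤ M := by
  have := sphereMeasure_prob hd
  have h := norm_integral_le_of_norm_le_const (μ := sphereMeasure d) (f := fun y => f (x - t • y)) (C := M) (Filter.Eventually.of_forall fun y => hM _)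
  simpa [SA] using h

lemma subst_intR (g : ℝ → ℝ) : ∫ v in Ioi (0:ℝ), g v = ∫ s in Ioi (0:ℝ), (2 * s) * g (s ^ 2) := by
  have h := subst_int (fun v => (g v : ℂ))
  have e : ∀ s : ℝ, (2 * s : ℝ) • (g (s^2) : ℂ) = (((2 * s) * g (s^2) : ℝ) : ℂ) := by
    intro s; rw [Complex.real_smul]; push_cast; rfl
  simp_rw [e] at h
  rw [integral_complex_ofReal, integral_complex_ofReal] at h
  exact_mod_cast h

/-- radial profile -/
def Gp (f : Euc d → ℝ) (x : Euc d) (m : ℝ) : ℝ := (sfm d univ).toReal / 2 * (max m 0 ^ (((d:ℝ) - 2) / 2) * SA f (Real.sqrt m) x)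

lemma av_Gp (hd : 3 ≤ d) {k : ℝ → ℝ} {K : ℝ} (hk : Continuous k) (hK : ∀ s, |k s| ≤ K) {f : Euc d → ℝ} (hf : Integrable f) (x : Euc d) (b : ℝ) :
    av k f x b = ∫ u, k u * Gp f x (b - u) := by
  have hd' : (3:ℝ) ≤ d := by exact_mod_cast hd
  have e1 : av k f x b = ∫ z, k (b - ‖z‖ ^ 2) * f (x - z) := by
    rw [av, ← integral_sub_left_eq_self _ volume x]; simp
  have hIntg : Integrable (fun z => k (b - ‖z‖ ^ 2) * f (x - z)) :=
    (hf.comp_sub_left x).bdd_mul (c := K) (hk.comp (by fun_prop)).aestronglyMeasurable (Filter.Eventually.of_forall fun y => hK _)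
  rw [e1, polar_intR (by lia) hIntg, ← integral_sub_left_eq_self _ volume b]
  have e2 : ∫ m, k (b - m) * Gp f x (b - (b - m)) = ∫ m in Ioi (0:ℝ), k (b - m) * Gp f x m := by
    rw [setIntegral_eq_integral_of_forall_compl_eq_zero]
    · simp
    · intro m hm
      have hm : m ≤ 0 := not_lt.1 hm
      rw [Gp, max_eq_right hm, Real.zero_rpow (by linarith)]; simp
  rw [e2, subst_intR (fun m => k (b - m) * Gp f x m)]
  refine setIntegral_congr_fun measurableSet_Ioi fun s hs => ?_
  have hs : 0 < s := hs
  have e3 : ∫ θ, k (b - ‖s • θ‖ ^ 2) * f (x - s • θ) ∂(sfm d) = k (b - s ^ 2) * ∫ θ, f (x - s • θ) ∂(sfm d) := by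
    rw [← integral_const_mul]
    refine integral_congr_ae ?_
    filter_upwards [sfm_ae d] with θ hθ
    rw [norm_smul, hθ, mul_one, Real.norm_eq_abs, sq_abs]
  rw [e3, sfm_int hd, Gp, Real.sqrt_sq hs.le, max_eq_left (by positivity)]
  have : (s ^ 2) ^ (((d:ℝ) - 2) / 2) = s ^ (d - 1) / s := by
    rw [← Real.rpow_natCast s 2, ← Real.rpow_mul hs.le, ← Real.rpow_natCast, ← Real.rpow_sub_one hs.ne']
    congr 1
    push_cast [show 1 ≤ d by lia]; ring
  rw [this, SA]; field_simp

lemma Gp_cont (hd : 3 ≤ d) {f : Euc d → ℝ} (hf : Continuous f) {M : ℝ} (hM : ∀ y, |f y| ≤ M) (x : Euc d) : Continuous (Gp f x) := by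
  have hd' : (3:ℝ) ≤ d := by exact_mod_cast hd
  have h1 : Continuous (fun m : ℝ => SA f (Real.sqrt m) x) := (SA_cont hd hf hM).comp (by fun_prop : Continuous fun m : ℝ => (Real.sqrt m, x))
  have h2 : Continuous (fun m : ℝ => max m 0 ^ (((d:ℝ) - 2) / 2)) := (by fun_prop : Continuous fun m : ℝ => max m 0).rpow_const fun m => Or.inr (by linarith)
  exact continuous_const.mul (h2.mul h1)

lemma av_lim (hd : 3 ≤ d) {φ : ℝ → ℝ} (hφ : Continuous φ) (hc : HasCompactSupport φ) (h1 : ∫ x, φ x = 1) {f : Euc d → ℝ} (hf : Continuous f)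
    (hfc : HasCompactSupport f) (x : Euc d) (b : ℝ) (Ls : ℕ → ℝ) (hL1 : ∀ j, 1 ≤ Ls j) (hL : Filter.Tendsto Ls Filter.atTop Filter.atTop) :
    Filter.Tendsto (fun j => av (dil (Ls j) φ) f x b) Filter.atTop (nhds (Gp f x b)) := by
  obtain ⟨K, hK0, hK⟩ := test_bdd hφ hc
  obtain ⟨A, hA0, hA⟩ := test_supp hc
  obtain ⟨M, hM⟩ := hfc.exists_bound_of_continuous hf
  have hG := Gp_cont hd hf hM x
  obtain ⟨B, hB⟩ := (isCompact_Icc (a := b - A) (b := b + A)).exists_bound_of_continuousOn hG.continuousOn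
  have e : ∀ j, av (dil (Ls j) φ) f x b = ∫ v, φ v * Gp f x (b - v / Ls j) := by
    intro j
    have hj : 0 < Ls j := by linarith [hL1 j]
    rw [av_Gp hd (dil_props hj hφ hK hA).1 (dil_props hj hφ hK hA).2.1 (hf.integrable_of_hasCompactSupport hfc)]
    have := Measure.integral_comp_mul_left (fun v => φ v * Gp f x (b - v / Ls j)) (Ls j)
    rw [abs_of_pos (inv_pos.2 hj), smul_eq_mul] at this
    rw [← mul_inv_cancel_left₀ hj.ne' (∫ v, φ v * Gp f x (b - v / Ls j)), ← this, ← integral_const_mul]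
    congr 1; ext u
    rw [dil, mul_div_cancel_left₀ _ hj.ne']; ring
  simp_rw [e]
  have hlim : Gp f x b = ∫ v, φ v * Gp f x b := by rw [integral_mul_const, h1, one_mul]
  rw [hlim]
  refine tendsto_integral_of_dominated_convergence (fun v => |φ v| * B) (fun j => Continuous.aestronglyMeasurable (by fun_prop))
    (((hφ.integrable_of_hasCompactSupport hc).abs).mul_const B) (fun j => Filter.Eventually.of_forall fun v => ?_) (Filter.Eventually.of_forall fun v => ?_)
  · rw [norm_mul, Real.norm_eq_abs]
    by_cases hv : A < |v|
    · rw [hA v hv]; simp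
    · gcongr
      apply hB
      have hj := hL1 j
      have : |v / Ls j| ≤ A := by
        rw [abs_div, abs_of_pos (by linarith : 0 < Ls j), div_le_iff₀ (by linarith)]
        nlinarith
      rw [abs_le] at this
      constructor <;> linarith
  · refine Filter.Tendsto.const_mul _ ((hG.tendsto b).comp ?_)
    have : Filter.Tendsto (fun j => b - v / Ls j) Filter.atTop (nhds (b - 0)) := tendsto_const_nhds.sub (hL.const_div_atTop v)
    simpa using this
end Pent
end

section
open MeasureTheory Metric Set
open scoped ENNReal NNReal FourierTransform ContDiff
namespace Pent
variable {d n : ℕ}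

lemma rVar_add {r : ℝ} (hr : 1 ≤ r) (E : Set ℝ) (a b : ℝ → ℂ) : rVar r E (fun t => a t + b t) ≤ rVar r E a + rVar r E b := by
  refine iSup_le fun N => iSup_le fun t => iSup_le fun ht => iSup_le fun hm => ?_
  have h1 : (∑ i : Fin N, (‖a (t i.succ) - a (t i.castSucc)‖₊ : ℝ≥0∞) ^ r) ^ (1 / r) ≤ rVar r E a :=
    le_iSup_of_le N (le_iSup_of_le t (le_iSup_of_le ht (le_iSup_of_le hm le_rfl)))
  have h2 : (∑ i : Fin N, (‖b (t i.succ) - b (t i.castSucc)‖₊ : ℝ≥0∞) ^ r) ^ (1 / r) ≤ rVar r E b :=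
    le_iSup_of_le N (le_iSup_of_le t (le_iSup_of_le ht (le_iSup_of_le hm le_rfl)))
  refine le_trans ?_ ((ENNReal.Lp_add_le Finset.univ _ _ hr).trans (add_le_add h1 h2))
  gcongr with i
  have : a (t i.succ) + b (t i.succ) - (a (t i.castSucc) + b (t i.castSucc)) = (a (t i.succ) - a (t i.castSucc)) + (b (t i.succ) - b (t i.castSucc)) := by ring
  rw [this]
  exact enorm_add_le (a (t i.succ) - a (t i.castSucc)) (b (t i.succ) - b (t i.castSucc))

lemma rVar_lim {r : ℝ} (hr : 0 < r) (E : Set ℝ) (a : ℕ → ℝ → ℂ) (a' : ℝ → ℂ) (h : ∀ t ∈ E, Filter.Tendsto (fun j => a j t) Filter.atTop (nhds (a' t)))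
    {B : ℝ≥0∞} (hB : ∀ j, rVar r E (a j) ≤ B) : rVar r E a' ≤ B := by
  refine iSup_le fun N => iSup_le fun t => iSup_le fun ht => iSup_le fun hm => ?_
  have hlim : Filter.Tendsto (fun j => (∑ i : Fin N, (‖a j (t i.succ) - a j (t i.castSucc)‖₊ : ℝ≥0∞) ^ r) ^ (1 / r)) Filter.atTop
      (nhds ((∑ i : Fin N, (‖a' (t i.succ) - a' (t i.castSucc)‖₊ : ℝ≥0∞) ^ r) ^ (1 / r))) := by
    refine ((ENNReal.continuous_rpow_const).tendsto _).comp (tendsto_finsetSum _ fun i _ => ?_)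
    refine ((ENNReal.continuous_rpow_const).tendsto _).comp ?_
    exact ((continuous_enorm).tendsto _).comp ((h _ (hm _)).sub (h _ (hm _)))
  refine le_of_tendsto' hlim fun j => le_trans ?_ (hB j)
  exact le_iSup_of_le N (le_iSup_of_le t (le_iSup_of_le ht (le_iSup_of_le hm le_rfl)))

lemma rVar_sq {r : ℝ} (u : ℝ → ℂ) : rVar r (Icc 1 2) (fun t => u (t ^ 2)) ≤ rVar r (Icc 1 4) u := by
  refine iSup_le fun N => iSup_le fun t => iSup_le fun ht => iSup_le fun hm => ?_
  refine le_iSup_of_le N (le_iSup_of_le (fun i => t i ^ 2) (le_iSup_of_le ?_ (le_iSup_of_le ?_ le_rfl)))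
  · intro i j hij
    have := ht hij
    have := (hm i).1
    show t i ^ 2 < t j ^ 2
    nlinarith
  · intro i
    have := hm i
    constructor <;> nlinarith [this.1, this.2]

lemma rVar_congr {r : ℝ} {E : Set ℝ} {a b : ℝ → ℂ} (h : ∀ t ∈ E, a t = b t) : rVar r E a = rVar r E b := by
  unfold rVar
  refine iSup_congr fun N => iSup_congr fun t => iSup_congr fun ht => iSup_congr fun hm => ?_
  simp_rw [h _ (hm _)]

lemma rVar_const_mul {r : ℝ} (hr : 0 < r) (E : Set ℝ) (c : ℂ) (a : ℝ → ℂ) : rVar r E (fun t => c * a t) ≤ ‖c‖ₑ * rVar r E a := by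
  refine iSup_le fun N => iSup_le fun t => iSup_le fun ht => iSup_le fun hm => ?_
  have h1 : (∑ i : Fin N, (‖a (t i.succ) - a (t i.castSucc)‖₊ : ℝ≥0∞) ^ r) ^ (1 / r) ≤ rVar r E a :=
    le_iSup_of_le N (le_iSup_of_le t (le_iSup_of_le ht (le_iSup_of_le hm le_rfl)))
  refine le_trans (le_of_eq ?_) (mul_le_mul_right h1 _)
  have : ∀ i : Fin N, (‖c * a (t i.succ) - c * a (t i.castSucc)‖₊ : ℝ≥0∞) ^ r = ‖c‖ₑ ^ r * (‖a (t i.succ) - a (t i.castSucc)‖₊ : ℝ≥0∞) ^ r := by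
    intro i
    rw [← ENNReal.mul_rpow_of_nonneg _ _ hr.le, ← mul_sub]
    congr 1
    exact enorm_mul _ _
  simp_rw [this]
  rw [← Finset.mul_sum, ENNReal.mul_rpow_of_nonneg _ _ (by positivity), ← ENNReal.rpow_mul, mul_one_div, div_self hr.ne', ENNReal.rpow_one]

lemma av_deriv {k k' : ℝ → ℝ} {K : ℝ} (hk : ∀ s, HasDerivAt k (k' s) s) (hk' : Continuous k') (hK : ∀ s, |k s| ≤ K) (hK' : ∀ s, |k' s| ≤ K)
    {g : Euc d → ℝ} (hg : Integrable g) (x : Euc d) (b : ℝ) : HasDerivAt (fun b => av k g x b) (av k' g x b) b := by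
  have hkc : Continuous k := continuous_iff_continuousAt.2 fun s => (hk s).continuousAt
  refine (hasDerivAt_integral_of_dominated_loc_of_deriv_le (F := fun b y => k (b - ‖x - y‖ ^ 2) * g y) (F' := fun b y => k' (b - ‖x - y‖ ^ 2) * g y)
    (bound := fun y => K * |g y|) (s := univ) Filter.univ_mem ?_ ?_ ?_ ?_ ?_ ?_).2
  · exact Filter.Eventually.of_forall fun b => (av_int hkc hK hg x b).1
  · exact av_int hkc hK hg x b
  · exact (av_int hk' hK' hg x b).1
  · refine Filter.Eventually.of_forall fun y b _ => ?_
    rw [norm_mul]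
    exact mul_le_mul_of_nonneg_right (hK' _) (abs_nonneg _)
  · exact hg.abs.const_mul K
  · refine Filter.Eventually.of_forall fun y b _ => ?_
    have h1 : HasDerivAt (fun b => b - ‖x - y‖ ^ 2) 1 b := (hasDerivAt_id b).sub_const _
    have := ((hk (b - ‖x - y‖ ^ 2)).comp b h1).mul_const (g y)
    simpa using this

lemma dil_deriv {κ : ℝ → ℝ} (h : ContDiff ℝ ∞ κ) (L s : ℝ) : HasDerivAt (dil L κ) (L * dil L (deriv κ) s) s := by
  have h1 : HasDerivAt κ (deriv κ (L * s)) (L * s) := ((h.differentiable (by simp)) _).hasDerivAt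
  have h2 : HasDerivAt (fun s => L * s) L s := by simpa using (hasDerivAt_id s).const_mul L
  have := (h1.comp s h2).const_mul L
  refine this.congr_deriv ?_
  rw [dil]; ring

lemma av_mul (k : ℝ → ℝ) (c : ℝ) (g : Euc d → ℝ) (x : Euc d) (b : ℝ) : av (fun s => c * k s) g x b = c * av k g x b := by
  unfold av; rw [← integral_const_mul]; congr 1; ext y; ring

/-- weighted piece -/
def wp (κ : ℝ → ℝ) (g : Euc d → ℝ) (x : Euc d) (b : ℝ) : ℝ := b ^ (-(((d:ℝ) - 2) / 2)) * av κ g x b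

def Epc (s L : ℝ) (κ : ℝ → ℝ) (g : Euc d → ℝ) (x : Euc d) : ℝ≥0∞ :=
  (ENNReal.ofReal L * ∫⁻ b in Icc (1:ℝ) 4, (‖av (dil L κ) g x b‖ₑ + ‖av (dil L (deriv κ)) g x b‖ₑ) ^ s) ^ (1 / s)

lemma piece (hd : 3 ≤ d) {κ : ℝ → ℝ} (h : ContDiff ℝ ∞ κ) (hc : HasCompactSupport κ) {L s r : ℝ} (hL : 1 ≤ L) (hs : 1 ≤ s) (hsr : s ≤ r)
    {g : Euc d → ℝ} (hg : Integrable g) (x : Euc d) :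
    rVar r (Icc 1 4) (fun b => (wp (dil L κ) g x b : ℂ)) ≤ ENNReal.ofReal (4 * d) * Epc s L κ g x ∧
    ∀ b ∈ Icc (1:ℝ) 4, ‖wp (dil L κ) g x b‖ₑ ≤ ENNReal.ofReal (4 * d) * Epc s L κ g x := by
  have hd' : (3:ℝ) ≤ d := by exact_mod_cast hd
  have hs0 : 0 < s := by linarith
  have hL0 : 0 < L := by linarith
  set e := ((d:ℝ) - 2) / 2 with he
  have he0 : 0 ≤ e := by rw [he]; linarith
  have h' : ContDiff ℝ ∞ (deriv κ) := (contDiff_infty_iff_deriv.1 h).2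
  have h'' : ContDiff ℝ ∞ (deriv (deriv κ)) := (contDiff_infty_iff_deriv.1 h').2
  obtain ⟨K0, _, hK0⟩ := test_bdd h.continuous hc
  obtain ⟨K1, _, hK1⟩ := test_bdd h'.continuous hc.deriv
  obtain ⟨K2, _, hK2⟩ := test_bdd h''.continuous hc.deriv.deriv
  have gen : ∀ (χ : ℝ → ℝ) (A B : ℝ), ContDiff ℝ ∞ χ → (∀ s, |χ s| ≤ A) → (∀ s, |deriv χ s| ≤ B) → ∀ b,
      HasDerivAt (fun b => av (dil L χ) g x b) (L * av (dil L (deriv χ)) g x b) b := by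
    intro χ A B hχ hA hB b
    have := av_deriv (K := max (L * A) (L * (L * B))) (dil_deriv hχ L) (k' := fun s => L * dil L (deriv χ) s) ?_ ?_ ?_ hg x b
    · rwa [av_mul] at this
    · have := (contDiff_infty_iff_deriv.1 hχ).2.continuous
      unfold dil; fun_prop
    · intro s; refine le_trans ?_ (le_max_left _ _)
      rw [dil, abs_mul, abs_of_pos hL0]; gcongr; exact hA _
    · intro s; refine le_trans ?_ (le_max_right _ _)
      rw [dil, abs_mul, abs_mul, abs_of_pos hL0]; gcongr; exact hB _
  have d1 := gen κ K0 K1 h hK0 hK1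
  have d2 := gen (deriv κ) K1 K2 h' hK1 hK2
  set a := fun b => av (dil L κ) g x b with ha
  set a' := fun b => av (dil L (deriv κ)) g x b with ha'
  have ca : Continuous a := continuous_iff_continuousAt.2 fun b => (d1 b).continuousAt
  have ca' : Continuous a' := continuous_iff_continuousAt.2 fun b => (d2 b).continuousAt
  set w' : ℝ → ℝ := fun b => (-e * b ^ (-e - 1)) * a b + b ^ (-e) * (L * a' b) with hw'
  have hw : ∀ b ∈ Icc (1:ℝ) 4, HasDerivAt (fun b => wp (dil L κ) g x b) (w' b) b := by
    intro b hb
    have hb0 : b ≠ 0 := by linarith [hb.1]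
    have := (Real.hasDerivAt_rpow_const (p := -e) (Or.inl hb0)).mul (d1 b)
    exact this
  have hcw : ContinuousOn w' (Icc (1:ℝ) 4) := by
    have r1 : ∀ p : ℝ, ContinuousOn (fun b : ℝ => b ^ p) (Icc (1:ℝ) 4) := fun p => continuousOn_id.rpow_const fun b hb => Or.inl (by
      have := hb.1; simp only [id]; linarith)
    exact ((continuousOn_const.mul (r1 _)).mul ca.continuousOn).add ((r1 _).mul (continuousOn_const.mul ca'.continuousOn))
  have hEn : (4 ^ s * ∫⁻ t in Icc (1:ℝ) 4, en (fun b => wp (dil L κ) g x b) w' s L⁻¹ t) ^ (1 / s) ≤ ENNReal.ofReal (4 * d) * Epc s L κ g x := by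
    have pt : ∀ b ∈ Icc (1:ℝ) 4, en (fun b => wp (dil L κ) g x b) w' s L⁻¹ b ≤ ENNReal.ofReal (d ^ s) * (ENNReal.ofReal L * (‖a b‖ₑ + ‖a' b‖ₑ) ^ s) := by
      intro b hb
      have hb1 : b ^ (-e) ≤ 1 := Real.rpow_le_one_of_one_le_of_nonpos hb.1 (by linarith)
      have hb2 : b ^ (-e-1) ≤ 1 := Real.rpow_le_one_of_one_le_of_nonpos hb.1 (by linarith)
      have hb0 : 0 < b := by linarith [hb.1]
      set S := |a b| + |a' b| with hS
      have hS0 : 0 ≤ S := by positivity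
      have k0 : ‖a b‖ₑ + ‖a' b‖ₑ = ENNReal.ofReal S := by
        rw [hS, ENNReal.ofReal_add (abs_nonneg _) (abs_nonneg _), ← Real.norm_eq_abs, ← Real.norm_eq_abs, ofReal_norm, ofReal_norm]
      have k1 : |wp (dil L κ) g x b| ≤ S := by
        rw [wp, abs_mul, abs_of_pos (by positivity)]
        calc _ ≤ 1 * |a b| := by gcongr
          _ ≤ S := by rw [hS]; linarith [abs_nonneg (a' b)]
      have k2 : |w' b| ≤ L * ((1 + e) * S) := by
        calc |w' b| ≤ |(-e * b ^ (-e - 1)) * a b| + |b ^ (-e) * (L * a' b)| := abs_add_le _ _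
          _ = e * b ^ (-e - 1) * |a b| + b ^ (-e) * (L * |a' b|) := by
            rw [abs_mul, abs_mul, abs_mul, abs_mul, abs_neg, abs_of_nonneg he0, abs_of_pos hL0, abs_of_pos (by positivity : 0 < b ^ (-e-1)), abs_of_pos (by positivity : 0 < b ^ (-e))]
          _ ≤ e * 1 * |a b| + 1 * (L * |a' b|) := by gcongr
          _ ≤ L * ((1 + e) * S) := by
            rw [hS]
            have := abs_nonneg (a b); have := abs_nonneg (a' b)
            have : e * |a b| ≤ L * (e * |a b|) := by nlinarith [mul_nonneg he0 (abs_nonneg (a b))]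
            have : 0 ≤ L * (|a b|) := by positivity
            have : 0 ≤ L * (e * |a' b|) := by positivity
            nlinarith
      rw [en, k0, inv_inv, ← ofReal_norm, ← ofReal_norm, ENNReal.ofReal_rpow_of_nonneg (norm_nonneg _) hs0.le, ENNReal.ofReal_rpow_of_nonneg (norm_nonneg _) hs0.le,
        ENNReal.ofReal_rpow_of_nonneg hS0 hs0.le, ← ENNReal.ofReal_mul hL0.le, ← ENNReal.ofReal_mul (by positivity), ← ENNReal.ofReal_mul (by positivity),
        ← ENNReal.ofReal_mul (by positivity), ← ENNReal.ofReal_add (by positivity) (by positivity)]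
      refine ENNReal.ofReal_le_ofReal ?_
      have hLs : L⁻¹ ^ (s - 1) * L ^ s = L := by
        rw [Real.inv_rpow hL0.le, Real.rpow_sub_one hL0.ne']
        have := (Real.rpow_pos_of_pos hL0 s).ne'
        field_simp
      have hde : 2 * (1 + e) = d := by rw [he]; ring
      have h2s : (2:ℝ) ≤ 2 ^ s := by
        calc (2:ℝ) = 2 ^ (1:ℝ) := by simp
          _ ≤ _ := Real.rpow_le_rpow_of_exponent_le (by norm_num) hs
      have h1e : 1 ≤ (1 + e) ^ s := Real.one_le_rpow (by linarith) hs0.le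
      calc _ ≤ L * S ^ s + L⁻¹ ^ (s - 1) * (L * ((1 + e) * S)) ^ s := by
            gcongr <;> assumption
        _ = L * S ^ s * (1 + (1 + e) ^ s) := by
            rw [Real.mul_rpow hL0.le (by positivity), Real.mul_rpow (by positivity) hS0, ← mul_assoc, hLs]; ring
        _ ≤ L * S ^ s * (2 ^ s * (1 + e) ^ s) := by
            gcongr; nlinarith
        _ = _ := by rw [← Real.mul_rpow (by norm_num) (by linarith), hde]; ring
    have h4 : (4:ℝ≥0∞) ^ s = ENNReal.ofReal (4 ^ s) := by
      rw [← ENNReal.ofReal_rpow_of_nonneg (by norm_num) hs0.le]; norm_num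
    have hI : 4 ^ s * ∫⁻ t in Icc (1:ℝ) 4, en (fun b => wp (dil L κ) g x b) w' s L⁻¹ t ≤ ENNReal.ofReal ((4 * d) ^ s) *
        (ENNReal.ofReal L * ∫⁻ b in Icc (1:ℝ) 4, (‖a b‖ₑ + ‖a' b‖ₑ) ^ s) := by
      calc _ ≤ 4 ^ s * ∫⁻ b in Icc (1:ℝ) 4, ENNReal.ofReal (d ^ s) * (ENNReal.ofReal L * (‖a b‖ₑ + ‖a' b‖ₑ) ^ s) := by
            exact mul_le_mul_right (setLIntegral_mono' measurableSet_Icc pt) _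
        _ = _ := by
          rw [lintegral_const_mul' _ _ (by simp), lintegral_const_mul' _ _ (by simp), h4, ← mul_assoc, ← ENNReal.ofReal_mul (by positivity),
            ← Real.mul_rpow (by norm_num) (by linarith)]
    refine (ENNReal.rpow_le_rpow hI (by positivity)).trans (le_of_eq ?_)
    rw [ENNReal.mul_rpow_of_nonneg _ _ (by positivity), ENNReal.ofReal_rpow_of_nonneg (by positivity) (by positivity), ← Real.rpow_mul (by positivity),
      mul_one_div, div_self hs0.ne', Real.rpow_one, Epc]
  have hδ1 : L⁻¹ ≤ 1 := inv_le_one_of_one_le₀ hL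
  exact ⟨(var_bound hs hsr (inv_pos.2 hL0) hw hcw).trans hEn, fun b hb => (sup_bound hs (inv_pos.2 hL0) hδ1 hw hcw hb).trans hEn⟩
end Pent
end

section
open MeasureTheory Metric Set
open scoped ENNReal NNReal FourierTransform ContDiff
namespace Pent
variable {d n : ℕ}

/-- L^q norm on SB -/
def Nq (q : ℝ) (u : Euc d → ℝ≥0∞) : ℝ≥0∞ := (∫⁻ x in SB d, u x ^ q) ^ (1 / q)

lemma Epc_meas {s L : ℝ} {κ : ℝ → ℝ} (h : ContDiff ℝ ∞ κ) {g : Euc d → ℝ} (hg : Measurable g) : Measurable (Epc s L κ g) := by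
  have h' : ContDiff ℝ ∞ (deriv κ) := (contDiff_infty_iff_deriv.1 h).2
  have c1 : Continuous (dil L κ) := by have := h.continuous; unfold dil; fun_prop
  have c2 : Continuous (dil L (deriv κ)) := by have := h'.continuous; unfold dil; fun_prop
  have : Measurable (fun z : Euc d × ℝ => (‖av (dil L κ) g z.1 z.2‖ₑ + ‖av (dil L (deriv κ)) g z.1 z.2‖ₑ) ^ s) :=
    ((av_meas c1 hg).enorm.add (av_meas c2 hg).enorm).pow_const s
  exact (this.lintegral_prod_right'.const_mul _).pow_const _

lemma Epc_norm {s L q : ℝ} (hs : 1 ≤ s) (hq : 1 ≤ q) (hL : 0 < L) {κ : ℝ → ℝ} (h : ContDiff ℝ ∞ κ) {g : Euc d → ℝ} (hg : Measurable g) :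
    Nq q (Epc s L κ g) ≤ ENNReal.ofReal (L ^ (1/s)) * (Nm q s (dil L κ) g + Nm q s (dil L (deriv κ)) g) := by
  have hs0 : 0 < s := by linarith
  have hq0 : 0 < q := by linarith
  have h' : ContDiff ℝ ∞ (deriv κ) := (contDiff_infty_iff_deriv.1 h).2
  have c1 : Continuous (dil L κ) := by have := h.continuous; unfold dil; fun_prop
  have c2 : Continuous (dil L (deriv κ)) := by have := h'.continuous; unfold dil; fun_prop
  refine le_trans (le_of_eq ?_) (mul_le_mul_right (Mx_add hq hs (av_meas c1 hg).enorm (av_meas c2 hg).enorm) _)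
  rw [Nq, Mx]
  have : ∀ x, Epc s L κ g x ^ q = ENNReal.ofReal (L ^ (1/s)) ^ q * (∫⁻ b in Icc (1:ℝ) 4, (‖av (dil L κ) g x b‖ₑ + ‖av (dil L (deriv κ)) g x b‖ₑ) ^ s) ^ (q / s) := by
    intro x
    rw [Epc, ENNReal.mul_rpow_of_nonneg _ _ (by positivity), ENNReal.mul_rpow_of_nonneg _ _ (by positivity), ENNReal.ofReal_rpow_of_nonneg hL.le (by positivity),
      ← ENNReal.rpow_mul, one_div_mul_eq_div]
  simp_rw [this]
  rw [lintegral_const_mul' _ _ (ENNReal.rpow_ne_top_of_nonneg hq0.le (by simp)), ENNReal.mul_rpow_of_nonneg _ _ (by positivity), ← ENNReal.rpow_mul,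
    mul_one_div, div_self hq0.ne', ENNReal.rpow_one]

lemma Nq_add {q : ℝ} (hq : 1 ≤ q) {u v : Euc d → ℝ≥0∞} (hu : Measurable u) (hv : Measurable v) : Nq q (fun x => u x + v x) ≤ Nq q u + Nq q v :=
  ENNReal.lintegral_Lp_add_le hu.aemeasurable hv.aemeasurable hq

lemma Nq_sum {q : ℝ} (hq : 1 ≤ q) (u : ℕ → Euc d → ℝ≥0∞) (hu : ∀ j, Measurable (u j)) (J : ℕ) :
    Nq q (fun x => ∑ j ∈ Finset.range J, u j x) ≤ ∑ j ∈ Finset.range J, Nq q (u j) := by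
  induction J with
  | zero => simp [Nq, ENNReal.zero_rpow_of_pos (by linarith : 0 < q), ENNReal.zero_rpow_of_pos (inv_pos.2 (by linarith : 0 < q))]
  | succ J ih =>
    simp_rw [Finset.sum_range_succ]
    refine (Nq_add hq (Finset.measurable_fun_sum _ fun j _ => hu j) (hu J)).trans ?_
    gcongr

lemma Nq_iSup {q : ℝ} (hq : 1 ≤ q) (u : ℕ → Euc d → ℝ≥0∞) (hu : ∀ j, Measurable (u j)) (hm : ∀ x, Monotone fun j => u j x) {B : ℝ≥0∞} (hB : ∀ j, Nq q (u j) ≤ B) :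
    Nq q (fun x => ⨆ j, u j x) ≤ B := by
  have hq0 : 0 < q := by linarith
  have h1 : ∀ x, (⨆ j, u j x) ^ q = ⨆ j, u j x ^ q := fun x => (ENNReal.orderIsoRpow q hq0).map_iSup _
  rw [Nq]
  simp_rw [h1]
  rw [lintegral_iSup (fun j => (hu j).pow_const q) (fun i j hij x => ENNReal.rpow_le_rpow (hm x hij) hq0.le)]
  have h2 := (ENNReal.orderIsoRpow (1/q) (by positivity)).map_iSup (fun j => ∫⁻ x in SB d, u j x ^ q)
  simp only [ENNReal.orderIsoRpow_apply] at h2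
  rw [h2]
  exact iSup_le hB

lemma l1_le {p : ℝ} (hp : 1 ≤ p) {g : Euc d → ℝ} (hg : Measurable g) (hsupp : ∀ y, 3 < ‖y‖ → g y = 0) {A : ℝ} (hA : 0 < A)
    (h : ∫⁻ y, ‖g y‖ₑ ^ p ≤ ENNReal.ofReal (A ^ p)) : ∫⁻ y, ‖g y‖ₑ ≤ ENNReal.ofReal (volume.real (closedBall (0 : Euc d) 3) ^ ((p-1)/p) * A) := by
  have hp0 : 0 < p := by linarith
  set V := volume.real (closedBall (0 : Euc d) 3) with hV
  have hV0 : 0 ≤ V := measureReal_nonneg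
  have e : ∫⁻ y, ‖g y‖ₑ = ∫⁻ y in closedBall (0 : Euc d) 3, ‖g y‖ₑ := by
    rw [setLIntegral_eq_of_support_subset]
    intro y hy
    rw [mem_closedBall, dist_zero_right]
    by_contra hh
    exact hy (by simp [hsupp y (not_le.1 hh)])
  have h1 := lint_pow_le (volume.restrict (closedBall (0 : Euc d) 3)) hp hg.enorm.aemeasurable
  rw [← e, Measure.restrict_apply_univ] at h1
  have h2 : (∫⁻ y, ‖g y‖ₑ) ^ p ≤ ENNReal.ofReal (V ^ (p-1) * A ^ p) := by
    refine h1.trans ?_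
    rw [ENNReal.ofReal_mul (by positivity), ← ENNReal.ofReal_rpow_of_nonneg hV0 (by linarith), hV, Measure.real, ENNReal.ofReal_toReal measure_closedBall_lt_top.ne]
    gcongr
    exact (setLIntegral_le_lintegral _ _).trans h
  have h3 := ENNReal.rpow_le_rpow h2 (by positivity : 0 ≤ 1 / p)
  rw [← ENNReal.rpow_mul, mul_one_div, div_self hp0.ne', ENNReal.rpow_one, ENNReal.ofReal_rpow_of_nonneg (by positivity) (by positivity),
    Real.mul_rpow (by positivity) (by positivity), ← Real.rpow_mul hV0, ← Real.rpow_mul hA.le, mul_one_div, mul_one_div, div_self hp0.ne', Real.rpow_one] at h3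
  exact h3

lemma Nm_triv {q s : ℝ} (hq : 0 < q) (hs : 0 < s) {k : ℝ → ℝ} {K : ℝ} (hK0 : 0 ≤ K) (hK : ∀ t, |k t| ≤ K) {g : Euc d → ℝ} {B : ℝ} (hB0 : 0 ≤ B)
    (hB : ∫⁻ y, ‖g y‖ₑ ≤ ENNReal.ofReal B) :
    Nm q s k g ≤ ENNReal.ofReal (K * B * 3 ^ (1/s) * volume.real (SB d) ^ (1/q)) := by
  have pt : ∀ x b, ‖av k g x b‖ₑ ≤ ENNReal.ofReal (K * B) := by
    intro x b
    refine (av_enorm_le k g x b).trans ?_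
    rw [ENNReal.ofReal_mul hK0]
    refine le_trans ?_ (mul_le_mul_right hB _)
    rw [← lintegral_const_mul' _ _ (by simp)]
    refine lintegral_mono fun y => ?_
    refine mul_le_mul_left ?_ _
    rw [← ofReal_norm]; exact ENNReal.ofReal_le_ofReal (hK _)
  refine (Mx_mono (a' := fun _ => ENNReal.ofReal (K * B)) hq hs fun x _ b _ => pt x b).trans (le_of_eq ?_)
  rw [Mx]
  simp only [lintegral_const, Measure.restrict_apply_univ, Real.volume_Icc]
  have e : volume (SB d) = ENNReal.ofReal (volume.real (SB d)) := by rw [Measure.real, ENNReal.ofReal_toReal (SB_fin d)]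
  rw [e, ENNReal.ofReal_rpow_of_nonneg (by positivity) hs.le, ← ENNReal.ofReal_mul (by positivity), ENNReal.ofReal_rpow_of_nonneg (by positivity) (by positivity),
    ← ENNReal.ofReal_mul (by positivity), ENNReal.ofReal_rpow_of_nonneg (by positivity) (by positivity)]
  congr 1
  have hKB : 0 ≤ K * B := by positivity
  rw [Real.mul_rpow (by positivity) (by positivity), Real.mul_rpow (by positivity) (by norm_num), Real.mul_rpow (by positivity) (by positivity),
    ← Real.rpow_mul hKB, ← Real.rpow_mul hKB, ← Real.rpow_mul (by norm_num), show s * (q / s) * (1 / q) = 1 by field_simp, Real.rpow_one,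
    show q / s * (1 / q) = 1 / s by field_simp]
  norm_num

lemma wp_double {φ ψ : ℝ → ℝ} (hψ : ψ = fun x => dil 2 φ x - φ x) {L K K' : ℝ} (h1 : Continuous (dil L φ)) (h2 : ∀ s, |dil L φ s| ≤ K)
    (h3 : Continuous (dil L ψ)) (h4 : ∀ s, |dil L ψ s| ≤ K') {g : Euc d → ℝ} (hg : Integrable g) (x : Euc d) (b : ℝ) :
    wp (dil (2 * L) φ) g x b = wp (dil L φ) g x b + wp (dil L ψ) g x b := by
  have : av (dil (2 * L) φ) g x b = av (dil L φ) g x b + av (dil L ψ) g x b := by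
    unfold av
    rw [← integral_add (av_int h1 h2 hg x b) (av_int h3 h4 hg x b)]
    congr 1; ext y
    rw [← add_mul]; congr 1
    simp only [hψ, dil]; ring_nf
  rw [wp, wp, wp, this, mul_add]
end Pent
end

section
open MeasureTheory Metric Set
open scoped ENNReal NNReal FourierTransform ContDiff
namespace Pent
variable {d n : ℕ}

set_option maxHeartbeats 1000000 in
theorem local_bd (hn : 2 ≤ n) {τ β s q p r : ℝ} (hτ : (n:ℝ)/(n+2) ≤ τ) (hτ1 : τ ≤ 1) (hβ : 0 < β) (hβ1 : β ≤ 1)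
    (hs : 1 + β ≤ s) (hq : 1 ≤ q) (hqs : q * (β * τ) < s) (hp : s < p) (hsr : s ≤ r) (hγ : 1 < β * ((n:ℝ) * (1 + τ) / 2)) :
    ∃ C : ℝ, 0 < C ∧ ∀ f : Euc (n+1) → ℝ, Continuous f → HasCompactSupport f → ∀ A > 0,
      ∫⁻ y in closedBall (0 : Euc (n+1)) 3, ‖f y‖ₑ ^ p ≤ ENNReal.ofReal (A ^ p) →
      ∃ Θ : Euc (n+1) → ℝ≥0∞, (∀ x ∈ SB (n+1), VrIA r (fun y => (f y : ℂ)) x ≤ Θ x ∧ ∀ t ∈ Icc (1:ℝ) 2, ‖SA f t x‖ₑ ≤ Θ x) ∧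
        Nq q Θ ≤ ENNReal.ofReal (C * A) := by
  classical
  have hs0 : 0 < s := by linarith
  have hs1 : 1 ≤ s := by linarith
  have hq0 : 0 < q := by linarith
  have hr1 : 1 ≤ r := by linarith
  have hd : 3 ≤ n + 1 := by lia
  obtain ⟨φ, hφ, hφc, hφ1, hψ⟩ := exists_phi n
  set ψ : ℝ → ℝ := fun x => dil 2 φ x - φ x with hψd
  obtain ⟨C1, L1, hC1, hL1, -, hw1⟩ := strong hn hψ hτ hτ1 hβ hβ1 hs hq hqs hp
  obtain ⟨C2, L2, hC2, hL2, -, hw2⟩ := strong hn hψ.deriv hτ hτ1 hβ hβ1 hs hq hqs hp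
  set γ := β * ((n:ℝ) * (1 + τ) / 2) with hγd
  obtain ⟨Kφ, hKφ0, hKφ⟩ := test_bdd hφ.continuous hφc
  obtain ⟨Kφ', hKφ0', hKφ'⟩ := test_bdd (contDiff_infty_iff_deriv.1 hφ).2.continuous hφc.deriv
  obtain ⟨Kψ, hKψ0, hKψ⟩ := test_bdd hψ.smooth.1.continuous hψ.smooth.2
  obtain ⟨a, ha0, ha⟩ := test_supp hφc
  set L0 := max (max L1 L2) (4 * a) with hL0
  have hL01 : L1 ≤ L0 := (le_max_left _ _).trans (le_max_left _ _)
  have hL02 : L2 ≤ L0 := (le_max_right _ _).trans (le_max_left _ _)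
  have hL03 : 4 * a ≤ L0 := le_max_right _ _
  have hL0p : 1 ≤ L0 := hL1.trans hL01
  set Ls : ℕ → ℝ := fun j => 2 ^ j * L0 with hLs
  have hLs0 : ∀ j, L0 ≤ Ls j := fun j => by
    have : (1:ℝ) ≤ 2 ^ j := one_le_pow₀ (by norm_num)
    simp only [hLs]; nlinarith
  have hLs1 : ∀ j, 1 ≤ Ls j := fun j => hL0p.trans (hLs0 j)
  have hLst : Filter.Tendsto Ls Filter.atTop Filter.atTop :=
    (tendsto_pow_atTop_atTop_of_one_lt (by norm_num : (1:ℝ) < 2)).atTop_mul_const (by linarith)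
  set ρ : ℝ := 2 ^ (-((γ - 1) / s)) with hρ
  have hρ0 : 0 < ρ := by positivity
  have hρ1 : ρ < 1 := Real.rpow_lt_one_of_one_lt_of_neg (by norm_num) (by rw [neg_lt_zero]; exact div_pos (by linarith) hs0)
  have h1ρ : 0 < 1 - ρ := by linarith
  set VB := volume.real (closedBall (0 : Euc (n+1)) 3) ^ ((p-1)/p) with hVB
  have hVB0 : 0 ≤ VB := by positivity
  set CL := L0 ^ (1/s) * (L0 * Kφ * VB * 3 ^ (1/s) * volume.real (SB (n+1)) ^ (1/q) + L0 * Kφ' * VB * 3 ^ (1/s) * volume.real (SB (n+1)) ^ (1/q)) with hCL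
  have hCL0 : 0 ≤ CL := by positivity
  set c0 := (sfm (n+1) univ).toReal / 2 with hc0
  have hc0p : 0 < c0 := by have := sfm_pos hd; positivity
  set cc := c0⁻¹ * (4 * ((n+1 : ℕ) : ℝ)) with hcc
  have hccp : 0 < cc := by positivity
  refine ⟨cc * (CL + (C1 + C2) * (1 - ρ)⁻¹), by positivity, ?_⟩
  intro f hf hfc A hA hfA
  obtain ⟨M, hM⟩ := hfc.exists_bound_of_continuous hf
  set g := (closedBall (0 : Euc (n+1)) 3).indicator f with hg
  have hM0 : 0 ≤ M := (norm_nonneg _).trans (hM 0)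
  have hgB : Bf g M 3 := by
    refine ⟨hf.measurable.indicator measurableSet_closedBall, fun y => ?_, fun y hy => ?_⟩
    · rw [hg, indicator_apply]; split_ifs
      · exact hM y
      · simpa using hM0
    · exact indicator_of_notMem (by simpa using hy) _
  have hgA : ∫⁻ y, ‖g y‖ₑ ^ p ≤ ENNReal.ofReal (A ^ p) := by
    refine le_trans (le_of_eq ?_) hfA
    rw [← lintegral_indicator measurableSet_closedBall]
    congr 1; ext y
    rw [hg, indicator_apply, indicator_apply]; split_ifs
    · rfl
    · simp [ENNReal.zero_rpow_of_pos (by linarith : 0 < p)]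
  have hgi := hgB.integrable
  -- the majorants
  set EE : ℕ → Euc (n+1) → ℝ≥0∞ := fun J x => Epc s L0 φ g x + ∑ j ∈ Finset.range J, Epc s (Ls j) ψ g x with hEE
  have mE : ∀ j, Measurable (Epc s (Ls j) ψ g) := fun j => Epc_meas hψ.smooth.1 hgB.meas
  have mE0 : Measurable (Epc s L0 φ g) := Epc_meas hφ hgB.meas
  have mEE : ∀ J, Measurable (EE J) := fun J => mE0.add (Finset.measurable_fun_sum _ fun j _ => mE j)
  have monoE : ∀ x, Monotone fun J => EE J x := by
    intro x i j hij
    simp only [hEE]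
    gcongr
  have low : Nq q (Epc s L0 φ g) ≤ ENNReal.ofReal (CL * A) := by
    refine (Epc_norm hs1 hq (by linarith) hφ hgB.meas).trans ?_
    have hB := l1_le (by linarith) hgB.meas hgB.supp hA hgA
    have t1 := Nm_triv hq0 hs0 (by positivity) (dil_props (by linarith : 0 < L0) hφ.continuous hKφ ha).2.1 (by positivity) hB
    have t2 := Nm_triv hq0 hs0 (k := dil L0 (deriv φ)) (K := L0 * Kφ') (by positivity) (fun t => by
      change |L0 * deriv φ (L0 * t)| ≤ _
      rw [abs_mul, abs_of_pos (by linarith : 0 < L0)]; gcongr; exact hKφ' _) (by positivity) hB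
    refine (mul_le_mul_right (add_le_add t1 t2) _).trans (le_of_eq ?_)
    rw [← ENNReal.ofReal_add (by positivity) (by positivity), ← ENNReal.ofReal_mul (by positivity)]
    congr 1
    rw [hCL]; ring
  have high : ∀ j, Nq q (Epc s (Ls j) ψ g) ≤ ENNReal.ofReal ((C1 + C2) * A * ρ ^ j) := by
    intro j
    have hLj : 0 < Ls j := by linarith [hLs1 j]
    refine (Epc_norm hs1 hq hLj hψ.smooth.1 hgB.meas).trans ?_
    have t1 := hw1 (Ls j) (hL01.trans (hLs0 j)) g M hgB A hA hgA
    have t2 := hw2 (Ls j) (hL02.trans (hLs0 j)) g M hgB A hA hgA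
    refine (mul_le_mul_right (add_le_add t1 t2) _).trans ?_
    rw [← ENNReal.ofReal_add (by positivity) (by positivity), ← ENNReal.ofReal_mul (by positivity)]
    refine ENNReal.ofReal_le_ofReal ?_
    have e1 : Ls j ^ (1/s) * Ls j ^ (-(γ / s)) ≤ ρ ^ j := by
      rw [← Real.rpow_add hLj]
      have e2 : 1 / s + -(γ / s) = -((γ - 1) / s) := by ring
      rw [e2, hLs, Real.mul_rpow (by positivity) (by linarith), hρ, ← Real.rpow_natCast, ← Real.rpow_natCast, ← Real.rpow_mul (by norm_num), ← Real.rpow_mul (by norm_num), mul_comm (j:ℝ)]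
      refine mul_le_of_le_one_right (by positivity) (Real.rpow_le_one_of_one_le_of_nonpos hL0p ?_)
      rw [neg_nonpos]; exact div_nonneg (by linarith) hs0.le
    calc _ = (C1 + C2) * A * (Ls j ^ (1/s) * Ls j ^ (-(γ / s))) := by ring
      _ ≤ _ := by gcongr
  have hN : ∀ J, Nq q (EE J) ≤ ENNReal.ofReal ((CL + (C1 + C2) * (1 - ρ)⁻¹) * A) := by
    intro J
    refine (Nq_add hq mE0 (Finset.measurable_fun_sum _ fun j _ => mE j)).trans ?_
    refine (add_le_add low ((Nq_sum hq _ mE J).trans (Finset.sum_le_sum fun j _ => high j))).trans ?_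
    rw [← ENNReal.ofReal_sum_of_nonneg (fun j _ => by positivity), ← ENNReal.ofReal_add (by positivity) (Finset.sum_nonneg fun j _ => by positivity), ← Finset.mul_sum]
    refine ENNReal.ofReal_le_ofReal ?_
    have hgs : ∑ j ∈ Finset.range J, ρ ^ j ≤ (1 - ρ)⁻¹ := by
      rw [← tsum_geometric_of_lt_one hρ0.le hρ1]
      exact (summable_geometric_of_lt_one hρ0.le hρ1).sum_le_tsum _ (fun j _ => by positivity)
    calc _ ≤ CL * A + (C1 + C2) * A * (1 - ρ)⁻¹ := by gcongr
      _ = _ := by ring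
  refine ⟨fun x => ENNReal.ofReal cc * ⨆ J, EE J x, ?_, ?_⟩
  swap
  · have h1 := Nq_iSup hq EE mEE monoE hN
    have e : Nq q (fun x => ENNReal.ofReal cc * ⨆ J, EE J x) = ENNReal.ofReal cc * Nq q (fun x => ⨆ J, EE J x) := by
      rw [Nq, Nq]
      simp_rw [ENNReal.mul_rpow_of_nonneg _ _ hq0.le]
      rw [lintegral_const_mul' _ _ (ENNReal.rpow_ne_top_of_nonneg hq0.le (by simp)), ENNReal.mul_rpow_of_nonneg _ _ (by positivity), ← ENNReal.rpow_mul,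
        mul_one_div, div_self hq0.ne', ENNReal.rpow_one]
    rw [e, mul_assoc, ENNReal.ofReal_mul hccp.le]
    exact mul_le_mul_right h1 _
  intro x hx
  -- bounds for the approximations
  have hdp := fun j => dil_props (by linarith [hLs1 j] : 0 < Ls j) hφ.continuous hKφ ha
  have hdψ := fun j => (by linarith [hLs1 j] : 0 < Ls j)
  have app : ∀ J, rVar r (Icc 1 4) (fun b => (wp (dil (Ls J) φ) g x b : ℂ)) ≤ ENNReal.ofReal (4 * ((n+1 : ℕ) : ℝ)) * EE J x ∧
      ∀ b ∈ Icc (1:ℝ) 4, ‖wp (dil (Ls J) φ) g x b‖ₑ ≤ ENNReal.ofReal (4 * ((n+1 : ℕ) : ℝ)) * EE J x := by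
    intro J
    induction J with
    | zero =>
      have := piece hd hφ hφc hL0p hs1 hsr hgi x
      simpa [hEE, hLs] using this
    | succ J ih =>
      have hp := piece hd hψ.smooth.1 hψ.smooth.2 (hLs1 J) hs1 hsr hgi x
      have e2 : Ls (J+1) = 2 * Ls J := by simp only [hLs]; ring
      have cψ : Continuous (dil (Ls J) ψ) := by have := hψ.smooth.1.continuous; unfold dil; fun_prop
      have bψ : ∀ t, |dil (Ls J) ψ t| ≤ Ls J * Kψ := fun t => by
        rw [dil, abs_mul, abs_of_pos (hdψ J)]; exact mul_le_mul_of_nonneg_left (hKψ _) (hdψ J).le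
      have e3 : ∀ b, wp (dil (Ls (J+1)) φ) g x b = wp (dil (Ls J) φ) g x b + wp (dil (Ls J) ψ) g x b := fun b => by
        rw [e2]; exact wp_double hψd (hdp J).1 (hdp J).2.1 cψ bψ hgi x b
      have e4 : EE (J+1) x = EE J x + Epc s (Ls J) ψ g x := by
        simp only [hEE, Finset.sum_range_succ, add_assoc]
      rw [e4, mul_add]
      constructor
      · simp_rw [e3, Complex.ofReal_add]
        exact (rVar_add hr1 _ _ _).trans (add_le_add ih.1 hp.1)
      · intro b hb
        rw [e3]
        exact (enorm_add_le _ _).trans (add_le_add (ih.2 b hb) (hp.2 b hb))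
  have same : ∀ J, ∀ b ∈ Icc (1:ℝ) 4, wp (dil (Ls J) φ) f x b = wp (dil (Ls J) φ) g x b := by
    intro J b hb
    rw [wp, wp]; congr 1
    unfold av
    congr 1; ext y
    by_cases hy : |b - ‖x - y‖ ^ 2| ≤ 1/4
    · have := loc (by lia) hx hb hy
      have : g y = f y := indicator_of_mem (by simpa using this.2) _
      rw [this]
    · rw [(hdp J).2.2 _, zero_mul, zero_mul]
      refine lt_of_le_of_lt ?_ (not_le.1 hy)
      rw [div_le_iff₀ (hdψ J)]
      linarith [hLs0 J]
  have lim : ∀ b ∈ Icc (1:ℝ) 4, Filter.Tendsto (fun J => wp (dil (Ls J) φ) g x b) Filter.atTop (nhds (c0 * SA f (Real.sqrt b) x)) := by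
    intro b hb
    have h1 := (av_lim hd hφ.continuous hφc hφ1 hf hfc x b Ls hLs1 hLst).const_mul (b ^ (-((((n+1:ℕ):ℝ) - 2) / 2)))
    have hb0 : 0 < b := by linarith [hb.1]
    have e : b ^ (-((((n+1:ℕ):ℝ) - 2) / 2)) * Gp f x b = c0 * SA f (Real.sqrt b) x := by
      rw [Gp, max_eq_left hb0.le, Real.rpow_neg hb0.le]
      have := (Real.rpow_pos_of_pos hb0 ((((n+1:ℕ):ℝ) - 2) / 2)).ne'
      field_simp
      rw [hc0]; ring
    rw [e] at h1
    refine h1.congr fun J => ?_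
    rw [← same J b hb, wp]
  set B := ENNReal.ofReal (4 * ((n+1 : ℕ) : ℝ)) * ⨆ J, EE J x with hB
  have app1 : ∀ J, ENNReal.ofReal (4 * ((n+1 : ℕ) : ℝ)) * EE J x ≤ B := fun J => mul_le_mul_right (le_iSup (fun J => EE J x) J) _
  have fin1 : rVar r (Icc 1 4) (fun b => ((c0 * SA f (Real.sqrt b) x : ℝ) : ℂ)) ≤ B :=
    rVar_lim (by linarith) _ (fun J b => (wp (dil (Ls J) φ) g x b : ℂ)) _ (fun b hb => (Complex.continuous_ofReal.tendsto _).comp (lim b hb))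
      (fun J => (app J).1.trans (app1 J))
  have fin2 : ∀ b ∈ Icc (1:ℝ) 4, ‖c0 * SA f (Real.sqrt b) x‖ₑ ≤ B := fun b hb =>
    le_of_tendsto' ((continuous_enorm.tendsto _).comp (lim b hb)) fun J => ((app J).2 b hb).trans (app1 J)
  have eB : ENNReal.ofReal cc * ⨆ J, EE J x = ENNReal.ofReal c0⁻¹ * B := by
    rw [hB, ← mul_assoc, ← ENNReal.ofReal_mul (by positivity)]
  have ec : ∀ b, SA f (Real.sqrt b) x = c0⁻¹ * (c0 * SA f (Real.sqrt b) x) := fun b => by field_simp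
  simp only [eB]
  constructor
  · have e1 : VrIA r (fun y => (f y : ℂ)) x = rVar r (Icc 1 2) (fun t => (fun b => ((SA f (Real.sqrt b) x : ℝ) : ℂ)) (t ^ 2)) := by
      rw [VrIA]
      refine rVar_congr fun t ht => ?_
      simp only
      rw [sphAvg_real, Real.sqrt_sq (by linarith [ht.1])]
    rw [e1]
    refine (rVar_sq (fun b => ((SA f (Real.sqrt b) x : ℝ) : ℂ))).trans ?_
    have e2 : (fun b : ℝ => ((SA f (Real.sqrt b) x : ℝ) : ℂ)) = fun b => ((c0⁻¹ : ℝ) : ℂ) * ((c0 * SA f (Real.sqrt b) x : ℝ) : ℂ) := by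
      ext b; rw [← Complex.ofReal_mul, ← ec]
    rw [e2]
    refine (rVar_const_mul (by linarith) _ _ _).trans ?_
    refine mul_le_mul' (le_of_eq ?_) fin1
    rw [← ofReal_norm, Complex.norm_real, Real.norm_of_nonneg (by positivity)]
  · intro t ht
    have hb : t ^ 2 ∈ Icc (1:ℝ) 4 := by constructor <;> nlinarith [ht.1, ht.2]
    have := fin2 (t ^ 2) hb
    rw [Real.sqrt_sq (by linarith [ht.1])] at this
    have e3 := ec (t ^ 2)
    rw [Real.sqrt_sq (by linarith [ht.1])] at e3
    rw [e3, enorm_mul]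
    refine mul_le_mul' (le_of_eq ?_) this
    rw [← ofReal_norm, Real.norm_of_nonneg (by positivity)]
end Pent
end

section
open MeasureTheory Metric Set
open scoped ENNReal NNReal FourierTransform ContDiff
namespace Pent
variable {d n : ℕ}

/-- local maximal function -/
def MX (f : Euc d → ℝ) (x : Euc d) : ℝ≥0∞ := ⨆ t ∈ Icc (1:ℝ) 2, ‖SA f t x‖ₑ

lemma VrIA_lsc (hd : 3 ≤ d) {r : ℝ} (hr : 0 < r) {f : Euc d → ℝ} (hf : Continuous f) {M : ℝ} (hM : ∀ y, |f y| ≤ M) :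
    LowerSemicontinuous (VrIA r (fun y => (f y : ℂ))) := by
  have hc := SA_cont hd hf hM
  unfold VrIA rVar
  refine lowerSemicontinuous_iSup fun N => lowerSemicontinuous_iSup fun t => lowerSemicontinuous_iSup fun _ => lowerSemicontinuous_iSup fun _ => ?_
  refine Continuous.lowerSemicontinuous ?_
  refine (ENNReal.continuous_rpow_const).comp ?_
  refine continuous_finsetSum _ fun i _ => ?_
  refine (ENNReal.continuous_rpow_const).comp ?_
  refine ENNReal.continuous_coe.comp (continuous_nnnorm.comp ?_)
  simp only [sphAvg_real]
  have h : ∀ s : ℝ, Continuous fun x => SA f s x := fun s => hc.comp (continuous_const.prodMk continuous_id)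
  exact (Complex.continuous_ofReal.comp (h _)).sub (Complex.continuous_ofReal.comp (h _))

lemma MX_lsc (hd : 3 ≤ d) {f : Euc d → ℝ} (hf : Continuous f) {M : ℝ} (hM : ∀ y, |f y| ≤ M) :
    LowerSemicontinuous (MX f) := by
  have hc := SA_cont hd hf hM
  unfold MX
  refine lowerSemicontinuous_iSup fun t => lowerSemicontinuous_iSup fun _ => ?_
  exact (continuous_enorm.comp (hc.comp (continuous_const.prodMk continuous_id))).lowerSemicontinuous

lemma glob_of_loc {W F : Euc d → ℝ≥0∞} (hW : Measurable W) (hF : Measurable F) {α : ℝ} (hα : 1 ≤ α) {K : ℝ≥0∞} {S B : Set (Euc d)}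
    (h : ∀ x0, ∫⁻ x in S, W (x + x0) ≤ K * (∫⁻ y in B, F (y + x0)) ^ α) (hK : K ≠ ⊤) (hFt : ∫⁻ y, F y ≠ ⊤) :
    volume S * ∫⁻ x, W x ≤ K * (volume B * (∫⁻ x, F x) ^ α) := by
  have key : ∀ {G : Euc d → ℝ≥0∞} (_ : Measurable G) (T : Set (Euc d)), ∫⁻ x0, ∫⁻ x in T, G (x + x0) = volume T * ∫⁻ x, G x := by
    intro G hG T
    rw [lintegral_lintegral_swap]
    · simp only [lintegral_add_left_eq_self]
      rw [lintegral_const, mul_comm]; simp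
    · exact (hG.comp (measurable_snd.add measurable_fst)).aemeasurable
  rw [← key hW S]
  refine (lintegral_mono h).trans ?_
  rw [lintegral_const_mul' _ _ hK]
  refine mul_le_mul_right ?_ _
  set T := ∫⁻ x, F x with hT
  have h1 : ∀ x0, (∫⁻ y in B, F (y + x0)) ^ α ≤ T ^ (α - 1) * ∫⁻ y in B, F (y + x0) := by
    intro x0
    have e : ∀ I : ℝ≥0∞, I ^ α = I ^ (α - 1) * I := fun I => by
      conv_rhs => rw [← ENNReal.rpow_one I, ← ENNReal.rpow_mul, one_mul]
      rw [← ENNReal.rpow_add_of_nonneg _ _ (by linarith) (by norm_num)]; simp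
    rw [e]
    refine mul_le_mul_left (ENNReal.rpow_le_rpow ?_ (by linarith)) _
    refine (setLIntegral_le_lintegral _ _).trans (le_of_eq ?_)
    exact lintegral_add_right_eq_self F x0
  refine (lintegral_mono h1).trans ?_
  rw [lintegral_const_mul' _ _ (ENNReal.rpow_ne_top_of_nonneg (by linarith) hFt), key hF B]
  have e : T ^ α = T ^ (α - 1) * T := by
      conv_rhs => rw [← ENNReal.rpow_one T, ← ENNReal.rpow_mul, one_mul]
      rw [← ENNReal.rpow_add_of_nonneg _ _ (by linarith) (by norm_num)]; simp
  rw [e]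
  apply le_of_eq; ring

lemma A_elim {J I : ℝ≥0∞} {C p : ℝ} (hC : 0 < C) (hp : 0 < p) (hI : I ≠ ⊤) (h : ∀ A > 0, I ≤ ENNReal.ofReal (A ^ p) → J ≤ ENNReal.ofReal (C * A)) :
    J ≤ ENNReal.ofReal C * I ^ (1/p) := by
  refine ENNReal.le_of_forall_pos_le_add fun ε hε _ => ?_
  set a := (I ^ (1/p)).toReal with ha
  have hIt : I ^ (1/p) ≠ ⊤ := ENNReal.rpow_ne_top_of_nonneg (by positivity) hI
  have hε' : (0:ℝ) < ε := hε
  have ha0 : 0 ≤ a := ENNReal.toReal_nonneg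
  have := h (a + ε / C) (by positivity) ?_
  · refine this.trans ?_
    rw [← ENNReal.ofReal_toReal hIt, ← ha, ← ENNReal.ofReal_mul hC.le, ← ENNReal.ofReal_coe_nnreal, ← ENNReal.ofReal_add (by positivity) (by positivity)]
    refine ENNReal.ofReal_le_ofReal (le_of_eq ?_)
    field_simp
  · rw [← ENNReal.ofReal_rpow_of_nonneg (by positivity) hp.le]
    have e : I = (ENNReal.ofReal a) ^ p := by
      rw [ha, ENNReal.ofReal_toReal hIt, ← ENNReal.rpow_mul, one_div, inv_mul_cancel₀ hp.ne', ENNReal.rpow_one]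
    calc I = _ := e
      _ ≤ _ := ENNReal.rpow_le_rpow (ENNReal.ofReal_le_ofReal (by linarith [div_pos hε' hC])) hp.le

theorem glob (hn : 2 ≤ n) {τ β s q p r : ℝ} (hτ : (n:ℝ)/(n+2) ≤ τ) (hτ1 : τ ≤ 1) (hβ : 0 < β) (hβ1 : β ≤ 1)
    (hs : 1 + β ≤ s) (hq : 1 ≤ q) (hqs : q * (β * τ) < s) (hp : s < p) (hsr : s ≤ r) (hγ : 1 < β * ((n:ℝ) * (1 + τ) / 2)) (hpq : p ≤ q) :
    ∃ C : ℝ≥0∞, C ≠ ⊤ ∧ ∀ f : Euc (n+1) → ℝ, Continuous f → HasCompactSupport f →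
      (∫⁻ x, VrIA r (fun y => (f y : ℂ)) x ^ q) ^ (1/q) ≤ C * (∫⁻ y, ‖f y‖ₑ ^ p) ^ (1/p) ∧
      (∫⁻ x, MX f x ^ q) ^ (1/q) ≤ C * (∫⁻ y, ‖f y‖ₑ ^ p) ^ (1/p) := by
  obtain ⟨C, hC, hloc⟩ := local_bd hn hτ hτ1 hβ hβ1 hs hq hqs hp hsr hγ
  have hp0 : 0 < p := by linarith
  have hq0 : 0 < q := by linarith
  have hd : 3 ≤ n + 1 := by lia
  set vS := volume (SB (n+1)) with hvS
  set vB := volume (closedBall (0 : Euc (n+1)) 3) with hvB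
  have hvS0 : vS ≠ 0 := (measure_closedBall_pos _ _ (by positivity)).ne'
  have hvSt : vS ≠ ⊤ := (measure_closedBall_lt_top).ne
  have hvBt : vB ≠ ⊤ := (measure_closedBall_lt_top).ne
  have hKt : ENNReal.ofReal C ^ q ≠ ⊤ := ENNReal.rpow_ne_top_of_nonneg hq0.le ENNReal.ofReal_ne_top
  refine ⟨(vS⁻¹ * ENNReal.ofReal C ^ q * vB) ^ (1/q), ENNReal.rpow_ne_top_of_nonneg (by positivity)
    (ENNReal.mul_ne_top (ENNReal.mul_ne_top (ENNReal.inv_ne_top.2 hvS0) hKt) hvBt), ?_⟩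
  intro f hf hfc
  obtain ⟨M, hM⟩ := hfc.exists_bound_of_continuous hf
  have hM' : ∀ y, |f y| ≤ M := hM
  have hmF : Measurable fun y => ‖f y‖ₑ ^ p := (hf.measurable.enorm).pow_const p
  have hFt : ∫⁻ y, ‖f y‖ₑ ^ p ≠ ⊤ := by
    have h := (hf.memLp_of_hasCompactSupport (μ := volume) hfc (p := ENNReal.ofReal p)).2
    rw [eLpNorm_lt_top_iff_lintegral_rpow_enorm_lt_top (by simpa using hp0) (by simp)] at h
    rw [ENNReal.toReal_ofReal hp0.le] at h
    exact h.ne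
  -- generic
  have gen : ∀ W : Euc (n+1) → ℝ≥0∞, Measurable W → (∀ x0 x, ∀ B : ℝ≥0∞, (VrIA r (fun y => ((fun z => f (z + x0)) y : ℂ)) x ≤ B ∧
      ∀ t ∈ Icc (1:ℝ) 2, ‖SA (fun z => f (z + x0)) t x‖ₑ ≤ B) → W (x + x0) ≤ B) →
      (∫⁻ x, W x ^ q) ^ (1/q) ≤ (vS⁻¹ * ENNReal.ofReal C ^ q * vB) ^ (1/q) * (∫⁻ y, ‖f y‖ₑ ^ p) ^ (1/p) := by
    intro W hW hWB
    have h1 := glob_of_loc (W := fun x => W x ^ q) (F := fun y => ‖f y‖ₑ ^ p) (hW.pow_const q) hmF (α := q / p)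
      ((one_le_div hp0).2 hpq) (K := ENNReal.ofReal C ^ q) (S := SB (n+1)) (B := closedBall 0 3) ?_ hKt hFt
    · have h2 : ∫⁻ x, W x ^ q ≤ (vS⁻¹ * ENNReal.ofReal C ^ q * vB) * (∫⁻ y, ‖f y‖ₑ ^ p) ^ (q/p) := by
        calc _ = vS⁻¹ * (vS * ∫⁻ x, W x ^ q) := by rw [← mul_assoc, ENNReal.inv_mul_cancel hvS0 hvSt, one_mul]
          _ ≤ vS⁻¹ * _ := mul_le_mul_right h1 _
          _ = _ := by ring
      calc _ ≤ _ := ENNReal.rpow_le_rpow h2 (by positivity)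
        _ = _ := by
          rw [ENNReal.mul_rpow_of_nonneg _ _ (by positivity), ← ENNReal.rpow_mul]
          congr 2; field_simp
    · intro x0
      set I := ∫⁻ y in closedBall (0 : Euc (n+1)) 3, ‖f (y + x0)‖ₑ ^ p with hI
      have hIt : I ≠ ⊤ := by
        refine ne_top_of_le_ne_top hFt ((setLIntegral_le_lintegral _ _).trans (le_of_eq ?_))
        exact lintegral_add_right_eq_self (fun y => ‖f y‖ₑ ^ p) x0
      have := A_elim (J := Nq q (fun x => W (x + x0))) hC hp0 hIt ?_
      · have h3 := ENNReal.rpow_le_rpow this hq0.le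
        rw [Nq, ← ENNReal.rpow_mul, one_div, inv_mul_cancel₀ hq0.ne', ENNReal.rpow_one, ENNReal.mul_rpow_of_nonneg _ _ hq0.le, ← ENNReal.rpow_mul] at h3
        refine h3.trans (le_of_eq ?_)
        congr 2; field_simp
      · intro A hA hIA
        obtain ⟨Θ, h4, h5⟩ := hloc (fun z => f (z + x0)) (hf.comp (continuous_add_right x0))
          (hfc.comp_homeomorph (Homeomorph.addRight x0)) A hA hIA
        refine le_trans ?_ h5
        rw [Nq, Nq]
        refine ENNReal.rpow_le_rpow (setLIntegral_mono' measurableSet_closedBall fun x hx => ?_) (by positivity)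
        exact ENNReal.rpow_le_rpow (hWB x0 x _ (h4 x hx)) hq0.le
  constructor
  · refine gen _ (VrIA_lsc hd (by linarith) hf hM').measurable fun x0 x B h => ?_
    refine le_trans (le_of_eq ?_) h.1
    rw [VrIA, VrIA]
    refine rVar_congr fun t _ => ?_
    rw [sphAvg, sphAvg]
    congr 1; ext y; congr 2; abel
  · refine gen _ (MX_lsc hd hf hM').measurable fun x0 x B h => ?_
    rw [MX]
    refine iSup_le fun t => iSup_le fun ht => ?_
    refine le_trans (le_of_eq ?_) (h.2 t ht)
    rw [SA, SA]
    congr 2; ext y; congr 1; abel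
end Pent
end

section
open MeasureTheory Metric Set
open scoped ENNReal NNReal FourierTransform ContDiff
namespace Pent
variable {d n : ℕ}

/-- Global `L^q` norm. -/
def NL (q : ℝ) (u : Euc d → ℝ≥0∞) : ℝ≥0∞ := (∫⁻ x, u x ^ q) ^ (1 / q)

lemma NL_add {q : ℝ} (hq : 1 ≤ q) {u v : Euc d → ℝ≥0∞} (hu : Measurable u) (hv : Measurable v) : NL q (fun x => u x + v x) ≤ NL q u + NL q v :=
  ENNReal.lintegral_Lp_add_le hu.aemeasurable hv.aemeasurable hq

lemma NL_sum {q : ℝ} (hq : 1 ≤ q) (u : ℕ → Euc d → ℝ≥0∞) (hu : ∀ j, Measurable (u j)) (J : ℕ) :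
    NL q (fun x => ∑ j ∈ Finset.range J, u j x) ≤ ∑ j ∈ Finset.range J, NL q (u j) := by
  induction J with
  | zero => simp [NL, ENNReal.zero_rpow_of_pos (by linarith : 0 < q), ENNReal.zero_rpow_of_pos (inv_pos.2 (by linarith : 0 < q))]
  | succ J ih =>
    simp_rw [Finset.sum_range_succ]
    refine (NL_add hq (Finset.measurable_fun_sum _ fun j _ => hu j) (hu J)).trans ?_
    gcongr

lemma NL_iSup {q : ℝ} (hq : 1 ≤ q) (u : ℕ → Euc d → ℝ≥0∞) (hu : ∀ j, Measurable (u j)) (hm : ∀ x, Monotone fun j => u j x) {B : ℝ≥0∞} (hB : ∀ j, NL q (u j) ≤ B) :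
    NL q (fun x => ⨆ j, u j x) ≤ B := by
  have hq0 : 0 < q := by linarith
  have h1 : ∀ x, (⨆ j, u j x) ^ q = ⨆ j, u j x ^ q := fun x => (ENNReal.orderIsoRpow q hq0).map_iSup _
  rw [NL]
  simp_rw [h1]
  rw [lintegral_iSup (fun j => (hu j).pow_const q) (fun i j hij x => ENNReal.rpow_le_rpow (hm x hij) hq0.le)]
  have h2 := (ENNReal.orderIsoRpow (1/q) (by positivity)).map_iSup (fun j => ∫⁻ x, u j x ^ q)
  simp only [ENNReal.orderIsoRpow_apply] at h2
  rw [h2]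
  exact iSup_le hB

lemma NL_tsum {q : ℝ} (hq : 1 ≤ q) (u : ℕ → Euc d → ℝ≥0∞) (hu : ∀ j, Measurable (u j)) :
    NL q (fun x => ∑' j, u j x) ≤ ∑' j, NL q (u j) := by
  simp_rw [ENNReal.tsum_eq_iSup_nat (f := fun j => u j _)]
  refine NL_iSup hq (fun J x => ∑ j ∈ Finset.range J, u j x) (fun J => Finset.measurable_fun_sum _ fun j _ => hu j) ?_ ?_
  · intro x i j hij
    simp only
    gcongr
  · intro J
    exact (NL_sum hq u hu J).trans (ENNReal.sum_le_tsum _)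

lemma NL_mono {q : ℝ} (hq : 0 < q) {u v : Euc d → ℝ≥0∞} (h : ∀ᵐ x, u x ≤ v x) : NL q u ≤ NL q v :=
  ENNReal.rpow_le_rpow (lintegral_mono_ae (h.mono fun _ hx => ENNReal.rpow_le_rpow hx hq.le)) (by positivity)

lemma NL_zero {q : ℝ} (hq : 0 < q) {u : Euc d → ℝ≥0∞} (hu : Measurable u) (h : NL q u = 0) : ∀ᵐ x, u x = 0 := by
  rw [NL, ENNReal.rpow_eq_zero_iff_of_pos (by positivity), lintegral_eq_zero_iff (hu.pow_const q)] at h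
  filter_upwards [h] with x hx
  exact (ENNReal.rpow_eq_zero_iff_of_pos hq).1 hx

lemma NL_fin {q : ℝ} (hq : 0 < q) {u : Euc d → ℝ≥0∞} (hu : Measurable u) (h : NL q u ≠ ⊤) : ∀ᵐ x, u x < ⊤ := by
  have : ∫⁻ x, u x ^ q ≠ ⊤ := fun h' => h (by rw [NL, h', ENNReal.top_rpow_of_pos (by positivity)])
  filter_upwards [ae_lt_top (hu.pow_const q) this] with x hx
  by_contra hc
  rw [not_lt, top_le_iff] at hc
  rw [hc, ENNReal.top_rpow_of_pos hq] at hx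
  exact lt_irrefl _ hx

lemma SA_nonneg_lint (hd : 3 ≤ d) {f : Euc d → ℝ} (hf : Continuous f) {M : ℝ} (hM : ∀ y, |f y| ≤ M) (h0 : ∀ y, 0 ≤ f y) (t : ℝ) (x : Euc d) :
    ‖SA f t x‖ₑ = ∫⁻ y, ENNReal.ofReal (f (x - t • y)) ∂(sphereMeasure d) := by
  haveI := sphereMeasure_prob hd
  have hc : Continuous fun y => f (x - t • y) := by fun_prop
  rw [SA, Real.enorm_of_nonneg (integral_nonneg fun y => h0 _)]
  refine ofReal_integral_eq_lintegral_ofReal ?_ (Filter.Eventually.of_forall fun y => h0 _)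
  exact Integrable.of_bound hc.aestronglyMeasurable M (Filter.Eventually.of_forall fun y => hM _)

/-- approximants of the indicator of an open set -/
def phU (U : Set (Euc d)) (i : ℕ) (y : Euc d) : ℝ := min (i * infDist y Uᶜ) 1 * max 0 (min 1 (i - ‖y‖))

lemma phU_props {U : Set (Euc d)} (hU : IsOpen U) (hne : Uᶜ.Nonempty) : (∀ i, Continuous (phU U i)) ∧ (∀ i, HasCompactSupport (phU U i)) ∧
    (∀ i y, 0 ≤ phU U i y) ∧ (∀ i y, phU U i y ≤ 1) ∧ (∀ i y, y ∉ U → phU U i y = 0) ∧ (∀ y, Monotone fun i => phU U i y) ∧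
    ∀ y ∈ U, ∃ i, phU U i y = 1 := by
  have a0 : ∀ (i : ℕ) y, 0 ≤ min (i * infDist y Uᶜ) (1:ℝ) := fun i y => le_min (by have := @infDist_nonneg _ _ Uᶜ y; positivity) (by norm_num)
  have b0 : ∀ (i : ℕ) (y : Euc d), 0 ≤ max 0 (min 1 ((i:ℝ) - ‖y‖)) := fun i y => le_max_left _ _
  refine ⟨fun i => ?_, fun i => ?_, fun i y => mul_nonneg (a0 i y) (b0 i y), fun i y => ?_, fun i y hy => ?_, fun y i j hij => ?_, fun y hy => ?_⟩
  · have := continuous_infDist_pt Uᶜ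
    unfold phU
    fun_prop
  · refine HasCompactSupport.intro (isCompact_closedBall (0 : Euc d) i) fun y hy => ?_
    have : (i:ℝ) < ‖y‖ := by simpa using hy
    rw [phU, max_eq_left, mul_zero]
    exact (min_le_right _ _).trans (by linarith)
  · exact mul_le_one₀ (min_le_right _ _) (b0 i y) (max_le (by norm_num) (min_le_left _ _))
  · rw [phU, infDist_zero_of_mem (by simpa using hy)]; simp
  · simp only [phU]
    have hij' : (i:ℝ) ≤ j := by exact_mod_cast hij
    have := @infDist_nonneg _ _ Uᶜ y
    refine mul_le_mul ?_ ?_ (b0 i y) (a0 j y)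
    · gcongr
    · gcongr
  · have hp : 0 < infDist y Uᶜ := (hU.isClosed_compl.notMem_iff_infDist_pos hne).1 (by simpa using hy)
    obtain ⟨i, hi⟩ := exists_nat_ge (max ((infDist y Uᶜ)⁻¹) (‖y‖ + 1))
    have h1 := (le_max_left _ _).trans hi
    have h2 := (le_max_right _ _).trans hi
    refine ⟨i, ?_⟩
    rw [phU, min_eq_right ((inv_le_iff_one_le_mul₀ hp).1 h1), min_eq_left (by linarith), max_eq_right (by norm_num), one_mul]

/-- Null sets are invisible to all spherical averages, at almost every centre. -/
lemma null_sph (hd : 3 ≤ d) {p q : ℝ} (hp : 1 ≤ p) (hq : 1 ≤ q) {C : ℝ≥0∞} (hC : C ≠ ⊤)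
    (hG : ∀ f : Euc d → ℝ, Continuous f → HasCompactSupport f → NL q (MX f) ≤ C * (∫⁻ y, ‖f y‖ₑ ^ p) ^ (1/p))
    {Z : Set (Euc d)} (hZ : volume Z = 0) : ∀ᵐ x : Euc d, ∀ t ∈ Icc (1:ℝ) 2, ∀ᵐ y ∂(sphereMeasure d), x - t • y ∉ Z := by
  haveI := sphereMeasure_prob hd
  haveI : Nonempty (Fin d) := ⟨⟨0, by lia⟩⟩
  have hp0 : 0 < p := by linarith
  have hq0 : 0 < q := by linarith
  have step : ∀ k : ℕ, ∃ H : Euc d → ℝ≥0∞, Measurable H ∧ NL q H ≤ C * (ENNReal.ofReal (1 / (k+1))) ^ (1/p) ∧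
      ∀ x, ∀ t ∈ Icc (1:ℝ) 2, sphereMeasure d {y | x - t • y ∈ Z} ≤ H x := by
    intro k
    obtain ⟨U, hZU, hUo, hUm⟩ := Z.exists_isOpen_lt_of_lt (μ := volume) (ENNReal.ofReal (1 / (k+1))) (by rw [hZ]; exact ENNReal.ofReal_pos.2 (by positivity))
    have hne : Uᶜ.Nonempty := by
      rw [nonempty_compl]
      rintro rfl
      rw [measure_univ_of_isAddLeftInvariant] at hUm
      exact absurd hUm (by simp)
    obtain ⟨c1, c2, c3, c4, c5, c6, c7⟩ := phU_props hUo hne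
    have hb : ∀ i y, |phU U i y| ≤ 1 := fun i y => by rw [abs_of_nonneg (c3 i y)]; exact c4 i y
    have mon : ∀ x, Monotone fun i => MX (phU U i) x := by
      intro x i j hij
      simp only [MX]
      refine iSup₂_mono fun t _ => ?_
      rw [SA_nonneg_lint hd (c1 i) (hb i) (c3 i), SA_nonneg_lint hd (c1 j) (hb j) (c3 j)]
      exact lintegral_mono fun y => ENNReal.ofReal_le_ofReal (c6 _ hij)
    have mm : ∀ i, Measurable (MX (phU U i)) := fun i => (MX_lsc hd (c1 i) (hb i)).measurable
    refine ⟨fun x => ⨆ i, MX (phU U i) x, Measurable.iSup mm, ?_, ?_⟩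
    · refine NL_iSup hq _ mm mon fun i => (hG _ (c1 i) (c2 i)).trans ?_
      refine mul_le_mul_right (ENNReal.rpow_le_rpow ?_ (by positivity)) _
      refine le_trans ?_ hUm.le
      rw [← lintegral_indicator_one hUo.measurableSet]
      refine lintegral_mono fun y => ?_
      by_cases hy : y ∈ U
      · rw [indicator_of_mem hy, Pi.one_apply]
        refine ENNReal.rpow_le_one ?_ hp0.le
        rw [Real.enorm_of_nonneg (c3 i y)]
        exact ENNReal.ofReal_le_one.2 (c4 i y)
      · rw [c5 i y hy]; simp [hp0]
    · intro x t ht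
      have hmt : Measurable fun y : Euc d => x - t • y := by fun_prop
      calc sphereMeasure d {y | x - t • y ∈ Z} ≤ sphereMeasure d {y | x - t • y ∈ U} := measure_mono fun y hy => hZU hy
        _ = ∫⁻ y, ({y | x - t • y ∈ U}).indicator 1 y ∂(sphereMeasure d) := (lintegral_indicator_one (hmt hUo.measurableSet)).symm
        _ ≤ ∫⁻ y, ⨆ i, ENNReal.ofReal (phU U i (x - t • y)) ∂(sphereMeasure d) := by
          refine lintegral_mono fun y => ?_
          by_cases hy : x - t • y ∈ U
          · rw [indicator_of_mem (by exact hy)]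
            obtain ⟨i, hi⟩ := c7 _ hy
            refine le_trans ?_ (le_iSup _ i)
            rw [hi]; simp
          · rw [indicator_of_notMem (by exact hy)]; exact bot_le
        _ = ⨆ i, ∫⁻ y, ENNReal.ofReal (phU U i (x - t • y)) ∂(sphereMeasure d) := by
          refine lintegral_iSup (fun i => ?_) fun i j hij y => ENNReal.ofReal_le_ofReal (c6 _ hij)
          exact ((c1 i).measurable.comp hmt).ennreal_ofReal
        _ ≤ _ := by
          refine iSup_mono fun i => ?_
          rw [← SA_nonneg_lint hd (c1 i) (hb i) (c3 i)]
          exact le_iSup₂ (f := fun t (_ : t ∈ Icc (1:ℝ) 2) => ‖SA (phU U i) t x‖ₑ) t ht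
  choose H hHm hHN hH using step
  have h0 : NL q (fun x => ⨅ k, H k x) = 0 := by
    refine le_antisymm ?_ bot_le
    have hl : Filter.Tendsto (fun k : ℕ => C * (ENNReal.ofReal (1 / ((k:ℝ)+1))) ^ (1/p)) Filter.atTop (nhds (C * 0)) := by
      refine ENNReal.Tendsto.const_mul ?_ (Or.inr hC)
      have h1 := ENNReal.tendsto_ofReal tendsto_one_div_add_atTop_nhds_zero_nat
      have h2 := (ENNReal.continuous_rpow_const (y := 1/p)).tendsto (ENNReal.ofReal 0)
      rw [ENNReal.ofReal_zero, ENNReal.zero_rpow_of_pos (by positivity)] at h2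
      rw [ENNReal.ofReal_zero] at h1
      exact h2.comp h1
    rw [mul_zero] at hl
    refine ge_of_tendsto' hl fun k => le_trans (NL_mono hq0 (Filter.Eventually.of_forall fun x => iInf_le _ k)) (hHN k)
  filter_upwards [NL_zero hq0 (Measurable.iInf hHm) h0] with x hx t ht
  rw [ae_iff]
  simp only [not_not]
  refine le_antisymm ?_ bot_le
  rw [← hx]
  exact le_iInf fun k => hH k x t ht
end Pent
end

section
open MeasureTheory Metric Set
open scoped ENNReal NNReal FourierTransform ContDiff
namespace Pent
variable {d n : ℕ}

lemma sph_int (hd : 3 ≤ d) {h : Euc d → ℂ} (hc : Continuous h) (hs : HasCompactSupport h) (t : ℝ) (x : Euc d) :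
    Integrable (fun y => h (x - t • y)) (sphereMeasure d) := by
  have := sphereMeasure_prob hd
  obtain ⟨M, hM⟩ := hs.exists_bound_of_continuous hc
  have hc : Continuous fun y => h (x - t • y) := by fun_prop
  exact Integrable.of_bound hc.aestronglyMeasurable M (Filter.Eventually.of_forall fun y => hM _)

/-- Measurable majorant for the variation of a complex test function. -/
def DD (r : ℝ) (h : Euc d → ℂ) (x : Euc d) : ℝ≥0∞ :=
  VrIA r (fun y => ((h y).re : ℂ)) x + VrIA r (fun y => ((h y).im : ℂ)) x

lemma re_cc {h : Euc d → ℂ} (hc : Continuous h) (hs : HasCompactSupport h) : Continuous (fun y => (h y).re) ∧ HasCompactSupport (fun y => (h y).re) :=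
  ⟨by fun_prop, hs.comp_left (g := Complex.re) (by simp)⟩
lemma im_cc {h : Euc d → ℂ} (hc : Continuous h) (hs : HasCompactSupport h) : Continuous (fun y => (h y).im) ∧ HasCompactSupport (fun y => (h y).im) :=
  ⟨by fun_prop, hs.comp_left (g := Complex.im) (by simp)⟩
lemma no_cc {h : Euc d → ℂ} (hc : Continuous h) (hs : HasCompactSupport h) : Continuous (fun y => ‖h y‖) ∧ HasCompactSupport (fun y => ‖h y‖) :=
  ⟨by fun_prop, hs.norm⟩

lemma VrIA_meas (hd : 3 ≤ d) {r : ℝ} (hr : 1 ≤ r) {f : Euc d → ℝ} (hf : Continuous f ∧ HasCompactSupport f) : Measurable (VrIA r (fun y => (f y : ℂ))) := by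
  obtain ⟨M, hM⟩ := hf.2.exists_bound_of_continuous hf.1
  exact (VrIA_lsc hd (by linarith) hf.1 hM).measurable

lemma MX_meas (hd : 3 ≤ d) {f : Euc d → ℝ} (hf : Continuous f ∧ HasCompactSupport f) : Measurable (MX f) := by
  obtain ⟨M, hM⟩ := hf.2.exists_bound_of_continuous hf.1
  exact (MX_lsc hd hf.1 hM).measurable

lemma VrIA_le_DD (hd : 3 ≤ d) {r : ℝ} (hr : 1 ≤ r) {h : Euc d → ℂ} (hc : Continuous h) (hs : HasCompactSupport h) (x : Euc d) : VrIA r h x ≤ DD r h x := by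
  have e : ∀ t, sphAvg h t x = sphAvg (fun y => ((h y).re : ℂ)) t x + Complex.I * sphAvg (fun y => ((h y).im : ℂ)) t x := by
    intro t
    have i1 := sph_int hd (h := fun y => ((h y).re : ℂ)) (by fun_prop) (hs.comp_left (g := fun z : ℂ => (z.re : ℂ)) (by simp)) t x
    have i2 := sph_int hd (h := fun y => ((h y).im : ℂ)) (by fun_prop) (hs.comp_left (g := fun z : ℂ => (z.im : ℂ)) (by simp)) t x
    rw [sphAvg, sphAvg, sphAvg, ← integral_const_mul, ← integral_add i1 (i2.const_mul _)]
    congr 1; ext y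
    rw [mul_comm Complex.I]
    exact (Complex.re_add_im _).symm
  rw [DD, VrIA]
  simp_rw [e]
  refine (rVar_add hr _ _ _).trans (add_le_add le_rfl ?_)
  refine (rVar_const_mul (by linarith) _ _ _).trans ?_
  simp [VrIA, ← ofReal_norm]

lemma eLp_re {p : ℝ≥0∞} (h0 : p ≠ 0) (h1 : p ≠ ⊤) {h : Euc d → ℂ} {f : Euc d → ℝ} (hle : ∀ y, ‖f y‖ ≤ ‖h y‖) :
    (∫⁻ y, ‖f y‖ₑ ^ p.toReal) ^ (1/p.toReal) ≤ eLpNorm h p volume := by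
  rw [← eLpNorm_eq_lintegral_rpow_enorm_toReal h0 h1]
  exact eLpNorm_mono hle

/-- Extension from test functions to all of `L^p`. -/
theorem ext_bdd (hd : 3 ≤ d) {p q : ℝ≥0∞} (hp : 1 ≤ p) (hpt : p ≠ ⊤) (hq : 1 ≤ q) (hqt : q ≠ ⊤) {r : ℝ} (hr : 1 ≤ r) {C : ℝ≥0∞} (hC : C ≠ ⊤)
    (hG : ∀ f : Euc d → ℝ, Continuous f → HasCompactSupport f →
      NL q.toReal (VrIA r (fun y => (f y : ℂ))) ≤ C * (∫⁻ y, ‖f y‖ₑ ^ p.toReal) ^ (1/p.toReal) ∧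
      NL q.toReal (MX f) ≤ C * (∫⁻ y, ‖f y‖ₑ ^ p.toReal) ^ (1/p.toReal)) : IsBddLpLq d p q (VrIA r) := by
  have hP : 1 ≤ p.toReal := by simpa using ENNReal.toReal_mono hpt hp
  have hQ : 1 ≤ q.toReal := by simpa using ENNReal.toReal_mono hqt hq
  have hP0 : 0 < p.toReal := by linarith
  have hQ0 : 0 < q.toReal := by linarith
  have hp0 : p ≠ 0 := (zero_lt_one.trans_le hp).ne'
  have hDD : ∀ h : Euc d → ℂ, Continuous h → HasCompactSupport h → NL q.toReal (DD r h) ≤ 2 * C * eLpNorm h p volume := by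
    intro h hc hs
    refine (NL_add hQ (VrIA_meas hd hr (re_cc hc hs)) (VrIA_meas hd hr (im_cc hc hs))).trans ?_
    rw [mul_assoc, two_mul]
    refine add_le_add ((hG _ (re_cc hc hs).1 (re_cc hc hs).2).1.trans ?_) ((hG _ (im_cc hc hs).1 (im_cc hc hs).2).1.trans ?_)
    · exact mul_le_mul_right (eLp_re hp0 hpt fun y => Complex.abs_re_le_norm _) _
    · exact mul_le_mul_right (eLp_re hp0 hpt fun y => Complex.abs_im_le_norm _) _
  have hMX : ∀ h : Euc d → ℂ, Continuous h → HasCompactSupport h → NL q.toReal (MX fun y => ‖h y‖) ≤ C * eLpNorm h p volume := by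
    intro h hc hs
    refine (hG _ (no_cc hc hs).1 (no_cc hc hs).2).2.trans ?_
    exact mul_le_mul_right (eLp_re hp0 hpt fun y => by simp) _
  refine ⟨(2 * C * 4).toNNReal, fun f hf => ?_⟩
  have hCt : 2 * C * 4 ≠ ⊤ := ENNReal.mul_ne_top (ENNReal.mul_ne_top (by simp) hC) (by simp)
  rw [ENNReal.coe_toNNReal hCt, lqNorm, if_neg hqt]
  change NL q.toReal (VrIA r f) ≤ _
  set N := eLpNorm f p volume with hN
  have hNt : N ≠ ⊤ := hf.2.ne
  have ch : ∀ k : ℕ, ∃ g : Euc d → ℂ, Continuous g ∧ HasCompactSupport g ∧ eLpNorm (f - g) p volume ≤ (2⁻¹ : ℝ≥0∞) ^ k * N ∧ (k = 0 → g = 0) := by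
    intro k
    rcases Nat.eq_zero_or_pos k with rfl | hk
    · exact ⟨0, continuous_zero, HasCompactSupport.zero, by simp [hN], fun _ => rfl⟩
    by_cases h0 : N = 0
    · refine ⟨0, continuous_zero, HasCompactSupport.zero, by simp [← hN, h0], fun _ => rfl⟩
    · obtain ⟨g, h1, h2, h3, -⟩ := hf.exists_hasCompactSupport_eLpNorm_sub_le hpt (ε := (2⁻¹ : ℝ≥0∞) ^ k * N) (mul_ne_zero (by simp) h0)
      exact ⟨g, h3, h1, h2, by lia⟩
  choose g gc gs gN g0 using ch
  have g0 : g 0 = 0 := g0 0 rfl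
  set h : ℕ → Euc d → ℂ := fun k => g (k+1) - g k with hh
  have hc : ∀ k, Continuous (h k) := fun k => (gc _).sub (gc _)
  have hs : ∀ k, HasCompactSupport (h k) := fun k => by
    have := (gs (k+1)).add ((gs k).neg)
    rwa [← sub_eq_add_neg] at this
  have gsum : ∀ K y, g K y = ∑ k ∈ Finset.range K, h k y := by
    intro K y
    rw [hh]
    simp only [Pi.sub_apply]
    rw [Finset.sum_range_sub (fun k => g k y), g0]; simp
  have hhN : ∀ k, eLpNorm (h k) p volume ≤ 2 * N * (2⁻¹ : ℝ≥0∞) ^ k := by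
    intro k
    have e : h k = (f - g k) - (f - g (k+1)) := by rw [hh]; simp
    rw [e]
    refine (eLpNorm_sub_le (hf.1.sub (gc k).aestronglyMeasurable) (hf.1.sub (gc (k+1)).aestronglyMeasurable) hp).trans ?_
    have h2 : (2⁻¹ : ℝ≥0∞) ^ (k+1) ≤ (2⁻¹ : ℝ≥0∞) ^ k := pow_le_pow_right_of_le_one' (by simp) (by lia)
    calc _ ≤ (2⁻¹ : ℝ≥0∞) ^ k * N + (2⁻¹ : ℝ≥0∞) ^ k * N := add_le_add (gN k) ((gN (k+1)).trans (mul_le_mul_left h2 _))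
      _ = _ := by ring
  have hsumN : ∑' k, eLpNorm (h k) p volume ≤ 4 * N := by
    refine (ENNReal.tsum_le_tsum hhN).trans ?_
    rw [ENNReal.tsum_mul_left, ENNReal.tsum_geometric, ENNReal.one_sub_inv_two, inv_inv]
    apply le_of_eq; ring
  -- a.e. convergence
  have ae1 : ∀ᵐ y, Filter.Tendsto (fun k => g k y) Filter.atTop (nhds (f y)) := by
    have m : ∀ k, AEMeasurable (fun y => ‖(f - g k) y‖ₑ ^ p.toReal) := fun k => ((hf.1.sub (gc k).aestronglyMeasurable).enorm).pow_const _
    have h1 : ∫⁻ y, ∑' k, ‖(f - g k) y‖ₑ ^ p.toReal ≠ ⊤ := by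
      rw [lintegral_tsum m]
      have h2 : ∀ k, ∫⁻ y, ‖(f - g k) y‖ₑ ^ p.toReal ≤ N ^ p.toReal * (2⁻¹ : ℝ≥0∞) ^ k := by
        intro k
        have := ENNReal.rpow_le_rpow (gN k) hP0.le
        rw [eLpNorm_eq_lintegral_rpow_enorm_toReal hp0 hpt, ← ENNReal.rpow_mul, one_div, inv_mul_cancel₀ hP0.ne', ENNReal.rpow_one,
          ENNReal.mul_rpow_of_nonneg _ _ hP0.le, mul_comm] at this
        refine this.trans (mul_le_mul_right ?_ _)
        exact ENNReal.rpow_le_self_of_le_one (pow_le_one' (by simp) _) hP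
      refine ne_top_of_le_ne_top ?_ (ENNReal.tsum_le_tsum h2)
      rw [ENNReal.tsum_mul_left, ENNReal.tsum_geometric, ENNReal.one_sub_inv_two, inv_inv]
      exact ENNReal.mul_ne_top (ENNReal.rpow_ne_top_of_nonneg hP0.le hNt) (by simp)
    filter_upwards [ae_lt_top' (AEMeasurable.ennreal_tsum m) h1] with y hy
    have h2 := ENNReal.tendsto_atTop_zero_of_tsum_ne_top hy.ne
    have h3 := ((ENNReal.continuous_rpow_const (y := 1/p.toReal)).tendsto 0).comp h2
    rw [ENNReal.zero_rpow_of_pos (by positivity)] at h3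
    rw [tendsto_iff_edist_tendsto_0]
    refine h3.congr fun k => ?_
    simp only [Function.comp]
    rw [← ENNReal.rpow_mul, mul_one_div_cancel hP0.ne', ENNReal.rpow_one, edist_comm, edist_eq_enorm_sub, Pi.sub_apply]
  have ae2 := null_sph hd hP hQ hC (fun f h1 h2 => (hG f h1 h2).2) (ae_iff.1 ae1)
  have mMX : ∀ k, Measurable (MX fun y => ‖h k y‖) := fun k => MX_meas hd (no_cc (hc k) (hs k))
  have ae3 : ∀ᵐ x, ∑' k, MX (fun y => ‖h k y‖) x < ⊤ := by
    refine NL_fin hQ0 (Measurable.ennreal_tsum mMX) (ne_top_of_le_ne_top ?_ (NL_tsum hQ _ mMX))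
    refine ne_top_of_le_ne_top ?_ (ENNReal.tsum_le_tsum fun k => hMX (h k) (hc k) (hs k))
    rw [ENNReal.tsum_mul_left]
    exact ENNReal.mul_ne_top hC (ne_top_of_le_ne_top (ENNReal.mul_ne_top (by simp) hNt) hsumN)
  have main : ∀ᵐ x, VrIA r f x ≤ ∑' k, DD r (h k) x := by
    filter_upwards [ae2, ae3] with x hx2 hx3
    rw [VrIA]
    refine rVar_lim (by linarith) _ (fun K t => sphAvg (g K) t x) _ (fun t ht => ?_) (fun K => ?_)
    · -- dominated convergence on the sphere
      set D : Euc d → ℝ≥0∞ := fun y => ∑' k, ‖h k (x - t • y)‖ₑ with hD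
      have mD1 : ∀ k, Measurable fun y => ‖h k (x - t • y)‖ₑ := fun k => by
        have : Continuous fun y => h k (x - t • y) := (hc k).comp (by fun_prop)
        exact this.measurable.enorm
      have mD : Measurable D := Measurable.ennreal_tsum mD1
      have hDi : ∫⁻ y, D y ∂(sphereMeasure d) ≠ ⊤ := by
        rw [hD, lintegral_tsum fun k => (mD1 k).aemeasurable]
        refine ne_top_of_le_ne_top hx3.ne (ENNReal.tsum_le_tsum fun k => ?_)
        obtain ⟨M, hM⟩ := (no_cc (hc k) (hs k)).2.exists_bound_of_continuous (no_cc (hc k) (hs k)).1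
        have := SA_nonneg_lint hd (no_cc (hc k) (hs k)).1 hM (fun y => norm_nonneg _) t x
        simp only [ofReal_norm] at this
        rw [← this]
        exact le_iSup₂ (f := fun t (_ : t ∈ Icc (1:ℝ) 2) => ‖SA (fun y => ‖h k y‖) t x‖ₑ) t ht
      have hDf := ae_lt_top mD hDi
      unfold sphAvg
      refine tendsto_integral_of_dominated_convergence (fun y => (D y).toReal) (fun K => (sph_int hd (gc K) (gs K) t x).aestronglyMeasurable)
        (integrable_toReal_of_lintegral_ne_top mD.aemeasurable hDi) (fun K => ?_) ?_
      · filter_upwards [hDf] with y hy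
        rw [← toReal_enorm]
        refine ENNReal.toReal_mono hy.ne ?_
        rw [gsum]
        exact (enorm_sum_le _ _).trans (ENNReal.sum_le_tsum _)
      · filter_upwards [hx2 t ht] with y hy
        simpa using hy
    · refine le_trans ?_ (ENNReal.sum_le_tsum (Finset.range K))
      induction K with
      | zero =>
        have e : (fun t => sphAvg (g 0) t x) = fun t => (0:ℂ) * (0:ℂ) := by
          ext t; rw [g0, sphAvg]; simp
        rw [e]
        refine (rVar_const_mul (by linarith) _ _ _).trans ?_
        simp
      | succ K ih =>
        have e : (fun t => sphAvg (g (K+1)) t x) = fun t => sphAvg (g K) t x + sphAvg (h K) t x := by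
          ext t
          rw [sphAvg, sphAvg, sphAvg, ← integral_add (sph_int hd (gc K) (gs K) t x) (sph_int hd (hc K) (hs K) t x)]
          congr 1; ext y
          rw [hh]; simp
        rw [e, Finset.sum_range_succ]
        refine (rVar_add hr _ _ _).trans (add_le_add ih ?_)
        exact VrIA_le_DD hd hr (hc K) (hs K) x
  refine (NL_mono hQ0 main).trans ?_
  have mDD : ∀ k, Measurable (DD r (h k)) := fun k => (VrIA_meas hd hr (re_cc (hc k) (hs k))).add (VrIA_meas hd hr (im_cc (hc k) (hs k)))
  refine (NL_tsum hQ _ mDD).trans ?_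
  refine (ENNReal.tsum_le_tsum fun k => hDD (h k) (hc k) (hs k)).trans ?_
  rw [ENNReal.tsum_mul_left, mul_assoc (2 * C)]
  exact mul_le_mul_right hsumN _
end Pent
end

section
open MeasureTheory Metric Set
open scoped ENNReal NNReal FourierTransform ContDiff
namespace Pent

theorem interior_case {d : ℕ} (hd : 3 ≤ d) {r : ℝ} (hr : ((d : ℝ) ^ 2 + 1) / ((d : ℝ) * ((d : ℝ) - 1)) < r)
    {p q : ℝ≥0∞} (hp : 1 ≤ p) (hq : 1 ≤ q) (h : (p⁻¹.toReal, q⁻¹.toReal) ∈ interior (pentagonBig d r)) : IsBddLpLq d p q (VrIA r) := by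
  obtain ⟨hr0, hr2, hr1⟩ := rpos hd hr
  obtain ⟨a1, a2, a3, a4, a5⟩ := interior_strict hd hr h
  obtain ⟨x', y', β, τ, b1, b2, b3, b4, b5, b6, b7, b8, b9, b10, b11, b12⟩ := params hd hr1 a1 a2 a3 a4 hr2 a5
  obtain ⟨n, rfl⟩ : ∃ n, d = n + 1 := ⟨d - 1, by omega⟩
  have ey : q⁻¹.toReal = q.toReal⁻¹ := ENNReal.toReal_inv q
  have ex : p⁻¹.toReal = p.toReal⁻¹ := ENNReal.toReal_inv p
  rw [ex] at b3 a1
  rw [ey] at b5 a1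
  have hqi : 0 < q.toReal⁻¹ := b1.trans b5
  have hpi : 0 < p.toReal⁻¹ := hqi.trans a1
  have hQ0 : 0 < q.toReal := inv_pos.1 hqi
  have hP0 : 0 < p.toReal := inv_pos.1 hpi
  have hqt : q ≠ ⊤ := by rintro rfl; simp at hQ0
  have hpt : p ≠ ⊤ := by rintro rfl; simp at hP0
  have hQ : 1 ≤ q.toReal := by simpa using ENNReal.toReal_mono hqt hq
  have hx0 : 0 < x' := hpi.trans b3
  have hpq : p.toReal ≤ q.toReal := ((inv_lt_inv₀ hQ0 hP0).1 a1).le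
  push_cast at b9 b12
  have hτ : (n:ℝ)/(n+2) ≤ τ := by
    refine le_trans (le_of_eq ?_) b9
    congr 1 <;> ring
  have hγ : 1 < β * ((n:ℝ) * (1 + τ) / 2) := by
    rw [← b11] at b12
    have : x' * 2 < x' * (n * β * (1 + τ)) := by nlinarith
    have := lt_of_mul_lt_mul_left this hx0.le
    linarith
  obtain ⟨C, hC, hG⟩ := glob (n := n) (s := 1 / x') (q := q.toReal) (p := p.toReal) (r := r) (by omega) hτ b10 b6 b7 (by linarith) hQ
    (by
      rw [lt_div_iff₀ hx0]
      calc q.toReal * (β * τ) * x' = q.toReal * y' := by rw [← b11]; ring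
        _ < q.toReal * q.toReal⁻¹ := mul_lt_mul_of_pos_left b5 hQ0
        _ = 1 := mul_inv_cancel₀ hQ0.ne')
    (by rw [one_div]; exact inv_lt_of_inv_lt₀ hP0 b3) (by rw [one_div_le hx0 hr0]; exact b2) hγ hpq
  exact ext_bdd hd hp hpt hq hqt hr1.le hC hG

theorem exterior_case {d : ℕ} (hd : 3 ≤ d) {r : ℝ} (hr : ((d : ℝ) ^ 2 + 1) / ((d : ℝ) * ((d : ℝ) - 1)) < r)
    {p q : ℝ≥0∞} (hq : 1 ≤ q) (h : (p⁻¹.toReal, q⁻¹.toReal) ∉ pentagonBig d r) : ¬ IsBddLpLq d p q (VrIA r) := by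
  obtain ⟨hr0, hr2, hr1⟩ := rpos hd hr
  by_contra hb
  refine h (mem_pent hd hr ⟨?_, ?_, ?_, ?_, ?_⟩)
  · by_contra hc; exact ex_a hd hr0 hq (not_le.1 hc) hb
  · by_contra hc; exact ex_b hd hr0 hq (not_le.1 hc) hb
  · by_contra hc; exact ex_c hd hr0 hq (not_le.1 hc) hb
  · by_contra hc; exact ex_d hd hr0 hq (not_le.1 hc) hb
  · by_contra hc; exact ex_e hd hr0 hq (not_le.1 hc) hb
end Pent
end

/-- Theorem 1.2 (i): for `d ≥ 3` and `r > (d²+1)/(d(d-1))`, the operator `V_r^I A` is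
`L^p → L^q` bounded for `(1/p,1/q)` in the interior of the pentagon `𝔓_d(r)` and
unbounded for `(1/p,1/q)` outside of `𝔓_d(r)`. -/
theorem local_variation_pentagon (d : ℕ) (hd : 3 ≤ d) (r : ℝ)
    (hr : ((d : ℝ) ^ 2 + 1) / ((d : ℝ) * ((d : ℝ) - 1)) < r)
    (p q : ℝ≥0∞) (hp : 1 ≤ p) (hq : 1 ≤ q) :
    (((p⁻¹.toReal, q⁻¹.toReal) ∈ interior (pentagonBig d r)) →
        IsBddLpLq d p q (VrIA r)) ∧
    (((p⁻¹.toReal, q⁻¹.toReal) ∉ pentagonBig d r) →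
        ¬ IsBddLpLq d p q (VrIA r)) := by
  exact ⟨fun h => Pent.interior_case hd hr hp hq h, fun h => Pent.exterior_case hd hr hq h⟩
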